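/- There exists a nonzero polynomial function P on the 35-dimensional space of cubic forms in five variables over ℂ such that, for every cubic form F with P(F) ≠ 0, F defines a smooth cubic threefold V = V(F) ⊂ ℙ⁴ and the set of lines l on V for which there exist 2-planes π₁, π₂ and two distinct lines r₁ ≠ r₂ on V satisfying V·π₁ = l + 2r₁ and V·π₂ = l + 2r₂ is finite of cardinality exactly 1485. (Equivalently: a general smooth cubic threefold contains exactly 1485 lines l admitting two distinct residual double lines; these are the nodes of the curve Γ ⊂ F(V).) -/

import Mathlib

open MvPolynomial

noncomputable section

/-- `F` defines a smooth cubic threefold: the only common zero of the five partial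
derivatives of `F` is the origin. -/
def IsSmoothCubic (F : MvPolynomial (Fin 5) ℂ) : Prop :=
  ∀ p : Fin 5 → ℂ, (∀ i : Fin 5, eval p (pderiv i F) = 0) → p = 0

/-- A line of `ℙ⁴`: a 2-dimensional linear subspace of `ℂ⁵`. -/
def IsLine (W : Submodule ℂ (Fin 5 → ℂ)) : Prop := Module.finrank ℂ W = 2

/-- A 2-plane of `ℙ⁴`: a 3-dimensional linear subspace of `ℂ⁵`. -/
def IsPlane (W : Submodule ℂ (Fin 5 → ℂ)) : Prop := Module.finrank ℂ W = 3

/-- The linear subspace `W` lies on the hypersurface defined by `F`. -/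
def LiesOn (F : MvPolynomial (Fin 5) ℂ) (W : Submodule ℂ (Fin 5 → ℂ)) : Prop :=
  ∀ p ∈ W, eval p F = 0

/-- The intersection cycle `V(F)·Pl` equals `l + 2r`: the restriction of `F` to the
2-plane `Pl` factors as `c·ℓ·ρ²` where `ℓ`, `ρ` are linear forms, nonzero on `Pl`,
whose kernels cut `l` and `r` respectively out of `Pl`. -/
def CycleLplus2R (F : MvPolynomial (Fin 5) ℂ) (l r Pl : Submodule ℂ (Fin 5 → ℂ)) : Prop :=
  IsLine l ∧ IsLine r ∧ IsPlane Pl ∧ l ≤ Pl ∧ r ≤ Pl ∧ r ≠ l ∧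
  ∃ (c : ℂ) (L R : (Fin 5 → ℂ) →ₗ[ℂ] ℂ), c ≠ 0 ∧
    (∃ p ∈ Pl, L p ≠ 0) ∧ (∃ p ∈ Pl, R p ≠ 0) ∧
    Pl ⊓ LinearMap.ker L = l ∧ Pl ⊓ LinearMap.ker R = r ∧
    ∀ p ∈ Pl, eval p F = c * L p * (R p) ^ 2


/-- The index type of the 35 monomials of degree 3 in five variables, so that
`MvPolynomial Deg3Monomials ℂ` is the ring of polynomial functions (in the
coefficients) on the 35-dimensional space of cubic forms in five variables. -/
def Deg3Monomials : Type := {d : Fin 5 →₀ ℕ // (d.sum fun _ n => n) = 3}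

/-! ### Symmetric trilinear forms -/

abbrev V5 := Fin 5 → ℂ
abbrev Tri := V5 →ₗ[ℂ] V5 →ₗ[ℂ] V5 →ₗ[ℂ] ℂ
def TSym (T : Tri) : Prop := ∀ x y z, T x y z = T y x z ∧ T x y z = T x z y
def TSmooth (T : Tri) : Prop := ∀ x, (∀ v, T x x v = 0) → x = 0

def TriOf (F : MvPolynomial (Fin 5) ℂ) (T : Tri) : Prop :=
  TSym T ∧ (∀ x, eval x F = T x x x) ∧ ∀ x i, eval x (pderiv i F) = 3 * T x x (Pi.single i 1)

lemma TriOf.add {F G T S} (h1 : TriOf F T) (h2 : TriOf G S) : TriOf (F + G) (T + S) := by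
  refine ⟨fun x y z => ?_, fun x => ?_, fun x i => ?_⟩
  · have a := h1.1 x y z; have b := h2.1 x y z
    simp only [LinearMap.add_apply]
    rw [← a.1, ← b.1, ← a.2, ← b.2]; simp
  · simp [h1.2.1, h2.2.1]
  · simp [h1.2.2, h2.2.2]; ring

lemma TriOf.smul {F T} (c : ℂ) (h1 : TriOf F T) : TriOf (C c * F) (c • T) := by
  refine ⟨fun x y z => ?_, fun x => ?_, fun x i => ?_⟩
  · have a := h1.1 x y z
    simp only [LinearMap.smul_apply]
    rw [← a.1, ← a.2]; simp
  · simp [h1.2.1]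
  · simp [h1.2.2]; ring

def tri1 (i j k : Fin 5) : Tri :=
  (LinearMap.proj i : V5 →ₗ[ℂ] ℂ).smulRight
    ((LinearMap.proj j : V5 →ₗ[ℂ] ℂ).smulRight (LinearMap.proj k : V5 →ₗ[ℂ] ℂ))

lemma tri1_apply (i j k x y z) : tri1 i j k x y z = x i * y j * z k := by
  simp [tri1]; ring

lemma triOf_mon (i j k : Fin 5) : ∃ T, TriOf (X i * X j * X k) T := by
  refine ⟨(1/6 : ℂ) • (tri1 i j k + tri1 i k j + tri1 j i k + tri1 j k i + tri1 k i j + tri1 k j i),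
    fun x y z => ?_, fun x => ?_, fun x l => ?_⟩
  · simp only [LinearMap.smul_apply, LinearMap.add_apply, tri1_apply]
    constructor <;> simp only [smul_eq_mul] <;> ring
  · simp only [LinearMap.smul_apply, LinearMap.add_apply, tri1_apply]
    simp only [smul_eq_mul, map_mul, eval_X]; ring
  · simp only [LinearMap.smul_apply, LinearMap.add_apply, tri1_apply]
    simp only [smul_eq_mul, Derivation.leibniz, pderiv_X, map_add, map_mul, eval_X, Pi.single_apply,
      eq_comm (a := l)]
    split_ifs <;> simp <;> ring

lemma exists_tri (F : MvPolynomial (Fin 5) ℂ) (hF : F.IsHomogeneous 3) : ∃ T, TriOf F T := by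
  have key : ∀ s : Finset (Fin 5 →₀ ℕ), (∀ d ∈ s, d.degree = 3) →
      ∃ T, TriOf (∑ d ∈ s, monomial d (F.coeff d)) T := by
    intro s
    induction s using Finset.induction_on with
    | empty => intro _; exact ⟨0, by refine ⟨fun x y z => by simp, fun x => by simp, fun x i => by simp⟩⟩
    | insert a s ha ih =>
      intro h
      rw [Finset.sum_insert ha]
      obtain ⟨T, hT⟩ := ih fun d hd => h d (Finset.mem_insert_of_mem hd)
      have h3 := h a (Finset.mem_insert_self _ _)
      have hc : (Finsupp.toMultiset a).card = 3 := by
        rw [Finsupp.card_toMultiset]; exact h3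
      obtain ⟨i, j, k, hm⟩ := Multiset.card_eq_three.mp hc
      have ha' : a = Finsupp.single i 1 + Finsupp.single j 1 + Finsupp.single k 1 := by
        apply Multiset.toFinsupp.symm.injective
        change Finsupp.toMultiset _ = Finsupp.toMultiset _
        rw [hm]; simp [Finsupp.toMultiset_single]
      obtain ⟨S, hS⟩ := triOf_mon i j k
      have e : monomial a (F.coeff a) = C (F.coeff a) * (X i * X j * X k) := by
        simp only [X, monomial_mul, C_mul_monomial, ← ha']; simp
      rw [e]
      exact ⟨_, (hS.smul _).add hT⟩
  obtain ⟨T, hT⟩ := key F.support (fun d hd => by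
    have := hF (mem_support_iff.mp hd)
    rw [← this, Finsupp.degree_eq_weight_one]; rfl)
  rw [← F.as_sum] at hT
  exact ⟨T, hT⟩

lemma TriOf.smooth {F T} (h : TriOf F T) : IsSmoothCubic F ↔ TSmooth T := by
  constructor
  · intro hs x hx
    exact hs x fun i => by rw [h.2.2, hx, mul_zero]
  · intro hs x hx
    refine hs x fun v => ?_
    rw [LinearMap.pi_apply_eq_sum_univ (T x x) v]
    refine Finset.sum_eq_zero fun i _ => ?_
    have := hx i
    rw [h.2.2] at this
    have h3 : T x x (Pi.single i 1) = 0 := by simpa using this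
    have : (fun j => if i = j then (1:ℂ) else 0) = Pi.single i 1 := by
      ext j; simp [Pi.single_apply, eq_comm]
    rw [this, h3, smul_zero]

/-! ### Dimension count -/

instance : Finite Deg3Monomials := by
  have : (Set.Finite {d : Fin 5 →₀ ℕ | (d.sum fun _ n => n) = 3}) := by
    refine (Finset.finite_toSet (Finset.finsuppAntidiag Finset.univ 3)).subset ?_
    intro d hd
    simp only [Finset.coe_sort_coe, Finset.mem_coe, Finset.mem_finsuppAntidiag]
    refine ⟨?_, Finset.subset_univ _⟩
    rw [← hd, Finsupp.sum_fintype]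
    simp
  exact this.to_subtype

lemma card_deg3 : Nat.card Deg3Monomials = 35 := by
  have h : ∀ d : Fin 5 →₀ ℕ, (d.sum fun _ n => n) = 3 ↔ d ∈ Finset.finsuppAntidiag Finset.univ 3 := by
    intro d
    simp only [Finset.mem_finsuppAntidiag]
    rw [Finsupp.sum_fintype]
    · simp
    · simp
  unfold Deg3Monomials
  rw [Nat.card_congr (Equiv.subtypeEquivRight h)]
  rw [Nat.card_eq_fintype_card, Fintype.card_coe, Finset.card_finsuppAntidiag_nat_eq_choose]
  rfl

/-- A finite parameter family with fewer than 35 parameters satisfies an equation. -/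
lemma dim_count {τ : Type} [Fintype τ] (hτ : Fintype.card τ < 35)
    (𝔽 : MvPolynomial (Fin 5) (MvPolynomial τ ℂ)) :
    ∃ P : MvPolynomial Deg3Monomials ℂ, P ≠ 0 ∧ ∀ F : MvPolynomial (Fin 5) ℂ,
      (∃ θ : τ → ℂ, ∀ x, eval x F = eval x (map (eval θ) 𝔽)) →
      eval (fun d : Deg3Monomials => F.coeff d.1) P = 0 := by
  let c : Deg3Monomials → MvPolynomial τ ℂ := fun d => 𝔽.coeff d.1
  have hnot : ¬ AlgebraicIndependent ℂ c := by
    intro h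
    have h1 := h.lift_cardinalMk_le_trdeg
    rw [MvPolynomial.trdeg_of_isDomain] at h1
    simp only [Cardinal.lift_id, Cardinal.mk_fintype] at h1
    rw [← Nat.cast_card, card_deg3] at h1
    have : 35 ≤ Fintype.card τ := by exact_mod_cast h1
    omega
  rw [algebraicIndependent_iff] at hnot
  push Not at hnot
  obtain ⟨P, hP, hP0⟩ := hnot
  refine ⟨P, hP0, ?_⟩
  rintro F ⟨θ, hθ⟩
  have hF : F = map (eval θ) 𝔽 := MvPolynomial.funext hθ
  have h2 : (fun d : Deg3Monomials => F.coeff d.1) = fun d => eval θ (c d) := by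
    funext d; rw [hF, coeff_map]
  rw [h2]
  have h3 := congrArg (eval θ) hP
  rw [map_zero] at h3
  rw [← h3]
  clear h3 hP hP0
  induction P using MvPolynomial.induction_on with
  | C a => simp
  | add p q hp hq => rw [map_add, map_add, map_add, hp, hq]
  | mul_X p i hp => rw [map_mul, map_mul, map_mul, hp]; simp

lemma dim_count_perm {τ : Type} [Fintype τ] (hτ : Fintype.card τ < 35)
    (𝔽 : MvPolynomial (Fin 5) (MvPolynomial τ ℂ)) :
    ∃ P : MvPolynomial Deg3Monomials ℂ, P ≠ 0 ∧ ∀ F : MvPolynomial (Fin 5) ℂ,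
      (∃ (σ : Equiv.Perm (Fin 5)) (θ : τ → ℂ), ∀ x : V5, eval (fun i => x (σ i)) F = eval x (map (eval θ) 𝔽)) →
      eval (fun d : Deg3Monomials => F.coeff d.1) P = 0 := by
  choose P hP hP2 using fun σ : Equiv.Perm (Fin 5) => dim_count hτ (rename σ.symm 𝔽)
  refine ⟨∏ σ, P σ, Finset.prod_ne_zero_iff.mpr fun σ _ => hP σ, ?_⟩
  rintro F ⟨σ, θ, h⟩
  rw [map_prod]
  refine Finset.prod_eq_zero (Finset.mem_univ σ) (hP2 σ F ⟨θ, fun x => ?_⟩)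
  have := h (fun i => x (σ.symm i))
  simp only [Equiv.symm_apply_apply] at this
  rw [this, map_rename, eval_rename]; rfl

/-! ### Expansion of cubic forms in coordinates -/

lemma tri_sum {T : Tri} (hT : TSym T) (b : Fin 5 → V5) (y : Fin 5 → ℂ) :
    T (∑ i, y i • b i) (∑ i, y i • b i) (∑ i, y i • b i) =
      ∑ i, ∑ j, ∑ k, T (b i) (b j) (b k) * (y i * y j * y k) := by
  simp only [map_sum, LinearMap.sum_apply, map_smul, LinearMap.smul_apply, smul_eq_mul]
  refine Finset.sum_congr rfl fun i _ => ?_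
  simp only [Finset.mul_sum]
  refine Finset.sum_congr rfl fun j _ => Finset.sum_congr rfl fun k _ => ?_
  rw [(hT (b i) (b j) (b k)).1, (hT (b j) (b i) (b k)).2, (hT (b j) (b k) (b i)).1]; ring

set_option maxHeartbeats 2000000 in
lemma sorted_sum (g : Fin 5 → Fin 5 → Fin 5 → ℂ) (h1 : ∀ i j k, g i j k = g j i k)
    (h2 : ∀ i j k, g i j k = g i k j) :
    ∃ m : Fin 5 → Fin 5 → Fin 5 → ℂ, (∀ i j k, ¬ (i ≤ j ∧ j ≤ k) → m i j k = 0) ∧ 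
    ∀ y : Fin 5 → ℂ, ∑ i, ∑ j, ∑ k, g i j k * (y i * y j * y k) =
      ∑ i, ∑ j, ∑ k, (m i j k * g i j k) * (y i * y j * y k) := by
  refine ⟨fun i j k => if i ≤ j ∧ j ≤ k then
    (if i = j then (if j = k then 1 else 3) else if j = k then 3 else 6) else 0,
    fun i j k h => by simp only [h, if_false], fun y => ?_⟩
  have s1 : ∀ i j k, j < i → g i j k = g j i k := fun i j k _ => h1 i j k
  have s2 : ∀ i j k, k < j → g i j k = g i k j := fun i j k _ => h2 i j k
  have e : ∀ f : Fin 5 → ℂ, ∑ i, f i = f 0 + f 1 + f 2 + f 3 + f 4 := fun f => by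
    rw [Fin.sum_univ_five]
  clear h1 h2
  simp only [e]
  simp (disch := decide) only [s1, s2]
  simp only [Fin.isValue, show ((0:Fin 5) ≤ 0) = True by simp, show ((1:Fin 5) ≤ 1) = True by simp]
  simp [Fin.le_def, Fin.ext_iff]
  ring

lemma good_sum (good : Fin 5 × Fin 5 × Fin 5 → Prop) [DecidablePred good]
    (g : Fin 5 → Fin 5 → Fin 5 → ℂ) (h1 : ∀ i j k, g i j k = g j i k)
    (h2 : ∀ i j k, g i j k = g i k j)
    (h3 : ∀ i j k, i ≤ j → j ≤ k → ¬ good (i, j, k) → g i j k = 0) :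
    ∃ t : {p // good p} → ℂ, ∀ y : Fin 5 → ℂ, ∑ i, ∑ j, ∑ k, g i j k * (y i * y j * y k) =
      ∑ p : {p // good p}, t p * (y p.1.1 * y p.1.2.1 * y p.1.2.2) := by
  obtain ⟨m, hm, hy⟩ := sorted_sum g h1 h2
  refine ⟨fun p => m p.1.1 p.1.2.1 p.1.2.2 * g p.1.1 p.1.2.1 p.1.2.2, fun y => ?_⟩
  rw [hy]
  have := Finset.sum_subtype (F := inferInstance) (Finset.univ.filter good) (p := good) (by simp)
    (fun p : Fin 5 × Fin 5 × Fin 5 => m p.1 p.2.1 p.2.2 * g p.1 p.2.1 p.2.2 * (y p.1 * y p.2.1 * y p.2.2))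
  rw [← this, Finset.sum_filter]
  simp only [Fintype.sum_prod_type]
  refine Finset.sum_congr rfl fun i _ => Finset.sum_congr rfl fun j _ => Finset.sum_congr rfl fun k _ => ?_
  split_ifs with h
  · rfl
  · by_cases hs : i ≤ j ∧ j ≤ k
    · rw [h3 i j k hs.1 hs.2 h]; simp
    · rw [hm i j k hs]; simp

lemma tri_good (good : Fin 5 × Fin 5 × Fin 5 → Prop) [DecidablePred good] {T : Tri} (hT : TSym T)
    (b : Fin 5 → V5)
    (h3 : ∀ i j k, i ≤ j → j ≤ k → ¬ good (i, j, k) → T (b i) (b j) (b k) = 0) :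
    ∃ t : {p // good p} → ℂ, ∀ y : Fin 5 → ℂ,
      T (∑ i, y i • b i) (∑ i, y i • b i) (∑ i, y i • b i) =
      ∑ p : {p // good p}, t p * (y p.1.1 * y p.1.2.1 * y p.1.2.2) := by
  obtain ⟨t, ht⟩ := good_sum good (fun i j k => T (b i) (b j) (b k)) (fun i j k => (hT _ _ _).1)
    (fun i j k => (hT _ _ _).2) h3
  exact ⟨t, fun y => by rw [tri_sum hT, ht]⟩

lemma form_sum (U : V5 →ₗ[ℂ] ℂ) (x : V5) : U x = ∑ i, U (Pi.single i 1) * x i := by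
  rw [LinearMap.pi_apply_eq_sum_univ U x]
  refine Finset.sum_congr rfl fun i _ => ?_
  have : (fun j => if i = j then (1:ℂ) else 0) = Pi.single i 1 := by
    ext j; simp [Pi.single_apply, eq_comm]
  rw [this, smul_eq_mul, mul_comm]

lemma form_perm (U : V5 →ₗ[ℂ] ℂ) (s : Equiv.Perm (Fin 5)) (x : V5) :
    U (fun i => x (s i)) = ∑ k, U (Pi.single (s.symm k) 1) * x k := by
  rw [form_sum]
  rw [← Equiv.sum_comp s (fun k => U (Pi.single (s.symm k) 1) * x k)]
  simp

lemma form_ext0 {U : V5 →ₗ[ℂ] ℂ} (h : ∀ i, U (Pi.single i 1) = 0) : U = 0 := by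
  ext x; simp [h]

lemma exists_ne_of_form {U : V5 →ₗ[ℂ] ℂ} (h : U ≠ 0) : ∃ i, U (Pi.single i 1) ≠ 0 := by
  by_contra hc; push Not at hc; exact h (form_ext0 hc)

/-- coordinates from an injective linear self-map -/
lemma dual_coords (y : V5 →ₗ[ℂ] V5) (hy : ∀ x, y x = 0 → x = 0) (s : Equiv.Perm (Fin 5)) :
    ∃ b : Fin 5 → V5, (∀ x : V5, (fun i => x (s i)) = ∑ i, y x i • b i) ∧
      ∀ i, ∃ x : V5, y x = Pi.single i 1 ∧ b i = fun j => x (s j) := by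
  have hinj : Function.Injective y := (injective_iff_map_eq_zero y).mpr hy
  have hsurj : Function.Surjective y := LinearMap.injective_iff_surjective.mp hinj
  choose g hg using hsurj
  refine ⟨fun i j => g (Pi.single i 1) (s j), fun x => ?_, fun i => ⟨g (Pi.single i 1), hg _, rfl⟩⟩
  have : x = ∑ i, y x i • g (Pi.single i 1) := by
    apply hinj
    rw [map_sum]
    simp only [map_smul, hg]
    ext j; simp [Finset.sum_apply, Pi.single_apply]
  funext j
  conv_lhs => rw [this]
  simp [Finset.sum_apply]

lemma exists_perm3 (i j k : Fin 5) (hij : i ≠ j) (hik : i ≠ k) (hjk : j ≠ k) :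
    ∃ s : Equiv.Perm (Fin 5), s.symm 0 = i ∧ s.symm 1 = j ∧ s.symm 2 = k := by
  have : ∀ i j k : Fin 5, i ≠ j → i ≠ k → j ≠ k → ∃ a b : Fin 5, a ≠ b ∧ a ≠ i ∧ a ≠ j ∧ a ≠ k ∧
    b ≠ i ∧ b ≠ j ∧ b ≠ k := by decide
  obtain ⟨a, b, h1, h2, h3, h4, h5, h6, h7⟩ := this i j k hij hik hjk
  have hinj : Function.Injective ![i, j, k, a, b] := by
    intro p q hpq
    fin_cases p <;> fin_cases q <;> simp_all
  let e := Equiv.ofBijective _ (Finite.injective_iff_bijective.mp hinj)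
  refine ⟨e.symm, ?_, ?_, ?_⟩ <;> simp [e]

/-- entry of a form -/
abbrev en (U : V5 →ₗ[ℂ] ℂ) (i : Fin 5) : ℂ := U (Pi.single i 1)

def det3 (U X Y : V5 →ₗ[ℂ] ℂ) (i j k : Fin 5) : ℂ :=
  en U i * (en X j * en Y k - en X k * en Y j) - en U j * (en X i * en Y k - en X k * en Y i)
  + en U k * (en X i * en Y j - en X j * en Y i)

lemma minor3 {U X Y : V5 →ₗ[ℂ] ℂ}
    (h : ∀ a b c : ℂ, a • U + b • X + c • Y = 0 → a = 0 ∧ b = 0 ∧ c = 0) :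
    ∃ i j k, i ≠ j ∧ i ≠ k ∧ j ≠ k ∧ en U i ≠ 0 ∧ det3 U X Y i j k ≠ 0 := by
  have hU : U ≠ 0 := fun h0 => by simpa using (h 1 0 0 (by simp [h0])).1
  obtain ⟨i, hi⟩ := exists_ne_of_form hU
  have hX : en U i • X - en X i • U ≠ 0 := fun h0 => hi (h (-en X i) (en U i) 0 (by
    rw [← h0]; module)).2.1
  obtain ⟨j, hj⟩ := exists_ne_of_form hX
  simp at hj
  set m := en U i * en X j - en X i * en U j with hm
  have hY : m • Y - (en Y j * en U i - en Y i * en U j) • X + (en Y j * en X i - en Y i * en X j) • U ≠ 0 :=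
    fun h0 => hj (h (en Y j * en X i - en Y i * en X j) (-(en Y j * en U i - en Y i * en U j)) m (by
    rw [← h0]; module)).2.2
  obtain ⟨k, hk⟩ := exists_ne_of_form hY
  simp at hk
  have hd : det3 U X Y i j k ≠ 0 := by
    intro h0; apply hk; rw [← h0]; unfold det3; rw [hm]; ring
  refine ⟨i, j, k, ?_, ?_, ?_, hi, hd⟩
  · rintro rfl; apply hd; unfold det3; ring
  · rintro rfl; apply hd; unfold det3; ring
  · rintro rfl; apply hd; unfold det3; ring

/-- The triangular coordinates used for the families. -/
def yD (u : Fin 4 → ℂ) (ξ η : Fin 3 → ℂ) : V5 →ₗ[ℂ] V5 where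
  toFun x := ![x 0 + u 0 * x 1 + u 1 * x 2 + u 2 * x 3 + u 3 * x 4,
    x 1 + ξ 0 * x 2 + ξ 1 * x 3 + ξ 2 * x 4, x 2 + η 0 * x 1 + η 1 * x 3 + η 2 * x 4, x 3, x 4]
  map_add' x y := by ext i; fin_cases i <;> simp <;> ring
  map_smul' c x := by ext i; fin_cases i <;> simp <;> ring

def yT (u v w : Fin 4 → ℂ) : V5 →ₗ[ℂ] V5 where
  toFun x := ![x 0 + u 0 * x 1 + u 1 * x 2 + u 2 * x 3 + u 3 * x 4,
    x 1 + v 0 * x 0 + v 1 * x 2 + v 2 * x 3 + v 3 * x 4,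
    x 2 + w 0 * x 0 + w 1 * x 1 + w 2 * x 3 + w 3 * x 4, x 3, x 4]
  map_add' x y := by ext i; fin_cases i <;> simp <;> ring
  map_smul' c x := by ext i; fin_cases i <;> simp <;> ring

lemma coords3 {U X Y : V5 →ₗ[ℂ] ℂ}
    (h : ∀ a b c : ℂ, a • U + b • X + c • Y = 0 → a = 0 ∧ b = 0 ∧ c = 0) :
    ∃ (s : Equiv.Perm (Fin 5)) (u : Fin 4 → ℂ) (ξ η : Fin 3 → ℂ) (α β γ κ κ' : ℂ) (b : Fin 5 → V5),
      α ≠ 0 ∧ β ≠ 0 ∧ γ ≠ 0 ∧ (∀ x : V5, (fun i => x (s i)) = ∑ i, yD u ξ η x i • b i) ∧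
      (∀ i, U (b i) = if i = 0 then α else 0) ∧
      (∀ i, X (b i) = if i = 0 then κ else if i = 1 then β else 0) ∧
      (∀ i, Y (b i) = if i = 0 then κ' else if i = 2 then γ else 0) := by
  obtain ⟨i, j, k, hij, hik, hjk, hi, hd⟩ := minor3 h
  -- choose the order of j,k
  have key : ∃ j k, i ≠ j ∧ i ≠ k ∧ j ≠ k ∧ det3 U X Y i j k ≠ 0 ∧
      en X j * en U i - en X i * en U j ≠ 0 ∧ en Y k * en U i - en Y i * en U k ≠ 0 := by
    by_cases h1 : (en X j * en U i - en X i * en U j) * (en Y k * en U i - en Y i * en U k) = 0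
    · refine ⟨k, j, hik, hij, hjk.symm, ?_, ?_⟩
      · intro h0; apply hd; unfold det3 at *; linear_combination -h0
      · rw [← mul_ne_zero_iff]
        intro h0
        have : en U i * det3 U X Y i j k = 0 := by unfold det3; linear_combination h1 - h0
        exact (mul_ne_zero hi hd) this
    · exact ⟨j, k, hij, hik, hjk, hd, (mul_ne_zero_iff.mp h1).1, (mul_ne_zero_iff.mp h1).2⟩
  clear hd hij hik hjk j k
  obtain ⟨j, k, hij, hik, hjk, hd, hb, hc⟩ := key
  obtain ⟨s, h0, h1, h2⟩ := exists_perm3 i j k hij hik hjk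
  set a3 := s.symm 3
  set a4 := s.symm 4
  set β := (en X j * en U i - en X i * en U j) / en U i with hβ
  set γ := (en Y k * en U i - en Y i * en U k) / en U i with hγ
  have hβ0 : β ≠ 0 := div_ne_zero hb hi
  have hγ0 : γ ≠ 0 := div_ne_zero hc hi
  set κ := en X i
  set κ' := en Y i
  set α := en U i
  let u : Fin 4 → ℂ := ![en U j / α, en U k / α, en U a3 / α, en U a4 / α]
  let ξ : Fin 3 → ℂ := ![(en X k - κ * (en U k / α)) / β, (en X a3 - κ * (en U a3 / α)) / β, (en X a4 - κ * (en U a4 / α)) / β]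
  let η : Fin 3 → ℂ := ![(en Y j - κ' * (en U j / α)) / γ, (en Y a3 - κ' * (en U a3 / α)) / γ, (en Y a4 - κ' * (en U a4 / α)) / γ]
  have hUx : ∀ x : V5, U (fun i => x (s i)) = α * yD u ξ η x 0 := by
    intro x; rw [form_perm, Fin.sum_univ_five, h0, h1, h2]
    simp [yD, u]; field_simp; ring
  have hXx : ∀ x : V5, X (fun i => x (s i)) = β * yD u ξ η x 1 + κ * yD u ξ η x 0 := by
    intro x; rw [form_perm, Fin.sum_univ_five, h0, h1, h2]
    have e : en X j = β + κ * (en U j / α) := by rw [hβ]; field_simp; ring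
    simp [yD, u, ξ]
    change κ * x 0 + en X j * x 1 + _ + _ + _ = _
    rw [e]; field_simp; ring
  have hYx : ∀ x : V5, Y (fun i => x (s i)) = γ * yD u ξ η x 2 + κ' * yD u ξ η x 0 := by
    intro x; rw [form_perm, Fin.sum_univ_five, h0, h1, h2]
    have e : en Y k = γ + κ' * (en U k / α) := by rw [hγ]; field_simp; ring
    simp [yD, u, η]
    change κ' * x 0 + _ + en Y k * x 2 + _ + _ = _
    rw [e]; field_simp; ring
  have hinj : ∀ x, yD u ξ η x = 0 → x = 0 := by
    intro x hx
    have e0 := congrFun hx 0; have e1 := congrFun hx 1; have e2 := congrFun hx 2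
    have e3 := congrFun hx 3; have e4 := congrFun hx 4
    simp [yD] at e0 e1 e2 e3 e4
    simp [e3, e4] at e0 e1 e2
    have hdet : (1 - ξ 0 * η 0) * (α * β * γ) = det3 U X Y i j k := by
      simp only [ξ, η, det3, Matrix.cons_val_zero]
      change _ = α * (_) - _ * (κ * _ - _ * κ') + _ * (κ * _ - _ * κ')
      have e : en X j = β + κ * (en U j / α) := by rw [hβ]; field_simp; ring
      have e' : en Y k = γ + κ' * (en U k / α) := by rw [hγ]; field_simp; ring
      rw [e, e']; field_simp; ring
    have hne : (1 - ξ 0 * η 0) ≠ 0 := by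
      intro h0; rw [h0, zero_mul] at hdet; exact hd hdet.symm
    have x1 : x 1 = 0 := by
      have : (1 - ξ 0 * η 0) * x 1 = 0 := by linear_combination e1 - ξ 0 * e2
      exact (mul_eq_zero.mp this).resolve_left hne
    have x2 : x 2 = 0 := by simpa [x1] using e2
    have x0 : x 0 = 0 := by simpa [x1, x2] using e0
    ext q; fin_cases q <;> simp [x0, x1, x2, e3, e4]
  obtain ⟨b, hb1, hb2⟩ := dual_coords (yD u ξ η) hinj s
  refine ⟨s, u, ξ, η, α, β, γ, κ, κ', b, hi, hβ0, hγ0, hb1, ?_, ?_, ?_⟩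
  · intro q; obtain ⟨x, hx, hx'⟩ := hb2 q
    rw [hx', hUx, hx]; fin_cases q <;> simp
  · intro q; obtain ⟨x, hx, hx'⟩ := hb2 q
    rw [hx', hXx, hx]; fin_cases q <;> simp
  · intro q; obtain ⟨x, hx, hx'⟩ := hb2 q
    rw [hx', hYx, hx]; fin_cases q <;> simp

lemma coordsT {X : Fin 3 → (V5 →ₗ[ℂ] ℂ)}
    (h : ∀ a b c : ℂ, a • X 0 + b • X 1 + c • X 2 = 0 → a = 0 ∧ b = 0 ∧ c = 0) :
    ∃ (s : Equiv.Perm (Fin 5)) (u v w : Fin 4 → ℂ) (α : Fin 3 → ℂ) (b : Fin 5 → V5),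
      (∀ i, α i ≠ 0) ∧ (∀ x : V5, (fun i => x (s i)) = ∑ i, yT u v w x i • b i) ∧
      (∀ q i, X q (b i) = if i = (Fin.castLE (by norm_num) q : Fin 5) then α q else 0) := by
  obtain ⟨i, j, k, hij, hik, hjk, hi, hd⟩ := minor3 h
  have key : ∃ i j k, i ≠ j ∧ i ≠ k ∧ j ≠ k ∧ det3 (X 0) (X 1) (X 2) i j k ≠ 0 ∧
      en (X 0) i * en (X 1) j * en (X 2) k ≠ 0 := by
    have sw1 : det3 (X 0) (X 1) (X 2) i k j ≠ 0 := by
      intro h0; apply hd; unfold det3 at *; linear_combination -h0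
    have sw2 : det3 (X 0) (X 1) (X 2) j i k ≠ 0 := by
      intro h0; apply hd; unfold det3 at *; linear_combination -h0
    have sw3 : det3 (X 0) (X 1) (X 2) k j i ≠ 0 := by
      intro h0; apply hd; unfold det3 at *; linear_combination -h0
    have sw4 : det3 (X 0) (X 1) (X 2) j k i ≠ 0 := by
      intro h0; apply hd; unfold det3 at *; linear_combination h0
    have sw5 : det3 (X 0) (X 1) (X 2) k i j ≠ 0 := by
      intro h0; apply hd; unfold det3 at *; linear_combination h0
    by_contra hc
    push Not at hc
    apply hd
    have c0 := hc i j k hij hik hjk hd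
    have c1 := hc i k j hik hij hjk.symm sw1
    have c2 := hc j i k hij.symm hjk hik sw2
    have c3 := hc k j i hjk.symm hik.symm hij.symm sw3
    have c4 := hc j k i hjk hij.symm hik.symm sw4
    have c5 := hc k i j hik.symm hjk.symm hij sw5
    unfold det3
    linear_combination c0 - c1 - c2 - c3 + c4 + c5
  clear hd hij hik hjk hi i j k
  obtain ⟨i, j, k, hij, hik, hjk, hd, hp⟩ := key
  have hx0 : en (X 0) i ≠ 0 := fun h => hp (by rw [h]; ring)
  have hx1 : en (X 1) j ≠ 0 := fun h => hp (by rw [h]; ring)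
  have hx2 : en (X 2) k ≠ 0 := fun h => hp (by rw [h]; ring)
  obtain ⟨s, h0, h1, h2⟩ := exists_perm3 i j k hij hik hjk
  set a3 := s.symm 3
  set a4 := s.symm 4
  let u : Fin 4 → ℂ := ![en (X 0) j / en (X 0) i, en (X 0) k / en (X 0) i, en (X 0) a3 / en (X 0) i, en (X 0) a4 / en (X 0) i]
  let v : Fin 4 → ℂ := ![en (X 1) i / en (X 1) j, en (X 1) k / en (X 1) j, en (X 1) a3 / en (X 1) j, en (X 1) a4 / en (X 1) j]
  let w : Fin 4 → ℂ := ![en (X 2) i / en (X 2) k, en (X 2) j / en (X 2) k, en (X 2) a3 / en (X 2) k, en (X 2) a4 / en (X 2) k]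
  have hX0 : ∀ x : V5, X 0 (fun i => x (s i)) = en (X 0) i * yT u v w x 0 := by
    intro x; rw [form_perm, Fin.sum_univ_five, h0, h1, h2]
    simp [yT, u]; field_simp; ring
  have hX1 : ∀ x : V5, X 1 (fun i => x (s i)) = en (X 1) j * yT u v w x 1 := by
    intro x; rw [form_perm, Fin.sum_univ_five, h0, h1, h2]
    simp [yT, v]; field_simp; ring
  have hX2 : ∀ x : V5, X 2 (fun i => x (s i)) = en (X 2) k * yT u v w x 2 := by
    intro x; rw [form_perm, Fin.sum_univ_five, h0, h1, h2]
    simp [yT, w]; field_simp; ring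
  have hinj : ∀ x, yT u v w x = 0 → x = 0 := by
    intro x hx
    have f0 := hX0 x; have f1 := hX1 x; have f2 := hX2 x
    have e3 := congrFun hx 3; have e4 := congrFun hx 4
    simp [yT] at e3 e4
    rw [hx, form_perm, Fin.sum_univ_five, h0, h1, h2] at f0 f1 f2
    simp [e3, e4] at f0 f1 f2
    have x0 : det3 (X 0) (X 1) (X 2) i j k * x 0 = 0 := by
      unfold det3
      linear_combination (en (X 1) j * en (X 2) k - en (X 1) k * en (X 2) j) * f0 -
        (en (X 0) j * en (X 2) k - en (X 0) k * en (X 2) j) * f1 +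
        (en (X 0) j * en (X 1) k - en (X 0) k * en (X 1) j) * f2
    have x1 : det3 (X 0) (X 1) (X 2) i j k * x 1 = 0 := by
      unfold det3
      linear_combination -(en (X 1) i * en (X 2) k - en (X 1) k * en (X 2) i) * f0 +
        (en (X 0) i * en (X 2) k - en (X 0) k * en (X 2) i) * f1 -
        (en (X 0) i * en (X 1) k - en (X 0) k * en (X 1) i) * f2
    have x2 : det3 (X 0) (X 1) (X 2) i j k * x 2 = 0 := by
      unfold det3
      linear_combination (en (X 1) i * en (X 2) j - en (X 1) j * en (X 2) i) * f0 -
        (en (X 0) i * en (X 2) j - en (X 0) j * en (X 2) i) * f1 +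
        (en (X 0) i * en (X 1) j - en (X 0) j * en (X 1) i) * f2
    have x0' := (mul_eq_zero.mp x0).resolve_left hd
    have x1' := (mul_eq_zero.mp x1).resolve_left hd
    have x2' := (mul_eq_zero.mp x2).resolve_left hd
    ext q; fin_cases q <;> simp [x0', x1', x2', e3, e4]
  obtain ⟨b, hb1, hb2⟩ := dual_coords (yT u v w) hinj s
  refine ⟨s, u, v, w, ![en (X 0) i, en (X 1) j, en (X 2) k], b, ?_, hb1, ?_⟩
  · intro q; fin_cases q <;> simpa
  · intro q p; obtain ⟨x, hx, hx'⟩ := hb2 p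
    rw [hx']
    fin_cases q
    · simp only [Fin.zero_eta, hX0, hx]; fin_cases p <;> simp
    · simp only [Fin.mk_one, hX1, hx]; fin_cases p <;> simp
    · simp only [Fin.reduceFinMk, hX2, hx]; fin_cases p <;> simp

/-- evaluation of a polynomial function on cubic forms -/
def evF (P : MvPolynomial Deg3Monomials ℂ) (F : MvPolynomial (Fin 5) ℂ) : ℂ :=
  eval (fun d : Deg3Monomials => F.coeff d.1) P

def goodPoly {α : Type} (good : Fin 5 × Fin 5 × Fin 5 → Prop) [DecidablePred good]
    (Y : Fin 5 → MvPolynomial (Fin 5) (MvPolynomial (α ⊕ {p // good p}) ℂ)) :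
    MvPolynomial (Fin 5) (MvPolynomial (α ⊕ {p // good p}) ℂ) :=
  ∑ p : {p // good p}, C (X (Sum.inr p)) * (Y p.1.1 * Y p.1.2.1 * Y p.1.2.2)

lemma eval_goodPoly {α : Type} (good : Fin 5 × Fin 5 × Fin 5 → Prop) [DecidablePred good]
    (Y : Fin 5 → MvPolynomial (Fin 5) (MvPolynomial (α ⊕ {p // good p}) ℂ))
    (θ : α ⊕ {p // good p} → ℂ) (x y : V5) (h : ∀ i, eval x (map (eval θ) (Y i)) = y i) :
    eval x (map (eval θ) (goodPoly good Y)) =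
      ∑ p : {p // good p}, θ (Sum.inr p) * (y p.1.1 * y p.1.2.1 * y p.1.2.2) := by
  unfold goodPoly
  simp [h]

lemma famS : ∃ P : MvPolynomial Deg3Monomials ℂ, P ≠ 0 ∧ ∀ F T, TriOf F T → ¬ TSmooth T →
    evF P F = 0 := by
  let good : Fin 5 × Fin 5 × Fin 5 → Prop := fun p => p.1 ≤ p.2.1 ∧ p.2.1 ≤ p.2.2 ∧ ¬ (p.1 = 0 ∧ p.2.1 = 0)
  let Y : Fin 5 → MvPolynomial (Fin 5) (MvPolynomial (Fin 4 ⊕ {p // good p}) ℂ) :=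
    ![X 0, X 1 - C (X (Sum.inl 0)) * X 0, X 2 - C (X (Sum.inl 1)) * X 0,
      X 3 - C (X (Sum.inl 2)) * X 0, X 4 - C (X (Sum.inl 3)) * X 0]
  obtain ⟨P, hP, h⟩ := dim_count_perm (τ := Fin 4 ⊕ {p // good p}) (by decide) (goodPoly good Y)
  refine ⟨P, hP, fun F T hT hns => h F ?_⟩
  unfold TSmooth at hns
  push Not at hns
  obtain ⟨p, hp, hp0⟩ := hns
  obtain ⟨i, hi⟩ : ∃ i, p i ≠ 0 := by
    by_contra hc; push Not at hc; exact hp0 (funext hc)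
  let s := Equiv.swap 0 i
  let q : V5 := (p i)⁻¹ • p
  have hq : ∀ v, T q q v = 0 := fun v => by simp [q, hp]
  have hqi : q i = 1 := by simp [q, hi]
  let b : Fin 5 → V5 := fun k => if k = 0 then q else Pi.single (s k) 1
  obtain ⟨t, ht⟩ := tri_good good hT.1 b (by
    intro j k l h1 h2 h3
    have : j = 0 ∧ k = 0 := by simp only [good] at h3; tauto
    rw [this.1, this.2]; simp only [b, if_true, hq])
  refine ⟨s, Sum.elim (fun k : Fin 4 => q (s k.succ)) t, fun x => ?_⟩
  let y : V5 := fun k => if k = 0 then x 0 else x k - q (s k) * x 0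
  have hx : (fun j => x (s j)) = ∑ k, y k • b k := by
    funext j
    obtain ⟨k, rfl⟩ := s.surjective j
    have : s (s k) = k := Equiv.swap_apply_self _ _ _
    rw [this, Finset.sum_apply, Fin.sum_univ_succ]
    have hs0 : s 0 = i := Equiv.swap_apply_left _ _
    have e : ∀ m : Fin 4, (y m.succ • b m.succ) (s k) = if m.succ = k then y m.succ else 0 := by
      intro m
      simp only [b, Fin.succ_ne_zero, if_false, Pi.smul_apply, Pi.single_apply, smul_eq_mul, mul_ite, mul_one, mul_zero]
      simp only [s.injective.eq_iff, eq_comm]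
    simp only [e]
    refine Fin.cases ?_ (fun m => ?_) k
    · simp [y, b, hs0, hqi]
    · simp [y, b]
      ring
  rw [hT.2.1, hx, ht, eval_goodPoly good Y _ x y]
  · simp
  · intro k
    fin_cases k <;> simp [Y, y] <;> rfl

lemma famE : ∃ P : MvPolynomial Deg3Monomials ℂ, P ≠ 0 ∧ ∀ F T, TriOf F T → 
    (∃ (U : V5 →ₗ[ℂ] ℂ) (v : V5), U ≠ 0 ∧ v ≠ 0 ∧ U v = 0 ∧ ∀ a c, U a = 0 → U c = 0 → T v a c = 0) →
    evF P F = 0 := by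
  let good : Fin 5 × Fin 5 × Fin 5 → Prop := fun p => p.1 ≤ p.2.1 ∧ p.2.1 ≤ p.2.2 ∧ (p.1 = 0 ∨ p.2.2 ≠ 4)
  let Y : Fin 5 → MvPolynomial (Fin 5) (MvPolynomial (Fin 7 ⊕ {p // good p}) ℂ) :=
    ![X 0 + C (X (Sum.inl 0)) * X 1 + C (X (Sum.inl 1)) * X 2 + C (X (Sum.inl 2)) * X 3 + C (X (Sum.inl 3)) * X 4,
      X 1 - C (X (Sum.inl 4)) * X 4, X 2 - C (X (Sum.inl 5)) * X 4,
      X 3 - C (X (Sum.inl 6)) * X 4, X 4]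
  obtain ⟨P, hP, h⟩ := dim_count_perm (τ := Fin 7 ⊕ {p // good p}) (by decide) (goodPoly good Y)
  refine ⟨P, hP, fun F T hT ⟨U, v, hU, hv, hUv, hz⟩ => h F ?_⟩
  obtain ⟨i, hi⟩ := exists_ne_of_form hU
  obtain ⟨j, hj, hij⟩ : ∃ j, v j ≠ 0 ∧ i ≠ j := by
    by_contra hc; push Not at hc
    have hvj : ∀ j, j ≠ i → v j = 0 := fun j hji => by
      by_contra h0; exact hji (hc j h0).symm
    rw [form_sum, Finset.sum_eq_single i (fun j _ hji => by rw [hvj j hji, mul_zero]) (by simp)] at hUv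
    have hvi : v i = 0 := by simpa [hi] using hUv
    apply hv; funext j
    by_cases hji : j = i
    · rw [hji, hvi]; rfl
    · exact hvj j hji
  obtain ⟨s0, h0, h1, -⟩ : ∃ s : Equiv.Perm (Fin 5), s.symm 0 = i ∧ s.symm 4 = j ∧ True := by
    obtain ⟨k, hk1, hk2⟩ : ∃ k : Fin 5, k ≠ i ∧ k ≠ j := by
      have : ∀ i j : Fin 5, ∃ k, k ≠ i ∧ k ≠ j := by decide
      exact this i j
    obtain ⟨s, a, b, -⟩ := exists_perm3 i j k hij hk1.symm hk2.symm
    refine ⟨s.trans (Equiv.swap 1 4), ?_, ?_, trivial⟩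
    · simp [Equiv.symm_trans_apply, Equiv.swap_apply_of_ne_of_ne, a]
    · simp [Equiv.symm_trans_apply, b]
  let w : V5 := fun k => v (s0.symm k)
  have hw4 : w 4 ≠ 0 := by simpa [w, h1] using hj
  let u : Fin 5 → ℂ := fun k => en U (s0.symm k) / en U i
  let y : V5 →ₗ[ℂ] V5 :=
    { toFun := fun x => ![x 0 + u 1 * x 1 + u 2 * x 2 + u 3 * x 3 + u 4 * x 4,
        x 1 - w 1 / w 4 * x 4, x 2 - w 2 / w 4 * x 4, x 3 - w 3 / w 4 * x 4, x 4]
      map_add' := fun x y => by ext i; fin_cases i <;> simp <;> ring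
      map_smul' := fun c x => by ext i; fin_cases i <;> simp <;> ring }
  have hy : ∀ x, y x = ![x 0 + u 1 * x 1 + u 2 * x 2 + u 3 * x 3 + u 4 * x 4,
        x 1 - w 1 / w 4 * x 4, x 2 - w 2 / w 4 * x 4, x 3 - w 3 / w 4 * x 4, x 4] := fun x => rfl
  have hUx : ∀ x : V5, U (fun i => x (s0 i)) = en U i * y x 0 := by
    intro x; rw [form_perm, Fin.sum_univ_five, h0, hy]
    simp [u]; field_simp
  have hinj : ∀ x, y x = 0 → x = 0 := by
    intro x hx
    rw [hy] at hx
    have e0 := congrFun hx 0; have e1 := congrFun hx 1; have e2 := congrFun hx 2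
    have e3 := congrFun hx 3; have e4 := congrFun hx 4
    simp at e0 e1 e2 e3 e4
    simp [e4] at e0 e1 e2 e3
    simp [e1, e2, e3] at e0
    ext q; fin_cases q <;> simp [e0, e1, e2, e3, e4]
  obtain ⟨b, hb1, hb2⟩ := dual_coords y hinj s0
  have hUb : ∀ k, k ≠ 0 → U (b k) = 0 := by
    intro k hk; obtain ⟨x, hx, hx'⟩ := hb2 k
    rw [hx', hUx, hx]; simp [hk.symm]
  have hb4 : v = w 4 • b 4 := by
    have := hb1 w
    have e : (fun k => w (s0 k)) = v := by funext k; simp [w]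
    have hy0 : y w 0 = 0 := by
      have := hUx w; rw [e, hUv] at this
      simpa [hi] using this.symm
    rw [e, Fin.sum_univ_five, hy0] at this
    rw [this, hy]
    simp [hw4]
  have hTb : ∀ k l, k ≠ 0 → l ≠ 0 → T (b k) (b l) (b 4) = 0 := by
    intro k l hk hl
    have := hz (b k) (b l) (hUb k hk) (hUb l hl)
    rw [hb4] at this
    rw [(hT.1 _ _ _).2, (hT.1 _ _ _).1]
    simpa [hw4] using this
  obtain ⟨t, ht⟩ := tri_good good hT.1 b (by
    intro j k l h1 h2 h3
    have : j ≠ 0 ∧ l = 4 := by simp only [good] at h3; tauto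
    rw [this.2]
    refine hTb _ _ this.1 ?_
    intro hk; rw [hk] at h1; exact this.1 (Fin.le_zero_iff.mp h1))
  refine ⟨s0, Sum.elim ![u 1, u 2, u 3, u 4, w 1 / w 4, w 2 / w 4, w 3 / w 4] t, fun x => ?_⟩
  rw [hT.2.1, hb1, ht, eval_goodPoly good Y _ x (y x)]
  · simp
  · intro k
    rw [hy]
    fin_cases k <;> simp [Y]

/-- independence of three linear forms -/
def Ind3 (U X Y : V5 →ₗ[ℂ] ℂ) : Prop :=
  ∀ a b c : ℂ, a • U + b • X + c • Y = 0 → a = 0 ∧ b = 0 ∧ c = 0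

def goodU : Fin 5 × Fin 5 × Fin 5 → Prop := fun p => p.1 = 0 ∧ p.2.1 ≤ p.2.2
instance : DecidablePred goodU := fun p => by unfold goodU; infer_instance

lemma tri_U {T : Tri} (hT : TSym T) (b : Fin 5 → V5) : ∃ t : {p // goodU p} → ℂ, ∀ y : Fin 5 → ℂ,
    T (∑ i, y i • b i) (∑ i, y i • b i) (∑ i, y i • b i) =
      ∑ p : {p // goodU p}, t p * (y p.1.1 * y p.1.2.1 * y p.1.2.2) +
      T (y 1 • b 1 + y 2 • b 2 + y 3 • b 3 + y 4 • b 4) (y 1 • b 1 + y 2 • b 2 + y 3 • b 3 + y 4 • b 4)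
        (y 1 • b 1 + y 2 • b 2 + y 3 • b 3 + y 4 • b 4) := by
  let b' : Fin 5 → V5 := fun i => if i = 0 then 0 else b i
  obtain ⟨t, ht⟩ := good_sum goodU (fun i j k => T (b i) (b j) (b k) - T (b' i) (b' j) (b' k))
    (fun i j k => by rw [(hT (b i) _ _).1, (hT (b' i) _ _).1])
    (fun i j k => by rw [(hT (b i) _ _).2, (hT (b' i) _ _).2]) (by
      intro i j k hij hjk hg
      have hi : i ≠ 0 := by unfold goodU at hg; tauto
      have hj : j ≠ 0 := by rintro rfl; exact hi (Fin.le_zero_iff.mp hij)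
      have hk : k ≠ 0 := by rintro rfl; exact hj (Fin.le_zero_iff.mp hjk)
      simp [b', hi, hj, hk])
  refine ⟨t, fun y => ?_⟩
  have e : (y 1 • b 1 + y 2 • b 2 + y 3 • b 3 + y 4 • b 4) = ∑ i, y i • b' i := by
    rw [Fin.sum_univ_five]; simp [b']
  rw [e, ← ht, tri_sum hT, tri_sum hT, ← Finset.sum_add_distrib]
  refine Finset.sum_congr rfl fun i _ => ?_
  rw [← Finset.sum_add_distrib]
  refine Finset.sum_congr rfl fun j _ => ?_
  rw [← Finset.sum_add_distrib]
  refine Finset.sum_congr rfl fun k _ => ?_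
  ring

def YU (n : ℕ) : Fin 5 → MvPolynomial (Fin 5) (MvPolynomial ((Fin 10 ⊕ Fin n) ⊕ {p // goodU p}) ℂ) :=
  let c : Fin 10 → MvPolynomial (Fin 5) (MvPolynomial ((Fin 10 ⊕ Fin n) ⊕ {p // goodU p}) ℂ) :=
    fun i => C (X (Sum.inl (Sum.inl i)))
  ![X 0 + c 0 * X 1 + c 1 * X 2 + c 2 * X 3 + c 3 * X 4,
    X 1 + c 4 * X 2 + c 5 * X 3 + c 6 * X 4, X 2 + c 7 * X 1 + c 8 * X 3 + c 9 * X 4, X 3, X 4]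

lemma eval_YU {n : ℕ} (u : Fin 4 → ℂ) (ξ η : Fin 3 → ℂ) (f : Fin n → ℂ) (t) (x : V5) (i : Fin 5) :
    eval x (map (eval (Sum.elim (Sum.elim
      ![u 0, u 1, u 2, u 3, ξ 0, ξ 1, ξ 2, η 0, η 1, η 2] f) t)) (YU n i)) = yD u ξ η x i := by
  fin_cases i <;> simp [YU, yD]

def cU (n : ℕ) (i : Fin n) : MvPolynomial (Fin 5) (MvPolynomial ((Fin 10 ⊕ Fin n) ⊕ {p // goodU p}) ℂ) :=
  C (X (Sum.inl (Sum.inr i)))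

lemma eval_cU {n : ℕ} (f : Fin n → ℂ) (g t) (x : V5) (i : Fin n) :
    eval x (map (eval (Sum.elim (Sum.elim g f) t)) (cU n i)) = f i := by
  simp [cU]

lemma exists_sqrt (a : ℂ) : ∃ r : ℂ, r ^ 2 = a := IsAlgClosed.exists_pow_nat_eq a (by norm_num)

lemma famD1 : ∃ P : MvPolynomial Deg3Monomials ℂ, P ≠ 0 ∧ ∀ F T, TriOf F T →
    (∃ (U X Y Z L : V5 →ₗ[ℂ] ℂ) (c d e : ℂ), Ind3 U X Y ∧ ∀ x, U x = 0 →
      T x x x = X x * Y x * L x - X x * Z x ^ 2 - Y x * (c * Z x + d * X x + e * Y x) ^ 2) →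
    evF P F = 0 := by
  let y := YU 9
  let c := cU 9
  let ζ := c 1 * y 3 + c 2 * y 4
  obtain ⟨P, hP, h⟩ := dim_count_perm (τ := (Fin 10 ⊕ Fin 9) ⊕ {p // goodU p}) (by decide) (goodPoly goodU y +
    (y 1 * y 2 * (c 5 * y 1 + c 6 * y 2 + c 7 * y 3 + c 8 * y 4) -
      y 1 * (c 0 * y 1 + ζ) ^ 2 - y 2 * (c 3 * ζ + c 4 * y 2) ^ 2))
  refine ⟨P, hP, fun F T hT => ?_⟩
  rintro ⟨U, X, Y, Z, L, c', d, e, hind, hF⟩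
  apply h F
  obtain ⟨s, u, ξ, η, α, β, γ, κ, κ', b, hα, hβ, hγ, hb, hUb, hXb, hYb⟩ := coords3 hind
  obtain ⟨t, ht⟩ := tri_U hT.1 b
  obtain ⟨r, hr⟩ := exists_sqrt β
  obtain ⟨q, hq⟩ := exists_sqrt γ
  have hr0 : r ≠ 0 := by rintro rfl; apply hβ; rw [← hr]; ring
  -- coefficients
  set z1 := Z (b 1); set z2 := Z (b 2); set z3 := Z (b 3); set z4 := Z (b 4)
  set d' := c' * z1 + d * β with hd'
  set e' := c' * z2 + e * γ with he'
  refine ⟨s, Sum.elim (Sum.elim ![u 0, u 1, u 2, u 3, ξ 0, ξ 1, ξ 2, η 0, η 1, η 2]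
    ![r * z1, r * z3, r * z4, q * c' / r, q * e', 
      β * γ * L (b 1) - β * 2 * z2 * z1 - γ * d' ^ 2, β * γ * L (b 2) - β * z2 ^ 2 - γ * 2 * d' * e',
      β * γ * L (b 3) - β * 2 * z2 * z3 - γ * 2 * d' * c' * z3,
      β * γ * L (b 4) - β * 2 * z2 * z4 - γ * 2 * d' * c' * z4]) t, fun x => ?_⟩
  rw [hT.2.1, hb, ht, RingHom.map_add, RingHom.map_add, eval_goodPoly goodU y _ x (yD u ξ η x) (eval_YU _ _ _ _ _ _)]
  congr 1
  simp only [RingHom.map_add, RingHom.map_sub, RingHom.map_mul, RingHom.map_pow, y, c, ζ, eval_YU, eval_cU]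
  generalize yD u ξ η x = w
  rw [hF]
  · simp only [map_add, map_smul, smul_eq_mul, hXb, hYb]
    simp
    field_simp
    rw [hd', he', ← hr, ← hq]
    ring
  · simp [hUb]

lemma famD2 : ∃ P : MvPolynomial Deg3Monomials ℂ, P ≠ 0 ∧ ∀ F T, TriOf F T →
    (∃ (U X Y Z W : V5 →ₗ[ℂ] ℂ) (c : ℂ), Ind3 U X Y ∧ ∀ x, U x = 0 →
      T x x x = c * X x * Y x ^ 2 - X x * Z x ^ 2 - Y x * W x ^ 2) →
    evF P F = 0 := by
  let y := YU 9
  let c := cU 9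
  obtain ⟨P, hP, h⟩ := dim_count_perm (τ := (Fin 10 ⊕ Fin 9) ⊕ {p // goodU p}) (by decide) (goodPoly goodU y +
    (c 8 * y 1 * y 2 ^ 2 - y 1 * (c 0 * y 1 + c 1 * y 2 + c 2 * y 3 + c 3 * y 4) ^ 2
     - y 2 * (c 4 * y 1 + c 5 * y 2 + c 6 * y 3 + c 7 * y 4) ^ 2))
  refine ⟨P, hP, fun F T hT => ?_⟩
  rintro ⟨U, X, Y, Z, W, c', hind, hF⟩
  apply h F
  obtain ⟨s, u, ξ, η, α, β, γ, κ, κ', b, hα, hβ, hγ, hb, hUb, hXb, hYb⟩ := coords3 hind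
  obtain ⟨t, ht⟩ := tri_U hT.1 b
  obtain ⟨r, hr⟩ := exists_sqrt β
  obtain ⟨q, hq⟩ := exists_sqrt γ
  refine ⟨s, Sum.elim (Sum.elim ![u 0, u 1, u 2, u 3, ξ 0, ξ 1, ξ 2, η 0, η 1, η 2]
    ![r * Z (b 1), r * Z (b 2), r * Z (b 3), r * Z (b 4), 
      q * W (b 1), q * W (b 2), q * W (b 3), q * W (b 4), c' * β * γ ^ 2]) t, fun x => ?_⟩
  rw [hT.2.1, hb, ht, RingHom.map_add, RingHom.map_add, eval_goodPoly goodU y _ x (yD u ξ η x) (eval_YU _ _ _ _ _ _)]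
  congr 1
  simp only [RingHom.map_add, RingHom.map_sub, RingHom.map_mul, RingHom.map_pow, y, c, eval_YU, eval_cU]
  generalize yD u ξ η x = w
  rw [hF]
  · simp only [map_add, map_smul, smul_eq_mul, hXb, hYb]
    simp
    rw [← hr, ← hq]
    ring
  · simp [hUb]

def goodT : Fin 5 × Fin 5 × Fin 5 → Prop := fun p => p.1 ≤ p.2.1 ∧ p.2.1 ≤ p.2.2 ∧
  ((p.1 < p.2.1 ∧ p.2.1 ≤ 2) ∨ (p.1 = p.2.1 ∧ p.2.1 < p.2.2 ∧ p.2.2 ≤ 2))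
instance : DecidablePred goodT := fun p => by unfold goodT; infer_instance

set_option maxHeartbeats 1000000 in
lemma tri_T {T : Tri} (hT : TSym T) (b : Fin 5 → V5) : ∃ t : {p // goodT p} → ℂ, ∀ y : Fin 5 → ℂ,
    T (∑ i, y i • b i) (∑ i, y i • b i) (∑ i, y i • b i) =
      ∑ p : {p // goodT p}, t p * (y p.1.1 * y p.1.2.1 * y p.1.2.2) +
      T (y 0 • b 0 + y 3 • b 3 + y 4 • b 4) (y 0 • b 0 + y 3 • b 3 + y 4 • b 4)
        (y 0 • b 0 + y 3 • b 3 + y 4 • b 4) +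
      T (y 1 • b 1 + y 3 • b 3 + y 4 • b 4) (y 1 • b 1 + y 3 • b 3 + y 4 • b 4)
        (y 1 • b 1 + y 3 • b 3 + y 4 • b 4) +
      T (y 2 • b 2 + y 3 • b 3 + y 4 • b 4) (y 2 • b 2 + y 3 • b 3 + y 4 • b 4)
        (y 2 • b 2 + y 3 • b 3 + y 4 • b 4) -
      2 * T (y 3 • b 3 + y 4 • b 4) (y 3 • b 3 + y 4 • b 4) (y 3 • b 3 + y 4 • b 4) := by
  let b0 : Fin 5 → V5 := ![b 0, 0, 0, b 3, b 4]
  let b1 : Fin 5 → V5 := ![0, b 1, 0, b 3, b 4]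
  let b2 : Fin 5 → V5 := ![0, 0, b 2, b 3, b 4]
  let b3 : Fin 5 → V5 := ![0, 0, 0, b 3, b 4]
  let G : (Fin 5 → V5) → Fin 5 → Fin 5 → Fin 5 → ℂ := fun b i j k => T (b i) (b j) (b k)
  have G1 : ∀ b i j k, G b i j k = G b j i k := fun b i j k => (hT _ _ _).1
  have G2 : ∀ b i j k, G b i j k = G b i k j := fun b i j k => (hT _ _ _).2
  obtain ⟨t, ht⟩ := good_sum goodT (fun i j k => G b i j k - G b0 i j k - G b1 i j k - G b2 i j k + 2 * G b3 i j k)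
    (fun i j k => by rw [G1 b, G1 b0, G1 b1, G1 b2, G1 b3])
    (fun i j k => by rw [G2 b, G2 b0, G2 b1, G2 b2, G2 b3]) (by
      intro i j k hij hjk hg
      unfold goodT at hg
      simp only [G]
      fin_cases i <;> fin_cases j <;>
      first
      | (exfalso; revert hij; decide)
      | (fin_cases k <;> first
        | (exfalso; revert hg; decide)
        | (exfalso; revert hjk; decide)
        | (simp [b0, b1, b2, b3] <;> ring)))
  refine ⟨t, fun y => ?_⟩
  have e0 : (y 0 • b 0 + y 3 • b 3 + y 4 • b 4) = ∑ i, y i • b0 i := by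
    rw [Fin.sum_univ_five]; simp [b0]
  have e1 : (y 1 • b 1 + y 3 • b 3 + y 4 • b 4) = ∑ i, y i • b1 i := by
    rw [Fin.sum_univ_five]; simp [b1]
  have e2 : (y 2 • b 2 + y 3 • b 3 + y 4 • b 4) = ∑ i, y i • b2 i := by
    rw [Fin.sum_univ_five]; simp [b2]
  have e3 : (y 3 • b 3 + y 4 • b 4) = ∑ i, y i • b3 i := by
    rw [Fin.sum_univ_five]; simp [b3]
  rw [e0, e1, e2, e3, ← ht, tri_sum hT, tri_sum hT, tri_sum hT, tri_sum hT, tri_sum hT]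
  simp only [Finset.mul_sum, ← Finset.sum_add_distrib, ← Finset.sum_sub_distrib]
  refine Finset.sum_congr rfl fun i _ => Finset.sum_congr rfl fun j _ => Finset.sum_congr rfl fun k _ => ?_
  simp only [G]
  ring

def D3cfg (T : Tri) : Prop :=
  ∃ (X ρ : Fin 3 → (V5 →ₗ[ℂ] ℂ)), Ind3 (X 0) (X 1) (X 2) ∧
    ∀ i x, (∀ j, j ≠ i → X j x = 0) → T x x x = X i x * ρ i x ^ 2

lemma famD3 : ∃ P : MvPolynomial Deg3Monomials ℂ, P ≠ 0 ∧ ∀ F T, TriOf F T → D3cfg T →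
    evF P F = 0 := by
  let τ := Fin 21 ⊕ {p // goodT p}
  let c : Fin 21 → MvPolynomial (Fin 5) (MvPolynomial τ ℂ) := fun i => C (X (Sum.inl i))
  let y : Fin 5 → MvPolynomial (Fin 5) (MvPolynomial τ ℂ) :=
    ![X 0 + c 0 * X 1 + c 1 * X 2 + c 2 * X 3 + c 3 * X 4,
    X 1 + c 4 * X 0 + c 5 * X 2 + c 6 * X 3 + c 7 * X 4, 
    X 2 + c 8 * X 0 + c 9 * X 1 + c 10 * X 3 + c 11 * X 4, X 3, X 4]
  obtain ⟨P, hP, h⟩ := dim_count_perm (τ := τ) (by decide) (goodPoly goodT y +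
    (y 0 * (c 12 * y 0 + c 13 * y 3 + c 14 * y 4) ^ 2 + y 1 * (c 15 * y 1 + c 16 * y 3 + c 17 * y 4) ^ 2
     + y 2 * (c 18 * y 2 + c 19 * y 3 + c 20 * y 4) ^ 2))
  refine ⟨P, hP, fun F T hT => ?_⟩
  rintro ⟨X, ρ, hind, hF⟩
  apply h F
  obtain ⟨s, u, v, w, α, b, hα, hb, hXb⟩ := coordsT hind
  obtain ⟨t, ht⟩ := tri_T hT.1 b
  choose r hr using fun i => exists_sqrt (α i)
  refine ⟨s, Sum.elim ![u 0, u 1, u 2, u 3, v 0, v 1, v 2, v 3, w 0, w 1, w 2, w 3,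
    r 0 * ρ 0 (b 0), r 0 * ρ 0 (b 3), r 0 * ρ 0 (b 4), r 1 * ρ 1 (b 1), r 1 * ρ 1 (b 3), r 1 * ρ 1 (b 4),
    r 2 * ρ 2 (b 2), r 2 * ρ 2 (b 3), r 2 * ρ 2 (b 4)] t, fun x => ?_⟩
  have hy : ∀ i, eval x (map (eval (Sum.elim ![u 0, u 1, u 2, u 3, v 0, v 1, v 2, v 3, w 0, w 1, w 2, w 3,
    r 0 * ρ 0 (b 0), r 0 * ρ 0 (b 3), r 0 * ρ 0 (b 4), r 1 * ρ 1 (b 1), r 1 * ρ 1 (b 3), r 1 * ρ 1 (b 4),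
    r 2 * ρ 2 (b 2), r 2 * ρ 2 (b 3), r 2 * ρ 2 (b 4)] t)) (y i)) = yT u v w x i := by
    intro i; fin_cases i <;> simp [y, c, yT]
  rw [hT.2.1, hb, ht, RingHom.map_add, RingHom.map_add, eval_goodPoly goodT y _ x (yT u v w x) hy]
  simp only [RingHom.map_add, RingHom.map_mul, RingHom.map_pow, hy]
  generalize yT u v w x = z
  have X0 : ∀ a, X a (z 0 • b 0 + z 3 • b 3 + z 4 • b 4) = if a = 0 then z 0 * α 0 else 0 := by
    intro a; fin_cases a <;> simp [hXb]
  have X1 : ∀ a, X a (z 1 • b 1 + z 3 • b 3 + z 4 • b 4) = if a = 1 then z 1 * α 1 else 0 := by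
    intro a; fin_cases a <;> simp [hXb]
  have X2 : ∀ a, X a (z 2 • b 2 + z 3 • b 3 + z 4 • b 4) = if a = 2 then z 2 * α 2 else 0 := by
    intro a; fin_cases a <;> simp [hXb]
  have X3 : ∀ a, X a (z 3 • b 3 + z 4 • b 4) = 0 := by
    intro a; fin_cases a <;> simp [hXb]
  rw [hF 0 (z 0 • b 0 + z 3 • b 3 + z 4 • b 4) (fun j hj => by rw [X0 j, if_neg hj]),
    hF 1 (z 1 • b 1 + z 3 • b 3 + z 4 • b 4) (fun j hj => by rw [X1 j, if_neg hj]),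
    hF 2 (z 2 • b 2 + z 3 • b 3 + z 4 • b 4) (fun j hj => by rw [X2 j, if_neg hj]),
    hF 0 (z 3 • b 3 + z 4 • b 4) (fun j hj => X3 j), X3 0, X0 0, X1 1, X2 2]
  simp [c, ← hr]
  ring

/-! ### Algebra on a hyperplane -/

lemma tri_line {T : Tri} (hT : TSym T) (x v : V5) (t : ℂ) :
    T (x + t • v) (x + t • v) (x + t • v) =
      T x x x + 3 * t * T x x v + 3 * t ^ 2 * T v v x + t ^ 3 * T v v v := by
  simp only [map_add, map_smul, LinearMap.add_apply, LinearMap.smul_apply, smul_eq_mul]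
  rw [(hT x v x).2, (hT v x x).1, (hT x v x).2, (hT x v v).1, (hT v x v).2]
  ring

lemma two_indep_of_finrank {E : Type} [AddCommGroup E] [Module ℂ E] [FiniteDimensional ℂ E] {K : Submodule ℂ E}
    (h : 2 ≤ Module.finrank ℂ K) :
    ∃ p ∈ K, ∃ q ∈ K, ∀ s t : ℂ, s • p + t • q = 0 → s = 0 ∧ t = 0 := by
  obtain ⟨x, hx⟩ := Module.finrank_pos_iff_exists_ne_zero.mp (show 0 < Module.finrank ℂ K by omega)
  obtain ⟨y, hy⟩ := exists_linearIndependent_pair_of_one_lt_finrank (show 1 < Module.finrank ℂ K by omega) hx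
  rw [LinearIndependent.pair_iff] at hy
  exact ⟨x, x.2, y, y.2, fun s t h => hy s t (Subtype.ext (by simpa using h))⟩

lemma ker3 (U A B : V5 →ₗ[ℂ] ℂ) : ∃ p q : V5, (∀ s t : ℂ, s • p + t • q = 0 → s = 0 ∧ t = 0) ∧
    ∀ s t : ℂ, U (s • p + t • q) = 0 ∧ A (s • p + t • q) = 0 ∧ B (s • p + t • q) = 0 := by
  let f : V5 →ₗ[ℂ] (Fin 3 → ℂ) := LinearMap.pi ![U, A, B]
  have h := LinearMap.finrank_range_add_finrank_ker f
  have h2 : Module.finrank ℂ (LinearMap.range f) ≤ 3 := by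
    simpa using Submodule.finrank_le (LinearMap.range f)
  have h5 : Module.finrank ℂ V5 = 5 := by simp
  obtain ⟨p, hp, q, hq, hpq⟩ := two_indep_of_finrank (K := LinearMap.ker f) (by omega)
  refine ⟨p, q, hpq, fun s t => ?_⟩
  have hm : s • p + t • q ∈ LinearMap.ker f := Submodule.add_mem _ (Submodule.smul_mem _ _ hp) (Submodule.smul_mem _ _ hq)
  rw [LinearMap.mem_ker] at hm
  exact ⟨by simpa [f] using congrFun hm 0, by simpa [f] using congrFun hm 1, by simpa [f] using congrFun hm 2⟩

lemma quad_zero (a b c : ℂ) : ∃ s t : ℂ, (s ≠ 0 ∨ t ≠ 0) ∧ s ^ 2 * a + s * t * b + t ^ 2 * c = 0 := by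
  by_cases ha : a = 0
  · exact ⟨1, 0, by simp, by simp [ha]⟩
  · obtain ⟨r, hr⟩ := exists_sqrt (b ^ 2 - 4 * a * c)
    refine ⟨(-b + r) / (2 * a), 1, by simp, ?_⟩
    field_simp
    linear_combination hr

/-- A hyperplane section of a smooth cubic has no singular line. -/
lemma no_sing_line {T : Tri} (hT : TSym T) (hs : TSmooth T) {U : V5 →ₗ[ℂ] ℂ} (hU : U ≠ 0) {p q : V5}
    (hpq : ∀ s t : ℂ, s • p + t • q = 0 → s = 0 ∧ t = 0)
    (h : ∀ s t : ℂ, ∀ v, U v = 0 → T (s • p + t • q) (s • p + t • q) v = 0) : False := by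
  obtain ⟨i, hi⟩ := exists_ne_of_form hU
  set b : V5 := Pi.single i 1
  obtain ⟨s, t, hst, h0⟩ := quad_zero (T p p b) (2 * T p q b) (T q q b)
  have hb : T (s • p + t • q) (s • p + t • q) b = 0 := by
    simp only [map_add, map_smul, LinearMap.add_apply, LinearMap.smul_apply, smul_eq_mul]
    rw [(hT q p b).1]; linear_combination h0
  have := hs (s • p + t • q) (fun v => by
    have e : v = (v - (U v / U b) • b) + (U v / U b) • b := by simp
    rw [e, map_add, map_smul, hb, h s t _ (by simp [hi]), smul_zero, add_zero])
  have := hpq s t this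
  tauto

/-- `F` restricted to the hyperplane cannot lie in the square of an ideal of two linear forms. -/
lemma no_sing_forms {T : Tri} (hT : TSym T) (hs : TSmooth T) {U : V5 →ₗ[ℂ] ℂ} (hU : U ≠ 0)
    (A B m1 m2 m3 : V5 →ₗ[ℂ] ℂ) (h : ∀ x, U x = 0 →
      T x x x = A x ^ 2 * m1 x + A x * B x * m2 x + B x ^ 2 * m3 x) : False := by
  obtain ⟨p, q, hpq, h0⟩ := ker3 U A B
  refine no_sing_line hT hs hU hpq fun s t v hv => ?_
  obtain ⟨hUx, hA, hB⟩ := h0 s t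
  set x := s • p + t • q
  have key : ∀ r : ℂ, T x x x + 3 * r * T x x v + 3 * r ^ 2 * T v v x + r ^ 3 * T v v v =
      r ^ 2 * (A v ^ 2 * (m1 x + r * m1 v) + A v * B v * (m2 x + r * m2 v) + B v ^ 2 * (m3 x + r * m3 v)) := by
    intro r
    rw [← tri_line hT, h _ (by simp [hUx, hv])]
    simp only [map_add, map_smul, hA, hB, smul_eq_mul]; ring
  have k0 := key 0; have k1 := key 1; have k2 := key (-1); have k3 := key 2
  linear_combination 1/3 * (-1/6 * k3 - 1/2 * k0 + k1 - 1/3 * k2)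

/-! ### Symmetric determinantal representations -/

abbrev M3 := Matrix (Fin 3) (Fin 3) ℂ

/-- `M` is a symmetric determinantal representation of the cubic `T` on the subspace `H`. -/
def SymDet (T : Tri) (H : Submodule ℂ V5) (M : V5 →ₗ[ℂ] M3) : Prop :=
  (∀ x, (M x).transpose = M x) ∧ ∀ x ∈ H, T x x x = (M x).det

def HypSet (T : Tri) : Set (Submodule ℂ V5) :=
  {H | Module.finrank ℂ H = 4 ∧ ∃ M, SymDet T H M}

def conjM (P : M3) (M : V5 →ₗ[ℂ] M3) : V5 →ₗ[ℂ] M3 where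
  toFun x := P.transpose * M x * P
  map_add' x y := by simp [Matrix.mul_add, Matrix.add_mul]
  map_smul' c x := by simp

lemma conjM_apply (P : M3) (M : V5 →ₗ[ℂ] M3) (x : V5) : conjM P M x = P.transpose * M x * P := rfl

def entM (M : V5 →ₗ[ℂ] M3) (i j : Fin 3) : V5 →ₗ[ℂ] ℂ where
  toFun x := M x i j
  map_add' x y := by simp
  map_smul' c x := by simp

lemma entM_apply (M : V5 →ₗ[ℂ] M3) (i j : Fin 3) (x : V5) : entM M i j x = M x i j := rfl

lemma sym_det {A : M3} (h : A.transpose = A) : A.det = A 0 0 * A 1 1 * A 2 2 + 2 * A 0 1 * A 0 2 * A 1 2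
    - A 0 0 * A 1 2 ^ 2 - A 1 1 * A 0 2 ^ 2 - A 2 2 * A 0 1 ^ 2 := by
  have h1 : A 1 0 = A 0 1 := congrFun (congrFun h 0) 1
  have h2 : A 2 0 = A 0 2 := congrFun (congrFun h 0) 2
  have h3 : A 2 1 = A 1 2 := congrFun (congrFun h 1) 2
  rw [Matrix.det_fin_three, h1, h2, h3]; ring

lemma conj_sym {A : M3} (P : M3) (h : A.transpose = A) : (P.transpose * A * P).transpose = P.transpose * A * P := by
  simp [Matrix.transpose_mul, h, Matrix.mul_assoc]

lemma SymDet.conj {T : Tri} {H : Submodule ℂ V5} {M : V5 →ₗ[ℂ] M3} (h : SymDet T H M) {P : M3} (hP : P.det ^ 2 = 1) :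
    SymDet T H (conjM P M) := by
  refine ⟨fun x => conj_sym P (h.1 x), fun x hx => ?_⟩
  rw [conjM_apply, Matrix.det_mul, Matrix.det_mul, Matrix.det_transpose, h.2 x hx]
  linear_combination (-(M x).det) * hP

lemma conj_entry (A P : M3) (i j : Fin 3) :
    (P.transpose * A * P) i j = (fun k => P k i) ⬝ᵥ (A.mulVec fun k => P k j) := by
  rw [Matrix.mul_assoc, Matrix.mul_apply']
  rfl

lemma ext_col (u : Fin 3 → ℂ) (hu : u ≠ 0) : ∃ P : M3, P.det = 1 ∧ (fun i => P i 0) = u := by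
  by_cases h0 : u 0 = 0
  · by_cases h1 : u 1 = 0
    · have h2 : u 2 ≠ 0 := fun h2 => hu (by ext i; fin_cases i <;> simp [h0, h1, h2])
      exact ⟨!![u 0, (u 2)⁻¹, 0; u 1, 0, 1; u 2, 0, 0], by rw [Matrix.det_fin_three]; simp [h2], by
        ext i; fin_cases i <;> simp⟩
    · exact ⟨!![u 0, -(u 1)⁻¹, 0; u 1, 0, 0; u 2, 0, 1], by rw [Matrix.det_fin_three]; simp [h1], by
        ext i; fin_cases i <;> simp⟩
  · exact ⟨!![u 0, 0, 0; u 1, (u 0)⁻¹, 0; u 2, 0, 1], by rw [Matrix.det_fin_three]; simp [h0], by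
        ext i; fin_cases i <;> simp⟩

lemma ext_col2 (u v : Fin 3 → ℂ) (h : ∀ s t : ℂ, s • u + t • v = 0 → s = 0 ∧ t = 0) :
    ∃ P : M3, P.det = 1 ∧ (fun i => P i 0) = u ∧ (fun i => P i 1) = v := by
  have hu : u ≠ 0 := fun h0 => by simpa using (h 1 0 (by simp [h0])).1
  obtain ⟨P, hP, hPu⟩ := ext_col u hu
  have hun : IsUnit P.det := by simp [hP]
  set w := P⁻¹.mulVec v with hw
  have hv : P.mulVec w = v := by rw [hw, Matrix.mulVec_mulVec, Matrix.mul_nonsing_inv _ hun, Matrix.one_mulVec]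
  have hex : ∃ a b : ℂ, w 1 * a - w 2 * b = 1 := by
    by_cases h1 : w 1 = 0
    · by_cases h2 : w 2 = 0
      · exfalso
        have := (h (-(w 0)) 1 (by
          rw [← hv, ← hPu]; ext i
          simp [Matrix.mulVec, dotProduct, Fin.sum_univ_three, h1, h2]; ring)).2
        simp at this
      · exact ⟨0, -(w 2)⁻¹, by simp [h2]⟩
    · exact ⟨(w 1)⁻¹, 0, by simp [h1]⟩
  obtain ⟨a, b, hab⟩ := hex
  refine ⟨P * !![1, w 0, 0; 0, w 1, b; 0, w 2, a], ?_, ?_, ?_⟩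
  · rw [Matrix.det_mul, hP, Matrix.det_fin_three]; simp; linear_combination hab
  · rw [← hPu]; ext i; simp [Matrix.mul_apply, Fin.sum_univ_three]
  · rw [← hv]; ext i; simp [Matrix.mul_apply, Fin.sum_univ_three, Matrix.mulVec, dotProduct]

lemma sing_u {T : Tri} (hT : TSym T) (hs : TSmooth T) {U : V5 →ₗ[ℂ] ℂ} (hU : U ≠ 0) {M : V5 →ₗ[ℂ] M3}
    (hM : SymDet T (LinearMap.ker U) M) {u : Fin 3 → ℂ} (hu : u ≠ 0)
    (h : ∀ x, U x = 0 → u ⬝ᵥ (M x).mulVec u = 0) : False := by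
  obtain ⟨P, hP, hPu⟩ := ext_col u hu
  have hM' := hM.conj (P := P) (by simp [hP])
  refine no_sing_forms hT hs hU (entM (conjM P M) 0 1) (entM (conjM P M) 0 2) (-(entM (conjM P M) 2 2))
    ((2 : ℂ) • entM (conjM P M) 1 2) (-(entM (conjM P M) 1 1)) fun x hx => ?_
  have h00 : conjM P M x 0 0 = 0 := by rw [conjM_apply, conj_entry, hPu, h x hx]
  rw [hM'.2 x hx, sym_det (hM'.1 x)]
  simp only [entM_apply, LinearMap.neg_apply, LinearMap.smul_apply, smul_eq_mul, h00]
  ring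

lemma sing_pencil (A B : M3) : ∃ s t : ℂ, (s ≠ 0 ∨ t ≠ 0) ∧ (s • A + t • B).det = 0 := by
  by_cases hB : B.det = 0
  · exact ⟨0, 1, by simp, by simp [hB]⟩
  have hB' : IsUnit B.det := isUnit_iff_ne_zero.mpr hB
  obtain ⟨t, ht⟩ := IsAlgClosed.exists_root ((-(B⁻¹ * A)).charpoly) (by
    rw [Matrix.charpoly_degree_eq_dim]; simp)
  refine ⟨1, t, by simp, ?_⟩
  rw [Polynomial.IsRoot, Matrix.eval_charpoly] at ht
  have : (1 : ℂ) • A + t • B = B * (Matrix.scalar (Fin 3) t - -(B⁻¹ * A)) := by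
    rw [sub_neg_eq_add, Matrix.mul_add, ← Matrix.mul_assoc, Matrix.mul_nonsing_inv _ hB', Matrix.one_mul, one_smul, add_comm,
      ← Matrix.scalar_comm t (fun r => Commute.all _ _), ]
    congr 1
    ext i j; simp
  rw [this, Matrix.det_mul, ht, mul_zero]

lemma sym_rank2 {C : M3} (hC : C.transpose = C) (hd : C.det = 0) :
    ∃ u v : Fin 3 → ℂ, ∀ i j, C i j = u i * v j + v i * u j := by
  obtain ⟨n, hn, hCn⟩ := Matrix.exists_mulVec_eq_zero_iff.mpr hd
  obtain ⟨P, hP, hPn⟩ := ext_col n hn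
  have hun : IsUnit P.det := by simp [hP]
  set C' := P.transpose * C * P with hC'
  have hs : C'.transpose = C' := conj_sym P hC
  have h0 : ∀ i, C' i 0 = 0 := fun i => by rw [hC', conj_entry, hPn, hCn]; simp
  have h0' : ∀ i, C' 0 i = 0 := fun i => by rw [← hs]; exact h0 i
  have h21 : C' 2 1 = C' 1 2 := congrFun (congrFun hs 1) 2
  have fac : ∃ p q : Fin 3 → ℂ, ∀ i j, C' i j = p i * q j + q i * p j := by
    by_cases ha : C' 1 1 = 0
    · refine ⟨![0, 0, 1], ![0, C' 1 2, C' 2 2 / 2], fun i j => ?_⟩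
      fin_cases i <;> fin_cases j <;> simp [h0, h0', h21, ha]
    · obtain ⟨r, hr⟩ := exists_sqrt (C' 1 2 ^ 2 - C' 1 1 * C' 2 2)
      refine ⟨![0, 1, (C' 1 2 + r) / C' 1 1], ![0, C' 1 1 / 2, (C' 1 2 - r) / 2], fun i j => ?_⟩
      fin_cases i <;> fin_cases j <;> simp [h0, h0', h21] <;> field_simp <;> first | ring1 | linear_combination 2 * hr
  obtain ⟨p, q, hpq⟩ := fac
  have hCeq : C = P⁻¹.transpose * C' * P⁻¹ := by
    have e1 : P⁻¹.transpose * P.transpose = 1 := by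
      rw [← Matrix.transpose_mul, Matrix.mul_nonsing_inv _ hun, Matrix.transpose_one]
    rw [hC', Matrix.mul_assoc, Matrix.mul_assoc, Matrix.mul_nonsing_inv _ hun, Matrix.mul_one, ← Matrix.mul_assoc, e1, Matrix.one_mul]
  refine ⟨fun i => ∑ k, P⁻¹ k i * p k, fun i => ∑ k, P⁻¹ k i * q k, fun i j => ?_⟩
  rw [hCeq]
  simp only [Matrix.mul_apply, Matrix.transpose_apply, Fin.sum_univ_three, hpq]
  ring

/-- The symmetric matrix with given entries. -/
def symC : (Fin 7 → ℂ) →ₗ[ℂ] M3 where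
  toFun c := !![c 0, c 3, c 4; c 3, c 1, c 5; c 4, c 5, c 2]
  map_add' c d := by ext i j; fin_cases i <;> fin_cases j <;> simp
  map_smul' c d := by ext i j; fin_cases i <;> fin_cases j <;> simp

lemma lemmaK {T : Tri} (hT : TSym T) (hs : TSmooth T) {U : V5 →ₗ[ℂ] ℂ} (hU : U ≠ 0) {M : V5 →ₗ[ℂ] M3}
    (hM : SymDet T (LinearMap.ker U) M) :
    ∃ u v : Fin 3 → ℂ, (∀ s t : ℂ, s • u + t • v = 0 → s = 0 ∧ t = 0) ∧
      ∀ x, U x = 0 → u ⬝ᵥ (M x).mulVec v = 0 := by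
  let m : Fin 7 → (V5 →ₗ[ℂ] ℂ) := ![entM M 0 0, entM M 1 1, entM M 2 2, (2:ℂ) • entM M 0 1, (2:ℂ) • entM M 0 2,
    (2:ℂ) • entM M 1 2, U]
  let f : (Fin 7 → ℂ) →ₗ[ℂ] (V5 →ₗ[ℂ] ℂ) := Fintype.linearCombination ℂ m
  have h1 := LinearMap.finrank_range_add_finrank_ker f
  have h2 : Module.finrank ℂ (LinearMap.range f) ≤ 5 := by
    have := Submodule.finrank_le (LinearMap.range f)
    rwa [Module.finrank_linearMap_self, Module.finrank_fin_fun] at this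
  have h7 : Module.finrank ℂ (Fin 7 → ℂ) = 7 := by simp
  obtain ⟨p, hp, q, hq, hpq⟩ := two_indep_of_finrank (K := LinearMap.ker f) (by omega)
  have hker : ∀ c, f c = 0 → symC c = 0 → c = 0 := by
    intro c hc h0
    have e : ∀ i j, symC c i j = 0 := fun i j => by rw [h0]; rfl
    have e0 : c 0 = 0 := e 0 0
    have e1 : c 1 = 0 := e 1 1
    have e2 : c 2 = 0 := e 2 2
    have e3 : c 3 = 0 := e 0 1
    have e4 : c 4 = 0 := e 0 2
    have e5 : c 5 = 0 := e 1 2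
    have e6 : c 6 = 0 := by
      simp [f, Fintype.linearCombination_apply, Fin.sum_univ_succ, m] at hc
      simpa [e0, e1, e2, e3, e4, e5, show (Fin.succ 3 : Fin 5) = 4 from rfl, hU] using hc
    ext i; fin_cases i <;> simp [e0, e1, e2, e3, e4, e5, e6]
  obtain ⟨s, t, hst, hdet⟩ := sing_pencil (symC p) (symC q)
  rw [← map_smul, ← map_smul, ← map_add] at hdet
  set c := s • p + t • q with hc
  have hfc : f c = 0 := by rw [hc, map_add, map_smul, map_smul, hp, hq]; simp
  have hc0 : c ≠ 0 := fun h0 => by have := hpq s t h0; tauto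
  obtain ⟨u, v, huv⟩ := sym_rank2 (C := symC c) (by
    ext i j; fin_cases i <;> fin_cases j <;> simp [symC]) hdet
  have hpair : ∀ x, U x = 0 → u ⬝ᵥ (M x).mulVec v = 0 := by
    intro x hx
    have hs1 : M x 1 0 = M x 0 1 := congrFun (congrFun (hM.1 x) 0) 1
    have hs2 : M x 2 0 = M x 0 2 := congrFun (congrFun (hM.1 x) 0) 2
    have hs3 : M x 2 1 = M x 1 2 := congrFun (congrFun (hM.1 x) 1) 2
    have e := LinearMap.congr_fun hfc x
    have e' : c 0 * M x 0 0 + c 1 * M x 1 1 + c 2 * M x 2 2 + c 3 * (2 * M x 0 1) + c 4 * (2 * M x 0 2) + c 5 * (2 * M x 1 2) = 0 := by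
      simp [f, Fintype.linearCombination_apply, Fin.sum_univ_succ, m, hx, entM_apply] at e
      rw [← e]; ring
    have e0 : c 0 = _ := huv 0 0
    have e1 : c 1 = _ := huv 1 1
    have e2 : c 2 = _ := huv 2 2
    have e3 : c 3 = _ := huv 0 1
    have e4 : c 4 = _ := huv 0 2
    have e5 : c 5 = _ := huv 1 2
    rw [e0, e1, e2, e3, e4, e5] at e'
    simp only [dotProduct, Matrix.mulVec, Fin.sum_univ_three, hs1, hs2, hs3]
    linear_combination e' / 2
  have hnz : ∀ w : Fin 3 → ℂ, (∀ i j, u i * v j = 0) → False := fun w h0 => hc0 (hker c hfc (by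
    ext i j; rw [huv, h0 i j, mul_comm, h0 j i]; simp))
  have hu0 : u ≠ 0 := fun h0 => hnz 0 (by simp [h0])
  have hv0 : v ≠ 0 := fun h0 => hnz 0 (by simp [h0])
  refine ⟨u, v, fun a b hab => ?_, hpair⟩
  by_contra hne
  by_cases hb : b = 0
  · subst hb
    have : a ≠ 0 := by tauto
    simp at hab; tauto
  have hv : v = (-a / b) • u := by
    have : b • v = -(a • u) := by rw [eq_neg_iff_add_eq_zero, add_comm]; exact hab
    rw [← inv_smul_smul₀ hb v, this, smul_neg, smul_smul, ← neg_smul]; congr 1; ring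
  have hk : -a / b ≠ 0 := fun h0 => hv0 (by rw [hv, h0, zero_smul])
  refine sing_u hT hs hU hM hu0 fun x hx => ?_
  have := hpair x hx
  rw [hv, Matrix.mulVec_smul, dotProduct_smul, smul_eq_mul] at this
  exact (mul_eq_zero.mp this).resolve_left hk

def e3 (n : Fin 4 → ℂ) : ℂ := n 0 * n 1 * n 2 + n 0 * n 1 * n 3 + n 0 * n 2 * n 3 + n 1 * n 2 * n 3

/-- `T` restricted to `H` is the Cayley cubic in the coordinates `N`. -/
def Cay (T : Tri) (H : Submodule ℂ V5) (N : Fin 4 → (V5 →ₗ[ℂ] ℂ)) : Prop :=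
  (∀ x ∈ H, (∀ i, N i x = 0) → x = 0) ∧ ∀ x ∈ H, T x x x = e3 (fun i => N i x)

def BadD1 (T : Tri) : Prop :=
  ∃ (U X Y Z L : V5 →ₗ[ℂ] ℂ) (c d e : ℂ), Ind3 U X Y ∧ ∀ x, U x = 0 →
      T x x x = X x * Y x * L x - X x * Z x ^ 2 - Y x * (c * Z x + d * X x + e * Y x) ^ 2

def BadD2 (T : Tri) : Prop :=
  ∃ (U X Y Z W : V5 →ₗ[ℂ] ℂ) (c : ℂ), Ind3 U X Y ∧ ∀ x, U x = 0 →
      T x x x = c * X x * Y x ^ 2 - X x * Z x ^ 2 - Y x * W x ^ 2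

lemma Ind3.swap {U X Y : V5 →ₗ[ℂ] ℂ} (h : Ind3 U X Y) : Ind3 U Y X := fun a b c h0 => by
  have := h a c b (by rw [← h0]; abel)
  tauto

lemma classify_forms {T : Tri} (hT : TSym T) (hs : TSmooth T) {U : V5 →ₗ[ℂ] ℂ} (hU : U ≠ 0)
    (X Y Z W L : V5 →ₗ[ℂ] ℂ)
    (h : ∀ x, U x = 0 → T x x x = X x * Y x * L x - X x * Z x ^ 2 - Y x * W x ^ 2) :
    Ind3 U X Y := by
  intro a b c h0
  have h0' : ∀ x, U x = 0 → b * X x + c * Y x = 0 := fun x hx => by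
    have := LinearMap.congr_fun h0 x
    simpa [hx] using this
  by_cases hc : c = 0
  · by_cases hb : b = 0
    · subst hc hb; simp [hU] at h0; simp [h0]
    · exfalso
      subst hc
      refine no_sing_forms hT hs hU W 0 (-Y) 0 0 fun x hx => ?_
      have hX : X x = 0 := by have := h0' x hx; simp [hb] at this; exact this
      rw [h x hx, hX]; simp; ring
  · exfalso
    obtain ⟨κ, hκ⟩ := exists_sqrt (b / c)
    refine no_sing_forms hT hs hU X (Z - κ • W) ((-(b / c)) • L) (-(Z + κ • W)) 0 fun x hx => ?_
    have hY : Y x = -(b / c) * X x := by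
      have := h0' x hx
      field_simp; linear_combination this
    rw [h x hx, hY, ← hκ]; simp; ring

lemma form_of_inj {Y : Fin 5 → (V5 →ₗ[ℂ] ℂ)} (hY : ∀ x, (∀ i, Y i x = 0) → x = 0) (L : V5 →ₗ[ℂ] ℂ) :
    ∃ l : Fin 5 → ℂ, ∀ x, L x = ∑ i, l i * Y i x := by
  obtain ⟨b, hb, -⟩ := dual_coords (LinearMap.pi Y) (fun x hx => hY x fun i => congrFun hx i) 1
  refine ⟨fun i => L (b i), fun x => ?_⟩
  have := hb x
  simp only [Equiv.Perm.coe_one, id] at this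
  have e : L x = L (∑ i, (LinearMap.pi Y) x i • b i) := congrArg L this
  rw [e, map_sum]; simp [mul_comm]

lemma relation_of_not_inj {Y : Fin 5 → (V5 →ₗ[ℂ] ℂ)} (hY : ¬ ∀ x, (∀ i, Y i x = 0) → x = 0) :
    ∃ c : Fin 5 → ℂ, c ≠ 0 ∧ ∀ x, ∑ i, c i * Y i x = 0 := by
  have hns : ¬ Function.Surjective (LinearMap.pi Y : V5 →ₗ[ℂ] V5) := fun hsur => hY fun x hx => by
    have := LinearMap.injective_iff_surjective.mpr hsur
    exact (injective_iff_map_eq_zero _).mp this x (by ext i; simpa using hx i)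
  obtain ⟨f, hf, hle⟩ := Submodule.exists_le_ker_of_lt_top (LinearMap.range (LinearMap.pi Y : V5 →ₗ[ℂ] V5))
    (lt_top_iff_ne_top.mpr fun h => hns (LinearMap.range_eq_top.mp h))
  obtain ⟨i, hi⟩ := exists_ne_of_form hf
  refine ⟨fun i => f (Pi.single i 1), fun h => hi (congrFun h i), fun x => ?_⟩
  have := hle (LinearMap.mem_range_self (LinearMap.pi Y : V5 →ₗ[ℂ] V5) x)
  rw [LinearMap.mem_ker, form_sum] at this
  simpa using this

lemma classify {T : Tri} {U : V5 →ₗ[ℂ] ℂ} (X Y Z W L : V5 →ₗ[ℂ] ℂ)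
    (h : ∀ x, U x = 0 → T x x x = X x * Y x * L x - X x * Z x ^ 2 - Y x * W x ^ 2) (hI : Ind3 U X Y) :
    BadD1 T ∨ BadD2 T ∨ ∃ N, Cay T (LinearMap.ker U) N := by
  by_cases hinj : ∀ x, (∀ i, (![U, X, Y, Z, W] : Fin 5 → (V5 →ₗ[ℂ] ℂ)) i x = 0) → x = 0
  · right
    obtain ⟨l, hl⟩ := form_of_inj hinj L
    have hL : ∀ x, U x = 0 → L x = l 1 * X x + l 2 * Y x + l 3 * Z x + l 4 * W x := fun x hx => by
      rw [hl, Fin.sum_univ_five]; simp [hx]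
    set α := l 1 + l 4 ^ 2 / 4 with hα
    set β := l 2 + l 3 ^ 2 / 4 with hβ
    set Z' := Z - (l 3 / 2) • Y with hZ'
    set W' := W - (l 4 / 2) • X with hW'
    have hh : ∀ x, U x = 0 → T x x x = α * X x ^ 2 * Y x + β * X x * Y x ^ 2 - X x * Z' x ^ 2 - Y x * W' x ^ 2 := by
      intro x hx
      rw [h x hx, hL x hx, hα, hβ, hZ', hW']; simp; ring
    by_cases hα0 : α = 0
    · left
      exact ⟨U, X, Y, Z', W', β, hI, fun x hx => by rw [hh x hx, hα0]; ring⟩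
    by_cases hβ0 : β = 0
    · left
      exact ⟨U, Y, X, W', Z', α, hI.swap, fun x hx => by rw [hh x hx, hβ0]; ring⟩
    right
    obtain ⟨m, hm⟩ : ∃ m : ℂ, m ^ 3 = 16 * α * β := IsAlgClosed.exists_pow_nat_eq _ (by norm_num)
    have hm0 : m ≠ 0 := by rintro rfl; simp [hα0, hβ0] at hm
    obtain ⟨x0, hx0⟩ : ∃ x0, x0 = 4 * α / m := ⟨_, rfl⟩
    obtain ⟨y0, hy0⟩ : ∃ y0, y0 = 4 * β / m := ⟨_, rfl⟩
    have hx0n : x0 ≠ 0 := by rw [hx0]; simp [hα0, hm0]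
    have hy0n : y0 ≠ 0 := by rw [hy0]; simp [hβ0, hm0]
    have e1 : x0 ^ 2 * y0 = 4 * α := by
      rw [hx0, hy0]; field_simp; rw [hm]; ring
    have e2 : x0 * y0 ^ 2 = 4 * β := by
      rw [hx0, hy0]; field_simp; rw [hm]; ring
    obtain ⟨r, hr⟩ := exists_sqrt y0
    obtain ⟨s, hs⟩ := exists_sqrt x0
    have hr0 : r ≠ 0 := by rintro rfl; exact hy0n (by rw [← hr]; ring)
    have hs0 : s ≠ 0 := by rintro rfl; exact hx0n (by rw [← hs]; ring)
    refine ⟨![(1/2 : ℂ) • (x0 • X + (2 / r) • W'), (1/2 : ℂ) • (y0 • Y + (2 / s) • Z'),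
      (1/2 : ℂ) • (y0 • Y - (2 / s) • Z'), (1/2 : ℂ) • (x0 • X - (2 / r) • W')], ?_, ?_⟩
    · intro x hx hN
      have n0 := hN 0; have n1 := hN 1; have n2 := hN 2; have n3 := hN 3
      simp [-mul_eq_zero] at n0 n1 n2 n3
      have hX : X x = 0 := by
        have : x0 * X x = 0 := by linear_combination n0 + n3
        exact (mul_eq_zero.mp this).resolve_left hx0n
      have hY : Y x = 0 := by
        have : y0 * Y x = 0 := by linear_combination n1 + n2
        exact (mul_eq_zero.mp this).resolve_left hy0n
      have hW : W' x = 0 := by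
        have : 2 / r * W' x = 0 := by linear_combination n0 - n3
        exact (mul_eq_zero.mp this).resolve_left (by simp [hr0])
      have hZ : Z' x = 0 := by
        have : 2 / s * Z' x = 0 := by linear_combination n1 - n2
        exact (mul_eq_zero.mp this).resolve_left (by simp [hs0])
      apply hinj
      intro i
      simp [hW', hZ', hX, hY] at hW hZ
      have hx' : U x = 0 := hx
      fin_cases i <;> simp [hx', hX, hY, hW, hZ]
    · intro x hx
      rw [hh x hx]
      have i1 : (2 / r) ^ 2 * y0 = 4 := by rw [← hr]; field_simp; norm_num
      have i2 : (2 / s) ^ 2 * x0 = 4 := by rw [← hs]; field_simp; norm_num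
      simp only [e3, Matrix.cons_val, LinearMap.smul_apply, LinearMap.add_apply, LinearMap.sub_apply, smul_eq_mul]
      generalize 2 / r = r' at *
      generalize 2 / s = s' at *
      linear_combination (-(X x) ^ 2 * Y x / 4) * e1 - X x * Y x ^ 2 / 4 * e2 + Y x * W' x ^ 2 / 4 * i1 + X x * Z' x ^ 2 / 4 * i2
  · left
    obtain ⟨c, hc, hrel⟩ := relation_of_not_inj hinj
    have hrel' : ∀ x, c 0 * U x + c 1 * X x + c 2 * Y x + c 3 * Z x + c 4 * W x = 0 := fun x => by
      have := hrel x
      rw [Fin.sum_univ_five] at this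
      simpa using this
    by_cases h4 : c 4 = 0
    · have h3 : c 3 ≠ 0 := fun h3 => by
        have := hI (c 0) (c 1) (c 2) (by
          refine LinearMap.ext fun x => ?_
          have := hrel' x
          simp [h3, h4] at this; simpa using this)
        apply hc; ext i; fin_cases i <;> simp [this, h3, h4]
      refine ⟨U, Y, X, W, L, 0, -c 2 / c 3, -c 1 / c 3, hI.swap, fun x hx => ?_⟩
      have hZ : Z x = 0 * W x + -c 2 / c 3 * Y x + -c 1 / c 3 * X x := by
        have := hrel' x
        rw [hx, h4] at this
        field_simp; linear_combination this
      rw [h x hx, ← hZ]; ring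
    · refine ⟨U, X, Y, Z, L, -c 3 / c 4, -c 1 / c 4, -c 2 / c 4, hI, fun x hx => ?_⟩
      have hW : W x = -c 3 / c 4 * Z x + -c 1 / c 4 * X x + -c 2 / c 4 * Y x := by
        have := hrel' x
        rw [hx] at this
        field_simp; linear_combination this
      rw [h x hx, ← hW]

/-- Normal form coming from Lemma K. -/
lemma symDet_norm {T : Tri} (hT : TSym T) (hs : TSmooth T) {U : V5 →ₗ[ℂ] ℂ} (hU : U ≠ 0) {M : V5 →ₗ[ℂ] M3}
    (hM : SymDet T (LinearMap.ker U) M) : ∃ P : M3, P.det = 1 ∧ SymDet T (LinearMap.ker U) (conjM P M) ∧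
      ∀ x, U x = 0 → conjM P M x 0 1 = 0 := by
  obtain ⟨u, v, hind, huv⟩ := lemmaK hT hs hU hM
  obtain ⟨P, hP, hPu, hPv⟩ := ext_col2 u v hind
  refine ⟨P, hP, hM.conj (by simp [hP]), fun x hx => ?_⟩
  rw [conjM_apply, conj_entry, hPu, hPv, huv x hx]

lemma symDet_forms {T : Tri} {U : V5 →ₗ[ℂ] ℂ} {M : V5 →ₗ[ℂ] M3} (hM : SymDet T (LinearMap.ker U) M)
    (h01 : ∀ x, U x = 0 → M x 0 1 = 0) : ∀ x, U x = 0 → T x x x =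
      entM M 0 0 x * entM M 1 1 x * entM M 2 2 x - entM M 0 0 x * entM M 1 2 x ^ 2
        - entM M 1 1 x * entM M 0 2 x ^ 2 := fun x hx => by
  rw [hM.2 x hx, sym_det (hM.1 x), h01 x hx]; simp only [entM_apply]; ring

lemma cay_or_bad {T : Tri} (hT : TSym T) (hs : TSmooth T) {U : V5 →ₗ[ℂ] ℂ} (hU : U ≠ 0) {M : V5 →ₗ[ℂ] M3}
    (hM : SymDet T (LinearMap.ker U) M) : BadD1 T ∨ BadD2 T ∨ ∃ N, Cay T (LinearMap.ker U) N := by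
  obtain ⟨P, -, hP, h01⟩ := symDet_norm hT hs hU hM
  have := symDet_forms hP h01
  exact classify _ _ _ _ _ this (classify_forms hT hs hU _ _ _ _ _ this)

lemma hyp_ker {H : Submodule ℂ V5} (h : Module.finrank ℂ H = 4) : ∃ U : V5 →ₗ[ℂ] ℂ, U ≠ 0 ∧ H = LinearMap.ker U := by
  obtain ⟨U, hU, hle⟩ := Submodule.exists_le_ker_of_lt_top H (lt_top_iff_ne_top.mpr fun h' => by
    rw [h'] at h; simp at h)
  refine ⟨U, hU, Submodule.eq_of_le_of_finrank_le hle ?_⟩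
  have h1 := LinearMap.finrank_range_add_finrank_ker U
  have h2 : Module.finrank ℂ V5 = 5 := by simp
  have h3 : LinearMap.range U = ⊤ := LinearMap.range_eq_top.mpr (LinearMap.surjective hU)
  rw [h3, finrank_top, Module.finrank_self] at h1
  omega

/-! ### Uniqueness of the representation on a Cayley section -/

/-- derivative of the determinant -/
def dd (A B : M3) : ℂ := (A.adjugate * B).trace

lemma dd_eq (A B : M3) : dd A B =
    (A 1 1 * A 2 2 - A 1 2 * A 2 1) * B 0 0 + (A 1 2 * A 2 0 - A 1 0 * A 2 2) * B 0 1 + (A 1 0 * A 2 1 - A 1 1 * A 2 0) * B 0 2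
    + (A 0 2 * A 2 1 - A 0 1 * A 2 2) * B 1 0 + (A 0 0 * A 2 2 - A 0 2 * A 2 0) * B 1 1 + (A 0 1 * A 2 0 - A 0 0 * A 2 1) * B 1 2
    + (A 0 1 * A 1 2 - A 0 2 * A 1 1) * B 2 0 + (A 0 2 * A 1 0 - A 0 0 * A 1 2) * B 2 1 + (A 0 0 * A 1 1 - A 0 1 * A 1 0) * B 2 2 := by
  rw [dd, Matrix.adjugate_fin_three]
  simp only [Matrix.trace, Matrix.diag, Matrix.mul_apply, Fin.sum_univ_three, Matrix.of_apply, Matrix.cons_val]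
  ring

lemma det_line (A B : M3) (t : ℂ) : (A + t • B).det = A.det + t * dd A B + t ^ 2 * dd B A + t ^ 3 * B.det := by
  simp only [dd_eq, Matrix.det_fin_three, Matrix.add_apply, Matrix.smul_apply, smul_eq_mul]
  ring

lemma cub_compare {a0 a1 a2 a3 b0 b1 b2 b3 : ℂ}
    (h : ∀ t : ℂ, a0 + t * a1 + t ^ 2 * a2 + t ^ 3 * a3 = b0 + t * b1 + t ^ 2 * b2 + t ^ 3 * b3) : a1 = b1 := by
  have k0 := h 0; have k1 := h 1; have k2 := h (-1); have k3 := h 2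
  linear_combination -1/6 * k3 - 1/2 * k0 + k1 - 1/3 * k2

lemma SymDet.deriv {T : Tri} (hT : TSym T) {H : Submodule ℂ V5} {M : V5 →ₗ[ℂ] M3} (hM : SymDet T H M)
    {x v : V5} (hx : x ∈ H) (hv : v ∈ H) : 3 * T x x v = dd (M x) (M v) := by
  refine cub_compare (a0 := T x x x) (a2 := 3 * T v v x) (a3 := T v v v) (b0 := (M x).det) (b2 := dd (M v) (M x))
    (b3 := (M v).det) fun t => ?_
  rw [← det_line, ← map_smul, ← map_add, ← hM.2 _ (H.add_mem hx (H.smul_mem t hv)), tri_line hT]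
  ring

def de3 (n m : Fin 4 → ℂ) : ℂ :=
  m 0 * (n 1 * n 2 + n 1 * n 3 + n 2 * n 3) + m 1 * (n 0 * n 2 + n 0 * n 3 + n 2 * n 3)
  + m 2 * (n 0 * n 1 + n 0 * n 3 + n 1 * n 3) + m 3 * (n 0 * n 1 + n 0 * n 2 + n 1 * n 2)

lemma Cay.deriv {T : Tri} (hT : TSym T) {H : Submodule ℂ V5} {N} (hN : Cay T H N)
    {x v : V5} (hx : x ∈ H) (hv : v ∈ H) : 3 * T x x v = de3 (fun i => N i x) (fun i => N i v) := by
  refine cub_compare (a0 := T x x x) (a2 := 3 * T v v x) (a3 := T v v v) (b0 := e3 fun i => N i x)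
    (b2 := de3 (fun i => N i v) (fun i => N i x)) (b3 := e3 fun i => N i v) fun t => ?_
  have := hN.2 _ (H.add_mem hx (H.smul_mem t hv))
  rw [tri_line hT] at this
  simp only [map_add, map_smul, smul_eq_mul, e3, de3] at this ⊢
  linear_combination this

/-- nodes of a Cayley section -/
lemma Cay.nodes {T : Tri} {U : V5 →ₗ[ℂ] ℂ} {N} (hN : Cay T (LinearMap.ker U) N) :
    ∃ b : Fin 4 → V5, (∀ i, U (b i) = 0) ∧ (∀ i j, N j (b i) = if i = j then 1 else 0) ∧
      ∀ x, U x = 0 → x = ∑ i, N i x • b i := by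
  obtain ⟨b, hb, hb'⟩ := dual_coords (LinearMap.pi ![N 0, N 1, N 2, N 3, U]) (fun x hx => hN.1 x
    (by simpa using congrFun hx 4) (fun i => by
      fin_cases i
      · simpa using congrFun hx 0
      · simpa using congrFun hx 1
      · simpa using congrFun hx 2
      · simpa using congrFun hx 3)) 1
  have hb2 : ∀ i, LinearMap.pi ![N 0, N 1, N 2, N 3, U] (b i) = Pi.single i 1 := fun i => by
    obtain ⟨x, hx, hxb⟩ := hb' i
    rw [← hx, hxb]; rfl
  have hb3 : ∀ i j, (![N 0, N 1, N 2, N 3, U] j) (b i) = (Pi.single i 1 : Fin 5 → ℂ) j := fun i j => by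
    rw [← hb2]; rfl
  refine ⟨fun i => b i.castSucc, fun i => ?_, fun i j => ?_, fun x hx => ?_⟩
  · have := hb3 i.castSucc 4
    fin_cases i <;> simpa using this
  · have := hb3 i.castSucc j.castSucc
    fin_cases i <;> fin_cases j <;> simpa using this
  · have := hb x
    simp only [Equiv.Perm.coe_one, id, Fin.sum_univ_five] at this
    rw [Fin.sum_univ_four]
    simpa [hx] using this

lemma dd_rank2 (u v : Fin 3 → ℂ) (A B : M3) (hA : ∀ i j, A i j = u i * v j + v i * u j) (hB : B.transpose = B) :
    dd A B = -((![u 1 * v 2 - u 2 * v 1, u 2 * v 0 - u 0 * v 2, u 0 * v 1 - u 1 * v 0] : Fin 3 → ℂ) ⬝ᵥ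
      B.mulVec ![u 1 * v 2 - u 2 * v 1, u 2 * v 0 - u 0 * v 2, u 0 * v 1 - u 1 * v 0]) := by
  have h1 : B 1 0 = B 0 1 := congrFun (congrFun hB 0) 1
  have h2 : B 2 0 = B 0 2 := congrFun (congrFun hB 0) 2
  have h3 : B 2 1 = B 1 2 := congrFun (congrFun hB 1) 2
  rw [dd_eq]
  simp only [hA, h1, h2, h3, dotProduct, Matrix.mulVec, Fin.sum_univ_three, Matrix.cons_val]
  ring

lemma rank1_of_cross (u v : Fin 3 → ℂ) (A : M3) (hA : ∀ i j, A i j = u i * v j + v i * u j)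
    (h : (![u 1 * v 2 - u 2 * v 1, u 2 * v 0 - u 0 * v 2, u 0 * v 1 - u 1 * v 0] : Fin 3 → ℂ) = 0) :
    ∃ p : Fin 3 → ℂ, ∀ i j, A i j = p i * p j := by
  by_cases hu : u = 0
  · exact ⟨0, fun i j => by rw [hA, hu]; simp⟩
  have h0 : u 1 * v 2 - u 2 * v 1 = 0 := congrFun h 0
  have h1 : u 2 * v 0 - u 0 * v 2 = 0 := congrFun h 1
  have h2 : u 0 * v 1 - u 1 * v 0 = 0 := congrFun h 2
  have hc : ∀ i j, u i * v j = u j * v i := by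
    intro i j
    fin_cases i <;> fin_cases j <;> simp <;>
      first | ring1 | linear_combination h0 | linear_combination h1 | linear_combination h2 | linear_combination -h0
            | linear_combination -h1 | linear_combination -h2
  obtain ⟨k, hk⟩ : ∃ k, u k ≠ 0 := by
    by_contra hc; push Not at hc; exact hu (funext hc)
  obtain ⟨r, hr⟩ := exists_sqrt (2 * (v k / u k))
  refine ⟨fun i => r * u i, fun i j => ?_⟩
  have e : ∀ j, v j = v k / u k * u j := fun j => by
    have := hc k j; field_simp; linear_combination this
  rw [hA, e i, e j]
  linear_combination (-(u i * u j)) * hr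

lemma node_rank1 {T : Tri} (hT : TSym T) (hs : TSmooth T) {U : V5 →ₗ[ℂ] ℂ} (hU : U ≠ 0) {M : V5 →ₗ[ℂ] M3}
    (hM : SymDet T (LinearMap.ker U) M) {b : V5} (hb : U b = 0) (hsing : ∀ v, U v = 0 → T b b v = 0) :
    ∃ p : Fin 3 → ℂ, ∀ i j, M b i j = p i * p j := by
  have hd : (M b).det = 0 := by rw [← hM.2 b hb]; exact hsing b hb
  obtain ⟨u, v, huv⟩ := sym_rank2 (hM.1 b) hd
  refine rank1_of_cross u v _ huv ?_
  by_contra hne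
  refine sing_u hT hs hU hM hne fun x hx => ?_
  have h1 := hM.deriv hT (x := b) (v := x) hb hx
  rw [hsing x hx, dd_rank2 u v _ _ huv (hM.1 x), mul_zero] at h1
  exact neg_eq_zero.mp h1.symm

/-- the standard determinantal representation of the Cayley cubic -/
def stdM (N : Fin 4 → (V5 →ₗ[ℂ] ℂ)) : V5 →ₗ[ℂ] M3 where
  toFun x := !![N 0 x + N 3 x, N 3 x, N 3 x; N 3 x, N 1 x + N 3 x, N 3 x; N 3 x, N 3 x, N 2 x + N 3 x]
  map_add' x y := by ext i j; fin_cases i <;> fin_cases j <;> simp <;> ring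
  map_smul' c x := by ext i j; fin_cases i <;> fin_cases j <;> simp <;> ring

lemma stdM_symDet {T : Tri} {H : Submodule ℂ V5} {N} (hN : Cay T H N) : SymDet T H (stdM N) := by
  refine ⟨fun x => ?_, fun x hx => ?_⟩
  · ext i j; fin_cases i <;> fin_cases j <;> simp [stdM]
  · rw [hN.2 x hx, Matrix.det_fin_three]; simp [stdM, e3]; ring

/-- equivalence of representations on `H` -/
def MEq (H : Submodule ℂ V5) (M M' : V5 →ₗ[ℂ] M3) : Prop :=
  ∃ P : M3, IsUnit P.det ∧ ∀ x ∈ H, M' x = P.transpose * M x * P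

lemma MEq.symm {H : Submodule ℂ V5} {M M' : V5 →ₗ[ℂ] M3} (h : MEq H M M') : MEq H M' M := by
  obtain ⟨P, hP, h⟩ := h
  refine ⟨P⁻¹, by simpa using hP, fun x hx => ?_⟩
  have e1 : P⁻¹.transpose * P.transpose = 1 := by
    rw [← Matrix.transpose_mul, Matrix.mul_nonsing_inv _ hP, Matrix.transpose_one]
  rw [h x hx, Matrix.mul_assoc, Matrix.mul_assoc, Matrix.mul_nonsing_inv _ hP, Matrix.mul_one, ← Matrix.mul_assoc, e1, Matrix.one_mul]

lemma MEq.trans {H : Submodule ℂ V5} {M M' M'' : V5 →ₗ[ℂ] M3} (h : MEq H M M') (h' : MEq H M' M'') : MEq H M M'' := by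
  obtain ⟨P, hP, h⟩ := h
  obtain ⟨Q, hQ, h'⟩ := h'
  refine ⟨P * Q, by rw [Matrix.det_mul]; exact hP.mul hQ, fun x hx => ?_⟩
  rw [h' x hx, h x hx]; simp [Matrix.transpose_mul, Matrix.mul_assoc]

lemma cayley_unique {T : Tri} (hT : TSym T) (hs : TSmooth T) {U : V5 →ₗ[ℂ] ℂ} (hU : U ≠ 0) {M : V5 →ₗ[ℂ] M3}
    (hM : SymDet T (LinearMap.ker U) M) {N} (hN : Cay T (LinearMap.ker U) N) :
    MEq (LinearMap.ker U) M (stdM N) := by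
  obtain ⟨b, hbU, hbN, hb⟩ := hN.nodes
  have hp : ∀ i, ∃ p : Fin 3 → ℂ, ∀ j k, M (b i) j k = p j * p k := fun i => by
    refine node_rank1 hT hs hU hM (hbU i) fun v hv => ?_
    have := hN.deriv hT (x := b i) (v := v) (hbU i) hv
    have h0 : de3 (fun j => N j (b i)) (fun j => N j v) = 0 := by
      simp only [hbN]
      fin_cases i <;> simp [de3]
    rw [h0] at this; simpa using this
  choose p hp using hp
  have hMx : ∀ x, U x = 0 → M x = ∑ i, N i x • M (b i) := fun x hx => by
    conv_lhs => rw [hb x hx]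
    simp
  -- values with arbitrary coordinates
  have hval : ∀ n : Fin 4 → ℂ, (∑ i, n i • M (b i)).det = e3 n := fun n => by
    have hx : ∑ i, n i • b i ∈ LinearMap.ker U := by
      rw [LinearMap.mem_ker, map_sum]; simp [hbU]
    have h1 := hM.2 _ hx
    rw [hN.2 _ hx, map_sum] at h1
    simp only [map_smul, map_sum, hbN] at h1
    rw [← h1]
    congr 1; ext i; fin_cases i <;> simp
  let A : M3 := Matrix.of fun j i => p i.castSucc j
  have hA : A.det ^ 2 = 1 := by
    have h1 := hval ![1, 1, 1, 0]
    rw [show e3 ![1, 1, 1, 0] = 1 by simp [e3], Fin.sum_univ_four] at h1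
    simp only [Matrix.cons_val, one_smul, zero_smul, add_zero] at h1
    have h2 : M (b 0) + M (b 1) + M (b 2) = A * A.transpose := by
      ext i j; simp [hp, Matrix.mul_apply, Fin.sum_univ_three, A]
    rw [h2, Matrix.det_mul, Matrix.det_transpose] at h1
    rw [sq]; exact h1
  have hAu : IsUnit A.det := isUnit_iff_ne_zero.mpr fun h0 => by rw [h0] at hA; simp at hA
  let q : Fin 3 → ℂ := A⁻¹.mulVec (p 3)
  have hq : p 3 = A.mulVec q := by
    simp only [q]; rw [Matrix.mulVec_mulVec, Matrix.mul_nonsing_inv _ hAu, Matrix.one_mulVec]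
  -- the matrix in new coordinates
  have hform : ∀ n : Fin 4 → ℂ, ∑ i, n i • M (b i) = A * (Matrix.diagonal ![n 0, n 1, n 2] + n 3 • Matrix.of fun i j => q i * q j) * A.transpose := by
    intro n
    have hp3 : ∀ i, p 3 i = ∑ j, A i j * q j := fun i => by rw [hq]; rfl
    ext i j
    simp only [Fin.sum_univ_four, Matrix.add_apply, Matrix.smul_apply, hp, Matrix.mul_apply, Fin.sum_univ_three, hp3,
      Matrix.diagonal_apply, Matrix.transpose_apply, Matrix.of_apply, smul_eq_mul]
    simp [A]
    ring
  have hval' : ∀ n : Fin 4 → ℂ, (Matrix.diagonal ![n 0, n 1, n 2] + n 3 • Matrix.of fun i j => q i * q j).det = e3 n := by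
    intro n
    rw [← hval, hform, Matrix.det_mul, Matrix.det_mul, Matrix.det_transpose]
    linear_combination (-(Matrix.diagonal ![n 0, n 1, n 2] + n 3 • Matrix.of fun i j => q i * q j).det) * hA
  have hq2 : ∀ i, q i ^ 2 = 1 := by
    have a0 := hval' ![0, 1, 1, 1]
    have a1 := hval' ![1, 0, 1, 1]
    have a2 := hval' ![1, 1, 0, 1]
    simp [Matrix.det_fin_three, e3] at a0 a1 a2
    intro i
    fin_cases i
    · change q 0 ^ 2 = 1; linear_combination a0
    · change q 1 ^ 2 = 1; linear_combination a1
    · change q 2 ^ 2 = 1; linear_combination a2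
  refine ⟨(A⁻¹).transpose * Matrix.diagonal q, ?_, fun x hx => ?_⟩
  · rw [Matrix.det_mul, Matrix.det_transpose, Matrix.det_diagonal, Fin.prod_univ_three]
    refine IsUnit.mul (by simpa using hAu) (isUnit_iff_ne_zero.mpr fun h0 => ?_)
    have : (q 0 * q 1 * q 2) ^ 2 = 1 := by rw [mul_pow, mul_pow, hq2, hq2, hq2]; norm_num
    rw [h0] at this; simp at this
  · rw [hMx x hx, hform]
    have e1 : A⁻¹ * A = 1 := Matrix.nonsing_inv_mul _ hAu
    have e2 : A.transpose * (A⁻¹).transpose = 1 := by rw [← Matrix.transpose_mul, e1, Matrix.transpose_one]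
    rw [Matrix.transpose_mul, Matrix.transpose_transpose, Matrix.diagonal_transpose]
    have : ∀ D : M3, Matrix.diagonal q * A⁻¹ * (A * D * A.transpose) * ((A⁻¹).transpose * Matrix.diagonal q) =
        Matrix.diagonal q * D * Matrix.diagonal q := fun D => by
      calc _ = Matrix.diagonal q * (A⁻¹ * A) * D * (A.transpose * (A⁻¹).transpose) * Matrix.diagonal q := by
            simp only [Matrix.mul_assoc]
        _ = _ := by rw [e1, e2]; simp [Matrix.mul_assoc]
    rw [this]
    ext i j
    rw [Matrix.mul_diagonal, Matrix.diagonal_mul]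
    have q0 := hq2 0; have q1 := hq2 1; have q2 := hq2 2
    fin_cases i <;> fin_cases j <;> simp [stdM]
    · linear_combination (-N 0 x - N 3 x * (q 0 ^ 2 + 1)) * q0
    · linear_combination (-N 3 x * (q 1 ^ 2)) * q0 - N 3 x * q1
    · linear_combination (-N 3 x * (q 2 ^ 2)) * q0 - N 3 x * q2
    · linear_combination (-N 3 x * (q 1 ^ 2)) * q0 - N 3 x * q1
    · linear_combination (-N 1 x - N 3 x * (q 1 ^ 2 + 1)) * q1
    · linear_combination (-N 3 x * (q 2 ^ 2)) * q1 - N 3 x * q2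
    · linear_combination (-N 3 x * (q 2 ^ 2)) * q0 - N 3 x * q2
    · linear_combination (-N 3 x * (q 2 ^ 2)) * q1 - N 3 x * q2
    · linear_combination (-N 2 x - N 3 x * (q 2 ^ 2 + 1)) * q2

/-! ### Nondegeneracy -/

/-- Every cubic on `H` is a combination of `∂_b T` and the minors of `M`. -/
def ND (T : Tri) (H : Submodule ℂ V5) (M : V5 →ₗ[ℂ] M3) : Prop :=
  ∀ G : Tri, ∃ (m : V5 →ₗ[ℂ] ℂ) (K : V5 →ₗ[ℂ] M3) (b : V5), ∀ x ∈ H,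
    G x x x = m x * T x x b + dd (M x) (K x)

lemma dd_add (A B C : M3) : dd A (B + C) = dd A B + dd A C := by simp [dd, Matrix.mul_add]
lemma dd_smul (A B : M3) (c : ℂ) : dd A (c • B) = c * dd A B := by simp [dd]

lemma dd_conj (P A B : M3) : dd (P.transpose * A * P) (P.transpose * B * P) = P.det ^ 2 * dd A B := by
  refine cub_compare (a0 := (P.transpose * A * P).det) (a2 := dd (P.transpose * B * P) (P.transpose * A * P))
    (a3 := (P.transpose * B * P).det) (b0 := P.det ^ 2 * A.det) (b2 := P.det ^ 2 * dd B A) (b3 := P.det ^ 2 * B.det) fun t => ?_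
  rw [← det_line]
  have : P.transpose * A * P + t • (P.transpose * B * P) = P.transpose * (A + t • B) * P := by
    simp [Matrix.mul_add, Matrix.add_mul]
  rw [this, Matrix.det_mul, Matrix.det_mul, det_line, Matrix.det_transpose]; ring

lemma ND.congr {T : Tri} {H : Submodule ℂ V5} {M M' : V5 →ₗ[ℂ] M3} (h : ND T H M) (hM : MEq H M M') : ND T H M' := by
  obtain ⟨P, hP, hM⟩ := hM
  intro G
  obtain ⟨m, K, b, hG⟩ := h G
  have hP0 : P.det ≠ 0 := hP.ne_zero
  refine ⟨m, (P.det ^ 2)⁻¹ • conjM P K, b, fun x hx => ?_⟩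
  rw [hG x hx, hM x hx, LinearMap.smul_apply, conjM_apply, dd_smul, dd_conj]
  field_simp

lemma bil_expand {ι : Type} [Fintype ι] (G : Tri) (b : ι → V5) (y : ι → ℂ) (v : V5) :
    G (∑ i, y i • b i) (∑ i, y i • b i) v = ∑ i, ∑ j, y i * y j * G (b i) (b j) v := by
  have e1 : ∀ u, G (∑ i, y i • b i) u v = ∑ i, y i * G (b i) u v := fun u => by simp [LinearMap.sum_apply]
  have e2 : ∀ w, G w (∑ i, y i • b i) v = ∑ i, y i * G w (b i) v := fun w => by simp [LinearMap.sum_apply]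
  rw [e1]
  simp only [e2, Finset.mul_sum, mul_assoc]

lemma tri_expand {ι : Type} [Fintype ι] (G : Tri) (b : ι → V5) (y : ι → ℂ) :
    G (∑ i, y i • b i) (∑ i, y i • b i) (∑ i, y i • b i) =
      ∑ i, ∑ j, ∑ k, y i * y j * y k * G (b i) (b j) (b k) := by
  rw [bil_expand]
  simp only [map_sum, map_smul, smul_eq_mul, Finset.mul_sum, mul_assoc]

lemma cay_ND {T : Tri} (hT : TSym T) (hs : TSmooth T) {U : V5 →ₗ[ℂ] ℂ} (hU : U ≠ 0) {N}
    (hN : Cay T (LinearMap.ker U) N) : ND T (LinearMap.ker U) (stdM N) := by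
  intro G
  obtain ⟨b, hbU, hbN, hb⟩ := hN.nodes
  obtain ⟨i0, hi0⟩ := exists_ne_of_form hU
  set c : V5 := Pi.single i0 1 with hc
  have hne : ∀ i, T (b i) (b i) c ≠ 0 := by
    intro i h0
    have hbi : b i ≠ 0 := fun h => by have := hbN i i; rw [h] at this; simp at this
    apply hbi
    apply hs
    intro v
    have e : v = (v - (U v / U c) • c) + (U v / U c) • c := by simp
    have h1 := hN.deriv hT (x := b i) (v := v - (U v / U c) • c) (hbU i) (by simp [LinearMap.mem_ker, hi0])
    have h2 : ∀ n, de3 (fun j => N j (b i)) n = 0 := fun n => by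
      simp only [hbN]
      fin_cases i <;> simp [de3]
    rw [h2] at h1
    have h1' : T (b i) (b i) (v - (U v / U c) • c) = 0 := by simpa using h1
    rw [e, map_add, map_smul, h0, h1', smul_zero, add_zero]
  let m : Fin 4 → ℂ := fun i => G (b i) (b i) (b i) / T (b i) (b i) c
  -- the set of functions expressible through minors
  have hadd : ∀ {ι : Type} (s : Finset ι) (g : ι → V5 → ℂ), (∀ i ∈ s, ∃ K : V5 →ₗ[ℂ] M3, ∀ x, g i x = dd (stdM N x) (K x)) →
      ∃ K : V5 →ₗ[ℂ] M3, ∀ x, ∑ i ∈ s, g i x = dd (stdM N x) (K x) := by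
    intro ι s g
    classical
    induction s using Finset.induction_on with
    | empty => exact fun _ => ⟨0, fun x => by simp [dd]⟩
    | insert a s ha ih =>
      intro h
      obtain ⟨K1, h1⟩ := h a (by simp)
      obtain ⟨K2, h2⟩ := ih fun i hi => h i (by simp [hi])
      exact ⟨K1 + K2, fun x => by rw [Finset.sum_insert ha, h1, h2, LinearMap.add_apply, dd_add]⟩
  have hsingle : ∀ (k1 k2 k3 k4 : V5 →ₗ[ℂ] ℂ), ∃ K : V5 →ₗ[ℂ] M3, ∀ x, K x = !![k1 x, k2 x, k3 x; 0, 0, k4 x; 0, 0, 0] := by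
    intro k1 k2 k3 k4
    exact ⟨{ toFun := fun x => !![k1 x, k2 x, k3 x; 0, 0, k4 x; 0, 0, 0]
             map_add' := fun x y => by ext i j; fin_cases i <;> fin_cases j <;> simp
             map_smul' := fun x y => by ext i j; fin_cases i <;> fin_cases j <;> simp }, fun x => rfl⟩
  have hmon' : ∀ i j : Fin 4, i < j → ∀ ℓ : V5 →ₗ[ℂ] ℂ, ∃ K : V5 →ₗ[ℂ] M3, ∀ x, N i x * N j x * ℓ x = dd (stdM N x) (K x) := by
    intro i j hij ℓ
    fin_cases i <;> fin_cases j <;> first | (exfalso; revert hij; decide) | skip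
    · obtain ⟨K, hK⟩ : ∃ K : V5 →ₗ[ℂ] M3, ∀ x, K x = !![0, 0, ℓ x; 0, 0, ℓ x; 0, 0, ℓ x] :=
        ⟨{ toFun := fun x => !![0, 0, ℓ x; 0, 0, ℓ x; 0, 0, ℓ x]
           map_add' := fun x y => by ext i j; fin_cases i <;> fin_cases j <;> simp
           map_smul' := fun x y => by ext i j; fin_cases i <;> fin_cases j <;> simp }, fun x => rfl⟩
      exact ⟨K, fun x => by rw [hK, dd_eq]; simp [stdM]; ring⟩
    · obtain ⟨K, hK⟩ : ∃ K : V5 →ₗ[ℂ] M3, ∀ x, K x = !![0, ℓ x, 0; 0, ℓ x, 0; 0, ℓ x, 0] :=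
        ⟨{ toFun := fun x => !![0, ℓ x, 0; 0, ℓ x, 0; 0, ℓ x, 0]
           map_add' := fun x y => by ext i j; fin_cases i <;> fin_cases j <;> simp
           map_smul' := fun x y => by ext i j; fin_cases i <;> fin_cases j <;> simp }, fun x => rfl⟩
      exact ⟨K, fun x => by rw [hK, dd_eq]; simp [stdM]; ring⟩
    · obtain ⟨K, hK⟩ := hsingle 0 0 0 (-ℓ)
      exact ⟨K, fun x => by rw [hK, dd_eq]; simp [stdM]; ring⟩
    · obtain ⟨K, hK⟩ := hsingle ℓ ℓ ℓ 0
      exact ⟨K, fun x => by rw [hK, dd_eq]; simp [stdM]; ring⟩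
    · obtain ⟨K, hK⟩ := hsingle 0 0 (-ℓ) 0
      exact ⟨K, fun x => by rw [hK, dd_eq]; simp [stdM]; ring⟩
    · obtain ⟨K, hK⟩ := hsingle 0 (-ℓ) 0 0
      exact ⟨K, fun x => by rw [hK, dd_eq]; simp [stdM]; ring⟩
  have hmon : ∀ i j : Fin 4, i ≠ j → ∀ ℓ : V5 →ₗ[ℂ] ℂ, ∃ K : V5 →ₗ[ℂ] M3, ∀ x, N i x * N j x * ℓ x = dd (stdM N x) (K x) := by
    intro i j hij ℓ
    rcases lt_or_gt_of_ne hij with h | h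
    · exact hmon' i j h ℓ
    · obtain ⟨K, hK⟩ := hmon' j i h ℓ
      exact ⟨K, fun x => by rw [← hK]; ring⟩
  obtain ⟨K, hK⟩ := hadd Finset.univ (fun (p : Fin 4 × Fin 4 × Fin 4) x =>
      N p.1 x * N p.2.1 x * N p.2.2 x * (G (b p.1) (b p.2.1) (b p.2.2) - m p.2.2 * T (b p.1) (b p.2.1) c)) (by
    rintro ⟨i, j, k⟩ -
    simp only
    by_cases hij : i = j
    · by_cases hik : i = k
      · subst hij hik
        refine ⟨0, fun x => ?_⟩
        simp only [m, div_mul_cancel₀ _ (hne i), sub_self, LinearMap.zero_apply]; simp [dd]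
      · obtain ⟨K, hK⟩ := hmon i k hik ((G (b i) (b j) (b k) - m k * T (b i) (b j) c) • N j)
        exact ⟨K, fun x => by rw [← hK, LinearMap.smul_apply, smul_eq_mul]; ring⟩
    · obtain ⟨K, hK⟩ := hmon i j hij ((G (b i) (b j) (b k) - m k * T (b i) (b j) c) • N k)
      exact ⟨K, fun x => by rw [← hK, LinearMap.smul_apply, smul_eq_mul]; ring⟩)
  refine ⟨∑ i, m i • N i, K, c, fun x hx => ?_⟩
  rw [← hK]
  have hxe := hb x hx
  have e1 : G x x x = ∑ i, ∑ j, ∑ k, N i x * N j x * N k x * G (b i) (b j) (b k) := by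
    conv_lhs => rw [hxe]
    exact tri_expand G b _
  have e2 : T x x c = ∑ i, ∑ j, N i x * N j x * T (b i) (b j) c := by
    conv_lhs => rw [hxe]
    exact bil_expand T b _ c
  rw [e1, e2, Fintype.sum_prod_type]
  simp only [Fintype.sum_prod_type]
  simp only [LinearMap.sum_apply, LinearMap.smul_apply, smul_eq_mul, Finset.sum_mul, Finset.mul_sum, mul_sub,
    Finset.sum_sub_distrib]
  rw [add_sub, eq_sub_iff_add_eq, add_comm]
  congr 1
  exact Finset.sum_congr rfl fun i _ => Finset.sum_congr rfl fun j _ => Finset.sum_congr rfl fun k _ => by ring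

/-! ### Node lines versus determinantal hyperplanes -/

def NodeSet (F : MvPolynomial (Fin 5) ℂ) : Set (Submodule ℂ (Fin 5 → ℂ)) :=
  {l : Submodule ℂ (Fin 5 → ℂ) | IsLine l ∧ LiesOn F l ∧
          ∃ Pl₁ Pl₂ r₁ r₂ : Submodule ℂ (Fin 5 → ℂ), r₁ ≠ r₂ ∧
            LiesOn F r₁ ∧ LiesOn F r₂ ∧
            CycleLplus2R F l r₁ Pl₁ ∧ CycleLplus2R F l r₂ Pl₂}

/-- subspace cut out by some of the coordinates -/
def cut (Y : Fin 5 → (V5 →ₗ[ℂ] ℂ)) (S : Finset (Fin 5)) : Submodule ℂ V5 := ⨅ i ∈ S, LinearMap.ker (Y i)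

lemma mem_cut {Y : Fin 5 → (V5 →ₗ[ℂ] ℂ)} {S : Finset (Fin 5)} {x : V5} : x ∈ cut Y S ↔ ∀ i ∈ S, Y i x = 0 := by
  simp [cut, Submodule.mem_iInf]

lemma finrank_cut {Y : Fin 5 → (V5 →ₗ[ℂ] ℂ)} (hY : ∀ x, (∀ i, Y i x = 0) → x = 0) (S : Finset (Fin 5)) :
    Module.finrank ℂ (cut Y S) = 5 - S.card := by
  have hinj : Function.Injective (LinearMap.pi Y : V5 →ₗ[ℂ] V5) :=
    (injective_iff_map_eq_zero _).mpr fun x hx => hY x fun i => congrFun hx i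
  let e : V5 ≃ₗ[ℂ] V5 := LinearEquiv.ofInjectiveEndo (LinearMap.pi Y) hinj
  have h1 : cut Y S = (⨅ i ∈ (S : Set (Fin 5)), LinearMap.ker (LinearMap.proj i : V5 →ₗ[ℂ] ℂ)).comap (e : V5 →ₗ[ℂ] V5) := by
    ext x; rw [mem_cut]; simp [Submodule.mem_iInf, e]
  have h2 : Module.finrank ℂ (cut Y S) = Module.finrank ℂ (⨅ i ∈ (S : Set (Fin 5)), LinearMap.ker (LinearMap.proj i : V5 →ₗ[ℂ] ℂ) : Submodule ℂ V5) := by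
    rw [h1]
    exact (e.submoduleMap _).finrank_eq.trans (by
      rw [Submodule.map_comap_eq_of_surjective e.surjective])
  rw [h2, (LinearMap.iInfKerProjEquiv ℂ (fun _ : Fin 5 => ℂ) (I := ((Sᶜ : Finset (Fin 5)) : Set (Fin 5))) (J := S)
    (by simpa using disjoint_compl_left) (by simp)).finrank_eq]
  simp [Finset.card_compl]

/-- `T` restricted to the plane `Pl` is a line plus a double line. -/
def DPlane (T : Tri) (l Pl : Submodule ℂ V5) : Prop :=
  Module.finrank ℂ Pl = 3 ∧ l ≤ Pl ∧ ∃ L R : V5 →ₗ[ℂ] ℂ, Pl ⊓ LinearMap.ker L = l ∧ ∀ p ∈ Pl, T p p p = L p * R p ^ 2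

lemma DPlane.of_cycle {F T} (hF : TriOf F T) {l r Pl : Submodule ℂ V5} (h : CycleLplus2R F l r Pl) : DPlane T l Pl := by
  obtain ⟨-, -, h3, h4, -, -, c, L, R, hc, -, -, hL, -, hp⟩ := h
  refine ⟨h3, h4, c • L, R, ?_, fun p hpP => ?_⟩
  · rw [← hL]; ext x; simp [hc]
  · rw [← hF.2.1, hp p hpP]; simp

lemma le_or_le_of_union {l r1 r2 : Submodule ℂ V5} (h : ∀ p ∈ r1, p ∈ l ∨ p ∈ r2) : r1 ≤ l ∨ r1 ≤ r2 := by
  by_contra hc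
  push Not at hc
  obtain ⟨p, hp, hpl⟩ := SetLike.not_le_iff_exists.mp hc.1
  obtain ⟨q, hq, hqr⟩ := SetLike.not_le_iff_exists.mp hc.2
  have hp2 := (h p hp).resolve_left hpl
  have hq2 := (h q hq).resolve_right hqr
  rcases h (p + q) (r1.add_mem hp hq) with h | h
  · exact hpl (by simpa using l.sub_mem h hq2)
  · exact hqr (by simpa using r2.sub_mem h hp2)

lemma planes_ne {F l r1 r2 Pl1 Pl2} (h1 : CycleLplus2R F l r1 Pl1) (h2 : CycleLplus2R F l r2 Pl2) (hr : r1 ≠ r2) :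
    Pl1 ≠ Pl2 := by
  rintro rfl
  obtain ⟨hl, hr1, h3, h4, h5, h6, c, L, R, hc, -, -, hL, hR, hp⟩ := h1
  obtain ⟨-, hr2, -, -, h5', h6', c', L', R', hc', -, -, hL', hR', hp'⟩ := h2
  have : ∀ p ∈ r1, p ∈ l ∨ p ∈ r2 := fun p hp1 => by
    have hpP := h5 hp1
    have hR0 : R p = 0 := by rw [← hR] at hp1; exact hp1.2
    have := hp' p hpP
    rw [hp p hpP, hR0] at this
    simp [hc'] at this
    rcases this with h | h
    · left; rw [← hL']; exact ⟨hpP, h⟩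
    · right; rw [← hR']; exact ⟨hpP, h⟩
  rcases le_or_le_of_union this with h | h
  · exact h6 (Submodule.eq_of_le_of_finrank_eq h (hr1.trans hl.symm))
  · exact hr (Submodule.eq_of_le_of_finrank_eq h (hr1.trans hr2.symm))

lemma finrank_le_two_of_lt {Pl K : Submodule ℂ V5} (h : Module.finrank ℂ Pl = 3) (hK : K < Pl) : Module.finrank ℂ K ≤ 2 := by
  have := Submodule.finrank_lt_finrank_of_lt hK
  omega

/-- linear algebra data of two planes through `l` -/
lemma two_planes {l Pl1 Pl2 : Submodule ℂ V5} (hl : Module.finrank ℂ l = 2) (h1 : Module.finrank ℂ Pl1 = 3)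
    (h2 : Module.finrank ℂ Pl2 = 3) (hl1 : l ≤ Pl1) (hl2 : l ≤ Pl2) (hne : Pl1 ≠ Pl2) :
    Module.finrank ℂ (Pl1 ⊔ Pl2 : Submodule ℂ V5) = 4 ∧ ∃ (s t : V5 →ₗ[ℂ] ℂ) (v1 v2 : V5), v1 ∈ Pl1 ∧ v2 ∈ Pl2 ∧
      Pl1 ≤ LinearMap.ker t ∧ Pl2 ≤ LinearMap.ker s ∧ s v1 = 1 ∧ t v2 = 1 ∧
      ∀ x ∈ Pl1 ⊔ Pl2, x - s x • v1 - t x • v2 ∈ l := by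
  have hinf : Pl1 ⊓ Pl2 = l := by
    refine (Submodule.eq_of_le_of_finrank_le (le_inf hl1 hl2) ?_).symm
    rw [hl]
    refine finrank_le_two_of_lt h1 (lt_of_le_of_ne inf_le_left fun h => hne ?_)
    exact Submodule.eq_of_le_of_finrank_eq (inf_eq_left.mp h) (h1.trans h2.symm)
  have hsum := Submodule.finrank_sup_add_finrank_inf_eq Pl1 Pl2
  rw [hinf, hl, h1, h2] at hsum
  refine ⟨by omega, ?_⟩
  have n1 : ¬ Pl1 ≤ Pl2 := fun h => hne (Submodule.eq_of_le_of_finrank_eq h (h1.trans h2.symm))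
  have n2 : ¬ Pl2 ≤ Pl1 := fun h => hne (Submodule.eq_of_le_of_finrank_eq h (h2.trans h1.symm)).symm
  obtain ⟨v1, hv1, hv1'⟩ := SetLike.not_le_iff_exists.mp n1
  obtain ⟨v2, hv2, hv2'⟩ := SetLike.not_le_iff_exists.mp n2
  obtain ⟨s, hs, hsk⟩ := Submodule.exists_le_ker_of_notMem hv1'
  obtain ⟨t, ht, htk⟩ := Submodule.exists_le_ker_of_notMem hv2'
  have a1 : Pl1 ⊓ LinearMap.ker s = l := by
    refine (Submodule.eq_of_le_of_finrank_le (le_inf hl1 (hl2.trans hsk)) ?_).symm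
    rw [hl]
    refine finrank_le_two_of_lt h1 (lt_of_le_of_ne inf_le_left fun h => hs ?_)
    exact (inf_eq_left.mp h) hv1
  have a2 : Pl2 ⊓ LinearMap.ker t = l := by
    refine (Submodule.eq_of_le_of_finrank_le (le_inf hl2 (hl1.trans htk)) ?_).symm
    rw [hl]
    refine finrank_le_two_of_lt h2 (lt_of_le_of_ne inf_le_left fun h => ht ?_)
    exact (inf_eq_left.mp h) hv2
  refine ⟨(s v1)⁻¹ • s, (t v2)⁻¹ • t, v1, v2, hv1, hv2, fun x hx => ?_, fun x hx => ?_, by simp [hs], by simp [ht], fun x hx => ?_⟩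
  · have := htk hx; rw [LinearMap.mem_ker] at this ⊢; simp [this]
  · have := hsk hx; rw [LinearMap.mem_ker] at this ⊢; simp [this]
  · obtain ⟨a, ha, b, hb, rfl⟩ := Submodule.mem_sup.mp hx
    have ta : t a = 0 := htk ha
    have sb : s b = 0 := hsk hb
    have m1 : a - ((s v1)⁻¹ * s a) • v1 ∈ l := by
      rw [← a1]; exact ⟨Pl1.sub_mem ha (Pl1.smul_mem _ hv1), by simp [LinearMap.mem_ker, hs]; field_simp; simp⟩
    have m2 : b - ((t v2)⁻¹ * t b) • v2 ∈ l := by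
      rw [← a2]; exact ⟨Pl2.sub_mem hb (Pl2.smul_mem _ hv2), by simp [LinearMap.mem_ker, ht]; field_simp; simp⟩
    have := l.add_mem m1 m2
    convert this using 1
    simp [ta, sb]; abel

/-- The cubic on a double plane in terms of a form `s` vanishing on `l` -/
lemma DPlane.form {T l Pl} (h : DPlane T l Pl) {v : V5} (hv : v ∈ Pl) :
    ∃ R : V5 →ₗ[ℂ] ℂ, ∀ p ∈ l, ∀ s : ℂ, T (p + s • v) (p + s • v) (p + s • v) = s * R (p + s • v) ^ 2 := by
  obtain ⟨-, hl, L, R, hL, hT⟩ := h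
  obtain ⟨r, hr⟩ := exists_sqrt (L v)
  refine ⟨r • R, fun p hp s => ?_⟩
  have hLp : L p = 0 := by rw [← hL] at hp; exact hp.2
  rw [hT _ (Pl.add_mem (hl hp) (Pl.smul_mem _ hv))]
  simp only [map_add, map_smul, hLp, LinearMap.smul_apply, smul_eq_mul]
  rw [← hr]; ring

lemma no_three {T : Tri} (hD : ¬ D3cfg T) {l Pl1 Pl2 Pl3 : Submodule ℂ V5} (hl : Module.finrank ℂ l = 2)
    (h1 : DPlane T l Pl1) (h2 : DPlane T l Pl2) (h3 : DPlane T l Pl3) (hne : Pl1 ≠ Pl2) : Pl3 ≤ Pl1 ⊔ Pl2 := by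
  by_contra hn
  obtain ⟨v3, hv3, hv3'⟩ := SetLike.not_le_iff_exists.mp hn
  obtain ⟨h4, s, t, v1, v2, hv1, hv2, ht1, hs2, hs1, ht2, hdec⟩ := two_planes hl h1.1 h2.1 h1.2.1 h2.2.1 hne
  obtain ⟨U, hU, hUk⟩ := hyp_ker h4
  have hU3 : U v3 ≠ 0 := fun h0 => hv3' (by rw [hUk]; exact h0)
  have hmem : ∀ x, U x = 0 → x - s x • v1 - t x • v2 ∈ l := fun x hx => hdec x (by rw [hUk]; exact hx)
  have hUv1 : U v1 = 0 := by
    have : v1 ∈ Pl1 ⊔ Pl2 := (le_sup_left : Pl1 ≤ _) hv1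
    rw [hUk] at this; exact this
  have hUv2 : U v2 = 0 := by
    have : v2 ∈ Pl1 ⊔ Pl2 := (le_sup_right : Pl2 ≤ _) hv2
    rw [hUk] at this; exact this
  have hUl : ∀ p ∈ l, U p = 0 := fun p hp => by
    have : p ∈ Pl1 ⊔ Pl2 := (le_sup_left : Pl1 ≤ _) (h1.2.1 hp)
    rw [hUk] at this; exact this
  have ht1' : t v1 = 0 := ht1 hv1
  have hs2' : s v2 = 0 := hs2 hv2
  obtain ⟨R1, hR1⟩ := h1.form hv1
  obtain ⟨R2, hR2⟩ := h2.form hv2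
  obtain ⟨R3, hR3⟩ := h3.form hv3
  set X2 : V5 →ₗ[ℂ] ℂ := (U v3)⁻¹ • U with hX2
  have x23 : X2 v3 = 1 := by simp [hX2, hU3]
  have x20 : ∀ x, X2 x = 0 → U x = 0 := fun x hx => by simpa [hX2, hU3] using hx
  have x21 : X2 v1 = 0 := by simp [hX2, hUv1]
  have x22 : X2 v2 = 0 := by simp [hX2, hUv2]
  refine hD ⟨![s - s v3 • X2, t - t v3 • X2, X2], ![R1, R2, R3], ?_, ?_⟩
  · intro a b c h0
    have e := fun x => LinearMap.congr_fun h0 x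
    have e1 := e v1; have e2 := e v2; have e3 := e v3
    simp [hs1, ht1', x21, x22, x23, ht2, hs2'] at e1 e2 e3
    exact ⟨e1, e2, e3⟩
  · intro i x hx
    fin_cases i
    · have k1 := hx 1 (by decide); have k2 := hx 2 (by decide)
      simp at k1 k2
      have k3 : t x = 0 := by simpa [k2] using k1
      have := hmem x (x20 x k2)
      rw [k3, zero_smul, sub_zero] at this
      have := hR1 _ this (s x)
      rw [sub_add_cancel] at this
      simpa [k2] using this
    · have k1 := hx 0 (by decide); have k2 := hx 2 (by decide)
      simp at k1 k2
      have k3 : s x = 0 := by simpa [k2] using k1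
      have := hmem x (x20 x k2)
      rw [k3, zero_smul, sub_zero] at this
      have := hR2 _ this (t x)
      rw [sub_add_cancel] at this
      simpa [k2] using this
    · have k1 := hx 0 (by decide); have k2 := hx 1 (by decide)
      simp at k1 k2
      have hh := hmem (x - X2 x • v3) (x20 _ (by simp [x23]))
      have e1 : s (x - X2 x • v3) = 0 := by simp; linear_combination k1
      have e2 : t (x - X2 x • v3) = 0 := by simp; linear_combination k2
      rw [e1, e2, zero_smul, zero_smul, sub_zero, sub_zero] at hh
      have := hR3 _ hh (X2 x)
      rw [sub_add_cancel] at this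
      simpa using this

lemma cut_inj {Y : Fin 5 → (V5 →ₗ[ℂ] ℂ)} (hY : ∀ x, (∀ i, Y i x = 0) → x = 0) {S S' : Finset (Fin 5)}
    (h : cut Y S = cut Y S') : S = S' := by
  have h1 : cut Y (S ∪ S') = cut Y S := by
    ext x
    have h2 : x ∈ cut Y S ↔ x ∈ cut Y S' := by rw [h]
    rw [mem_cut]
    constructor
    · intro hx; exact mem_cut.mpr fun i hi => hx i (Finset.mem_union_left _ hi)
    · intro hx i hi
      rcases Finset.mem_union.mp hi with hi | hi
      · exact mem_cut.mp hx i hi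
      · exact mem_cut.mp (h2.mp hx) i hi
  have c1 := finrank_cut hY S
  have c2 := finrank_cut hY S'
  have c3 := finrank_cut hY (S ∪ S')
  have d1 := Finset.card_le_univ S
  have d2 := Finset.card_le_univ S'
  have d3 := Finset.card_le_univ (S ∪ S')
  rw [h1] at c3
  rw [← h] at c2
  simp only [Fintype.card_fin] at d1 d2 d3
  have e1 : S = S ∪ S' := Finset.eq_of_subset_of_card_le Finset.subset_union_left (by omega)
  have e2 : S' = S ∪ S' := Finset.eq_of_subset_of_card_le Finset.subset_union_right (by omega)
  rw [e1, ← e2]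

/-- the line `{A + D = B + C = 0}` of a Cayley hyperplane section -/
lemma cay_line {F T} (hF : TriOf F T) {U A B C D : V5 →ₗ[ℂ] ℂ}
    (hinj : ∀ x, U x = 0 → A x = 0 → B x = 0 → C x = 0 → D x = 0 → x = 0)
    (hc : ∀ x, U x = 0 → T x x x = A x * B x * C x + A x * B x * D x + A x * C x * D x + B x * C x * D x)
    {l : Submodule ℂ V5} (hl : ∀ x, x ∈ l ↔ U x = 0 ∧ A x + D x = 0 ∧ B x + C x = 0) :
    l ∈ NodeSet F ∧ ∃ Pl1 Pl2, DPlane T l Pl1 ∧ DPlane T l Pl2 ∧ Pl1 ≠ Pl2 ∧ Pl1 ≤ LinearMap.ker U ∧ Pl2 ≤ LinearMap.ker U := by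
  set Y : Fin 5 → (V5 →ₗ[ℂ] ℂ) := ![U, A + D, B + C, A, B] with hYd
  have hY : ∀ x, (∀ i, Y i x = 0) → x = 0 := fun x hx => by
    have h0 := hx 0; have h1 := hx 1; have h2 := hx 2; have h3 := hx 3; have h4 := hx 4
    simp [Y] at h0 h1 h2 h3 h4
    exact hinj x h0 h3 h4 (by simpa [h4] using h2) (by simpa [h3] using h1)
  have hlc : l = cut Y {0, 1, 2} := by
    ext x; rw [hl, mem_cut]; simp [Y]
  have c1 : CycleLplus2R F l (cut Y {0, 1, 3}) (cut Y {0, 1}) := by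
    rw [hlc]
    refine ⟨finrank_cut hY _, finrank_cut hY _, finrank_cut hY _, ?_, ?_, ?_, -1, Y 2, Y 3, by simp, ?_, ?_, ?_, ?_, ?_⟩
    · intro x; simp only [mem_cut]; intro h i hi; exact h i (by revert hi; revert i; decide)
    · intro x; simp only [mem_cut]; intro h i hi; exact h i (by revert hi; revert i; decide)
    · intro h; exact absurd (cut_inj hY h) (by decide)
    · by_contra hcon
      push Not at hcon
      refine absurd (cut_inj hY (S := {0, 1, 2}) (S' := {0, 1}) ?_) (by decide)
      ext x
      have := hcon x
      simp only [mem_cut] at this ⊢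
      simp at this ⊢
      tauto
    · by_contra hcon
      push Not at hcon
      refine absurd (cut_inj hY (S := {0, 1, 3}) (S' := {0, 1}) ?_) (by decide)
      ext x
      have := hcon x
      simp only [mem_cut] at this ⊢
      simp at this ⊢
      tauto
    · ext x; simp [mem_cut, and_assoc]
    · ext x; simp [mem_cut, and_assoc]
    · intro p hp
      have h0 := mem_cut.mp hp 0 (by simp); have h1 := mem_cut.mp hp 1 (by simp)
      simp [Y] at h0 h1
      rw [hF.2.1, hc p h0]
      simp [Y]
      linear_combination (A p * B p + A p * C p + B p * C p) * h1
  have c2 : CycleLplus2R F l (cut Y {0, 2, 4}) (cut Y {0, 2}) := by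
    rw [hlc]
    refine ⟨finrank_cut hY _, finrank_cut hY _, finrank_cut hY _, ?_, ?_, ?_, -1, Y 1, Y 4, by simp, ?_, ?_, ?_, ?_, ?_⟩
    · intro x; simp only [mem_cut]; intro h i hi; exact h i (by revert hi; revert i; decide)
    · intro x; simp only [mem_cut]; intro h i hi; exact h i (by revert hi; revert i; decide)
    · intro h; exact absurd (cut_inj hY h) (by decide)
    · by_contra hcon
      push Not at hcon
      refine absurd (cut_inj hY (S := {0, 1, 2}) (S' := {0, 2}) ?_) (by decide)
      ext x
      have := hcon x
      simp only [mem_cut] at this ⊢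
      simp at this ⊢
      tauto
    · by_contra hcon
      push Not at hcon
      refine absurd (cut_inj hY (S := {0, 2, 4}) (S' := {0, 2}) ?_) (by decide)
      ext x
      have := hcon x
      simp only [mem_cut] at this ⊢
      simp at this ⊢
      tauto
    · ext x; simp [mem_cut]; tauto
    · ext x; simp [mem_cut, and_assoc]
    · intro p hp
      have h0 := mem_cut.mp hp 0 (by simp); have h1 := mem_cut.mp hp 2 (by simp)
      simp [Y] at h0 h1
      rw [hF.2.1, hc p h0]
      simp [Y]
      linear_combination (A p * B p + A p * D p + B p * D p) * h1
  refine ⟨⟨c1.1, ?_, _, _, _, _, ?_, ?_, ?_, c1, c2⟩, _, _, DPlane.of_cycle hF c1, DPlane.of_cycle hF c2, ?_, ?_, ?_⟩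
  · intro p hp
    have h := (hl p).mp hp
    rw [hF.2.1, hc p h.1]
    linear_combination (A p * B p + A p * C p + B p * C p) * h.2.1 - A p * A p * h.2.2
  · intro h; exact absurd (cut_inj hY h) (by decide)
  · obtain ⟨-, -, -, -, -, -, c, L, R, -, -, -, -, hR, hp⟩ := c1
    intro p hp'
    rw [← hR] at hp'
    rw [hp p hp'.1, show R p = 0 from hp'.2]; ring
  · obtain ⟨-, -, -, -, -, -, c, L, R, -, -, -, -, hR, hp⟩ := c2
    intro p hp'
    rw [← hR] at hp'
    rw [hp p hp'.1, show R p = 0 from hp'.2]; ring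
  · intro h; exact absurd (cut_inj hY h) (by decide)
  · intro x hx; exact mem_cut.mp hx 0 (by simp)
  · intro x hx; exact mem_cut.mp hx 0 (by simp)

lemma tri_three {T : Tri} (hT : TSym T) (p v1 v2 : V5) (s t : ℂ) :
    T (p + s • v1 + t • v2) (p + s • v1 + t • v2) (p + s • v1 + t • v2) =
      T (p + s • v1) (p + s • v1) (p + s • v1) + T (p + t • v2) (p + t • v2) (p + t • v2) - T p p p
      + s * t * (6 * T p v1 v2 + 3 * s * T v1 v1 v2 + 3 * t * T v1 v2 v2) := by
  have b1 : T v1 p p = T p p v1 := by rw [(hT v1 p p).1, (hT p v1 p).2]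
  have b2 : T p v1 p = T p p v1 := (hT p v1 p).2
  have b3 : T v2 p p = T p p v2 := by rw [(hT v2 p p).1, (hT p v2 p).2]
  have b4 : T p v2 p = T p p v2 := (hT p v2 p).2
  have b5 : T v1 v1 p = T p v1 v1 := by rw [(hT v1 v1 p).2, (hT v1 p v1).1]
  have b6 : T v1 p v1 = T p v1 v1 := (hT v1 p v1).1
  have b7 : T v2 v2 p = T p v2 v2 := by rw [(hT v2 v2 p).2, (hT v2 p v2).1]
  have b8 : T v2 p v2 = T p v2 v2 := (hT v2 p v2).1
  have b9 : T p v2 v1 = T p v1 v2 := (hT p v2 v1).2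
  have b10 : T v1 v2 p = T p v1 v2 := by rw [(hT v1 v2 p).2, (hT v1 p v2).1]
  have b11 : T v2 v1 p = T p v1 v2 := by rw [(hT v2 v1 p).1, b10]
  have b12 : T v1 p v2 = T p v1 v2 := (hT v1 p v2).1
  have b13 : T v2 p v1 = T p v1 v2 := by rw [(hT v2 p v1).1, b9]
  have b14 : T v1 v2 v1 = T v1 v1 v2 := (hT v1 v2 v1).2
  have b15 : T v2 v1 v1 = T v1 v1 v2 := by rw [(hT v2 v1 v1).1, b14]
  have b16 : T v2 v1 v2 = T v1 v2 v2 := (hT v2 v1 v2).1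
  have b17 : T v2 v2 v1 = T v1 v2 v2 := by rw [(hT v2 v2 v1).2, b16]
  simp only [map_add, map_smul, LinearMap.add_apply, LinearMap.smul_apply, smul_eq_mul, b1, b2, b3, b4, b5, b6, b7, b8, b9, b10, b11, b12, b13, b14, b15, b16, b17]
  ring

/-- symmetric determinantal representation coming from a node line -/
lemma node_symDet {F T} (hF : TriOf F T) {l : Submodule ℂ V5} (hl : l ∈ NodeSet F) :
    ∃ (U s t : V5 →ₗ[ℂ] ℂ) (M : V5 →ₗ[ℂ] M3), U ≠ 0 ∧ Module.finrank ℂ (LinearMap.ker U) = 4 ∧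
      SymDet T (LinearMap.ker U) M ∧ (∀ x, M x 0 0 = s x) ∧
      (∀ x, M x 1 1 = t x) ∧ (∀ x, M x 0 1 = 0) ∧ ∀ x, x ∈ l ↔ U x = 0 ∧ s x = 0 ∧ t x = 0 := by
  obtain ⟨hl2, -, Pl1, Pl2, r1, r2, hr, -, -, c1, c2⟩ := hl
  have hne := planes_ne c1 c2 hr
  have h1 := DPlane.of_cycle hF c1
  have h2 := DPlane.of_cycle hF c2
  have hT := hF.1
  obtain ⟨h4, s, t, v1, v2, hv1, hv2, ht1, hs2, hs1, ht2, hdec⟩ := two_planes hl2 h1.1 h2.1 h1.2.1 h2.2.1 hne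
  obtain ⟨U, hU, hUk⟩ := hyp_ker h4
  obtain ⟨R1, hR1⟩ := h1.form hv1
  obtain ⟨R2, hR2⟩ := h2.form hv2
  let ρ1 : V5 →ₗ[ℂ] ℂ := R1 - R1 v2 • t
  let ρ2 : V5 →ₗ[ℂ] ℂ := R2 - R2 v1 • s
  let L : V5 →ₗ[ℂ] ℂ := (6:ℂ) • (T v1 v2) - (3 * T v1 v1 v2) • s - (3 * T v1 v2 v2) • t
  let M : V5 →ₗ[ℂ] M3 :=
    { toFun := fun x => !![s x, 0, Complex.I * ρ2 x; 0, t x, Complex.I * ρ1 x; Complex.I * ρ2 x, Complex.I * ρ1 x, L x]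
      map_add' := fun x y => by ext i j; fin_cases i <;> fin_cases j <;> simp <;> ring
      map_smul' := fun c x => by ext i j; fin_cases i <;> fin_cases j <;> simp <;> ring }
  have hMx : ∀ x, M x = !![s x, 0, Complex.I * ρ2 x; 0, t x, Complex.I * ρ1 x; Complex.I * ρ2 x, Complex.I * ρ1 x, L x] :=
    fun x => rfl
  refine ⟨U, s, t, M, hU, by rw [← hUk]; exact h4, ⟨?_, ?_⟩, ?_, ?_, ?_, ?_⟩
  · intro x; rw [hMx]; ext i j; fin_cases i <;> fin_cases j <;> simp
  · intro x hx
    rw [← hUk] at hx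
    have hp := hdec x hx
    set p := x - s x • v1 - t x • v2 with hpd
    have hxp : x = p + s x • v1 + t x • v2 := by rw [hpd]; abel
    have e1 := hR1 p hp (s x)
    have e2 := hR2 p hp (t x)
    have e3 := hR1 p hp 0
    have r1 : R1 (p + s x • v1) = ρ1 x := by
      simp only [hpd, ρ1, map_add, map_sub, map_smul, LinearMap.sub_apply, LinearMap.smul_apply, smul_eq_mul]; ring
    have r2 : R2 (p + t x • v2) = ρ2 x := by
      simp only [hpd, ρ2, map_add, map_sub, map_smul, LinearMap.sub_apply, LinearMap.smul_apply, smul_eq_mul]; ring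
    have hLx : L x = 6 * T p v1 v2 + 3 * s x * T v1 v1 v2 + 3 * t x * T v1 v2 v2 := by
      have a1 : T v1 v2 x = T x v1 v2 := by rw [(hT v1 v2 x).2, (hT v1 x v2).1]
      have a2 : T v2 v1 v2 = T v1 v2 v2 := (hT v2 v1 v2).1
      simp only [L, hpd, map_sub, map_smul, LinearMap.sub_apply, LinearMap.smul_apply, smul_eq_mul, a1, a2]; ring
    rw [r1] at e1
    rw [r2] at e2
    simp at e3
    rw [hMx, Matrix.det_fin_three]
    simp only [Matrix.of_apply, Matrix.cons_val]
    rw [hLx]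
    have hTx := tri_three hT p v1 v2 (s x) (t x)
    rw [← hxp, e1, e2, e3] at hTx
    rw [hTx]
    linear_combination (s x * ρ1 x ^ 2 + t x * ρ2 x ^ 2) * Complex.I_sq
  · intro x; simp [hMx]
  · intro x; simp [hMx]
  · intro x; simp [hMx]
  · intro x
    constructor
    · intro hx
      have a1 := h1.2.1 hx
      refine ⟨?_, hs2 (h2.2.1 hx), ht1 a1⟩
      have : x ∈ Pl1 ⊔ Pl2 := (le_sup_left : Pl1 ≤ _) a1
      rw [hUk] at this; exact this
    · rintro ⟨a, b, c⟩
      have := hdec x (by rw [hUk]; exact a)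
      simpa [b, c] using this

lemma two_supports {p q : Fin 3 → ℂ} (hp : p ≠ 0) (hq : q ≠ 0) (hpq : ∀ k, p k * q k = 0) (hsum : p 0 + p 1 + p 2 = 0) :
    ∃ a : Fin 3, q a ≠ 0 ∧ p a = 0 ∧ q (a + 1) = 0 ∧ q (a + 2) = 0 ∧ p (a + 1) ≠ 0 ∧ p (a + 2) = - p (a + 1) := by
  have h0 := hpq 0; have h1 := hpq 1; have h2 := hpq 2
  obtain ⟨a, ha⟩ := Function.ne_iff.mp hq
  obtain ⟨c, hc⟩ := Function.ne_iff.mp hp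
  simp only [Pi.zero_apply] at ha hc
  refine ⟨a, ha, ?_⟩
  fin_cases a <;> simp at ha ⊢
  · have e : p 0 = 0 := by simpa [ha] using h0
    have e' : p 2 = - p 1 := by linear_combination hsum - e
    have n : p 1 ≠ 0 := fun h => by
      apply hc; rw [h] at e'; fin_cases c <;> simp [*]
    rw [e'] at h2
    simp [n] at h1 h2
    exact ⟨e, h1, h2, n, e'⟩
  · have e : p 1 = 0 := by simpa [ha] using h1
    have e' : p 0 = - p 2 := by linear_combination hsum - e
    have n : p 2 ≠ 0 := fun h => by
      apply hc; rw [h] at e'; fin_cases c <;> simp [*]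
    rw [e'] at h0
    simp [n] at h0 h2
    exact ⟨e, h2, h0, n, e'⟩
  · have e : p 2 = 0 := by simpa [ha] using h2
    have e' : p 1 = - p 0 := by linear_combination hsum - e
    have n : p 0 ≠ 0 := fun h => by
      apply hc; rw [h] at e'; fin_cases c <;> simp [*]
    rw [e'] at h1
    simp [n] at h0 h1
    exact ⟨e, h0, h1, n, e'⟩

def line3 (H : Submodule ℂ V5) (N : Fin 4 → (V5 →ₗ[ℂ] ℂ)) (a : Fin 3) : Submodule ℂ V5 :=
  H ⊓ LinearMap.ker (N a.castSucc + N 3) ⊓ LinearMap.ker (N (a + 1).castSucc + N (a + 2).castSucc)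

lemma mem_line3 {H N a} {x : V5} : x ∈ line3 H N a ↔ x ∈ H ∧ N a.castSucc x + N 3 x = 0 ∧
    N (a + 1).castSucc x + N (a + 2).castSucc x = 0 := by
  simp [line3, and_assoc]

lemma stdM_entry (N : Fin 4 → (V5 →ₗ[ℂ] ℂ)) (Q : M3) (x : V5) (i j : Fin 3) :
    (Q.transpose * stdM N x * Q) i j = Q 0 i * Q 0 j * N 0 x + Q 1 i * Q 1 j * N 1 x + Q 2 i * Q 2 j * N 2 x
      + (Q 0 i + Q 1 i + Q 2 i) * (Q 0 j + Q 1 j + Q 2 j) * N 3 x := by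
  simp [Matrix.mul_apply, Fin.sum_univ_three, stdM]
  ring

lemma col_ne {Q : M3} (hQ : IsUnit Q.det) (j : Fin 3) : (fun k => Q k j) ≠ 0 := fun h => by
  rw [Matrix.det_eq_zero_of_column_eq_zero j fun i => congrFun h i] at hQ
  simp at hQ

lemma line_of_cols {U s t : V5 →ₗ[ℂ] ℂ} {N : Fin 4 → (V5 →ₗ[ℂ] ℂ)} {p q : Fin 3 → ℂ}
    (hp : p ≠ 0) (hq : q ≠ 0) (hpq : ∀ k, p k * q k = 0) (hsum : p 0 + p 1 + p 2 = 0)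
    (hs : ∀ x, U x = 0 → s x = p 0 * p 0 * N 0 x + p 1 * p 1 * N 1 x + p 2 * p 2 * N 2 x + (p 0 + p 1 + p 2) * (p 0 + p 1 + p 2) * N 3 x)
    (ht : ∀ x, U x = 0 → t x = q 0 * q 0 * N 0 x + q 1 * q 1 * N 1 x + q 2 * q 2 * N 2 x + (q 0 + q 1 + q 2) * (q 0 + q 1 + q 2) * N 3 x) :
    ∃ a, ∀ x, U x = 0 ∧ s x = 0 ∧ t x = 0 ↔ x ∈ line3 (LinearMap.ker U) N a := by
  obtain ⟨a, ha, pa, q1, q2, p1, p2⟩ := two_supports hp hq hpq hsum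
  refine ⟨a, fun x => ?_⟩
  rw [mem_line3, LinearMap.mem_ker]
  refine and_congr_right fun hx => ?_
  have es : s x = p (a + 1) ^ 2 * (N (a + 1).castSucc x + N (a + 2).castSucc x) := by
    rw [hs x hx, hsum]
    fin_cases a <;> simp at * <;> simp [pa, p2] <;> ring
  have et : t x = q a ^ 2 * (N a.castSucc x + N 3 x) := by
    rw [ht x hx]
    fin_cases a <;> simp at * <;> simp [q1, q2] <;> ring
  rw [es, et]
  simp [ha, p1]
  tauto

/-- `CayAll T`: every determinantal hyperplane section is a Cayley cubic -/
def CayAll (T : Tri) : Prop := ∀ (U : V5 →ₗ[ℂ] ℂ) (M : V5 →ₗ[ℂ] M3), U ≠ 0 → SymDet T (LinearMap.ker U) M →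
  ∃ N, Cay T (LinearMap.ker U) N

lemma node_is_line3 {F T} (hF : TriOf F T) (hs : TSmooth T) {l : Submodule ℂ V5} (hl : l ∈ NodeSet F) :
    ∃ H ∈ HypSet T, ∀ N, Cay T H N → ∃ a, l = line3 H N a := by
  obtain ⟨U, s, t, M, hU, h4, hM, hMs, hMt, hM0, hlm⟩ := node_symDet hF hl
  refine ⟨LinearMap.ker U, ⟨h4, M, hM⟩, fun N hN => ?_⟩
  obtain ⟨Q, hQ, hMQ⟩ := (cayley_unique hF.1 hs hU hM hN).symm
  have ent : ∀ x, U x = 0 → ∀ i j, M x i j = _ := fun x hx i j => by rw [hMQ x hx, stdM_entry]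
  obtain ⟨b, hbU, hbN, -⟩ := hN.nodes
  have key : ∀ k, Q k 0 * Q k 1 = 0 := fun k => by
    have := ent (b k.castSucc) (hbU _) 0 1
    rw [hM0] at this
    fin_cases k <;> simp [hbN] at this <;> simpa using this
  have key2 : Q 0 0 + Q 1 0 + Q 2 0 = 0 ∨ Q 0 1 + Q 1 1 + Q 2 1 = 0 := by
    have := ent (b 3) (hbU _) 0 1
    rw [hM0] at this
    simpa [hbN] using this.symm
  rcases key2 with h | h
  · obtain ⟨a, ha⟩ := line_of_cols (U := U) (s := s) (t := t) (N := N) (col_ne hQ 0) (col_ne hQ 1) key h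
      (fun x hx => by rw [← hMs, ent x hx]) (fun x hx => by rw [← hMt, ent x hx])
    exact ⟨a, by ext x; rw [hlm, ha]⟩
  · obtain ⟨a, ha⟩ := line_of_cols (U := U) (s := t) (t := s) (N := N) (col_ne hQ 1) (col_ne hQ 0)
      (fun k => by rw [mul_comm]; exact key k) h
      (fun x hx => by rw [← hMt, ent x hx]) (fun x hx => by rw [← hMs, ent x hx])
    exact ⟨a, by ext x; rw [hlm, ← ha]; tauto⟩

lemma line3_node {F T} (hF : TriOf F T) {U : V5 →ₗ[ℂ] ℂ} {N} (hN : Cay T (LinearMap.ker U) N) (a : Fin 3) :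
    line3 (LinearMap.ker U) N a ∈ NodeSet F ∧ ∃ Pl1 Pl2, DPlane T (line3 (LinearMap.ker U) N a) Pl1 ∧
      DPlane T (line3 (LinearMap.ker U) N a) Pl2 ∧ Pl1 ≠ Pl2 ∧ Pl1 ≤ LinearMap.ker U ∧ Pl2 ≤ LinearMap.ker U := by
  refine cay_line hF (U := U) (A := N a.castSucc) (B := N (a + 1).castSucc) (C := N (a + 2).castSucc) (D := N 3) ?_ ?_ ?_
  · intro x h0 h1 h2 h3 h4
    refine hN.1 x h0 fun i => ?_
    fin_cases a <;> fin_cases i <;> simp_all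
  · intro x hx
    rw [hN.2 x hx]
    fin_cases a <;> simp [e3] <;> ring
  · intro x; rw [mem_line3, LinearMap.mem_ker]

lemma node_count {F T} (hF : TriOf F T) (hs : TSmooth T) (hC : CayAll T) (hD : ¬ D3cfg T) (hfin : (HypSet T).Finite) :
    (NodeSet F).Finite ∧ (NodeSet F).ncard = 3 * (HypSet T).ncard := by
  have hex : ∀ H : HypSet T, ∃ (U : V5 →ₗ[ℂ] ℂ) (N : Fin 4 → (V5 →ₗ[ℂ] ℂ)), H.1 = LinearMap.ker U ∧ Cay T (LinearMap.ker U) N := by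
    rintro ⟨H, h4, M, hM⟩
    obtain ⟨U, hU, rfl⟩ := hyp_ker h4
    obtain ⟨N, hN⟩ := hC U M hU hM
    exact ⟨U, N, rfl, hN⟩
  choose U N hU hN using hex
  let f : HypSet T × Fin 3 → Submodule ℂ V5 := fun p => line3 p.1.1 (N p.1) p.2
  have hinj : Function.Injective f := by
    rintro ⟨H, a⟩ ⟨H', a'⟩ h
    simp only [f] at h
    have hH : H = H' := by
      obtain ⟨hn, P1, P2, d1, d2, hne, hle1, hle2⟩ := line3_node hF (hN H) a
      obtain ⟨hn', P1', P2', d1', d2', hne', hle1', hle2'⟩ := line3_node hF (hN H') a'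
      rw [← hU] at hn d1 d2 hle1 hle2 hn' d1' d2' hle1' hle2'
      rw [← h] at d1' d2'
      have hsup : P1 ⊔ P2 = H.1 := Submodule.eq_of_le_of_finrank_eq (sup_le hle1 hle2)
        ((two_planes hn.1 d1.1 d2.1 d1.2.1 d2.2.1 hne).1.trans H.2.1.symm)
      have hsup' : P1' ⊔ P2' = H'.1 := Submodule.eq_of_le_of_finrank_eq (sup_le hle1' hle2')
        ((two_planes hn.1 d1'.1 d2'.1 d1'.2.1 d2'.2.1 hne').1.trans H'.2.1.symm)
      have := sup_le (no_three hD hn.1 d1 d2 d1' hne) (no_three hD hn.1 d1 d2 d2' hne)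
      rw [hsup, hsup'] at this
      exact Subtype.ext (Submodule.eq_of_le_of_finrank_eq this (H'.2.1.trans H.2.1.symm)).symm
    subst hH
    obtain ⟨b, hbU, hbN, -⟩ := (hN H).nodes
    have hm : b a.castSucc - b 3 ∈ line3 H.1 (N H) a := by
      rw [mem_line3]
      refine ⟨?_, ?_, ?_⟩
      · rw [hU]; simp [hbU]
      · simp only [map_sub, hbN]; fin_cases a <;> simp
      · simp only [map_sub, hbN]; fin_cases a <;> simp
    rw [h, mem_line3] at hm
    have h2 := hm.2.1
    simp only [map_sub, hbN] at h2
    congr 1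
    by_contra hne
    revert h2
    fin_cases a <;> fin_cases a' <;> simp at hne ⊢
  have hrange : NodeSet F = Set.range f := by
    ext l
    constructor
    · intro hl
      obtain ⟨H, hH, h⟩ := node_is_line3 hF hs hl
      obtain ⟨a, ha⟩ := h (N ⟨H, hH⟩) (by have := hN ⟨H, hH⟩; rwa [← hU] at this)
      exact ⟨(⟨H, hH⟩, a), ha.symm⟩
    · rintro ⟨⟨H, a⟩, rfl⟩
      have := (line3_node hF (hN H) a).1
      rwa [← hU] at this
  have : Finite (HypSet T) := hfin
  refine ⟨by rw [hrange]; exact Set.finite_range f, ?_⟩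
  rw [hrange, ← Set.image_univ, Set.ncard_image_of_injective _ hinj, Set.ncard_univ, Nat.card_prod, Nat.card_coe_set_eq]
  simp [mul_comm]

/-! ### Charts: flags transverse to the cubic -/

lemma cont_ext {f : V5 → ℂ} (hf : ∀ k v, Continuous fun t : ℂ => f (k + t • v)) {U l : V5 →ₗ[ℂ] ℂ} {q0 : V5}
    (hq0 : U q0 = 0) (hl0 : l q0 ≠ 0) (h : ∀ q, U q = 0 → l q ≠ 0 → f q = 0) : ∀ q, U q = 0 → f q = 0 := by
  intro q hq
  by_cases hl : l q = 0
  · have h1 : Filter.Tendsto (fun t : ℂ => f (q + t • q0)) (nhdsWithin 0 {0}ᶜ) (nhds (f (q + (0:ℂ) • q0))) :=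
      ((hf q q0).tendsto 0).mono_left nhdsWithin_le_nhds
    have h2 : Filter.Tendsto (fun t : ℂ => f (q + t • q0)) (nhdsWithin 0 {0}ᶜ) (nhds 0) := by
      refine (tendsto_const_nhds (x := (0:ℂ))).congr' ?_
      filter_upwards [self_mem_nhdsWithin] with t ht
      exact (h _ (by simp [hq, hq0]) (by simpa [hl, hl0] using ht)).symm
    have := tendsto_nhds_unique h1 h2
    simpa using this
  · exact h q hq hl

lemma exists_smooth_pt {T : Tri} (hT : TSym T) (hs : TSmooth T) {U : V5 →ₗ[ℂ] ℂ} (hU : U ≠ 0) :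
    ∃ p q0, U p = 0 ∧ U q0 = 0 ∧ T p p p = 0 ∧ T p p q0 ≠ 0 := by
  by_contra hcon
  push Not at hcon
  have hz : ∀ p, U p = 0 → T p p p = 0 → ∀ v, U v = 0 → T p p v = 0 := fun p hp h0 v hv => hcon p v hp hv h0
  -- every 2-dim subspace contains a zero
  have hzero : ∀ p q : V5, ∃ s t : ℂ, (s ≠ 0 ∨ t ≠ 0) ∧ T (s • p + t • q) (s • p + t • q) (s • p + t • q) = 0 := by
    intro p q
    by_cases hq : T q q q = 0
    · exact ⟨0, 1, by simp, by simpa using hq⟩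
    · let c : Polynomial ℂ := Polynomial.C (T q q q) * Polynomial.X ^ 3 + Polynomial.C (3 * T q q p) * Polynomial.X ^ 2
        + Polynomial.C (3 * T p p q) * Polynomial.X + Polynomial.C (T p p p)
      have hd : c.degree = 3 := Polynomial.degree_cubic hq
      obtain ⟨t, ht⟩ := IsAlgClosed.exists_root c (by rw [hd]; decide)
      refine ⟨1, t, by simp, ?_⟩
      simp [c] at ht
      rw [one_smul, tri_line hT]
      linear_combination ht
  obtain ⟨a, b, hab, hU0⟩ := ker3 U U U
  obtain ⟨s, t, hst, h0⟩ := hzero a b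
  set p := s • a + t • b with hp
  have hUp : U p = 0 := (hU0 s t).1
  have hp0 : p ≠ 0 := fun h => by have := hab s t h; tauto
  obtain ⟨i, hi⟩ : ∃ i, p i ≠ 0 := Function.ne_iff.mp hp0
  obtain ⟨a', b', hab', hU0'⟩ := ker3 U (LinearMap.proj i) 0
  obtain ⟨s', t', hst', h0'⟩ := hzero a' b'
  set p' := s' • a' + t' • b' with hp'
  have hUp' : U p' = 0 := (hU0' s' t').1
  have hpi' : p' i = 0 := (hU0' s' t').2.1
  have hp0' : p' ≠ 0 := fun h => by have := hab' s' t' h; tauto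
  clear_value p p'
  refine no_sing_line hT hs hU (p := p) (q := p') (fun u v huv => ?_) fun u v w hw => ?_
  · have h1 : u = 0 := by
      have := congrFun huv i
      simpa [hpi', hi] using this
    subst h1
    simpa [hp0'] using huv
  · refine hz _ (by simp [hUp, hUp']) ?_ w hw
    have e1 := hz p hUp h0 p' hUp'
    have e2 := hz p' hUp' h0' p hUp
    have e3 : T p p' p = 0 := by rw [(hT p p' p).2, e1]
    have e4 : T p' p p = 0 := by rw [(hT p' p p).1, e3]
    have e5 : T p' p p' = 0 := by rw [(hT p' p p').2, e2]
    have e6 : T p p' p' = 0 := by rw [(hT p p' p').1, e5]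
    simp [e1, e2, e3, e4, e5, e6, h0, h0']

lemma exists_transverse {T : Tri} (hT : TSym T) (hs : TSmooth T) {U : V5 →ₗ[ℂ] ℂ} (hU : U ≠ 0) :
    ∃ p q, U p = 0 ∧ U q = 0 ∧ T p p p = 0 ∧ T p p q ≠ 0 ∧ 9 * T p q q ^ 2 - 12 * T p p q * T q q q ≠ 0 := by
  obtain ⟨p, q0, hp, hq0, h0, hl0⟩ := exists_smooth_pt hT hs hU
  by_contra hcon
  push Not at hcon
  have hdisc : ∀ q, U q = 0 → 9 * T p q q ^ 2 - 12 * T p p q * T q q q = 0 := by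
    refine cont_ext (l := T p p) (fun k v => ?_) hq0 hl0 fun q hq hl => hcon p q hp hq h0 hl
    simp only [map_add, map_smul, LinearMap.add_apply, LinearMap.smul_apply, smul_eq_mul]
    fun_prop
  have hK : ∀ k, U k = 0 → T p p k = 0 → T p k k = 0 := fun k hk hlk => by
    have := hdisc k hk
    rw [hlk] at this
    simpa using this
  let m : V5 →ₗ[ℂ] ℂ := (T p p q0)⁻¹ • ((2:ℂ) • T p q0 - (T p q0 q0 / T p p q0) • T p p)
  have hm : ∀ q, U q = 0 → T p q q = T p p q * m q := fun q hq => by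
    set r := T p p q / T p p q0 with hr
    have hk := hK (q + (-r) • q0) (by simp [hq, hq0]) (by simp [hr, hl0])
    have hrr : T p p q = r * T p p q0 := by rw [hr]; field_simp
    simp only [map_add, map_smul, LinearMap.add_apply, LinearMap.smul_apply, smul_eq_mul, (hT p q q0).2] at hk
    simp only [m, LinearMap.smul_apply, LinearMap.sub_apply, smul_eq_mul]
    rw [hrr]
    field_simp
    linear_combination hk
  have hh : ∀ q, U q = 0 → T q q q - (3 / 4) * T p p q * m q ^ 2 = 0 := by
    refine cont_ext (l := T p p) (fun k v => ?_) hq0 hl0 fun q hq hl => ?_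
    · simp only [map_add, map_smul, LinearMap.add_apply, LinearMap.smul_apply, smul_eq_mul]
      fun_prop
    · have := hdisc q hq
      rw [hm q hq] at this
      have h3 : T p p q * (T q q q - (3 / 4) * T p p q * m q ^ 2) = 0 := by linear_combination (-1/12) * this
      exact (mul_eq_zero.mp h3).resolve_left hl
  refine no_sing_forms hT hs hU m 0 ((3 / 4 : ℂ) • T p p) 0 0 fun x hx => ?_
  have := hh x hx
  simp only [LinearMap.smul_apply, LinearMap.zero_apply, smul_eq_mul]
  linear_combination this

lemma flag_pair {T : Tri} (hT : TSym T) (hs : TSmooth T) {U : V5 →ₗ[ℂ] ℂ} (hU : U ≠ 0) :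
    ∃ b1 b2, U b1 = 0 ∧ U b2 = 0 ∧ LinearIndependent ℂ ![b1, b2] ∧ T b1 b1 b1 ≠ 0 ∧ ∃ d : Fin 3 → ℂ, Function.Injective d ∧
      ∀ x : ℂ, T (b2 + x • b1) (b2 + x • b1) (b2 + x • b1) = T b1 b1 b1 * ((d 0 + x) * (d 1 + x) * (d 2 + x)) := by
  obtain ⟨p, q', hp, hq', h0, hl', hd'⟩ := exists_transverse hT hs hU
  -- shift so that the cubic does not vanish at q
  obtain ⟨q, hq, hl, hd, hqq⟩ : ∃ q, U q = 0 ∧ T p p q ≠ 0 ∧ 9 * T p q q ^ 2 - 12 * T p p q * T q q q ≠ 0 ∧ T q q q ≠ 0 := by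
    have inv : ∀ s : ℂ, T (q' + s • p) (q' + s • p) (q' + s • p) = T q' q' q' + 3 * s * T p q' q' + 3 * s ^ 2 * T p p q' := fun s => by
      rw [tri_line hT, h0, (hT q' q' p).2, (hT q' p q').1]; ring
    have inv2 : ∀ s : ℂ, T p (q' + s • p) (q' + s • p) = T p q' q' + 2 * s * T p p q' := fun s => by
      simp only [map_add, map_smul, LinearMap.add_apply, LinearMap.smul_apply, smul_eq_mul, h0, (hT p q' p).2]; ring
    have inv3 : ∀ s : ℂ, T p p (q' + s • p) = T p p q' := fun s => by simp [h0]
    have : ∃ s : ℂ, T q' q' q' + 3 * s * T p q' q' + 3 * s ^ 2 * T p p q' ≠ 0 := by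
      by_contra hc
      push Not at hc
      have k0 := hc 0; have k1 := hc 1; have k2 := hc (-1)
      exact hl' (by linear_combination (1/6) * k1 + (1/6) * k2 - (1/3) * k0)
    obtain ⟨s, hs⟩ := this
    refine ⟨q' + s • p, by simp [hp, hq'], by rw [inv3]; exact hl', ?_, by rw [inv]; exact hs⟩
    rw [inv, inv2, inv3]
    convert hd' using 1
    ring
  obtain ⟨r, hr⟩ := exists_sqrt (9 * T p q q ^ 2 - 12 * T p p q * T q q q)
  have hr0 : r ≠ 0 := fun h => hd (by rw [← hr, h]; ring)
  set h := T q q q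
  refine ⟨q, p, hq, hp, ?_, hqq, ![0, (3 * T p q q + r) / (2 * h), (3 * T p q q - r) / (2 * h)], ?_, fun x => ?_⟩
  · rw [LinearIndependent.pair_iff]
    intro s t hst
    have hs0 : s = 0 := by
      by_contra hs0
      have e : q = (-(t / s)) • p := by
        have : s⁻¹ • (s • q + t • p) = 0 := by rw [hst, smul_zero]
        rw [smul_add, smul_smul, smul_smul, inv_mul_cancel₀ hs0, one_smul] at this
        rw [eq_neg_of_add_eq_zero_left this, neg_smul]; congr 2; field_simp
      apply hl; rw [e]; simp [h0]
    refine ⟨hs0, ?_⟩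
    have hp0 : p ≠ 0 := fun h => hl (by rw [h]; simp)
    simpa [hs0, hp0] using hst
  · have n1 : (3 * T p q q + r) * (3 * T p q q - r) ≠ 0 := by
      have : (3 * T p q q + r) * (3 * T p q q - r) = 12 * T p p q * h := by linear_combination -hr
      rw [this]; simp [hl, hqq]
    have n2 := left_ne_zero_of_mul n1
    have n3 := right_ne_zero_of_mul n1
    have n4 : (3 * T p q q + r) / (2 * h) ≠ (3 * T p q q - r) / (2 * h) := fun he => hr0 (by
      field_simp at he; linear_combination (1/2) * he)
    intro i j
    fin_cases i <;> fin_cases j <;> simp [hqq, n2, n3, n4, n4.symm]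
    · exact fun he => absurd he.symm (by simp [hqq, n2])
    · exact fun he => absurd he.symm (by simp [hqq, n3])
  · rw [tri_line hT, h0]
    simp only [Matrix.cons_val]
    rw [(hT q q p).2, (hT q p q).1]
    field_simp
    linear_combination x * h * hr

/-- A chart adapted to the hyperplane `H` -/
structure IsChart (T : Tri) (H : Submodule ℂ V5) (bs : Module.Basis (Fin 5) ℂ V5) : Prop where
  ker : H = LinearMap.ker (bs.coord 0)
  ne : T (bs 1) (bs 1) (bs 1) ≠ 0
  roots : ∃ d : Fin 3 → ℂ, Function.Injective d ∧ ∀ x : ℂ, T (bs 2 + x • bs 1) (bs 2 + x • bs 1) (bs 2 + x • bs 1) =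
    T (bs 1) (bs 1) (bs 1) * ((d 0 + x) * (d 1 + x) * (d 2 + x))

lemma exists_snoc {n : ℕ} {v : Fin n → V5} (hv : LinearIndependent ℂ v) {H : Submodule ℂ V5} (hvH : ∀ i, v i ∈ H)
    (hn : n < Module.finrank ℂ H) : ∃ w ∈ H, LinearIndependent ℂ (Fin.snoc v w : Fin (n+1) → V5) := by
  have h1 : Submodule.span ℂ (Set.range v) ≤ H := Submodule.span_le.mpr (by rintro _ ⟨i, rfl⟩; exact hvH i)
  have h2 : Module.finrank ℂ (Submodule.span ℂ (Set.range v)) = n := by rw [finrank_span_eq_card hv]; simp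
  have h3 : ¬ H ≤ Submodule.span ℂ (Set.range v) := fun h => by
    have := Submodule.finrank_mono h
    omega
  obtain ⟨w, hw, hw'⟩ := SetLike.not_le_iff_exists.mp h3
  exact ⟨w, hw, linearIndependent_finSnoc.mpr ⟨hv, hw'⟩⟩

lemma exists_chart {T : Tri} (hT : TSym T) (hs : TSmooth T) {H : Submodule ℂ V5} (hH : Module.finrank ℂ H = 4) :
    ∃ bs, IsChart T H bs := by
  obtain ⟨U, hU, rfl⟩ := hyp_ker hH
  obtain ⟨b1, b2, h1, h2, hli, hne, hd⟩ := flag_pair hT hs hU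
  obtain ⟨b3, h3, hli3⟩ := exists_snoc hli (H := LinearMap.ker U) (fun i => by fin_cases i <;> simpa) (by omega)
  obtain ⟨b4, h4, hli4⟩ := exists_snoc hli3 (H := LinearMap.ker U) (fun i => by fin_cases i <;> simpa [Fin.snoc]) (by omega)
  obtain ⟨i0, hi0⟩ := exists_ne_of_form hU
  set b0 : V5 := Pi.single i0 1
  set v : Fin 4 → V5 := Fin.snoc (Fin.snoc ![b1, b2] b3 : Fin 3 → V5) b4 with hv
  have hvU : ∀ i, U (v i) = 0 := fun i => by
    fin_cases i
    · simpa [hv, Fin.snoc] using h1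
    · simpa [hv, Fin.snoc] using h2
    · simpa [hv, Fin.snoc] using h3
    · simpa [hv, Fin.snoc] using h4
  have hli5 : LinearIndependent ℂ (Fin.cons b0 v : Fin 5 → V5) := by
    refine linearIndependent_finCons.mpr ⟨hli4, fun hmem => hi0 ?_⟩
    have : Submodule.span ℂ (Set.range v) ≤ LinearMap.ker U := Submodule.span_le.mpr (by rintro _ ⟨i, rfl⟩; exact hvU i)
    exact this hmem
  let bs := basisOfLinearIndependentOfCardEqFinrank hli5 (by simp)
  have hbs : ∀ i, bs i = (Fin.cons b0 v : Fin 5 → V5) i := fun i => by simp [bs]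
  have e1 : bs 1 = b1 := by rw [hbs]; simp [hv, Fin.cons, Fin.snoc]; rfl
  have e2 : bs 2 = b2 := by rw [hbs]; simp [hv, Fin.cons, Fin.snoc]; rfl
  refine ⟨bs, ⟨?_, by rw [e1]; exact hne, by rw [e1, e2]; exact hd⟩⟩
  have hUe : U = U b0 • bs.coord 0 := by
    refine bs.ext fun i => ?_
    refine Fin.cases ?_ (fun j => ?_) i
    · rw [LinearMap.smul_apply, Module.Basis.coord_apply, Module.Basis.repr_self, hbs]; simp
    · rw [LinearMap.smul_apply, Module.Basis.coord_apply, Module.Basis.repr_self, hbs]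
      simp [hvU]
  ext x
  conv_lhs => rw [hUe]
  simp [hi0]

/-! ### Polarised determinant and normal forms -/

def pol (A B C : M3) : ℂ :=
  ((A + B + C).det - (A + B).det - (A + C).det - (B + C).det + A.det + B.det + C.det) / 6

lemma pol_swap12 (A B C : M3) : pol A B C = pol B A C := by
  rw [pol, pol, add_comm B A]; ring
lemma pol_swap23 (A B C : M3) : pol A B C = pol A C B := by
  rw [pol, pol, add_right_comm A C B, add_comm C B]; ring
lemma pol_add (A B C C' : M3) : pol A B (C + C') = pol A B C + pol A B C' := by
  simp only [pol, Matrix.det_fin_three, Matrix.add_apply]; ring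
lemma pol_smul (A B C : M3) (t : ℂ) : pol A B (t • C) = t * pol A B C := by
  simp only [pol, Matrix.det_fin_three, Matrix.add_apply, Matrix.smul_apply, smul_eq_mul]; ring
lemma pol_self (A : M3) : pol A A A = A.det := by
  simp only [pol, Matrix.det_fin_three, Matrix.add_apply]; ring
lemma pol_dd (A B : M3) : 3 * pol A A B = dd A B := by
  simp only [pol, dd_eq, Matrix.det_fin_three, Matrix.add_apply]; ring
lemma pol_conj (P A B C : M3) : pol (P.transpose * A * P) (P.transpose * B * P) (P.transpose * C * P) = P.det ^ 2 * pol A B C := by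
  simp only [pol, ← Matrix.mul_add, ← Matrix.add_mul, Matrix.det_mul, Matrix.det_transpose]; ring

def polL : M3 →ₗ[ℂ] M3 →ₗ[ℂ] M3 →ₗ[ℂ] ℂ :=
  LinearMap.mk₂ ℂ (fun A B => { toFun := fun C => pol A B C, map_add' := pol_add A B, map_smul' := fun t C => pol_smul A B C t })
    (fun A A' B => by
      ext1 C; simp only [LinearMap.coe_mk, AddHom.coe_mk, LinearMap.add_apply]
      rw [pol_swap12, pol_swap23, pol_add, pol_swap23, pol_swap12 B, pol_swap23 B, pol_swap12 B])
    (fun t A B => by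
      ext1 C; simp only [LinearMap.coe_mk, AddHom.coe_mk, LinearMap.smul_apply]
      rw [pol_swap12, pol_swap23, pol_smul, pol_swap23, pol_swap12 B]; rfl)
    (fun A B B' => by
      ext1 C; simp only [LinearMap.coe_mk, AddHom.coe_mk, LinearMap.add_apply]
      rw [pol_swap23, pol_add, pol_swap23, pol_swap23 A C])
    (fun t A B => by
      ext1 C; simp only [LinearMap.coe_mk, AddHom.coe_mk, LinearMap.smul_apply]
      rw [pol_swap23, pol_smul, pol_swap23]; rfl)

lemma polL_apply (A B C : M3) : polL A B C = pol A B C := rfl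

lemma tri_polar {T : Tri} (hT : TSym T) (x y z : V5) : 6 * T x y z =
    T (x + y + z) (x + y + z) (x + y + z) - T (x + y) (x + y) (x + y) - T (x + z) (x + z) (x + z)
      - T (y + z) (y + z) (y + z) + T x x x + T y y y + T z z z := by
  have b9 : T x z y = T x y z := (hT x z y).2
  have b10 : T y z x = T x y z := by rw [(hT y z x).2, (hT y x z).1]
  have b11 : T z y x = T x y z := by rw [(hT z y x).1, b10]
  have b12 : T y x z = T x y z := (hT y x z).1
  have b13 : T z x y = T x y z := by rw [(hT z x y).1, b9]
  simp only [map_add, LinearMap.add_apply, b9, b10, b11, b12, b13]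
  ring

lemma SymDet.pol {T : Tri} (hT : TSym T) {H : Submodule ℂ V5} {M : V5 →ₗ[ℂ] M3} (hM : SymDet T H M) {x y z : V5}
    (hx : x ∈ H) (hy : y ∈ H) (hz : z ∈ H) : T x y z = polL (M x) (M y) (M z) := by
  have h := tri_polar hT x y z
  rw [hM.2 _ (H.add_mem (H.add_mem hx hy) hz), hM.2 _ (H.add_mem hx hy), hM.2 _ (H.add_mem hx hz), hM.2 _ (H.add_mem hy hz),
    hM.2 _ hx, hM.2 _ hy, hM.2 _ hz] at h
  rw [polL_apply, _root_.pol]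
  simp only [map_add] at h
  linear_combination h / 6

lemma cubic_roots (a b c : ℂ) : ∃ d : Fin 3 → ℂ, ∀ x : ℂ, x ^ 3 + a * x ^ 2 + b * x + c = (d 0 + x) * (d 1 + x) * (d 2 + x) := by
  let p : Polynomial ℂ := Polynomial.C 1 * Polynomial.X ^ 3 + Polynomial.C a * Polynomial.X ^ 2
    + Polynomial.C b * Polynomial.X + Polynomial.C c
  have hd : p.degree = 3 := Polynomial.degree_cubic one_ne_zero
  obtain ⟨t, ht⟩ := IsAlgClosed.exists_root p (by rw [hd]; decide)
  simp [p] at ht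
  obtain ⟨r, hr⟩ := exists_sqrt ((a + t) ^ 2 - 4 * (b + t * (a + t)))
  refine ⟨![-t, ((a + t) + r) / 2, ((a + t) - r) / 2], fun x => ?_⟩
  simp only [Matrix.cons_val]
  linear_combination ht + (x - t) / 4 * hr

/-- simultaneous diagonalisation -/
lemma simul_diag {A1 A2 : M3} (h1 : A1.transpose = A1) (h2 : A2.transpose = A2) (hdet : A1.det ≠ 0) {d : Fin 3 → ℂ}
    (hd : Function.Injective d) (h : ∀ x : ℂ, (A2 + x • A1).det = A1.det * ((d 0 + x) * (d 1 + x) * (d 2 + x))) :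
    ∃ P : M3, IsUnit P.det ∧ P.transpose * A1 * P = 1 ∧ P.transpose * A2 * P = Matrix.diagonal d := by
  have hu : IsUnit A1.det := isUnit_iff_ne_zero.mpr hdet
  have hex : ∀ i, ∃ v : Fin 3 → ℂ, v ≠ 0 ∧ (A2 + (-d i) • A1).mulVec v = 0 := fun i => by
    refine Matrix.exists_mulVec_eq_zero_iff.mpr ?_
    rw [h]; fin_cases i <;> simp
  choose v hv0 hv using hex
  have hv' : ∀ i, A2.mulVec (v i) = d i • A1.mulVec (v i) := fun i => by
    have := hv i
    rw [Matrix.add_mulVec, Matrix.smul_mulVec, neg_smul] at this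
    exact (eq_neg_of_add_eq_zero_left this).trans (neg_neg _)
  have sym : ∀ {A : M3}, A.transpose = A → ∀ x y : Fin 3 → ℂ, x ⬝ᵥ A.mulVec y = y ⬝ᵥ A.mulVec x := fun {A} hA x y => by
    rw [Matrix.dotProduct_mulVec, ← Matrix.mulVec_transpose, hA, dotProduct_comm]
  have orth : ∀ i j, i ≠ j → v i ⬝ᵥ A1.mulVec (v j) = 0 := fun i j hij => by
    have e1 : v i ⬝ᵥ A2.mulVec (v j) = d j * (v i ⬝ᵥ A1.mulVec (v j)) := by rw [hv', dotProduct_smul, smul_eq_mul]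
    have e2 : v i ⬝ᵥ A2.mulVec (v j) = d i * (v i ⬝ᵥ A1.mulVec (v j)) := by
      rw [sym h2, hv', dotProduct_smul, smul_eq_mul, sym h1]
    have : (d j - d i) * (v i ⬝ᵥ A1.mulVec (v j)) = 0 := by rw [sub_mul, ← e1, ← e2, sub_self]
    exact (mul_eq_zero.mp this).resolve_left (sub_ne_zero.mpr fun h => hij (hd h).symm)
  have hli : LinearIndependent ℂ v := by
    refine Module.End.eigenvectors_linearIndependent' (Matrix.toLin' (A1⁻¹ * A2)) d hd v fun i => ?_
    rw [Module.End.hasEigenvector_iff, Module.End.mem_eigenspace_iff]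
    refine ⟨?_, hv0 i⟩
    rw [Matrix.toLin'_apply, ← Matrix.mulVec_mulVec, hv', Matrix.mulVec_smul, Matrix.mulVec_mulVec, Matrix.nonsing_inv_mul _ hu, Matrix.one_mulVec]
  have hne : ∀ i, v i ⬝ᵥ A1.mulVec (v i) ≠ 0 := fun i h0 => by
    have hall : ∀ j, v j ⬝ᵥ A1.mulVec (v i) = 0 := fun j => by
      by_cases hj : j = i
      · rw [hj]; exact h0
      · exact orth j i hj
    have hsp : Submodule.span ℂ (Set.range v) = ⊤ := hli.span_eq_top_of_card_eq_finrank' (by simp)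
    have hz : ∀ w : Fin 3 → ℂ, w ⬝ᵥ A1.mulVec (v i) = 0 := fun w => by
      have hw : w ∈ Submodule.span ℂ (Set.range v) := by rw [hsp]; trivial
      induction hw using Submodule.span_induction with
      | mem x hx => obtain ⟨j, rfl⟩ := hx; exact hall j
      | zero => simp
      | add x y _ _ hx hy => rw [add_dotProduct, hx, hy, add_zero]
      | smul a x _ hx => rw [smul_dotProduct, hx, smul_zero]
    have hz2 : A1.mulVec (v i) = 0 := dotProduct_eq_zero_iff.mp fun w => by rw [dotProduct_comm]; exact hz w
    refine hv0 i ?_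
    have := congrArg A1⁻¹.mulVec hz2
    rwa [Matrix.mulVec_mulVec, Matrix.nonsing_inv_mul _ hu, Matrix.one_mulVec, Matrix.mulVec_zero] at this
  choose r hr using fun i => exists_sqrt (v i ⬝ᵥ A1.mulVec (v i))
  have hr0 : ∀ i, r i ≠ 0 := fun i h0 => hne i (by rw [← hr, h0]; ring)
  let P : M3 := Matrix.of fun i j => (r j)⁻¹ * v j i
  have hcol : ∀ j, (fun k => P k j) = (r j)⁻¹ • v j := fun j => by ext k; simp [P]
  have e1 : P.transpose * A1 * P = 1 := by
    ext i j
    rw [conj_entry, hcol, hcol, Matrix.mulVec_smul, smul_dotProduct, dotProduct_smul, smul_eq_mul, smul_eq_mul]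
    by_cases hij : i = j
    · subst hij
      rw [← hr]; have := hr0 i; simp; field_simp
    · rw [orth i j hij, Matrix.one_apply_ne hij]; ring
  refine ⟨P, ?_, e1, ?_⟩
  · have := congrArg Matrix.det e1
    rw [Matrix.det_mul, Matrix.det_one] at this
    exact IsUnit.of_mul_eq_one _ (by rw [mul_comm]; exact this)
  · ext i j
    rw [conj_entry, hcol, hcol, Matrix.mulVec_smul, smul_dotProduct, dotProduct_smul, hv', dotProduct_smul, smul_eq_mul, smul_eq_mul, smul_eq_mul]
    by_cases hij : i = j
    · subst hij
      rw [← hr]; have := hr0 i; simp; field_simp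
    · rw [orth i j hij, Matrix.diagonal_apply_ne _ hij]; ring

/-- normal form of a determinantal representation with respect to a frame -/
structure NF (T : Tri) (β : Fin 4 → V5) (A : Fin 4 → M3) (d : Fin 3 → ℂ) : Prop where
  sym : ∀ k, (A k).transpose = A k
  one : A 0 = 1
  diag : A 1 = Matrix.diagonal d
  eq : ∀ i j k, T (β i) (β j) (β k) = T (β 0) (β 0) (β 0) * polL (A i) (A j) (A k)

lemma nf_of_symDet {T : Tri} (hT : TSym T) {H : Submodule ℂ V5} {M : V5 →ₗ[ℂ] M3} (hM : SymDet T H M) {β : Fin 4 → V5}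
    (hβ : ∀ k, β k ∈ H) (h0 : T (β 0) (β 0) (β 0) ≠ 0) {d : Fin 3 → ℂ} (hd : Function.Injective d)
    (h : ∀ x : ℂ, T (β 1 + x • β 0) (β 1 + x • β 0) (β 1 + x • β 0) = T (β 0) (β 0) (β 0) * ((d 0 + x) * (d 1 + x) * (d 2 + x))) :
    ∃ P : M3, IsUnit P.det ∧ NF T β (fun k => P.transpose * M (β k) * P) d := by
  have e0 := hM.2 _ (hβ 0)
  obtain ⟨P, hP, h1, h2⟩ := simul_diag (hM.1 (β 0)) (hM.1 (β 1)) (by rw [← e0]; exact h0) hd (fun x => by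
    rw [← e0, ← h, hM.2 _ (H.add_mem (hβ 1) (H.smul_mem x (hβ 0))), map_add, map_smul])
  refine ⟨P, hP, ⟨fun k => conj_sym P (hM.1 _), h1, h2, fun i j k => ?_⟩⟩
  have hdet : P.det ^ 2 * (M (β 0)).det = 1 := by
    have := congrArg Matrix.det h1
    rw [Matrix.det_mul, Matrix.det_mul, Matrix.det_transpose, Matrix.det_one] at this
    linear_combination this
  rw [hM.pol hT (hβ i) (hβ j) (hβ k), polL_apply, polL_apply, pol_conj, e0]
  linear_combination (-_root_.pol (M (β i)) (M (β j)) (M (β k))) * hdet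

/-- frame of the hyperplane with parameter `c` -/
def fr (bs : Module.Basis (Fin 5) ℂ V5) (c : Fin 4 → ℂ) (k : Fin 4) : V5 := bs k.succ + c k • bs 0

/-- equation of the hyperplane with parameter `c` -/
def hU (bs : Module.Basis (Fin 5) ℂ V5) (c : Fin 4 → ℂ) : V5 →ₗ[ℂ] ℂ := bs.coord 0 - ∑ k : Fin 4, c k • bs.coord k.succ

lemma hU_bs0 (bs : Module.Basis (Fin 5) ℂ V5) (c : Fin 4 → ℂ) : hU bs c (bs 0) = 1 := by
  simp [hU]

lemma hU_ne (bs : Module.Basis (Fin 5) ℂ V5) (c : Fin 4 → ℂ) : hU bs c ≠ 0 := fun h => by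
  have := hU_bs0 bs c
  rw [h] at this; simp at this

lemma coord_fr (bs : Module.Basis (Fin 5) ℂ V5) (c : Fin 4 → ℂ) (k j : Fin 4) : bs.coord k.succ (fr bs c j) = if k = j then 1 else 0 := by
  simp [fr, Finsupp.single_apply, eq_comm]

lemma hU_fr (bs : Module.Basis (Fin 5) ℂ V5) (c : Fin 4 → ℂ) (j : Fin 4) : hU bs c (fr bs c j) = 0 := by
  have h0 : bs.coord 0 (fr bs c j) = c j := by simp [fr]
  rw [hU, LinearMap.sub_apply, h0, LinearMap.sum_apply]
  simp only [LinearMap.smul_apply, coord_fr, smul_eq_mul]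
  simp

lemma expand_fr (bs : Module.Basis (Fin 5) ℂ V5) (c : Fin 4 → ℂ) {x : V5} (hx : hU bs c x = 0) :
    x = ∑ k, bs.coord k.succ x • fr bs c k := by
  have h0 : bs.coord 0 x = ∑ k : Fin 4, c k * bs.coord k.succ x := by
    simpa [hU, sub_eq_zero] using hx
  conv_lhs => rw [← bs.sum_repr x, Fin.sum_univ_succ]
  simp only [fr, smul_add, Finset.sum_add_distrib, ← Module.Basis.coord_apply]
  rw [h0, Finset.sum_smul, add_comm]
  congr 1
  refine Finset.sum_congr rfl fun k _ => ?_
  rw [smul_smul, mul_comm]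

lemma finrank_hU (bs : Module.Basis (Fin 5) ℂ V5) (c : Fin 4 → ℂ) : Module.finrank ℂ (LinearMap.ker (hU bs c)) = 4 := by
  have h1 := LinearMap.finrank_range_add_finrank_ker (hU bs c)
  have h2 : LinearMap.range (hU bs c) = ⊤ := LinearMap.range_eq_top.mpr fun y => ⟨y • bs 0, by simp [hU_bs0]⟩
  rw [h2] at h1
  simp at h1
  omega

/-- the representation with prescribed matrices on the frame -/
def mkM (bs : Module.Basis (Fin 5) ℂ V5) (κ : ℂ) (A : Fin 4 → M3) : V5 →ₗ[ℂ] M3 :=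
  ∑ k : Fin 4, (bs.coord k.succ).smulRight (κ • A k)

lemma mkM_apply (bs : Module.Basis (Fin 5) ℂ V5) (κ : ℂ) (A : Fin 4 → M3) (x : V5) :
    mkM bs κ A x = ∑ k : Fin 4, bs.coord k.succ x • κ • A k := by simp [mkM]

lemma mkM_fr (bs : Module.Basis (Fin 5) ℂ V5) (κ : ℂ) (A : Fin 4 → M3) (c : Fin 4 → ℂ) (j : Fin 4) :
    mkM bs κ A (fr bs c j) = κ • A j := by
  rw [mkM_apply]; simp only [coord_fr]; simp

lemma mkM_symDet {T : Tri} (bs : Module.Basis (Fin 5) ℂ V5) {κ μ : ℂ} (hκ : κ ^ 3 = μ) {A : Fin 4 → M3} {c : Fin 4 → ℂ}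
    (hA : ∀ k, (A k).transpose = A k)
    (h : ∀ i j k, T (fr bs c i) (fr bs c j) (fr bs c k) = μ * polL (A i) (A j) (A k)) :
    SymDet T (LinearMap.ker (hU bs c)) (mkM bs κ A) := by
  refine ⟨fun x => ?_, fun x hx => ?_⟩
  · rw [mkM_apply, Matrix.transpose_sum]; simp [hA]
  · have hx' := expand_fr bs c hx
    rw [← pol_self, ← polL_apply, mkM_apply]
    conv_lhs => rw [hx']
    simp only [map_sum, map_smul, LinearMap.sum_apply, LinearMap.smul_apply, smul_eq_mul, h, ← hκ]
    simp only [Finset.mul_sum]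
    refine Finset.sum_congr rfl fun i _ => Finset.sum_congr rfl fun j _ => Finset.sum_congr rfl fun k _ => ?_
    ring

/-! ### The implicit function theorem for normal forms -/

/-- unknowns: hyperplane, scale, diagonal matrix, two symmetric matrices -/
abbrev EE := (Fin 4 → ℂ) × ℂ × (Fin 3 → ℂ) × (Fin 6 → ℂ) × (Fin 6 → ℂ)

def sM (s : Fin 6 → ℂ) : M3 := !![s 0, s 1, s 2; s 1, s 3, s 4; s 2, s 4, s 5]

lemma sM_sym (s : Fin 6 → ℂ) : (sM s).transpose = sM s := by
  ext i j; fin_cases i <;> fin_cases j <;> rfl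

lemma sM_surj {A : M3} (h : A.transpose = A) : sM ![A 0 0, A 0 1, A 0 2, A 1 1, A 1 2, A 2 2] = A := by
  have h' : ∀ i j, A j i = A i j := fun i j => congrFun (congrFun h i) j
  ext i j; fin_cases i <;> fin_cases j <;> simp [sM, h' 0 1, h' 0 2, h' 1 2]

lemma sM_add (s t : Fin 6 → ℂ) : sM (s + t) = sM s + sM t := by
  ext i j; fin_cases i <;> fin_cases j <;> simp [sM]

lemma sM_smul (c : ℂ) (t : Fin 6 → ℂ) : sM (c • t) = c • sM t := by
  ext i j; fin_cases i <;> fin_cases j <;> simp [sM]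

def fam (ξ : EE) : Fin 4 → M3 := ![1, Matrix.diagonal ξ.2.2.1, sM ξ.2.2.2.1, sM ξ.2.2.2.2]
def famD (ξ : EE) : Fin 4 → M3 := ![0, Matrix.diagonal ξ.2.2.1, sM ξ.2.2.2.1, sM ξ.2.2.2.2]

lemma fam_sym (ξ : EE) (k : Fin 4) : (fam ξ k).transpose = fam ξ k := by
  fin_cases k <;> simp [fam, sM_sym]

lemma fam_line (ξ η : EE) (t : ℂ) (k : Fin 4) : fam (ξ + t • η) k = fam ξ k + t • famD η k := by
  fin_cases k
  · simp [fam, famD]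
  · ext i j; fin_cases i <;> fin_cases j <;> simp [fam, famD]
  · simp [fam, famD, sM_add, sM_smul]
  · simp [fam, famD, sM_add, sM_smul]

def Idx := {p : Fin 4 × Fin 4 × Fin 4 // p.1 ≤ p.2.1 ∧ p.2.1 ≤ p.2.2}

instance : Fintype Idx := inferInstanceAs (Fintype {p : Fin 4 × Fin 4 × Fin 4 // p.1 ≤ p.2.1 ∧ p.2.1 ≤ p.2.2})
instance : DecidableEq Idx := inferInstanceAs (DecidableEq {p : Fin 4 × Fin 4 × Fin 4 // p.1 ≤ p.2.1 ∧ p.2.1 ≤ p.2.2})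

lemma card_Idx : Fintype.card Idx = 20 := by decide

def srt (i j k : Fin 4) : Idx :=
  ⟨(min (min i j) k, max (min i j) (min (max i j) k), max (max i j) k), by
    refine ⟨?_, ?_⟩
    · exact le_trans (min_le_left _ _) (le_max_left _ _)
    · exact max_le (le_trans min_le_max (le_max_left _ _)) (le_trans (min_le_left _ _) (le_max_left _ _))⟩

lemma srt_self (p : Idx) : srt p.1.1 p.1.2.1 p.1.2.2 = p := by revert p; decide
lemma srt_12 (i j k : Fin 4) : srt i j k = srt j i k := by revert i j k; decide
lemma srt_23 (i j k : Fin 4) : srt i j k = srt i k j := by revert i j k; decide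

def PhiF (T : ℂ → Tri) (bs : Module.Basis (Fin 5) ℂ V5) (z : ℂ) (ξ : EE) (i j k : Fin 4) : ℂ :=
  T z (fr bs ξ.1 i) (fr bs ξ.1 j) (fr bs ξ.1 k) - ξ.2.1 * polL (fam ξ i) (fam ξ j) (fam ξ k)

def Phi (T : ℂ → Tri) (bs : Module.Basis (Fin 5) ℂ V5) (p : ℂ × EE) : Idx → ℂ :=
  fun s => PhiF T bs p.1 p.2 s.1.1 s.1.2.1 s.1.2.2

lemma Phi_zero {T : ℂ → Tri} (hT : ∀ z, TSym (T z)) {bs : Module.Basis (Fin 5) ℂ V5} {p : ℂ × EE} :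
    Phi T bs p = 0 ↔ ∀ i j k, T p.1 (fr bs p.2.1 i) (fr bs p.2.1 j) (fr bs p.2.1 k) = p.2.2.1 * polL (fam p.2 i) (fam p.2 j) (fam p.2 k) := by
  constructor
  · intro h
    have h1 : ∀ i j k, i ≤ j → j ≤ k → PhiF T bs p.1 p.2 i j k = 0 := fun i j k a b => congrFun h ⟨(i, j, k), a, b⟩
    have s12 : ∀ i j k, PhiF T bs p.1 p.2 i j k = PhiF T bs p.1 p.2 j i k := fun i j k => by
      rw [PhiF, PhiF, (hT _ _ _ _).1, polL_apply, pol_swap12]; rfl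
    have s23 : ∀ i j k, PhiF T bs p.1 p.2 i j k = PhiF T bs p.1 p.2 i k j := fun i j k => by
      rw [PhiF, PhiF, (hT _ _ _ _).2, polL_apply, pol_swap23]; rfl
    intro i j k
    rw [← sub_eq_zero]
    change PhiF T bs p.1 p.2 i j k = 0
    rcases le_total i j with a | a <;> rcases le_total j k with b | b <;> rcases le_total i k with c | c
    · exact h1 _ _ _ a b
    · exact h1 _ _ _ a b
    · rw [s23]; exact h1 _ _ _ c b
    · rw [s23, s12]; exact h1 _ _ _ c a
    · rw [s12]; exact h1 _ _ _ a c
    · rw [s12, s23]; exact h1 _ _ _ b c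
    · rw [s12, s23, s12]; exact h1 _ _ _ b a
    · rw [s12, s23, s12]; exact h1 _ _ _ b a
  · intro h
    funext s
    exact sub_eq_zero.mpr (h _ _ _)

lemma contDiff_fam (k : Fin 4) (a b : Fin 3) : ContDiff ℂ 1 (fun p : ℂ × EE => fam p.2 k a b) := by
  fin_cases k
  · simp only [fam, Fin.zero_eta, Matrix.cons_val]; exact contDiff_const
  all_goals
    fin_cases a <;> fin_cases b <;> simp [fam, sM] <;> fun_prop

lemma contDiff_pol {X : Type*} [NormedAddCommGroup X] [NormedSpace ℂ X] {f g h : X → M3}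
    (hf : ∀ a b, ContDiff ℂ 1 (fun p => f p a b)) (hg : ∀ a b, ContDiff ℂ 1 (fun p => g p a b)) (hh : ∀ a b, ContDiff ℂ 1 (fun p => h p a b)) :
    ContDiff ℂ 1 (fun p => polL (f p) (g p) (h p)) := by
  simp only [polL_apply, pol, Matrix.det_fin_three, Matrix.add_apply]
  fun_prop

lemma contDiff_Phi (T0 T1 : Tri) (bs : Module.Basis (Fin 5) ℂ V5) : ContDiff ℂ 1 (Phi (fun z => T0 + z • T1) bs) := by
  rw [contDiff_pi]
  intro s
  simp only [Phi, PhiF]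
  refine ContDiff.sub ?_ (ContDiff.mul (by fun_prop) (contDiff_pol (contDiff_fam _) (contDiff_fam _) (contDiff_fam _)))
  simp only [fr, map_add, map_smul, LinearMap.add_apply, LinearMap.smul_apply, smul_eq_mul]
  fun_prop

lemma hasDerivAt_quartic {f : ℂ → ℂ} {a0 a1 a2 a3 a4 : ℂ} (h : ∀ t, f t = a0 + t * a1 + t ^ 2 * a2 + t ^ 3 * a3 + t ^ 4 * a4) :
    HasDerivAt f a1 0 := by
  have : f = fun t => a0 + t * a1 + t ^ 2 * a2 + t ^ 3 * a3 + t ^ 4 * a4 := funext h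
  rw [this]
  have h1 := ((((hasDerivAt_const (0 : ℂ) a0).add ((hasDerivAt_id (0 : ℂ)).mul_const a1)).add
    ((hasDerivAt_pow 2 (0 : ℂ)).mul_const a2)).add ((hasDerivAt_pow 3 (0 : ℂ)).mul_const a3)).add ((hasDerivAt_pow 4 (0 : ℂ)).mul_const a4)
  have e : a1 = 0 + 1 * a1 + ((2 : ℕ) : ℂ) * 0 ^ (2 - 1) * a2 + ((3 : ℕ) : ℂ) * 0 ^ (3 - 1) * a3 + ((4 : ℕ) : ℂ) * 0 ^ (4 - 1) * a4 := by simp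
  refine HasDerivAt.congr_deriv h1 e.symm

lemma deriv_Phi (T : ℂ → Tri) (bs : Module.Basis (Fin 5) ℂ V5) (z : ℂ) (ξ η : EE) (i j k : Fin 4) :
    HasDerivAt (fun t : ℂ => PhiF T bs z (ξ + t • η) i j k)
      (η.1 i * T z (bs 0) (fr bs ξ.1 j) (fr bs ξ.1 k) + η.1 j * T z (fr bs ξ.1 i) (bs 0) (fr bs ξ.1 k)
        + η.1 k * T z (fr bs ξ.1 i) (fr bs ξ.1 j) (bs 0)
        - η.2.1 * polL (fam ξ i) (fam ξ j) (fam ξ k)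
        - ξ.2.1 * (polL (famD η i) (fam ξ j) (fam ξ k) + polL (fam ξ i) (famD η j) (fam ξ k) + polL (fam ξ i) (fam ξ j) (famD η k))) 0 := by
  have hfr : ∀ (t : ℂ) k, fr bs (ξ + t • η).1 k = fr bs ξ.1 k + (t * η.1 k) • bs 0 := fun t k => by
    simp [fr, add_smul, add_assoc]
  have hmu : ∀ t : ℂ, (ξ + t • η).2.1 = ξ.2.1 + t * η.2.1 := fun t => rfl
  refine hasDerivAt_quartic (a0 := PhiF T bs z ξ i j k)
    (a2 := η.1 i * η.1 j * T z (bs 0) (bs 0) (fr bs ξ.1 k) + η.1 j * η.1 k * T z (fr bs ξ.1 i) (bs 0) (bs 0)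
        + η.1 i * η.1 k * T z (bs 0) (fr bs ξ.1 j) (bs 0)
        - η.2.1 * (polL (famD η i) (fam ξ j) (fam ξ k) + polL (fam ξ i) (famD η j) (fam ξ k) + polL (fam ξ i) (fam ξ j) (famD η k))
        - ξ.2.1 * (polL (fam ξ i) (famD η j) (famD η k) + polL (famD η i) (fam ξ j) (famD η k) + polL (famD η i) (famD η j) (fam ξ k)))
    (a3 := η.1 i * η.1 j * η.1 k * T z (bs 0) (bs 0) (bs 0)
        - η.2.1 * (polL (fam ξ i) (famD η j) (famD η k) + polL (famD η i) (fam ξ j) (famD η k) + polL (famD η i) (famD η j) (fam ξ k))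
        - ξ.2.1 * polL (famD η i) (famD η j) (famD η k))
    (a4 := - η.2.1 * polL (famD η i) (famD η j) (famD η k)) fun t => ?_
  simp only [PhiF, hfr, hmu, fam_line, map_add, map_smul, LinearMap.add_apply, LinearMap.smul_apply, smul_eq_mul]
  ring

def triG (bs : Module.Basis (Fin 5) ℂ V5) (g : Idx → ℂ) : Tri :=
  ∑ i : Fin 4, ∑ j : Fin 4, ∑ k : Fin 4, g (srt i j k) •
    (bs.coord i.succ).smulRight ((bs.coord j.succ).smulRight (bs.coord k.succ))

lemma triG_apply (bs : Module.Basis (Fin 5) ℂ V5) (g : Idx → ℂ) (x y z : V5) : triG bs g x y z =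
    ∑ i : Fin 4, ∑ j : Fin 4, ∑ k : Fin 4, g (srt i j k) * (bs.coord i.succ x * (bs.coord j.succ y * bs.coord k.succ z)) := by
  simp only [triG, LinearMap.sum_apply, LinearMap.smul_apply, LinearMap.smulRight_apply, smul_eq_mul]

lemma triG_sym (bs : Module.Basis (Fin 5) ℂ V5) (g : Idx → ℂ) : TSym (triG bs g) := fun x y z => by
  constructor
  · rw [triG_apply, triG_apply, Finset.sum_comm]
    refine Finset.sum_congr rfl fun i _ => Finset.sum_congr rfl fun j _ => Finset.sum_congr rfl fun k _ => ?_
    rw [srt_12]; ring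
  · rw [triG_apply, triG_apply]
    refine Finset.sum_congr rfl fun i _ => ?_
    rw [Finset.sum_comm]
    refine Finset.sum_congr rfl fun j _ => Finset.sum_congr rfl fun k _ => ?_
    rw [srt_23]; ring

lemma triG_fr (bs : Module.Basis (Fin 5) ℂ V5) (g : Idx → ℂ) (c : Fin 4 → ℂ) (i j k : Fin 4) :
    triG bs g (fr bs c i) (fr bs c j) (fr bs c k) = g (srt i j k) := by
  rw [triG_apply]
  simp only [coord_fr]
  simp

lemma nd_polar {T G : Tri} (hT : TSym T) (hG : TSym G) {H : Submodule ℂ V5} {M K : V5 →ₗ[ℂ] M3} {m : V5 →ₗ[ℂ] ℂ} {b : V5}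
    (h : ∀ x ∈ H, G x x x = m x * T x x b + dd (M x) (K x)) {x y z : V5} (hx : x ∈ H) (hy : y ∈ H) (hz : z ∈ H) :
    3 * G x y z = m x * T y z b + m y * T x z b + m z * T x y b
      + 3 * (polL (K x) (M y) (M z) + polL (M x) (K y) (M z) + polL (M x) (M y) (K z)) := by
  have e := tri_polar hG x y z
  rw [h _ (H.add_mem (H.add_mem hx hy) hz), h _ (H.add_mem hx hy), h _ (H.add_mem hx hz), h _ (H.add_mem hy hz),
    h _ hx, h _ hy, h _ hz] at e
  have s1 : T y x b = T x y b := (hT _ _ _).1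
  have s2 : T z x b = T x z b := (hT _ _ _).1
  have s3 : T z y b = T y z b := (hT _ _ _).1
  have p12 : ∀ A B C : M3, polL A B C = polL B A C := pol_swap12
  have p23 : ∀ A B C : M3, polL A B C = polL A C B := pol_swap23
  have q1 : polL (M x) (M z) (K y) = polL (M x) (K y) (M z) := p23 _ _ _
  have q2 : polL (M z) (M x) (K y) = polL (M x) (K y) (M z) := by rw [p12, q1]
  have q3 : polL (M y) (M z) (K x) = polL (K x) (M y) (M z) := by rw [p23, p12]
  have q4 : polL (M z) (M y) (K x) = polL (K x) (M y) (M z) := by rw [p12, q3]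
  have q5 : polL (M y) (M x) (K z) = polL (M x) (M y) (K z) := p12 _ _ _
  simp only [← pol_dd, ← polL_apply, map_add, LinearMap.add_apply, s1, s2, s3, q1, q2, q3, q4, q5] at e
  linear_combination e / 2

lemma nd_b0 {T : Tri} (hT : TSym T) {bs : Module.Basis (Fin 5) ℂ V5} {c : Fin 4 → ℂ} {M : V5 →ₗ[ℂ] M3}
    (hM : SymDet T (LinearMap.ker (hU bs c)) M) (hN : ND T (LinearMap.ker (hU bs c)) M) (G : Tri) :
    ∃ (m : V5 →ₗ[ℂ] ℂ) (K : V5 →ₗ[ℂ] M3), ∀ x ∈ LinearMap.ker (hU bs c), G x x x = m x * T x x (bs 0) + dd (M x) (K x) := by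
  obtain ⟨m, K, b, h⟩ := hN G
  set l := hU bs c b with hl
  have hb : b - l • bs 0 ∈ LinearMap.ker (hU bs c) := by
    rw [LinearMap.mem_ker, map_sub, map_smul, hU_bs0, ← hl]; simp
  refine ⟨l • m, K + m.smulRight ((1 / 3 : ℂ) • M (b - l • bs 0)), fun x hx => ?_⟩
  have e1 : T x x b = l * T x x (bs 0) + polL (M x) (M x) (M (b - l • bs 0)) := by
    rw [← hM.pol hT hx hx hb, map_sub, map_smul, smul_eq_mul]; ring
  rw [h x hx, e1, ← pol_dd, ← pol_dd, ← polL_apply, ← polL_apply, LinearMap.add_apply, LinearMap.smulRight_apply, map_add, map_smul, map_smul,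
    LinearMap.smul_apply, smul_eq_mul, smul_eq_mul, smul_eq_mul]
  ring

lemma pol_transpose {A B : M3} (hA : A.transpose = A) (hB : B.transpose = B) (K : M3) : pol A B K.transpose = pol A B K := by
  have h : ∀ X Y : M3, X.transpose = Y → Y.det = X.det := fun X Y e => by rw [← e, Matrix.det_transpose]
  unfold pol
  rw [h (A + B + K) (A + B + K.transpose) (by simp [hA, hB]), h (A + K) (A + K.transpose) (by simp [hA]),
    h (B + K) (B + K.transpose) (by simp [hB]), Matrix.det_transpose]

lemma pol_gauge (A B C R : M3) :
    polL (R.transpose * A + A * R) B C + polL A (R.transpose * B + B * R) C + polL A B (R.transpose * C + C * R)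
      = 2 * R.trace * polL A B C := by
  simp only [polL_apply, pol, Matrix.det_fin_three, Matrix.add_apply, Matrix.mul_apply, Fin.sum_univ_three, Matrix.transpose_apply,
    Matrix.trace_fin_three]
  ring

lemma gauge_norm {d : Fin 3 → ℂ} (hd : Function.Injective d) {K0 K1 : M3} (h0 : K0.transpose = K0) (h1 : K1.transpose = K1) :
    ∃ (R : M3) (δ : Fin 3 → ℂ), K0 = R.transpose * 1 + 1 * R ∧
      K1 = R.transpose * Matrix.diagonal d + Matrix.diagonal d * R + Matrix.diagonal δ := by
  have s0 : ∀ i j, K0 j i = K0 i j := fun i j => congrFun (congrFun h0 i) j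
  have s1 : ∀ i j, K1 j i = K1 i j := fun i j => congrFun (congrFun h1 i) j
  refine ⟨Matrix.of fun i j => if i = j then K0 i i / 2 else (K1 i j - d j * K0 i j) / (d i - d j), fun i => K1 i i - d i * K0 i i, ?_, ?_⟩
  · ext i j
    rw [Matrix.mul_one, Matrix.one_mul, Matrix.add_apply, Matrix.transpose_apply, Matrix.of_apply, Matrix.of_apply]
    by_cases h : i = j
    · subst h; simp
    · have e1 : d i - d j ≠ 0 := sub_ne_zero.mpr fun e => h (hd e)
      have e2 : d j - d i ≠ 0 := sub_ne_zero.mpr fun e => h (hd e.symm)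
      rw [if_neg h, if_neg (Ne.symm h), s0 i j, s1 i j, ← neg_sub (d i) (d j)]
      field_simp; ring
  · ext i j
    rw [Matrix.add_apply, Matrix.add_apply, Matrix.mul_diagonal, Matrix.diagonal_mul, Matrix.transpose_apply, Matrix.of_apply, Matrix.of_apply]
    by_cases h : i = j
    · subst h; simp; ring
    · have e1 : d i - d j ≠ 0 := sub_ne_zero.mpr fun e => h (hd e)
      have e2 : d j - d i ≠ 0 := sub_ne_zero.mpr fun e => h (hd e.symm)
      rw [if_neg h, if_neg (Ne.symm h), s0 i j, s1 i j, ← neg_sub (d i) (d j), Matrix.diagonal_apply_ne _ h]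
      field_simp; ring

lemma nd_surj {T : Tri} (hT : TSym T) {bs : Module.Basis (Fin 5) ℂ V5} {ξ : EE} {κ : ℂ} (hμ : ξ.2.1 ≠ 0)
    (hd : Function.Injective ξ.2.2.1)
    (hM : SymDet T (LinearMap.ker (hU bs ξ.1)) (mkM bs κ (fam ξ))) (hN : ND T (LinearMap.ker (hU bs ξ.1)) (mkM bs κ (fam ξ))) (g : Idx → ℂ) :
    ∃ η : EE, ∀ i j k, η.1 i * T (bs 0) (fr bs ξ.1 j) (fr bs ξ.1 k) + η.1 j * T (fr bs ξ.1 i) (bs 0) (fr bs ξ.1 k)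
        + η.1 k * T (fr bs ξ.1 i) (fr bs ξ.1 j) (bs 0)
        - η.2.1 * polL (fam ξ i) (fam ξ j) (fam ξ k)
        - ξ.2.1 * (polL (famD η i) (fam ξ j) (fam ξ k) + polL (fam ξ i) (famD η j) (fam ξ k) + polL (fam ξ i) (fam ξ j) (famD η k))
        = g (srt i j k) := by
  obtain ⟨m, K, h⟩ := nd_b0 hT hM hN (triG bs g)
  set β := fr bs ξ.1 with hβ
  set A := fam ξ with hA
  have hmem : ∀ k, β k ∈ LinearMap.ker (hU bs ξ.1) := fun k => hU_fr bs ξ.1 k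
  have sA : ∀ k, (A k).transpose = A k := fam_sym ξ
  have hp : ∀ i j k, 3 * g (srt i j k) = m (β i) * T (β j) (β k) (bs 0) + m (β j) * T (β i) (β k) (bs 0) + m (β k) * T (β i) (β j) (bs 0)
      + 3 * κ ^ 2 * (polL (K (β i)) (A j) (A k) + polL (A i) (K (β j)) (A k) + polL (A i) (A j) (K (β k))) := fun i j k => by
    rw [← triG_fr bs g ξ.1 i j k, nd_polar hT (triG_sym bs g) h (hmem i) (hmem j) (hmem k)]
    simp only [hβ, mkM_fr, map_smul, LinearMap.smul_apply, smul_eq_mul]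
    ring
  have p12 : ∀ A B C : M3, polL A B C = polL B A C := pol_swap12
  have p23 : ∀ A B C : M3, polL A B C = polL A C B := pol_swap23
  let L : Fin 4 → M3 := fun k => (1 / 2 : ℂ) • (K (β k) + (K (β k)).transpose)
  have sL : ∀ k, (L k).transpose = L k := fun k => by
    simp only [L, Matrix.transpose_smul, Matrix.transpose_add, Matrix.transpose_transpose, add_comm]
  have hL : ∀ i j k, polL (A i) (A j) (L k) = polL (A i) (A j) (K (β k)) := fun i j k => by
    have := pol_transpose (sA i) (sA j) (K (β k))
    simp only [L, map_smul, map_add, smul_eq_mul]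
    rw [polL_apply, polL_apply, this]; ring
  have hL1 : ∀ i j k, polL (K (β i)) (A j) (A k) = polL (L i) (A j) (A k) := fun i j k => by
    rw [p12, p23, ← hL, p23, p12]
  have hL2 : ∀ i j k, polL (A i) (K (β j)) (A k) = polL (A i) (L j) (A k) := fun i j k => by
    rw [p23, ← hL, p23]
  obtain ⟨R, δ, g0, g1⟩ := gauge_norm hd (sL 0) (sL 1)
  let N : Fin 4 → M3 := fun k => L k - (R.transpose * A k + A k * R)
  have sN : ∀ k, (N k).transpose = N k := fun k => by
    simp only [N, Matrix.transpose_sub, sL, Matrix.transpose_add, Matrix.transpose_mul, Matrix.transpose_transpose, sA]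
    rw [add_comm]
  have hLN : ∀ k, L k = (R.transpose * A k + A k * R) + N k := fun k => by simp [N]
  have n0 : N 0 = 0 := by simp only [N]; rw [g0]; simp [A, fam]
  have n1 : N 1 = Matrix.diagonal δ := by simp only [N]; rw [g1]; simp [A, fam]
  have hsum : ∀ i j k, polL (L i) (A j) (A k) + polL (A i) (L j) (A k) + polL (A i) (A j) (L k) = 2 * R.trace * polL (A i) (A j) (A k)
      + (polL (N i) (A j) (A k) + polL (A i) (N j) (A k) + polL (A i) (A j) (N k)) := fun i j k => by
    rw [← pol_gauge, hLN i, hLN j, hLN k]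
    simp only [map_add, LinearMap.add_apply]; ring
  let c : ℂ := -κ ^ 2 / ξ.2.1
  let η : EE := (fun k => m (β k) / 3, - 2 * κ ^ 2 * R.trace, c • δ,
    c • ![N 2 0 0, N 2 0 1, N 2 0 2, N 2 1 1, N 2 1 2, N 2 2 2], c • ![N 3 0 0, N 3 0 1, N 3 0 2, N 3 1 1, N 3 1 2, N 3 2 2])
  have hη : ∀ k, famD η k = c • N k := by
    intro k
    match k with
    | 0 => simp [famD, n0]
    | 1 =>
      rw [n1]
      ext i j; simp [famD, η, Matrix.diagonal_apply]
    | 2 => rw [← sM_surj (sN 2), ← sM_smul]; rfl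
    | 3 => rw [← sM_surj (sN 3), ← sM_smul]; rfl
  refine ⟨η, fun i j k => ?_⟩
  have hc : ξ.2.1 * c = -κ ^ 2 := by simp only [c]; field_simp
  have t1 : T (bs 0) (β j) (β k) = T (β j) (β k) (bs 0) := by rw [(hT _ _ _).1, (hT _ _ _).2]
  have t2 : T (β i) (bs 0) (β k) = T (β i) (β k) (bs 0) := (hT _ _ _).2
  have e1 : η.1 = fun k => m (β k) / 3 := rfl
  have e2 : η.2.1 = - 2 * κ ^ 2 * R.trace := rfl
  have h3 := hp i j k
  rw [hL1, hL2, ← hL, hsum] at h3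
  simp only [hη, map_smul, LinearMap.smul_apply, smul_eq_mul, t1, t2, e1, e2]
  linear_combination -h3 / 3 - (polL (N i) (A j) (A k) + polL (A i) (N j) (A k) + polL (A i) (A j) (N k)) * hc

/-- a solution of the normal form equations -/
def Sol (T : ℂ → Tri) (bs : Module.Basis (Fin 5) ℂ V5) (z : ℂ) (ξ : EE) : Prop :=
  ∀ i j k, T z (fr bs ξ.1 i) (fr bs ξ.1 j) (fr bs ξ.1 k) = ξ.2.1 * polL (fam ξ i) (fam ξ j) (fam ξ k)

lemma branch (T0 T1 : Tri) (hT : ∀ z : ℂ, TSym (T0 + z • T1)) {bs : Module.Basis (Fin 5) ℂ V5} {z : ℂ} {ξ : EE} {κ : ℂ}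
    (hκ : κ ^ 3 = ξ.2.1) (hμ : ξ.2.1 ≠ 0) (hd : Function.Injective ξ.2.2.1) (hS : Sol (fun z => T0 + z • T1) bs z ξ)
    (hN : ND (T0 + z • T1) (LinearMap.ker (hU bs ξ.1)) (mkM bs κ (fam ξ))) :
    ∃ g : ℂ → EE, Filter.Tendsto g (nhds z) (nhds ξ) ∧ (∀ᶠ w in nhds z, Sol (fun z => T0 + z • T1) bs w (g w)) ∧
      ∀ᶠ v in nhds (z, ξ), Sol (fun z => T0 + z • T1) bs v.1 v.2 → v.2 = g v.1 := by
  set T : ℂ → Tri := fun z => T0 + z • T1 with hTd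
  have h1 : HasStrictFDerivAt (Phi T bs) (fderiv ℂ (Phi T bs) (z, ξ)) (z, ξ) :=
    (contDiff_Phi T0 T1 bs).contDiffAt.hasStrictFDerivAt one_ne_zero
  have h0 : Phi T bs (z, ξ) = 0 := (Phi_zero hT).mpr hS
  have hsurj : Function.Surjective ((fderiv ℂ (Phi T bs) (z, ξ)) ∘L ContinuousLinearMap.inr ℂ ℂ EE) := by
    intro g
    obtain ⟨η, hη⟩ := nd_surj (hT z) hμ hd (mkM_symDet bs hκ (fam_sym ξ) hS) hN g
    refine ⟨η, ?_⟩
    have hl : HasDerivAt (fun t : ℂ => ((z, ξ) : ℂ × EE) + t • ((0 : ℂ), η)) ((0 : ℂ), η) 0 := by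
      simpa using ((hasDerivAt_id (0 : ℂ)).smul_const ((0 : ℂ), η)).const_add ((z, ξ) : ℂ × EE)
    have hc := HasFDerivAt.comp_hasDerivAt_of_eq (0 : ℂ) h1.hasFDerivAt hl (by simp)
    funext s
    have hc' := (hasDerivAt_pi.mp hc) s
    have hd' := deriv_Phi T bs z ξ η s.1.1 s.1.2.1 s.1.2.2
    have fe : (fun x => (Phi T bs ∘ fun t : ℂ => ((z, ξ) : ℂ × EE) + t • ((0 : ℂ), η)) x s)
        = fun t : ℂ => PhiF T bs z (ξ + t • η) s.1.1 s.1.2.1 s.1.2.2 := by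
      funext t; simp [Phi]
    rw [fe] at hc'
    have e := hc'.unique hd'
    rw [hη, srt_self] at e
    exact e
  have hinj : Function.Injective ((fderiv ℂ (Phi T bs) (z, ξ)) ∘L ContinuousLinearMap.inr ℂ ℂ EE) := by
    refine (LinearMap.injective_iff_surjective_of_finrank_eq_finrank
      (f := (((fderiv ℂ (Phi T bs) (z, ξ)) ∘L ContinuousLinearMap.inr ℂ ℂ EE : EE →L[ℂ] (Idx → ℂ)) : EE →ₗ[ℂ] (Idx → ℂ))) ?_).mpr hsurj
    rw [Module.finrank_fintype_fun_eq_card, card_Idx]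
    simp
  have hinv : ((fderiv ℂ (Phi T bs) (z, ξ)) ∘L ContinuousLinearMap.inr ℂ ℂ EE).IsInvertible :=
    ⟨ContinuousLinearEquiv.ofBijective _ (LinearMap.ker_eq_bot.mpr hinj) (LinearMap.range_eq_top.mpr hsurj),
      ContinuousLinearEquiv.coe_ofBijective _ _ _⟩
  refine ⟨h1.implicitFunctionOfProdDomain hinv, h1.tendsto_implicitFunctionOfProdDomain hinv, ?_, ?_⟩
  · filter_upwards [h1.eventually_apply_implicitFunctionOfProdDomain hinv] with w hw
    rw [h0] at hw
    exact (Phi_zero hT).mp hw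
  · filter_upwards [h1.eventually_apply_eq_iff_implicitFunctionOfProdDomain hinv] with v hv hs
    exact (hv.mp (by rw [h0]; exact (Phi_zero hT).mpr hs)).symm

/-! ### Compactness along ultrafilters -/
open Filter Topology

lemma ultra_dich {ι V : Type*} [NormedAddCommGroup V] [NormedSpace ℂ V] [ProperSpace V] (𝒰 : Ultrafilter ι) (f : ι → V) :
    (∃ x, Tendsto f 𝒰 (𝓝 x)) ∨ ∃ (w : V) (r : ι → ℂ), w ≠ 0 ∧ Tendsto r 𝒰 (𝓝 0) ∧ Tendsto (fun n => r n • f n) 𝒰 (𝓝 w) := by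
  have key : ∀ (g : ι → V) (R : ℝ), (∀ᶠ n in (𝒰 : Filter ι), ‖g n‖ ≤ R) → ∃ x, Tendsto g 𝒰 (𝓝 x) := fun g R h => by
    have hc : IsCompact (Metric.closedBall (0 : V) R) := isCompact_closedBall 0 R
    obtain ⟨x, -, hx⟩ := hc.ultrafilter_le_nhds (𝒰.map g) (by
      rw [le_principal_iff]
      change ∀ᶠ n in (𝒰 : Filter ι), g n ∈ Metric.closedBall (0 : V) R
      filter_upwards [h] with n hn
      simpa using hn)
    exact ⟨x, hx⟩
  by_cases hb : ∃ R : ℝ, ∀ᶠ n in (𝒰 : Filter ι), ‖f n‖ ≤ R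
  · obtain ⟨R, hR⟩ := hb
    exact Or.inl (key f R hR)
  · right
    push Not at hb
    have hR : ∀ R : ℝ, ∀ᶠ n in (𝒰 : Filter ι), R < ‖f n‖ := hb
    have ht : Tendsto (fun n => ‖f n‖) 𝒰 atTop := tendsto_atTop.mpr fun R => (hR R).mono fun n hn => hn.le
    have hr : Tendsto (fun n => ((‖f n‖⁻¹ : ℝ) : ℂ)) 𝒰 (𝓝 0) := by
      have := (Complex.continuous_ofReal.tendsto 0).comp (tendsto_inv_atTop_zero.comp ht)
      simpa [Function.comp_def] using this
    have hn : ∀ᶠ n in (𝒰 : Filter ι), ‖((‖f n‖⁻¹ : ℝ) : ℂ) • f n‖ = 1 := by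
      filter_upwards [hR 0] with n hn
      rw [norm_smul, Complex.norm_real, norm_inv, norm_norm, inv_mul_cancel₀ hn.ne']
    obtain ⟨w, hw⟩ := key (fun n => ((‖f n‖⁻¹ : ℝ) : ℂ) • f n) 1 (hn.mono fun n h => h.le)
    refine ⟨w, _, ?_, hr, hw⟩
    intro h0
    have h1 : Tendsto (fun n => ‖((‖f n‖⁻¹ : ℝ) : ℂ) • f n‖) 𝒰 (𝓝 ‖w‖) := hw.norm
    have h2 : Tendsto (fun n => ‖((‖f n‖⁻¹ : ℝ) : ℂ) • f n‖) 𝒰 (𝓝 1) := tendsto_const_nhds.congr' (hn.mono fun n h => h.symm)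
    have := tendsto_nhds_unique h1 h2
    rw [h0] at this; simp at this

lemma conv_roots {ι : Type*} (𝒰 : Ultrafilter ι) {d : ι → Fin 3 → ℂ} {a b c : ℂ}
    (h1 : Tendsto (fun n => d n 0 + d n 1 + d n 2) 𝒰 (𝓝 a))
    (h2 : Tendsto (fun n => d n 0 * d n 1 + d n 0 * d n 2 + d n 1 * d n 2) 𝒰 (𝓝 b))
    (h3 : Tendsto (fun n => d n 0 * d n 1 * d n 2) 𝒰 (𝓝 c)) : ∃ d', Tendsto d 𝒰 (𝓝 d') := by
  rcases ultra_dich 𝒰 d with h | ⟨w, r, hw, hr, hrd⟩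
  · exact h
  · exfalso
    have t : ∀ i, Tendsto (fun n => r n * d n i) 𝒰 (𝓝 (w i)) := fun i => by
      simpa using (tendsto_pi_nhds.mp hrd) i
    have e1 : w 0 + w 1 + w 2 = 0 := by
      refine tendsto_nhds_unique (((t 0).add (t 1)).add (t 2)) ?_
      have := hr.mul h1
      rw [zero_mul] at this
      exact this.congr fun n => by ring
    have e2 : w 0 * w 1 + w 0 * w 2 + w 1 * w 2 = 0 := by
      refine tendsto_nhds_unique ((((t 0).mul (t 1)).add ((t 0).mul (t 2))).add ((t 1).mul (t 2))) ?_
      have := (hr.pow 2).mul h2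
      rw [zero_pow two_ne_zero, zero_mul] at this
      exact this.congr fun n => by ring
    have e3 : w 0 * w 1 * w 2 = 0 := by
      refine tendsto_nhds_unique (((t 0).mul (t 1)).mul (t 2)) ?_
      have := (hr.pow 3).mul h3
      rw [zero_pow three_ne_zero, zero_mul] at this
      exact this.congr fun n => by ring
    apply hw
    funext i
    have h3 : w i ^ 3 = 0 := by
      fin_cases i
      · change w 0 ^ 3 = 0; linear_combination w 0 ^ 2 * e1 - w 0 * e2 + e3
      · change w 1 ^ 3 = 0; linear_combination w 1 ^ 2 * e1 - w 1 * e2 + e3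
      · change w 2 ^ 3 = 0; linear_combination w 2 ^ 2 * e1 - w 2 * e2 + e3
    exact pow_eq_zero_iff three_ne_zero |>.mp h3

lemma pol_kill {d : Fin 3 → ℂ} (hd : Function.Injective d) {w : Fin 6 → ℂ}
    (h1 : polL 1 1 (sM w) = 0) (h2 : polL 1 (Matrix.diagonal d) (sM w) = 0) (h3 : polL (Matrix.diagonal d) (Matrix.diagonal d) (sM w) = 0)
    (h4 : polL 1 (sM w) (sM w) = 0) (h5 : polL (Matrix.diagonal d) (sM w) (sM w) = 0) (h6 : polL (sM w) (sM w) (sM w) = 0) : w = 0 := by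
  have d01 : d 0 - d 1 ≠ 0 := sub_ne_zero.mpr fun e => by simpa using hd e
  have d02 : d 0 - d 2 ≠ 0 := sub_ne_zero.mpr fun e => by simpa using hd e
  have d12 : d 1 - d 2 ≠ 0 := sub_ne_zero.mpr fun e => by simpa using hd e
  simp [polL_apply, pol, Matrix.det_fin_three, sM, Fin.prod_univ_three] at h1 h2 h3 h4 h5 h6
  have k1 : w 0 + w 3 + w 5 = 0 := by linear_combination h1 / 2
  have k2 : (d 1 + d 2) * w 0 + (d 0 + d 2) * w 3 + (d 0 + d 1) * w 5 = 0 := by linear_combination h2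
  have k3 : d 1 * d 2 * w 0 + d 0 * d 2 * w 3 + d 0 * d 1 * w 5 = 0 := by linear_combination h3 / 2
  have w0 : w 0 = 0 := by
    have : (d 0 - d 1) * (d 0 - d 2) * w 0 = 0 := by linear_combination d 0 ^ 2 * k1 - d 0 * k2 + k3
    simpa [d01, d02] using this
  have w3 : w 3 = 0 := by
    have : (d 0 - d 1) * (d 1 - d 2) * w 3 = 0 := by linear_combination -(d 1 ^ 2 * k1 - d 1 * k2 + k3)
    simpa [d01, d12] using this
  have w5 : w 5 = 0 := by
    have : (d 0 - d 2) * (d 1 - d 2) * w 5 = 0 := by linear_combination d 2 ^ 2 * k1 - d 2 * k2 + k3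
    simpa [d02, d12] using this
  simp only [w0, w3, w5] at h4 h5 h6
  have k4 : w 1 ^ 2 + w 2 ^ 2 + w 4 ^ 2 = 0 := by linear_combination -h4 / 2
  have k5 : d 2 * w 1 ^ 2 + d 1 * w 2 ^ 2 + d 0 * w 4 ^ 2 = 0 := by linear_combination -h5 / 2
  have k6 : w 1 * (w 2 * w 4) = 0 := by linear_combination h6 / 12
  have z : w 1 = 0 ∧ w 2 = 0 ∧ w 4 = 0 := by
    rcases mul_eq_zero.mp k6 with h | h
    · have : (d 0 - d 1) * w 2 ^ 2 = 0 := by linear_combination d 0 * k4 - k5 - (d 0 - d 2) * w 1 * h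
      have h2 : w 2 = 0 := by simpa [d01] using this
      exact ⟨h, h2, by simpa [h, h2] using k4⟩
    rcases mul_eq_zero.mp h with h | h
    · have : (d 0 - d 2) * w 1 ^ 2 = 0 := by linear_combination d 0 * k4 - k5 - (d 0 - d 1) * w 2 * h
      have h2 : w 1 = 0 := by simpa [d02] using this
      exact ⟨h2, h, by simpa [h, h2] using k4⟩
    · have : (d 1 - d 2) * w 1 ^ 2 = 0 := by linear_combination d 1 * k4 - k5 - (d 1 - d 0) * w 4 * h
      have h2 : w 1 = 0 := by simpa [d12] using this
      exact ⟨h2, by simpa [h, h2] using k4, h⟩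
  funext i
  fin_cases i <;> simp [w0, w3, w5, z]

lemma cont_sM : Continuous sM := by
  refine continuous_matrix fun i j => ?_
  fin_cases i <;> fin_cases j <;> simp [sM] <;> fun_prop

lemma tendsto_pol {ι : Type*} {l : Filter ι} {f g h : ι → M3} {F G H : M3} (hf : Tendsto f l (𝓝 F)) (hg : Tendsto g l (𝓝 G))
    (hh : Tendsto h l (𝓝 H)) : Tendsto (fun n => polL (f n) (g n) (h n)) l (𝓝 (polL F G H)) := by
  have hD : ∀ {f : ι → M3} {F : M3}, Tendsto f l (𝓝 F) → Tendsto (fun n => (f n).det) l (𝓝 F.det) := fun {f F} hf => by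
    have hc : Continuous fun A : M3 => A.det := continuous_id.matrix_det
    exact (hc.tendsto F).comp hf
  simp only [polL_apply, pol]
  exact (((((((hD ((hf.add hg).add hh)).sub (hD (hf.add hg))).sub (hD (hf.add hh))).sub (hD (hg.add hh))).add (hD hf)).add (hD hg)).add
    (hD hh)).div_const 6

lemma conv_S {ι : Type*} (𝒰 : Ultrafilter ι) {d : ι → Fin 3 → ℂ} {d' : Fin 3 → ℂ} (hd : Tendsto d 𝒰 (𝓝 d')) (hinj : Function.Injective d')
    {s : ι → Fin 6 → ℂ} {c : Fin 6 → ℂ}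
    (h1 : Tendsto (fun n => polL 1 1 (sM (s n))) 𝒰 (𝓝 (c 0)))
    (h2 : Tendsto (fun n => polL 1 (Matrix.diagonal (d n)) (sM (s n))) 𝒰 (𝓝 (c 1)))
    (h3 : Tendsto (fun n => polL (Matrix.diagonal (d n)) (Matrix.diagonal (d n)) (sM (s n))) 𝒰 (𝓝 (c 2)))
    (h4 : Tendsto (fun n => polL 1 (sM (s n)) (sM (s n))) 𝒰 (𝓝 (c 3)))
    (h5 : Tendsto (fun n => polL (Matrix.diagonal (d n)) (sM (s n)) (sM (s n))) 𝒰 (𝓝 (c 4)))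
    (h6 : Tendsto (fun n => polL (sM (s n)) (sM (s n)) (sM (s n))) 𝒰 (𝓝 (c 5))) : ∃ s', Tendsto s 𝒰 (𝓝 s') := by
  rcases ultra_dich 𝒰 s with h | ⟨w, r, hw, hr, hrd⟩
  · exact h
  · exfalso
    have tD : Tendsto (fun n => Matrix.diagonal (d n)) 𝒰 (𝓝 (Matrix.diagonal d')) :=
      ((Continuous.matrix_diagonal continuous_id).tendsto d').comp hd
    have t1 : Tendsto (fun _ : ι => (1 : M3)) 𝒰 (𝓝 1) := tendsto_const_nhds
    have tS : Tendsto (fun n => r n • sM (s n)) 𝒰 (𝓝 (sM w)) := by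
      simpa only [Function.comp_def, sM_smul] using (cont_sM.tendsto w).comp hrd
    apply hw
    refine pol_kill hinj ?_ ?_ ?_ ?_ ?_ ?_
    · refine tendsto_nhds_unique (tendsto_pol t1 t1 tS) ?_
      simpa using hr.mul h1
    · refine tendsto_nhds_unique (tendsto_pol t1 tD tS) ?_
      simpa using hr.mul h2
    · refine tendsto_nhds_unique (tendsto_pol tD tD tS) ?_
      simpa using hr.mul h3
    · refine tendsto_nhds_unique (tendsto_pol t1 tS tS) ?_
      simpa using hr.mul (hr.mul h4)
    · refine tendsto_nhds_unique (tendsto_pol tD tS tS) ?_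
      simpa using hr.mul (hr.mul h5)
    · refine tendsto_nhds_unique (tendsto_pol tS tS tS) ?_
      simpa using hr.mul (hr.mul (hr.mul h6))

/-! ### Limits of determinantal representations -/

lemma ultra_bdd {ι V : Type*} [NormedAddCommGroup V] [ProperSpace V] (𝒰 : Ultrafilter ι) (g : ι → V) (R : ℝ)
    (h : ∀ᶠ n in (𝒰 : Filter ι), ‖g n‖ ≤ R) : ∃ x, Tendsto g 𝒰 (𝓝 x) := by
  have hc : IsCompact (Metric.closedBall (0 : V) R) := isCompact_closedBall 0 R
  obtain ⟨x, -, hx⟩ := hc.ultrafilter_le_nhds (𝒰.map g) (by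
    rw [le_principal_iff]
    change ∀ᶠ n in (𝒰 : Filter ι), g n ∈ Metric.closedBall (0 : V) R
    filter_upwards [h] with n hn
    simpa using hn)
  exact ⟨x, hx⟩

lemma roots_follow {ι : Type*} (𝒰 : Ultrafilter ι) {a b c : ι → ℂ} {a' b' c' : ℂ} (ha : Tendsto a 𝒰 (𝓝 a')) (hb : Tendsto b 𝒰 (𝓝 b'))
    (hc : Tendsto c 𝒰 (𝓝 c')) {d0 : Fin 3 → ℂ} (hd : Function.Injective d0)
    (h0 : ∀ x : ℂ, x ^ 3 + a' * x ^ 2 + b' * x + c' = (d0 0 + x) * (d0 1 + x) * (d0 2 + x)) :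
    ∃ d : ι → Fin 3 → ℂ, Tendsto d 𝒰 (𝓝 d0) ∧ ∀ n (x : ℂ), x ^ 3 + a n * x ^ 2 + b n * x + c n = (d n 0 + x) * (d n 1 + x) * (d n 2 + x) := by
  choose d hd' using fun n => cubic_roots (a n) (b n) (c n)
  have ec : ∀ n, d n 0 * d n 1 * d n 2 = c n := fun n => by linear_combination -hd' n 0
  have ea : ∀ n, d n 0 + d n 1 + d n 2 = a n := fun n => by
    linear_combination -(hd' n 1 + hd' n (-1)) / 2 + hd' n 0
  have eb : ∀ n, d n 0 * d n 1 + d n 0 * d n 2 + d n 1 * d n 2 = b n := fun n => by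
    linear_combination -(hd' n 1 - hd' n (-1)) / 2
  obtain ⟨d', ht⟩ := conv_roots 𝒰 (ha.congr fun n => (ea n).symm) (hb.congr fun n => (eb n).symm) (hc.congr fun n => (ec n).symm)
  have ht' := tendsto_pi_nhds.mp ht
  have hpr : ∀ x : ℂ, (d0 0 + x) * (d0 1 + x) * (d0 2 + x) = (d' 0 + x) * (d' 1 + x) * (d' 2 + x) := fun x => by
    rw [← h0]
    refine tendsto_nhds_unique (f := fun n => x ^ 3 + a n * x ^ 2 + b n * x + c n) (l := (𝒰 : Filter ι)) ?_ ?_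
    · exact ((tendsto_const_nhds.add (ha.mul_const _)).add (hb.mul_const _)).add hc
    · simp only [hd']
      exact (((ht' 0).add_const x).mul ((ht' 1).add_const x)).mul ((ht' 2).add_const x)
  have hex : ∀ i, ∃ j, d' j = d0 i := fun i => by
    have h1 : (d0 0 + -d0 i) * (d0 1 + -d0 i) * (d0 2 + -d0 i) = 0 := by
      fin_cases i <;> simp
    rw [hpr] at h1
    rcases mul_eq_zero.mp h1 with h | h
    · rcases mul_eq_zero.mp h with h | h
      · exact ⟨0, by linear_combination h⟩
      · exact ⟨1, by linear_combination h⟩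
    · exact ⟨2, by linear_combination h⟩
  choose σ hσ using hex
  have hinj : Function.Injective σ := fun i j h => hd (by rw [← hσ, ← hσ, h])
  let e : Fin 3 ≃ Fin 3 := Equiv.ofBijective σ (Finite.injective_iff_bijective.mp hinj)
  refine ⟨fun n i => d n (σ i), ?_, fun n x => ?_⟩
  · rw [tendsto_pi_nhds]
    intro i
    rw [← hσ i]
    exact ht' (σ i)
  · rw [hd' n x]
    have h1 := Fin.prod_univ_three fun i => d n i + x
    have h2 := Fin.prod_univ_three fun i => d n (σ i) + x
    rw [← h1, ← h2]
    exact (Equiv.prod_comp e fun i => d n i + x).symm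

lemma tendsto_T {ι : Type*} {l : Filter ι} {T0 T1 : Tri} {z : ι → ℂ} {z' : ℂ} (hz : Tendsto z l (𝓝 z')) (bs : Module.Basis (Fin 5) ℂ V5)
    {c : ι → Fin 4 → ℂ} {c' : Fin 4 → ℂ} (hc : Tendsto c l (𝓝 c')) (i j k : Fin 4) :
    Tendsto (fun n => (T0 + z n • T1) (fr bs (c n) i) (fr bs (c n) j) (fr bs (c n) k)) l
      (𝓝 ((T0 + z' • T1) (fr bs c' i) (fr bs c' j) (fr bs c' k))) := by
  have hcont : Continuous fun p : ℂ × (Fin 4 → ℂ) => (T0 + p.1 • T1) (fr bs p.2 i) (fr bs p.2 j) (fr bs p.2 k) := by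
    simp only [fr, map_add, map_smul, LinearMap.add_apply, LinearMap.smul_apply, smul_eq_mul]
    fun_prop
  have key : ∀ φ : ℂ × (Fin 4 → ℂ) → ℂ, Continuous φ → Tendsto (fun n => φ (z n, c n)) l (𝓝 (φ (z', c'))) :=
    fun φ hφ => (hφ.tendsto (z', c')).comp (hz.prodMk_nhds hc)
  exact key (fun p => (T0 + p.1 • T1) (fr bs p.2 i) (fr bs p.2 j) (fr bs p.2 k)) hcont

lemma tendsto_fam {ι : Type*} {l : Filter ι} {ξ : ι → EE} {ξ' : EE} (h : Tendsto ξ l (𝓝 ξ')) (k : Fin 4) :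
    Tendsto (fun n => fam (ξ n) k) l (𝓝 (fam ξ' k)) := by
  have hc : Continuous fun ξ : EE => fam ξ k := by
    match k with
    | 0 => exact continuous_const
    | 1 => exact Continuous.matrix_diagonal (by fun_prop)
    | 2 => exact cont_sM.comp (by fun_prop)
    | 3 => exact cont_sM.comp (by fun_prop)
  exact (hc.tendsto ξ').comp h

lemma sol_limit {ι : Type*} {l : Filter ι} [l.NeBot] {T0 T1 : Tri} {z : ι → ℂ} {z' : ℂ} (hz : Tendsto z l (𝓝 z'))
    {bs : Module.Basis (Fin 5) ℂ V5} {ξ : ι → EE} {ξ' : EE} (h : Tendsto ξ l (𝓝 ξ'))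
    (hS : ∀ᶠ n in l, Sol (fun z => T0 + z • T1) bs (z n) (ξ n)) : Sol (fun z => T0 + z • T1) bs z' ξ' := by
  intro i j k
  have h1 : Tendsto (fun n => (ξ n).1) l (𝓝 ξ'.1) := (continuous_fst.tendsto ξ').comp h
  have h2 : Tendsto (fun n => (ξ n).2.1) l (𝓝 ξ'.2.1) := ((continuous_fst.comp continuous_snd).tendsto ξ').comp h
  refine tendsto_nhds_unique (tendsto_T hz bs h1 i j k) ?_
  have h3 := h2.mul (tendsto_pol (tendsto_fam h i) (tendsto_fam h j) (tendsto_fam h k))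
  exact h3.congr' (hS.mono fun n hn => (hn i j k).symm)

/-- the normal form vector attached to matrices on a frame -/
def mkE (c : Fin 4 → ℂ) (μ : ℂ) (d : Fin 3 → ℂ) (A B : M3) : EE :=
  (c, μ, d, ![A 0 0, A 0 1, A 0 2, A 1 1, A 1 2, A 2 2], ![B 0 0, B 0 1, B 0 2, B 1 1, B 1 2, B 2 2])

lemma fam_mkE {c : Fin 4 → ℂ} {μ : ℂ} {d : Fin 3 → ℂ} {A : Fin 4 → M3} (h0 : A 0 = 1) (h1 : A 1 = Matrix.diagonal d)
    (h2 : (A 2).transpose = A 2) (h3 : (A 3).transpose = A 3) : fam (mkE c μ d (A 2) (A 3)) = A := by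
  funext k
  match k with
  | 0 => exact h0.symm
  | 1 => exact h1.symm
  | 2 => exact sM_surj h2
  | 3 => exact sM_surj h3

lemma inj_open {ι : Type*} {l : Filter ι} {d : ι → Fin 3 → ℂ} {d' : Fin 3 → ℂ} (h : Tendsto d l (𝓝 d')) (hd : Function.Injective d') :
    ∀ᶠ n in l, Function.Injective (d n) := by
  have h' := tendsto_pi_nhds.mp h
  have hne : ∀ i j, i ≠ j → ∀ᶠ n in l, d n i ≠ d n j := fun i j hij => by
    have := ((h' i).sub (h' j)).eventually_ne (sub_ne_zero.mpr fun e => hij (hd e))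
    exact this.mono fun n hn => sub_ne_zero.mp hn
  have hall : ∀ᶠ n in l, ∀ i j, i ≠ j → d n i ≠ d n j := by
    rw [eventually_all]; intro i
    rw [eventually_all]; intro j
    by_cases hij : i = j
    · exact Eventually.of_forall fun n h => absurd hij h
    · exact (hne i j hij).mono fun n hn _ => hn
  exact hall.mono fun n hn i j e => by
    by_contra hij
    exact hn i j hij e

lemma core1 {ι : Type*} (𝒰 : Ultrafilter ι) {T0 T1 : Tri} (hT : ∀ z : ℂ, TSym (T0 + z • T1)) {z : ι → ℂ} {z' : ℂ} (hz : Tendsto z 𝒰 (𝓝 z'))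
    {bs : Module.Basis (Fin 5) ℂ V5} {d0 : Fin 3 → ℂ} (hd : Function.Injective d0)
    (hne : (T0 + z' • T1) (bs 1) (bs 1) (bs 1) ≠ 0)
    (hr : ∀ x : ℂ, (T0 + z' • T1) (bs 2 + x • bs 1) (bs 2 + x • bs 1) (bs 2 + x • bs 1)
      = (T0 + z' • T1) (bs 1) (bs 1) (bs 1) * ((d0 0 + x) * (d0 1 + x) * (d0 2 + x)))
    {c : ι → Fin 4 → ℂ} (hc : Tendsto c 𝒰 (𝓝 0)) {M : ι → V5 →ₗ[ℂ] M3}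
    (hM : ∀ᶠ n in (𝒰 : Filter ι), SymDet (T0 + z n • T1) (LinearMap.ker (hU bs (c n))) (M n)) :
    ∃ (ξ : ι → EE) (ξ' : EE), Tendsto ξ 𝒰 (𝓝 ξ') ∧ ξ'.1 = 0 ∧ ξ'.2.1 = (T0 + z' • T1) (bs 1) (bs 1) (bs 1) ∧ ξ'.2.2.1 = d0 ∧ (∀ n, (ξ n).1 = c n) ∧
      ∀ᶠ n in (𝒰 : Filter ι), Sol (fun z => T0 + z • T1) bs (z n) (ξ n) := by
  have tT := fun i j k => tendsto_T (T0 := T0) (T1 := T1) hz bs hc i j k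
  have f0 : ∀ k : Fin 4, fr bs 0 k = bs k.succ := fun k => by simp [fr]
  set τ : ι → ℂ := fun n => (T0 + z n • T1) (fr bs (c n) 0) (fr bs (c n) 0) (fr bs (c n) 0) with hτ
  have e1 : fr bs 0 0 = bs 1 := f0 0
  have e2 : fr bs 0 1 = bs 2 := f0 1
  set τ' : ℂ := (T0 + z' • T1) (bs 1) (bs 1) (bs 1) with hτ'
  have tτ : Tendsto τ 𝒰 (𝓝 τ') := by have := tT 0 0 0; rwa [e1] at this
  have ev : ∀ᶠ n in (𝒰 : Filter ι), τ n ≠ 0 := tτ.eventually_ne hne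
  have ta : Tendsto (fun n => 3 * (T0 + z n • T1) (fr bs (c n) 0) (fr bs (c n) 0) (fr bs (c n) 1) / τ n) 𝒰
      (𝓝 (3 * (T0 + z' • T1) (bs 1) (bs 1) (bs 2) / τ')) := by
    have := ((tT 0 0 1).const_mul 3).div tτ hne; rwa [e1, e2] at this
  have tb : Tendsto (fun n => 3 * (T0 + z n • T1) (fr bs (c n) 1) (fr bs (c n) 1) (fr bs (c n) 0) / τ n) 𝒰
      (𝓝 (3 * (T0 + z' • T1) (bs 2) (bs 2) (bs 1) / τ')) := by
    have := ((tT 1 1 0).const_mul 3).div tτ hne; rwa [e1, e2] at this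
  have tc : Tendsto (fun n => (T0 + z n • T1) (fr bs (c n) 1) (fr bs (c n) 1) (fr bs (c n) 1) / τ n) 𝒰
      (𝓝 ((T0 + z' • T1) (bs 2) (bs 2) (bs 2) / τ')) := by
    have := (tT 1 1 1).div tτ hne; rwa [e2] at this
  obtain ⟨d, td, hdn⟩ := roots_follow 𝒰 ta tb tc hd (fun x => by
    have h1 := hr x
    rw [tri_line (hT z')] at h1
    field_simp
    linear_combination h1)
  have evd := inj_open td hd
  have hNF : ∀ n, ∃ A : Fin 4 → M3, (τ n ≠ 0 ∧ Function.Injective (d n) ∧ SymDet (T0 + z n • T1) (LinearMap.ker (hU bs (c n))) (M n)) → NF (T0 + z n • T1) (fr bs (c n)) A (d n) := fun n => by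
    by_cases hg : τ n ≠ 0 ∧ Function.Injective (d n) ∧ SymDet (T0 + z n • T1) (LinearMap.ker (hU bs (c n))) (M n)
    · obtain ⟨P, -, hP⟩ := nf_of_symDet (hT (z n)) hg.2.2 (β := fr bs (c n)) (fun k => hU_fr bs (c n) k) hg.1 hg.2.1 (fun x => by
        rw [tri_line (hT (z n)), ← hdn n x]
        have := hg.1
        change _ = τ n * _
        field_simp
        simp only [hτ]
        ring)
      exact ⟨_, fun _ => hP⟩
    · exact ⟨0, fun h => absurd h hg⟩
  choose A hA using hNF
  have hgood : ∀ᶠ n in (𝒰 : Filter ι), τ n ≠ 0 ∧ NF (T0 + z n • T1) (fr bs (c n)) (A n) (d n) := by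
    filter_upwards [ev, evd, hM] with n h1 h2 h3
    exact ⟨h1, hA n ⟨h1, h2, h3⟩⟩
  let ξ : ι → EE := fun n => mkE (c n) (τ n) (d n) (A n 2) (A n 3)
  have hfam : ∀ᶠ n in (𝒰 : Filter ι), τ n ≠ 0 ∧ fam (ξ n) = A n ∧ NF (T0 + z n • T1) (fr bs (c n)) (A n) (d n) :=
    hgood.mono fun n hn => ⟨hn.1, fam_mkE hn.2.one hn.2.diag (hn.2.sym 2) (hn.2.sym 3), hn.2⟩
  have hpol : ∀ i j k, Tendsto (fun n => polL (fam (ξ n) i) (fam (ξ n) j) (fam (ξ n) k)) 𝒰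
      (𝓝 ((T0 + z' • T1) (fr bs 0 i) (fr bs 0 j) (fr bs 0 k) / τ')) := fun i j k => by
    refine ((tT i j k).div tτ hne).congr' (hfam.mono fun n hn => ?_)
    change (T0 + z n • T1) (fr bs (c n) i) (fr bs (c n) j) (fr bs (c n) k) / τ n = polL (fam (ξ n) i) (fam (ξ n) j) (fam (ξ n) k)
    rw [hn.2.1, div_eq_iff hn.1, hn.2.2.eq i j k, mul_comm]
  obtain ⟨s2, ts2⟩ := conv_S 𝒰 td hd (s := fun n => (ξ n).2.2.2.1)
    (c := ![_, _, _, _, _, _]) (hpol 0 0 2) (hpol 0 1 2) (hpol 1 1 2) (hpol 0 2 2) (hpol 1 2 2) (hpol 2 2 2)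
  obtain ⟨s3, ts3⟩ := conv_S 𝒰 td hd (s := fun n => (ξ n).2.2.2.2)
    (c := ![_, _, _, _, _, _]) (hpol 0 0 3) (hpol 0 1 3) (hpol 1 1 3) (hpol 0 3 3) (hpol 1 3 3) (hpol 3 3 3)
  refine ⟨ξ, (0, τ', d0, s2, s3), hc.prodMk_nhds (tτ.prodMk_nhds (td.prodMk_nhds (ts2.prodMk_nhds ts3))), rfl, rfl, rfl, fun n => rfl, ?_⟩
  filter_upwards [hfam] with n hn i j k
  rw [hn.2.1]
  exact hn.2.2.eq i j k

lemma meq_frame {bs : Module.Basis (Fin 5) ℂ V5} {c : Fin 4 → ℂ} {M M' : V5 →ₗ[ℂ] M3} {s : ℂ} (hs : s ≠ 0) {P : M3} (hP : IsUnit P.det)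
    (h : ∀ k, M' (fr bs c k) = s • (P.transpose * M (fr bs c k) * P)) : MEq (LinearMap.ker (hU bs c)) M M' := by
  obtain ⟨r, hr⟩ := exists_sqrt s
  have hr0 : r ≠ 0 := fun e => hs (by rw [← hr, e]; simp)
  refine ⟨r • P, ?_, fun x hx => ?_⟩
  · rw [Matrix.det_smul]
    exact (IsUnit.mk0 _ (pow_ne_zero _ hr0)).mul hP
  · have e : ∀ k, M' (fr bs c k) = (r • P).transpose * M (fr bs c k) * (r • P) := fun k => by
      rw [h k, Matrix.transpose_smul, Matrix.smul_mul, Matrix.smul_mul, Matrix.mul_smul, smul_smul, ← hr, pow_two]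
    rw [expand_fr bs c hx]
    simp only [map_sum, map_smul, e, Finset.mul_sum, Finset.sum_mul, Matrix.mul_smul, Matrix.smul_mul]
    refine Finset.sum_congr rfl fun k _ => smul_comm _ _ _

lemma famQ {bs : Module.Basis (Fin 5) ℂ V5} {c : Fin 4 → ℂ} {κ κ' : ℂ} (h : κ ≠ 0) (h' : κ' ≠ 0) {A A' : Fin 4 → M3}
    (hM : MEq (LinearMap.ker (hU bs c)) (mkM bs κ A) (mkM bs κ' A')) : ∃ Q : M3, IsUnit Q.det ∧ ∀ k, A' k = Q.transpose * A k * Q := by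
  obtain ⟨P, hP, hPM⟩ := hM
  obtain ⟨r, hr⟩ := exists_sqrt (κ / κ')
  have hr0 : r ≠ 0 := fun e => (div_ne_zero h h') (by rw [← hr, e]; simp)
  refine ⟨r • P, ?_, fun k => ?_⟩
  · rw [Matrix.det_smul]
    exact (IsUnit.mk0 _ (pow_ne_zero _ hr0)).mul hP
  · have := hPM _ (LinearMap.mem_ker.mpr (hU_fr bs c k))
    rw [mkM_fr, mkM_fr] at this
    rw [Matrix.transpose_smul, Matrix.smul_mul, Matrix.smul_mul, Matrix.mul_smul, smul_smul, ← pow_two, hr]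
    rw [Matrix.mul_smul, Matrix.smul_mul] at this
    rw [div_eq_inv_mul, ← smul_smul, ← this, smul_smul, inv_mul_cancel₀ h', one_smul]

lemma diagQ {d d' : Fin 3 → ℂ} (h : ∀ a b, a ≠ b → d a ≠ d' b) {Q : M3} (h1 : Q.transpose * 1 * Q = 1)
    (h2 : Q.transpose * Matrix.diagonal d * Q = Matrix.diagonal d') : ∃ q : Fin 3 → ℂ, Q = Matrix.diagonal q ∧ ∀ a, q a ^ 2 = 1 := by
  rw [Matrix.mul_one] at h1
  have h3 : Q * Q.transpose = 1 := mul_eq_one_comm.mp h1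
  have h4 : Matrix.diagonal d * Q = Q * Matrix.diagonal d' := by
    rw [← h2, ← Matrix.mul_assoc, ← Matrix.mul_assoc, h3, Matrix.one_mul]
  have h5 : ∀ a b, a ≠ b → Q a b = 0 := fun a b hab => by
    have := congrFun (congrFun h4 a) b
    rw [Matrix.diagonal_mul, Matrix.mul_diagonal] at this
    have h6 : (d a - d' b) * Q a b = 0 := by linear_combination this
    exact (mul_eq_zero.mp h6).resolve_left (sub_ne_zero.mpr (h a b hab))
  have h7 : Q = Matrix.diagonal fun a => Q a a := by
    ext a b
    by_cases hab : a = b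
    · subst hab; simp
    · rw [h5 a b hab, Matrix.diagonal_apply_ne _ hab]
  refine ⟨fun a => Q a a, h7, fun a => ?_⟩
  rw [h7, Matrix.diagonal_transpose, Matrix.diagonal_mul_diagonal] at h1
  have := congrFun (congrFun h1 a) a
  simp at this
  linear_combination this

lemma hU_zero (bs : Module.Basis (Fin 5) ℂ V5) : hU bs 0 = bs.coord 0 := by simp [hU]

lemma rep_nf {T : Tri} (hT : TSym T) {bs : Module.Basis (Fin 5) ℂ V5} {d0 : Fin 3 → ℂ} (hd : Function.Injective d0)
    (hne : T (bs 1) (bs 1) (bs 1) ≠ 0)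
    (hr : ∀ x : ℂ, T (bs 2 + x • bs 1) (bs 2 + x • bs 1) (bs 2 + x • bs 1) = T (bs 1) (bs 1) (bs 1) * ((d0 0 + x) * (d0 1 + x) * (d0 2 + x)))
    {M : V5 →ₗ[ℂ] M3} (hM : SymDet T (LinearMap.ker (hU bs 0)) M) :
    ∃ ξ : EE, ξ.1 = 0 ∧ ξ.2.1 = T (bs 1) (bs 1) (bs 1) ∧ ξ.2.2.1 = d0 ∧
      (∀ i j k, T (fr bs ξ.1 i) (fr bs ξ.1 j) (fr bs ξ.1 k) = ξ.2.1 * polL (fam ξ i) (fam ξ j) (fam ξ k)) ∧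
      ∀ κ : ℂ, κ ≠ 0 → MEq (LinearMap.ker (hU bs 0)) M (mkM bs κ (fam ξ)) := by
  have f0 : ∀ k : Fin 4, fr bs 0 k = bs k.succ := fun k => by simp [fr]
  have e1 : fr bs 0 0 = bs 1 := f0 0
  have e2 : fr bs 0 1 = bs 2 := f0 1
  obtain ⟨P, hP, hN⟩ := nf_of_symDet hT hM (β := fr bs 0) (fun k => hU_fr bs 0 k) (by rw [e1]; exact hne) hd
    (by intro x; rw [e1, e2]; exact hr x)
  have hf := fam_mkE (A := fun k => P.transpose * M (fr bs 0 k) * P) (d := d0) (c := 0) (μ := T (bs 1) (bs 1) (bs 1)) hN.one hN.diag (hN.sym 2) (hN.sym 3)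
  refine ⟨mkE 0 (T (bs 1) (bs 1) (bs 1)) d0 (P.transpose * M (fr bs 0 2) * P) (P.transpose * M (fr bs 0 3) * P), rfl, rfl, rfl, ?_, ?_⟩
  rotate_left
  · intro κ hκ
    refine meq_frame hκ hP fun k => ?_
    rw [mkM_fr]
    rw [hf]
  · intro i j k
    rw [hf]
    have := hN.eq i j k
    rw [e1] at this
    exact this

lemma hyp_limit {ι : Type*} (𝒰 : Ultrafilter ι) {U : ι → V5 →ₗ[ℂ] ℂ} (hU0 : ∀ n, U n ≠ 0) :
    ∃ w : V5 →ₗ[ℂ] ℂ, w ≠ 0 ∧ ∀ bs : Module.Basis (Fin 5) ℂ V5, LinearMap.ker w = LinearMap.ker (bs.coord 0) →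
      ∃ c : ι → Fin 4 → ℂ, Tendsto c 𝒰 (𝓝 0) ∧ ∀ᶠ n in (𝒰 : Filter ι), LinearMap.ker (U n) = LinearMap.ker (hU bs (c n)) := by
  let u : ι → Fin 5 → ℂ := fun n i => U n (Pi.single i 1)
  have hu : ∀ n, u n ≠ 0 := fun n h => by
    obtain ⟨i, hi⟩ := exists_ne_of_form (hU0 n)
    exact hi (congrFun h i)
  have hsum : ∀ n x, U n x = ∑ i, x i * u n i := fun n x => by
    rw [LinearMap.pi_apply_eq_sum_univ (U n) x]
    refine Finset.sum_congr rfl fun i _ => ?_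
    rw [smul_eq_mul]
    congr 2
    funext j
    simp [Pi.single_apply, eq_comm]
  have hn1 : ∀ n, ‖((‖u n‖⁻¹ : ℝ) : ℂ) • u n‖ = 1 := fun n => by
    rw [norm_smul, Complex.norm_real, norm_inv, norm_norm, inv_mul_cancel₀ (norm_ne_zero_iff.mpr (hu n))]
  obtain ⟨v, hv⟩ := ultra_bdd 𝒰 (fun n => ((‖u n‖⁻¹ : ℝ) : ℂ) • u n) 1 (Eventually.of_forall fun n => (hn1 n).le)
  have hv1 : ‖v‖ = 1 := tendsto_nhds_unique hv.norm (tendsto_const_nhds.congr fun n => (hn1 n).symm)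
  let w : V5 →ₗ[ℂ] ℂ := ∑ i, v i • LinearMap.proj i
  have hw : ∀ x, w x = ∑ i, x i * v i := fun x => by simp [w, mul_comm]
  have hlim : ∀ x, Tendsto (fun n => ((‖u n‖⁻¹ : ℝ) : ℂ) * U n x) 𝒰 (𝓝 (w x)) := fun x => by
    rw [hw]
    have : Tendsto (fun n => ∑ i, x i * (((‖u n‖⁻¹ : ℝ) : ℂ) • u n) i) 𝒰 (𝓝 (∑ i, x i * v i)) :=
      tendsto_finsetSum _ fun i _ => ((tendsto_pi_nhds.mp hv) i).const_mul (x i)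
    refine this.congr fun n => ?_
    rw [hsum, Finset.mul_sum]
    refine Finset.sum_congr rfl fun i _ => ?_
    rw [Pi.smul_apply, smul_eq_mul]; ring
  refine ⟨w, fun h0 => ?_, fun bs hbs => ?_⟩
  · have : v = 0 := by
      funext i
      have := hw (Pi.single i 1)
      rw [h0] at this
      simpa [Pi.single_apply] using this.symm
    rw [this] at hv1; simp at hv1
  · have wk : ∀ k : Fin 4, w (bs k.succ) = 0 := fun k => by
      have : bs k.succ ∈ LinearMap.ker (bs.coord 0) := by simp
      rw [← hbs] at this; exact this
    have w0 : w (bs 0) ≠ 0 := fun h => by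
      have : bs 0 ∈ LinearMap.ker w := h
      rw [hbs] at this
      simp at this
    have hev : ∀ᶠ n in (𝒰 : Filter ι), ((‖u n‖⁻¹ : ℝ) : ℂ) * U n (bs 0) ≠ 0 := (hlim (bs 0)).eventually_ne w0
    refine ⟨fun n k => - (((‖u n‖⁻¹ : ℝ) : ℂ) * U n (bs k.succ)) / (((‖u n‖⁻¹ : ℝ) : ℂ) * U n (bs 0)), ?_, ?_⟩
    · rw [tendsto_pi_nhds]
      intro k
      have := ((hlim (bs k.succ)).neg).div (hlim (bs 0)) w0
      rw [wk, neg_zero, zero_div] at this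
      exact this
    · filter_upwards [hev] with n hn
      have h1 := left_ne_zero_of_mul hn
      have h2 := right_ne_zero_of_mul hn
      have e : U n = U n (bs 0) • hU bs (fun k => - (((‖u n‖⁻¹ : ℝ) : ℂ) * U n (bs k.succ)) / (((‖u n‖⁻¹ : ℝ) : ℂ) * U n (bs 0))) := by
        refine bs.ext fun i => ?_
        refine Fin.cases ?_ (fun k => ?_) i
        · rw [LinearMap.smul_apply, hU_bs0]; simp
        · simp [hU, Finsupp.single_apply]
          have h3 : ((‖u n‖:ℝ):ℂ) ≠ 0 := by exact_mod_cast norm_ne_zero_iff.mpr (hu n)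
          field_simp
      conv_lhs => rw [e]
      exact LinearMap.ker_smul _ _ h2

lemma mkE_self (ξ : EE) : mkE ξ.1 ξ.2.1 ξ.2.2.1 (fam ξ 2) (fam ξ 3) = ξ := by
  obtain ⟨c, μ, d, s, t⟩ := ξ
  simp only [mkE, Prod.mk.injEq, true_and]
  constructor <;> funext k <;> fin_cases k <;> rfl

/-- conjugation of a parameter point by `diagonal q` -/
def conjE (q : Fin 3 → ℂ) (ξ : EE) : EE :=
  mkE ξ.1 ξ.2.1 ξ.2.2.1 ((Matrix.diagonal q).transpose * fam ξ 2 * Matrix.diagonal q)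
    ((Matrix.diagonal q).transpose * fam ξ 3 * Matrix.diagonal q)

lemma cont_conjE (q : Fin 3 → ℂ) : Continuous (conjE q) := by
  refine Continuous.prodMk (by fun_prop) (Continuous.prodMk (by fun_prop) (Continuous.prodMk (by fun_prop) (Continuous.prodMk ?_ ?_)))
  all_goals
    refine continuous_pi fun k => ?_
    fin_cases k <;> simp [fam, sM] <;> fun_prop

lemma fam_conjE {q : Fin 3 → ℂ} (hq : ∀ a, q a ^ 2 = 1) (ξ : EE) :
    fam (conjE q ξ) = fun k => (Matrix.diagonal q).transpose * fam ξ k * Matrix.diagonal q := by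
  refine fam_mkE (A := fun k => (Matrix.diagonal q).transpose * fam ξ k * Matrix.diagonal q) ?_ ?_ (conj_sym _ (fam_sym ξ 2)) (conj_sym _ (fam_sym ξ 3))
  · show (Matrix.diagonal q).transpose * 1 * Matrix.diagonal q = 1
    rw [Matrix.diagonal_transpose, Matrix.mul_one, Matrix.diagonal_mul_diagonal, ← Matrix.diagonal_one]
    congr 1; funext a; rw [← pow_two, hq]
  · show (Matrix.diagonal q).transpose * Matrix.diagonal ξ.2.2.1 * Matrix.diagonal q = _
    rw [Matrix.diagonal_transpose, Matrix.diagonal_mul_diagonal, Matrix.diagonal_mul_diagonal]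
    congr 1; funext a; linear_combination ξ.2.2.1 a * hq a

lemma sol_conjE {q : Fin 3 → ℂ} (hq : ∀ a, q a ^ 2 = 1) {ξ : EE} {T : ℂ → Tri} {bs : Module.Basis (Fin 5) ℂ V5} {z : ℂ}
    (h : Sol T bs z ξ) : Sol T bs z (conjE q ξ) := by
  intro i j k
  rw [fam_conjE hq]
  refine (h i j k).trans ?_
  show ξ.2.1 * polL (fam ξ i) (fam ξ j) (fam ξ k) = ξ.2.1 * pol _ _ _
  rw [pol_conj, polL_apply]
  have : (Matrix.diagonal q : M3).det ^ 2 = 1 := by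
    rw [Matrix.det_diagonal, ← Finset.prod_pow]
    exact Finset.prod_eq_one fun a _ => hq a
  rw [this, one_mul]

structure BD (T0 T1 : Tri) (zs : ℂ) (bs : Module.Basis (Fin 5) ℂ V5) (d0 : Fin 3 → ℂ) (M : V5 →ₗ[ℂ] M3) (ξ : EE) (g : ℂ → EE) : Prop where
  c : ξ.1 = 0
  μ : ξ.2.1 = (T0 + zs • T1) (bs 1) (bs 1) (bs 1)
  μ0 : ξ.2.1 ≠ 0
  d : ξ.2.2.1 = d0
  meq : ∀ κ : ℂ, κ ≠ 0 → MEq (LinearMap.ker (hU bs 0)) M (mkM bs κ (fam ξ))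
  tend : Tendsto g (𝓝 zs) (𝓝 ξ)
  sol : ∀ᶠ w in 𝓝 zs, Sol (fun z => T0 + z • T1) bs w (g w)
  uniq : ∀ᶠ v in 𝓝 (zs, ξ), Sol (fun z => T0 + z • T1) bs v.1 v.2 → v.2 = g v.1

lemma exists_BD {T0 T1 : Tri} (hT : ∀ z : ℂ, TSym (T0 + z • T1)) {zs : ℂ} {bs : Module.Basis (Fin 5) ℂ V5} {d0 : Fin 3 → ℂ}
    (hd : Function.Injective d0) (hne : (T0 + zs • T1) (bs 1) (bs 1) (bs 1) ≠ 0)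
    (hr : ∀ x : ℂ, (T0 + zs • T1) (bs 2 + x • bs 1) (bs 2 + x • bs 1) (bs 2 + x • bs 1)
      = (T0 + zs • T1) (bs 1) (bs 1) (bs 1) * ((d0 0 + x) * (d0 1 + x) * (d0 2 + x)))
    {M : V5 →ₗ[ℂ] M3} (hM : SymDet (T0 + zs • T1) (LinearMap.ker (hU bs 0)) M) (hN : ND (T0 + zs • T1) (LinearMap.ker (hU bs 0)) M) :
    ∃ ξ g, BD T0 T1 zs bs d0 M ξ g := by
  obtain ⟨ξ, h1, h2, h3, h4, h5⟩ := rep_nf (hT zs) hd hne hr hM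
  have hμ0 : ξ.2.1 ≠ 0 := by rw [h2]; exact hne
  obtain ⟨κ, hκ⟩ := IsAlgClosed.exists_pow_nat_eq ξ.2.1 (n := 3) (by norm_num)
  have hκ0 : κ ≠ 0 := fun e => hμ0 (by rw [← hκ, e]; simp)
  obtain ⟨g, g1, g2, g3⟩ := branch T0 T1 hT (bs := bs) (z := zs) hκ hμ0 (by rw [h3]; exact hd) h4 (by rw [h1]; exact hN.congr (h5 κ hκ0))
  exact ⟨ξ, g, h1, h2, hμ0, h3, h5, g1, g2, g3⟩

lemma famQ_diag {bs : Module.Basis (Fin 5) ℂ V5} {c : Fin 4 → ℂ} {κ κ' : ℂ} (h : κ ≠ 0) (h' : κ' ≠ 0) {ξ ξ' : EE}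
    (hd : ∀ a b, a ≠ b → ξ.2.2.1 a ≠ ξ'.2.2.1 b)
    (hM : MEq (LinearMap.ker (hU bs c)) (mkM bs κ (fam ξ)) (mkM bs κ' (fam ξ'))) :
    ∃ q : Fin 3 → ℂ, (∀ a, q a ^ 2 = 1) ∧ ∀ k, fam ξ' k = (Matrix.diagonal q).transpose * fam ξ k * Matrix.diagonal q := by
  obtain ⟨Q, _, hQ⟩ := famQ h h' hM
  obtain ⟨q, rfl, hq⟩ := diagQ hd (hQ 0).symm (hQ 1).symm
  exact ⟨q, hq, hQ⟩

lemma core_c {ι : Type*} {l : Filter ι} {T0 T1 : Tri} {zs : ℂ} {bs : Module.Basis (Fin 5) ℂ V5} {d0 : Fin 3 → ℂ}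
    (hd : Function.Injective d0) {M : V5 →ₗ[ℂ] M3} {ξ : EE} {g : ℂ → EE} (hb : BD T0 T1 zs bs d0 M ξ g) {z : ι → ℂ} (hz : Tendsto z l (𝓝 zs))
    {η : ι → EE} {η' : EE} (hη : Tendsto η l (𝓝 η')) (h1 : η'.1 = 0) (h2 : η'.2.1 = (T0 + zs • T1) (bs 1) (bs 1) (bs 1)) (h3 : η'.2.2.1 = d0)
    (hS : ∀ᶠ n in l, Sol (fun z => T0 + z • T1) bs (z n) (η n)) {κ : ℂ} (hκ : κ ≠ 0)
    (hM : MEq (LinearMap.ker (hU bs 0)) (mkM bs κ (fam η')) M) : ∀ᶠ n in l, (η n).1 = (g (z n)).1 := by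
  obtain ⟨q, hq, hf⟩ := famQ_diag hκ hκ (by rw [h3, hb.d]; exact fun a b hab e => hab (hd e)) (hM.trans (hb.meq κ hκ))
  have e : conjE q η' = ξ := by
    rw [conjE, ← hf, ← hf, h1, h2, h3, ← hb.c, ← hb.μ, ← hb.d, mkE_self]
  have t : Tendsto (fun n => (z n, conjE q (η n))) l (𝓝 (zs, ξ)) := by
    rw [← e]
    exact hz.prodMk_nhds (((cont_conjE q).tendsto _).comp hη)
  filter_upwards [t.eventually hb.uniq, hS] with n hn hs
  have := hn (sol_conjE hq hs)
  have h := congrArg Prod.fst this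
  exact h

lemma hU_tend {ι : Type*} {l : Filter ι} (bs : Module.Basis (Fin 5) ℂ V5) {c : ι → Fin 4 → ℂ} {c' : Fin 4 → ℂ} (hc : Tendsto c l (𝓝 c')) (x : V5) :
    Tendsto (fun n => hU bs (c n) x) l (𝓝 (hU bs c' x)) := by
  have : Continuous fun c : Fin 4 → ℂ => hU bs c x := by
    simp only [hU, LinearMap.sub_apply, LinearMap.sum_apply, LinearMap.smul_apply, smul_eq_mul]
    fun_prop
  exact (this.tendsto c').comp hc

lemma lim_le {ι : Type*} {l : Filter ι} [l.NeBot] {bs bs' : Module.Basis (Fin 5) ℂ V5} {c c' : ι → Fin 4 → ℂ} (hc : Tendsto c l (𝓝 0))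
    (hc' : Tendsto c' l (𝓝 0)) (h : ∀ᶠ n in l, LinearMap.ker (hU bs (c n)) = LinearMap.ker (hU bs' (c' n))) :
    LinearMap.ker (hU bs 0) ≤ LinearMap.ker (hU bs' 0) := by
  intro x hx
  rw [LinearMap.mem_ker] at hx ⊢
  have t : Tendsto (fun n => hU bs' (c' n) x - hU bs (c n) x * hU bs' (c' n) (bs 0)) l (𝓝 (hU bs' 0 x - hU bs 0 x * hU bs' 0 (bs 0))) :=
    (hU_tend bs' hc' x).sub ((hU_tend bs hc x).mul (hU_tend bs' hc' _))
  rw [hx, zero_mul, sub_zero] at t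
  refine tendsto_nhds_unique t (tendsto_const_nhds.congr' ?_)
  filter_upwards [h] with n hn
  have : x - hU bs (c n) x • bs 0 ∈ LinearMap.ker (hU bs (c n)) := by
    rw [LinearMap.mem_ker, map_sub, map_smul, hU_bs0, smul_eq_mul, mul_one, sub_self]
  rw [hn, LinearMap.mem_ker, map_sub, map_smul, smul_eq_mul] at this
  exact this.symm

lemma hU_inj {bs : Module.Basis (Fin 5) ℂ V5} {c c' : Fin 4 → ℂ} (h : LinearMap.ker (hU bs c) = LinearMap.ker (hU bs c')) : c = c' := by
  funext k
  have h1 : fr bs c k ∈ LinearMap.ker (hU bs c') := by rw [← h]; exact LinearMap.mem_ker.mpr (hU_fr bs c k)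
  have h2 : fr bs c k = fr bs c' k + (c k - c' k) • bs 0 := by simp only [fr, sub_smul]; abel
  rw [LinearMap.mem_ker, h2, map_add, map_smul, hU_fr, hU_bs0] at h1
  simpa [sub_eq_zero] using h1

def Uniq (T : Tri) : Prop := ∀ (H : Submodule ℂ V5) (M M' : V5 →ₗ[ℂ] M3), Module.finrank ℂ H = 4 → SymDet T H M → SymDet T H M' → MEq H M M'

lemma core_d (𝒰 : Ultrafilter ℂ) {T0 T1 : Tri} {zs : ℂ} (hz : (𝒰 : Filter ℂ) ≤ 𝓝 zs) {bs : Module.Basis (Fin 5) ℂ V5} {d0 : Fin 3 → ℂ}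
    (hd : Function.Injective d0) {M M' : V5 →ₗ[ℂ] M3} {ξ ξ' : EE} {g g' : ℂ → EE} (hb : BD T0 T1 zs bs d0 M ξ g) (hb' : BD T0 T1 zs bs d0 M' ξ' g')
    (h : ∀ᶠ w in (𝒰 : Filter ℂ), Uniq (T0 + w • T1) ∧ LinearMap.ker (hU bs (g w).1) = LinearMap.ker (hU bs (g' w).1)) :
    MEq (LinearMap.ker (hU bs 0)) M M' := by
  have tg : Tendsto g 𝒰 (𝓝 ξ) := hb.tend.mono_left hz
  have tg' : Tendsto g' 𝒰 (𝓝 ξ') := hb'.tend.mono_left hz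
  have tμ : ∀ᶠ w in (𝒰 : Filter ℂ), (g w).2.1 ≠ 0 := (((continuous_fst.comp continuous_snd).tendsto ξ).comp tg).eventually_ne hb.μ0
  have tμ' : ∀ᶠ w in (𝒰 : Filter ℂ), (g' w).2.1 ≠ 0 := (((continuous_fst.comp continuous_snd).tendsto ξ').comp tg').eventually_ne hb'.μ0
  have td : Tendsto (fun w => (g w).2.2.1) 𝒰 (𝓝 d0) := by
    have := ((continuous_fst.comp (continuous_snd.comp continuous_snd)).tendsto ξ).comp tg
    rw [← hb.d]; exact this
  have td' : Tendsto (fun w => (g' w).2.2.1) 𝒰 (𝓝 d0) := by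
    have := ((continuous_fst.comp (continuous_snd.comp continuous_snd)).tendsto ξ').comp tg'
    rw [← hb'.d]; exact this
  have hdd : ∀ᶠ w in (𝒰 : Filter ℂ), ∀ a b, a ≠ b → (g w).2.2.1 a ≠ (g' w).2.2.1 b := by
    rw [eventually_all]; intro a
    rw [eventually_all]; intro b
    by_cases hab : a = b
    · exact Eventually.of_forall fun w hw => (hw hab).elim
    · have := (((tendsto_pi_nhds.mp td) a).sub ((tendsto_pi_nhds.mp td') b)).eventually_ne (sub_ne_zero.mpr fun e => hab (hd e))
      exact this.mono fun w hw _ => sub_ne_zero.mp hw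
  have key : ∀ᶠ w in (𝒰 : Filter ℂ), ∃ s : Fin 3 → Bool, ∀ k, fam (g' w) k = (Matrix.diagonal fun a => if s a then 1 else -1).transpose * fam (g w) k * Matrix.diagonal fun a => if s a then 1 else -1 := by
    filter_upwards [h, tμ, tμ', hdd, hz hb.sol, hz hb'.sol] with w hw m m' dd s s'
    obtain ⟨κ, hκ⟩ := IsAlgClosed.exists_pow_nat_eq (g w).2.1 (n := 3) (by norm_num)
    obtain ⟨κ', hκ'⟩ := IsAlgClosed.exists_pow_nat_eq (g' w).2.1 (n := 3) (by norm_num)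
    have k0 : κ ≠ 0 := fun e => m (by rw [← hκ, e]; simp)
    have k0' : κ' ≠ 0 := fun e => m' (by rw [← hκ', e]; simp)
    have s1 := mkM_symDet bs hκ (fam_sym (g w)) s
    have s2 := mkM_symDet bs hκ' (fam_sym (g' w)) s'
    rw [← hw.2] at s2
    obtain ⟨q, hq, hf⟩ := famQ_diag k0 k0' dd (hw.1 _ _ _ (finrank_hU bs _) s1 s2)
    have hqq : q = fun a => if (decide (q a = 1)) then 1 else -1 := by
      funext a
      by_cases h1 : q a = 1
      · simp [h1]
      · have : (q a - 1) * (q a + 1) = 0 := by linear_combination hq a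
        have h2 := (mul_eq_zero.mp this).resolve_left (sub_ne_zero.mpr h1)
        simp [h1]; linear_combination h2
    refine ⟨fun a => decide (q a = 1), ?_⟩
    rw [← hqq]; exact hf
  obtain ⟨s, hs⟩ := Ultrafilter.eventually_exists_iff.mp key
  set q : Fin 3 → ℂ := fun a => if s a then 1 else -1 with hqd
  have hq : ∀ a, q a ^ 2 = 1 := fun a => by rw [hqd]; dsimp only; split_ifs <;> norm_num
  have hlim : ∀ k, fam ξ' k = (Matrix.diagonal q).transpose * fam ξ k * Matrix.diagonal q := fun k => by
    have t1 : Tendsto (fun w => fam (g' w) k) 𝒰 (𝓝 (fam ξ' k)) := tendsto_fam tg' k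
    have t2 : Tendsto (fun w => (Matrix.diagonal q).transpose * fam (g w) k * Matrix.diagonal q) 𝒰 (𝓝 ((Matrix.diagonal q).transpose * fam ξ k * Matrix.diagonal q)) :=
      (tendsto_const_nhds.mul (tendsto_fam tg k)).mul tendsto_const_nhds
    refine tendsto_nhds_unique t1 (t2.congr' ?_)
    filter_upwards [hs] with w hw
    exact (hw k).symm
  have hu : IsUnit (Matrix.diagonal q : M3).det := by
    rw [Matrix.det_diagonal, isUnit_iff_ne_zero, Finset.prod_ne_zero_iff]
    intro a _ h0
    have := hq a
    rw [h0] at this; norm_num at this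
  have hm : MEq (LinearMap.ker (hU bs 0)) (mkM bs 1 (fam ξ)) (mkM bs 1 (fam ξ')) := by
    refine meq_frame one_ne_zero hu fun k => ?_
    rw [mkM_fr, mkM_fr, hlim k, one_smul, one_smul, one_smul]
  exact ((hb.meq 1 one_ne_zero).trans hm).trans (hb'.meq 1 one_ne_zero).symm

structure Reps (T : Tri) (I : Type) (Hs : I → Submodule ℂ V5) (Ms : I → V5 →ₗ[ℂ] M3) : Prop where
  fin : ∀ i, Module.finrank ℂ (Hs i) = 4
  sd : ∀ i, SymDet T (Hs i) (Ms i)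
  nd : ∀ i, ND T (Hs i) (Ms i)
  complete : ∀ (H : Submodule ℂ V5) (M : V5 →ₗ[ℂ] M3), Module.finrank ℂ H = 4 → SymDet T H M → ∃ i, H = Hs i ∧ MEq H M (Ms i)
  ineq : ∀ i j, Hs i = Hs j → MEq (Hs i) (Ms i) (Ms j) → i = j

lemma core2 {T0 T1 : Tri} (hT : ∀ z : ℂ, TSym (T0 + z • T1)) {zs : ℂ} (hs : TSmooth (T0 + zs • T1)) {I : Type} {Hs : I → Submodule ℂ V5}
    {Ms : I → V5 →ₗ[ℂ] M3} (hR : Reps (T0 + zs • T1) I Hs Ms) :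
    ∃ Hb : I → ℂ → Submodule ℂ V5,
      (∀ i, ∀ᶠ w in 𝓝 zs, Hb i w ∈ HypSet (T0 + w • T1)) ∧
      (∀ (ι : Type) (𝒰 : Ultrafilter ι) (z : ι → ℂ) (H : ι → Submodule ℂ V5), Tendsto z 𝒰 (𝓝 zs) → (∀ n, H n ∈ HypSet (T0 + z n • T1)) →
        ∃ i, ∀ᶠ n in (𝒰 : Filter ι), H n = Hb i (z n)) ∧
      ∀ i j, (∃ᶠ w in 𝓝 zs, Uniq (T0 + w • T1) ∧ Hb i w = Hb j w) → i = j := by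
  have hch : ∀ H : Submodule ℂ V5, Module.finrank ℂ H = 4 → ∃ bd : Module.Basis (Fin 5) ℂ V5 × (Fin 3 → ℂ), H = LinearMap.ker (hU bd.1 0) ∧
      (T0 + zs • T1) (bd.1 1) (bd.1 1) (bd.1 1) ≠ 0 ∧ Function.Injective bd.2 ∧
      ∀ x : ℂ, (T0 + zs • T1) (bd.1 2 + x • bd.1 1) (bd.1 2 + x • bd.1 1) (bd.1 2 + x • bd.1 1)
      = (T0 + zs • T1) (bd.1 1) (bd.1 1) (bd.1 1) * ((bd.2 0 + x) * (bd.2 1 + x) * (bd.2 2 + x)) := fun H hH => by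
    obtain ⟨bs, hb⟩ := exists_chart (hT zs) hs hH
    obtain ⟨d, h1, h2⟩ := hb.roots
    exact ⟨(bs, d), by rw [hU_zero]; exact hb.ker, hb.ne, h1, h2⟩
  have : Inhabited (Module.Basis (Fin 5) ℂ V5) := ⟨Pi.basisFun ℂ (Fin 5)⟩
  choose! bd hk hne hinj hr using hch
  have hbd : ∀ i, ∃ ξg : EE × (ℂ → EE), BD T0 T1 zs (bd (Hs i)).1 (bd (Hs i)).2 (Ms i) ξg.1 ξg.2 := fun i => by
    have hf := hR.fin i
    obtain ⟨ξ, g, h⟩ := exists_BD hT (hinj _ hf) (hne _ hf) (hr _ hf) (M := Ms i) (by rw [← hk _ hf]; exact hR.sd i) (by rw [← hk _ hf]; exact hR.nd i)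
    exact ⟨(ξ, g), h⟩
  choose ξg hbd using hbd
  refine ⟨fun i w => LinearMap.ker (hU (bd (Hs i)).1 ((ξg i).2 w).1), fun i => ?_, fun ι 𝒰 z H hz hH => ?_, fun i j hij => ?_⟩
  · filter_upwards [(hbd i).sol] with w hw
    obtain ⟨κ, hκ⟩ := IsAlgClosed.exists_pow_nat_eq ((ξg i).2 w).2.1 (n := 3) (by norm_num)
    exact ⟨finrank_hU _ _, _, mkM_symDet _ hκ (fam_sym _) hw⟩
  · have hU' : ∀ n, ∃ U : V5 →ₗ[ℂ] ℂ, U ≠ 0 ∧ H n = LinearMap.ker U := fun n => hyp_ker (hH n).1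
    choose U hU0 hHU using hU'
    have hM' : ∀ n, ∃ M, SymDet (T0 + z n • T1) (H n) M := fun n => (hH n).2
    choose M hM using hM'
    obtain ⟨w, hw0, hw⟩ := hyp_limit 𝒰 hU0
    have hf : Module.finrank ℂ (LinearMap.ker w) = 4 := by
      have h1 := LinearMap.finrank_range_add_finrank_ker w
      rw [LinearMap.range_eq_top.mpr (LinearMap.surjective hw0)] at h1
      simp at h1; omega
    obtain ⟨c, hc, hcH⟩ := hw (bd (LinearMap.ker w)).1 (by rw [← hU_zero]; exact hk _ hf)
    obtain ⟨η, η', t, e1, e2, e3, e4, e5⟩ := core1 𝒰 hT hz (hinj _ hf) (hne _ hf) (hr _ hf) hc (M := M)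
      (by filter_upwards [hcH] with n hn; rw [← hn, ← hHU]; exact hM n)
    have hS := sol_limit hz t e5
    obtain ⟨κ, hκ⟩ := IsAlgClosed.exists_pow_nat_eq η'.2.1 (n := 3) (by norm_num)
    have hκ0 : κ ≠ 0 := fun e => hne _ hf (by rw [← e2, ← hκ, e]; simp)
    have hsd := mkM_symDet _ hκ (fam_sym _) hS
    rw [e1] at hsd
    obtain ⟨i, hi, hMi⟩ := hR.complete _ _ (finrank_hU _ _) hsd
    have hbi := hbd i
    rw [← hk _ hf] at hi
    refine ⟨i, ?_⟩
    dsimp only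
    rw [← hi] at hbi ⊢
    filter_upwards [core_c (hinj _ hf) hbi hz t e1 e2 e3 e5 hκ0 hMi, hcH] with n h1 h2
    rw [← h1, e4, hHU, h2]
  · have hN : (𝓝 zs ⊓ 𝓟 {w | Uniq (T0 + w • T1) ∧ LinearMap.ker (hU (bd (Hs i)).1 ((ξg i).2 w).1) = LinearMap.ker (hU (bd (Hs j)).1 ((ξg j).2 w).1)}).NeBot :=
      frequently_mem_iff_neBot.mp hij
    have h1 := Ultrafilter.of_le (𝓝 zs ⊓ 𝓟 {w | Uniq (T0 + w • T1) ∧ LinearMap.ker (hU (bd (Hs i)).1 ((ξg i).2 w).1) = LinearMap.ker (hU (bd (Hs j)).1 ((ξg j).2 w).1)})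
    set 𝒰 := Ultrafilter.of (𝓝 zs ⊓ 𝓟 {w | Uniq (T0 + w • T1) ∧ LinearMap.ker (hU (bd (Hs i)).1 ((ξg i).2 w).1) = LinearMap.ker (hU (bd (Hs j)).1 ((ξg j).2 w).1)})
    have h2 : (𝒰 : Filter ℂ) ≤ 𝓝 zs := h1.trans inf_le_left
    have h3 : ∀ᶠ w in (𝒰 : Filter ℂ), Uniq (T0 + w • T1) ∧ LinearMap.ker (hU (bd (Hs i)).1 ((ξg i).2 w).1) = LinearMap.ker (hU (bd (Hs j)).1 ((ξg j).2 w).1) :=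
      h1 (mem_inf_of_right (mem_principal_self _))
    have tc : ∀ i, Tendsto (fun w => ((ξg i).2 w).1) 𝒰 (𝓝 0) := fun i => by
      rw [← (hbd i).c]
      exact (continuous_fst.tendsto _).comp ((hbd i).tend.mono_left h2)
    have hij' : Hs i = Hs j := by
      rw [hk _ (hR.fin i), hk _ (hR.fin j)]
      exact le_antisymm (lim_le (tc i) (tc j) (h3.mono fun w h => h.2)) (lim_le (tc j) (tc i) (h3.mono fun w h => h.2.symm))
    refine hR.ineq i j hij' ?_
    have hbj := hbd j
    rw [← hij'] at hbj h3
    have := core_d 𝒰 h2 (hinj _ (hR.fin i)) (hbd i) hbj h3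
    rw [← hk _ (hR.fin i)] at this
    exact this

lemma loc_const {T0 T1 : Tri} (hT : ∀ z : ℂ, TSym (T0 + z • T1)) {zs : ℂ} (hs : TSmooth (T0 + zs • T1)) {I : Type} [Finite I] {Hs : I → Submodule ℂ V5}
    {Ms : I → V5 →ₗ[ℂ] M3} (hR : Reps (T0 + zs • T1) I Hs Ms) :
    ∀ᶠ z in 𝓝 zs, Uniq (T0 + z • T1) → (HypSet (T0 + z • T1)).ncard = Nat.card I := by
  obtain ⟨Hb, h1, h2, h3⟩ := core2 hT hs hR
  have hA : ∀ᶠ z in 𝓝 zs, ∀ i, Hb i z ∈ HypSet (T0 + z • T1) := eventually_all.mpr h1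
  have hB : ∀ᶠ z in 𝓝 zs, ∀ H ∈ HypSet (T0 + z • T1), ∃ i, H = Hb i z := by
    by_contra hcon
    have hcon : ∃ᶠ z in 𝓝 zs, ¬ ∀ H ∈ HypSet (T0 + z • T1), ∃ i, H = Hb i z := not_eventually.mp hcon
    let S := {z | ¬ ∀ H ∈ HypSet (T0 + z • T1), ∃ i, H = Hb i z}
    have hex : ∀ n : S, ∃ H ∈ HypSet (T0 + (n : ℂ) • T1), ∀ i, H ≠ Hb i n := fun n => by
      have := n.2
      simp only [S, Set.mem_ofPred_eq] at this
      push Not at this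
      exact this
    choose H hH hHn using hex
    have hN' : (comap ((↑) : S → ℂ) (𝓝 zs)).NeBot := by
      rw [comap_neBot_iff_frequently]
      exact hcon.mono fun z hz => ⟨⟨z, hz⟩, rfl⟩
    obtain ⟨i, hi⟩ := h2 S (Ultrafilter.of (comap ((↑) : S → ℂ) (𝓝 zs))) (fun n => n) H (tendsto_comap.mono_left (Ultrafilter.of_le _)) hH
    obtain ⟨n, hn⟩ := hi.exists
    exact hHn n i hn
  have hC : ∀ᶠ z in 𝓝 zs, ∀ i j, i ≠ j → ¬ (Uniq (T0 + z • T1) ∧ Hb i z = Hb j z) := by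
    rw [eventually_all]; intro i
    rw [eventually_all]; intro j
    by_cases hij : i = j
    · exact Eventually.of_forall fun w hw => (hw hij).elim
    · have := mt (h3 i j) hij
      rw [not_frequently] at this
      exact this.mono fun w hw _ => hw
  filter_upwards [hA, hB, hC] with z a b c hu
  have e : HypSet (T0 + z • T1) = Set.range fun i => Hb i z := by
    ext H
    constructor
    · intro h; obtain ⟨i, rfl⟩ := b H h; exact ⟨i, rfl⟩
    · rintro ⟨i, rfl⟩; exact a i
  have hi : Function.Injective fun i => Hb i z := fun i j hij => by
    by_contra hne
    exact c i j hne ⟨hu, hij⟩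
  rw [e, ← Set.image_univ, Set.ncard_image_of_injective _ hi, Set.ncard_univ]

structure Nice (T : Tri) : Prop where
  sym : TSym T
  smooth : TSmooth T
  cay : CayAll T

lemma ker_finrank {U : V5 →ₗ[ℂ] ℂ} (h : U ≠ 0) : Module.finrank ℂ (LinearMap.ker U) = 4 := by
  have h1 := LinearMap.finrank_range_add_finrank_ker U
  rw [LinearMap.range_eq_top.mpr (LinearMap.surjective h)] at h1
  simp at h1; omega

lemma Nice.uniq {T : Tri} (h : Nice T) : Uniq T := fun H M M' hH hM hM' => by
  obtain ⟨U, hU, rfl⟩ := hyp_ker hH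
  obtain ⟨N, hN⟩ := h.cay U M hU hM
  exact (cayley_unique h.sym h.smooth hU hM hN).trans (cayley_unique h.sym h.smooth hU hM' hN).symm

lemma Nice.reps {T : Tri} (h : Nice T) : ∃ Ms, Reps T (HypSet T) (fun i => i.1) Ms := by
  have : ∀ i : HypSet T, ∃ M, SymDet T i.1 M := fun i => i.2.2
  choose Ms hMs using this
  refine ⟨Ms, fun i => i.2.1, hMs, fun i => ?_, fun H M hH hM => ⟨⟨H, hH, M, hM⟩, rfl, h.uniq H _ _ hH hM (hMs _)⟩, fun i j hij _ => Subtype.ext hij⟩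
  obtain ⟨U, hU, hUi⟩ := hyp_ker i.2.1
  have hM := hMs i
  show ND T i.1 (Ms i)
  rw [hUi] at hM ⊢
  obtain ⟨N, hN⟩ := h.cay U _ hU hM
  exact (cay_ND h.sym h.smooth hU hN).congr (cayley_unique h.sym h.smooth hU hM hN).symm

lemma Nice.finite {T : Tri} (h : Nice T) : (HypSet T).Finite := by
  by_contra hinf
  have : Infinite (HypSet T) := Set.infinite_coe_iff.mpr hinf
  obtain ⟨Ms, hR⟩ := h.reps
  have e : ∀ z : ℂ, T + z • (0 : Tri) = T := fun z => by rw [smul_zero, add_zero]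
  obtain ⟨Hb, _, h2, _⟩ := core2 (T0 := T) (T1 := 0) (zs := 0) (fun z => by rw [e]; exact h.sym) (by rw [e]; exact h.smooth) (by rw [e]; exact hR)
  obtain ⟨i, hi⟩ := h2 (HypSet T) (hyperfilter (HypSet T)) (fun _ => 0) (fun n => n.1) tendsto_const_nhds (fun n => by rw [e]; exact n.2)
  obtain ⟨n, hn⟩ := hi.exists
  have h3 : ∀ᶠ m in (hyperfilter (HypSet T) : Filter (HypSet T)), m = n := hi.mono fun m hm => Subtype.ext (hm.trans hn.symm)
  have h4 : ({n} : Set (HypSet T)) ∈ hyperfilter (HypSet T) := h3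
  exact (Set.finite_singleton n).notMem_hyperfilter h4

/-- the Fermat cubic as a trilinear form -/
def fT : Tri := ∑ i : Fin 5, (LinearMap.proj i : V5 →ₗ[ℂ] ℂ).smulRight ((LinearMap.proj i : V5 →ₗ[ℂ] ℂ).smulRight (LinearMap.proj i : V5 →ₗ[ℂ] ℂ))

lemma fT_apply (x y z : V5) : fT x y z = ∑ i, x i * y i * z i := by
  simp [fT, LinearMap.sum_apply, mul_assoc]

lemma fT_sym : TSym fT := fun x y z => by
  simp only [fT_apply]
  exact ⟨Finset.sum_congr rfl fun i _ => by ring, Finset.sum_congr rfl fun i _ => by ring⟩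

lemma fT_of : TriOf (∑ i : Fin 5, X i ^ 3) fT := by
  refine ⟨fT_sym, fun x => ?_, fun x i => ?_⟩
  · simp only [map_sum, map_pow, eval_X, fT_apply]
    exact Finset.sum_congr rfl fun i _ => by ring
  · simp only [fT_apply, map_sum, Derivation.leibniz_pow, pderiv_X, Pi.single_apply]
    rw [Finset.sum_eq_single i (by intro j _ hj; simp [hj]) (by simp), Finset.sum_eq_single i (by intro j _ hj; simp [hj]) (by simp)]
    simp; ring

lemma fT_smooth : TSmooth fT := fun x h => by
  funext i
  have := h (Pi.single i 1)
  rw [fT_apply, Finset.sum_eq_single i (by intro j _ hj; simp [hj]) (by simp)] at this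
  simpa using this

lemma good_poly : ∃ P : MvPolynomial Deg3Monomials ℂ, P ≠ 0 ∧ ∀ F T, TriOf F T → evF P F ≠ 0 → Nice T ∧ ¬ D3cfg T := by
  obtain ⟨P1, h1, f1⟩ := famS
  obtain ⟨P2, h2, f2⟩ := famD1
  obtain ⟨P3, h3, f3⟩ := famD2
  obtain ⟨P4, h4, f4⟩ := famD3
  refine ⟨P1 * P2 * P3 * P4, mul_ne_zero (mul_ne_zero (mul_ne_zero h1 h2) h3) h4, fun F T hF hP => ?_⟩
  have e : evF (P1 * P2 * P3 * P4) F = evF P1 F * evF P2 F * evF P3 F * evF P4 F := by simp [evF]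
  rw [e] at hP
  have n4 := right_ne_zero_of_mul hP
  have n3 := right_ne_zero_of_mul (left_ne_zero_of_mul hP)
  have n2 := right_ne_zero_of_mul (left_ne_zero_of_mul (left_ne_zero_of_mul hP))
  have n1 := left_ne_zero_of_mul (left_ne_zero_of_mul (left_ne_zero_of_mul hP))
  have hs : TSmooth T := by by_contra h; exact n1 (f1 F T hF h)
  refine ⟨⟨hF.1, hs, fun U M hU hM => ?_⟩, fun h => n4 (f4 F T hF h)⟩
  rcases cay_or_bad hF.1 hs hU hM with h | h | h
  · exact (n2 (f2 F T hF h)).elim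
  · exact (n3 (f3 F T hF h)).elim
  · exact h

lemma evF_line (P : MvPolynomial Deg3Monomials ℂ) (F G : MvPolynomial (Fin 5) ℂ) (h : ∃ z, evF P (F + C z * G) ≠ 0) :
    {z | evF P (F + C z * G) = 0}.Finite := by
  let p : Polynomial ℂ := aeval (fun d : Deg3Monomials => Polynomial.C (F.coeff d.1) + Polynomial.X * Polynomial.C (G.coeff d.1)) P
  have hp : ∀ z, p.eval z = evF P (F + C z * G) := fun z => by
    have h1 : (Polynomial.aeval z : Polynomial ℂ →ₐ[ℂ] ℂ) p = aeval (fun d : Deg3Monomials => (F + C z * G).coeff d.1) P := by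
      show (Polynomial.aeval z : Polynomial ℂ →ₐ[ℂ] ℂ) (aeval _ P) = _
      rw [MvPolynomial.comp_aeval_apply]
      congr 2
      funext d
      simp [coeff_C_mul]
      ring
    rw [Polynomial.coe_aeval_eq_eval] at h1
    rw [h1, evF, MvPolynomial.aeval_eq_eval]
  obtain ⟨z, hz⟩ := h
  have h0 : p ≠ 0 := fun e => hz (by rw [← hp, e]; simp)
  refine (Polynomial.finite_setOfPred_isRoot h0).subset fun w hw => ?_
  show p.eval w = 0
  rw [hp]; exact hw

lemma chain {I : Type} [Finite I] (hI : Nat.card I = 495) {Hs : I → Submodule ℂ V5} {Ms : I → V5 →ₗ[ℂ] M3} (hR : Reps fT I Hs Ms)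
    {P : MvPolynomial Deg3Monomials ℂ} (hP : ∀ F T, TriOf F T → evF P F ≠ 0 → Nice T ∧ ¬ D3cfg T) {F : MvPolynomial (Fin 5) ℂ} {T : Tri}
    (hF : TriOf F T) (hPF : evF P F ≠ 0) : (HypSet T).ncard = 495 := by
  let F0 : MvPolynomial (Fin 5) ℂ := ∑ i : Fin 5, X i ^ 3
  let G := F + C (-1) * F0
  let S : Tri := T + (-1 : ℂ) • fT
  have hG : TriOf G S := hF.add (fT_of.smul (-1))
  have hz : ∀ z : ℂ, TriOf (F0 + C z * G) (fT + z • S) := fun z => fT_of.add (hG.smul z)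
  have e1 : F0 + C 1 * G = F := by simp [G]
  have eT : fT + (1 : ℂ) • S = T := by
    show fT + (1 : ℂ) • (T + (-1 : ℂ) • fT) = T
    refine LinearMap.ext fun x => LinearMap.ext fun y => LinearMap.ext fun z => ?_
    simp only [LinearMap.add_apply, LinearMap.smul_apply, smul_eq_mul]
    ring
  have hfin := evF_line P F0 G ⟨1, by rw [e1]; exact hPF⟩
  let Ω : Set ℂ := ({z | evF P (F0 + C z * G) = 0} \ {0})ᶜ
  have hΩ : IsPreconnected Ω :=
    (Set.Countable.isPathConnected_compl_of_one_lt_rank (by simp) (hfin.subset Set.sdiff_subset).countable).isConnected.isPreconnected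
  have hN : ∀ z ∈ Ω, z ≠ 0 → Nice (fT + z • S) := fun z hz1 hz0 => by
    refine (hP _ _ (hz z) fun h => hz1 ⟨h, hz0⟩).1
  classical
  let ν : ℂ → ℕ := fun z => if z = 0 then 495 else (HypSet (fT + z • S)).ncard
  have hloc : ∀ zs ∈ Ω, ∀ᶠ z in 𝓝 zs, z ∈ Ω → ν z = ν zs := fun zs hzs => by
    by_cases h0 : zs = 0
    · subst h0
      have e0 : fT + (0 : ℂ) • S = fT := by rw [zero_smul, add_zero]
      have := loc_const (T0 := fT) (T1 := S) (zs := 0) (fun z => (hz z).1) (by rw [e0]; exact fT_smooth) (by rw [e0]; exact hR)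
      filter_upwards [this] with z h hzΩ
      by_cases hz0 : z = 0
      · rw [hz0]
      · simp only [ν, hz0, if_false, if_true]
        rw [h (hN z hzΩ hz0).uniq, hI]
    · obtain ⟨Ms', hR'⟩ := (hN zs hzs h0).reps
      have : Finite (HypSet (fT + zs • S)) := (hN zs hzs h0).finite
      have := loc_const (T0 := fT) (T1 := S) (zs := zs) (fun z => (hz z).1) (hN zs hzs h0).smooth hR'
      filter_upwards [this, eventually_ne_nhds h0] with z h hz0 hzΩ
      simp only [ν, hz0, h0, if_false]
      rw [h (hN z hzΩ hz0).uniq]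
      rfl
  have hc : ContinuousOn ν Ω := fun zs hzs => by
    refine tendsto_const_nhds.congr' ?_
    rw [EventuallyEq, eventually_nhdsWithin_iff]
    exact (hloc zs hzs).mono fun z h hz => (h hz).symm
  have h1Ω : (1 : ℂ) ∈ Ω := fun h => hPF (by have := h.1; rw [Set.mem_ofPred_eq, e1] at this; exact this)
  have h0Ω : (0 : ℂ) ∈ Ω := fun h => h.2 rfl
  have := hΩ.constant hc h1Ω h0Ω
  simp only [ν, one_ne_zero, if_false, if_true] at this
  rw [eT] at this
  exact this

lemma main_of_reps {I : Type} [Finite I] (hI : Nat.card I = 495) {Hs : I → Submodule ℂ V5} {Ms : I → V5 →ₗ[ℂ] M3} (hR : Reps fT I Hs Ms) :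
    ∃ P : MvPolynomial Deg3Monomials ℂ, P ≠ 0 ∧ ∀ F : MvPolynomial (Fin 5) ℂ, F.IsHomogeneous 3 → evF P F ≠ 0 →
      IsSmoothCubic F ∧ (NodeSet F).Finite ∧ (NodeSet F).ncard = 1485 := by
  obtain ⟨P, hP0, hP⟩ := good_poly
  refine ⟨P, hP0, fun F hF hPF => ?_⟩
  obtain ⟨T, hT⟩ := exists_tri F hF
  obtain ⟨hn, hD⟩ := hP F T hT hPF
  obtain ⟨h1, h2⟩ := node_count hT hn.smooth hn.cay hD hn.finite
  refine ⟨hT.smooth.mpr hn.smooth, h1, ?_⟩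
  rw [h2, chain hI hR hP hT hPF]

/-! ### Part D: the Fermat cubic. Constants -/

lemma exists_om : ∃ w : ℂ, w ^ 2 + w + 1 = 0 := by
  obtain ⟨r, hr⟩ := exists_sqrt (-3)
  exact ⟨(r - 1) / 2, by linear_combination hr / 4⟩

/-- primitive cube root of unity -/
def om : ℂ := exists_om.choose
lemma om_eq : om ^ 2 + om + 1 = 0 := exists_om.choose_spec
lemma om_cube : om ^ 3 = 1 := by linear_combination (om - 1) * om_eq
lemma om_ne : om ≠ 0 := fun h => by have := om_eq; rw [h] at this; norm_num at this
lemma om_ne1 : om ≠ 1 := fun h => by have := om_eq; rw [h] at this; norm_num at this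
lemma om_sq_ne1 : om ^ 2 ≠ 1 := fun h => om_ne1 (by linear_combination om_cube - om * h)
lemma om_sq_ne : om ^ 2 ≠ om := fun h => om_ne1 (mul_left_cancel₀ om_ne (by linear_combination h))

lemma cube_one {x : ℂ} (h : x ^ 3 = 1) : ∃ e : Fin 3, x = om ^ (e : ℕ) := by
  have h2 : (x - 1) * ((x - om) * (x - om ^ 2)) = 0 := by linear_combination h + (x ^ 2 * (-1) + x * om + 1 - om) * om_eq
  rcases mul_eq_zero.mp h2 with h | h
  · exact ⟨0, by simpa using sub_eq_zero.mp h⟩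
  rcases mul_eq_zero.mp h with h | h
  · exact ⟨1, by simpa using sub_eq_zero.mp h⟩
  · exact ⟨2, by simpa using sub_eq_zero.mp h⟩

lemma om_inj {e e' : Fin 3} (h : om ^ (e : ℕ) = om ^ (e' : ℕ)) : e = e' := by
  have h1 := om_ne1; have h2 := om_sq_ne1; have h3 := om_sq_ne
  fin_cases e <;> fin_cases e' <;> simp at h ⊢ <;> first | exact h1 h | exact h1 h.symm | exact h2 h | exact h2 h.symm | exact h3 h | exact h3 h.symm | grind

lemma om_pow_cube (e : ℕ) : (om ^ e) ^ 3 = 1 := by rw [← pow_mul, mul_comm, pow_mul, om_cube, one_pow]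

lemma om_pow_ne (e : ℕ) : om ^ e ≠ 0 := pow_ne_zero _ om_ne

lemma exists_tau : ∃ w : ℂ, w ^ 3 = 1 / 2 := IsAlgClosed.exists_pow_nat_eq _ (by norm_num)
def tau0 : ℂ := exists_tau.choose
lemma tau0_eq : tau0 ^ 3 = 1 / 2 := exists_tau.choose_spec

lemma exists_tau_e {t : ℂ} (h : 2 * t ^ 3 = 1) : ∃ e : Fin 3, t = om ^ (e : ℕ) * tau0 := by
  have h0 : tau0 ≠ 0 := fun h => by have := tau0_eq; rw [h] at this; norm_num at this
  obtain ⟨e, he⟩ := cube_one (x := t / tau0) (by rw [div_pow, tau0_eq]; linear_combination h)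
  exact ⟨e, by rw [← he, div_mul_cancel₀ _ h0]⟩

lemma tau_e (e : ℕ) : 2 * (om ^ e * tau0) ^ 3 = 1 := by rw [mul_pow, om_pow_cube, tau0_eq]; norm_num

lemma fT_perm (s : Equiv.Perm (Fin 5)) (x y z : V5) : fT x y z = x (s 0) * y (s 0) * z (s 0) + x (s 1) * y (s 1) * z (s 1)
    + x (s 2) * y (s 2) * z (s 2) + x (s 3) * y (s 3) * z (s 3) + x (s 4) * y (s 4) * z (s 4) := by
  rw [fT_apply, ← Equiv.sum_comp s, Fin.sum_univ_five]

/-! ### Eckardt hyperplanes -/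

/-- symmetric matrix with given entries -/
def sy (a0 a1 a2 a b c : ℂ) : M3 := !![a0, c, b; c, a1, a; b, a, a2]

lemma sy_of {A : M3} (h : A.transpose = A) : A = sy (A 0 0) (A 1 1) (A 2 2) (A 1 2) (A 0 2) (A 0 1) := by
  have h1 : A 1 0 = A 0 1 := congrFun (congrFun h 0) 1
  have h2 : A 2 0 = A 0 2 := congrFun (congrFun h 0) 2
  have h3 : A 2 1 = A 1 2 := congrFun (congrFun h 1) 2
  ext i j; fin_cases i <;> fin_cases j <;> simp [sy, h1, h2, h3]

lemma pol_sy (a0 a1 a2 a b c e0 e1 e2 e f g k0 k1 k2 k l m : ℂ) :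
    6 * pol (sy a0 a1 a2 a b c) (sy e0 e1 e2 e f g) (sy k0 k1 k2 k l m) =
      k0 * (a1 * e2 + a2 * e1 - 2 * a * e) + k1 * (a0 * e2 + a2 * e0 - 2 * b * f) + k2 * (a0 * e1 + a1 * e0 - 2 * c * g)
      + 2 * k * (b * g + c * f - a0 * e - a * e0) + 2 * l * (a * g + c * e - a1 * f - b * e1) + 2 * m * (a * f + b * e - a2 * g - c * e2) := by
  simp only [pol, sy, Matrix.det_fin_three, Matrix.add_apply, Matrix.of_apply, Matrix.cons_val]
  ring

def eU (s : Equiv.Perm (Fin 5)) (α : ℂ) : V5 →ₗ[ℂ] ℂ := LinearMap.proj (s 0) + α • LinearMap.proj (s 1)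
lemma eU_apply (s : Equiv.Perm (Fin 5)) (α : ℂ) (x : V5) : eU s α x = x (s 0) + α * x (s 1) := by simp [eU]

def eM (s : Equiv.Perm (Fin 5)) (t : ℂ) : V5 →ₗ[ℂ] M3 where
  toFun x := sy (x (s 2) + x (s 3)) (x (s 2) + om * x (s 3)) (x (s 2) + om ^ 2 * x (s 3)) (t * x (s 4)) (om ^ 2 * t * x (s 4)) (om * t * x (s 4))
  map_add' x y := by ext i j; fin_cases i <;> fin_cases j <;> simp [sy] <;> ring
  map_smul' c x := by ext i j; fin_cases i <;> fin_cases j <;> simp [sy] <;> ring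

lemma eM_apply (s : Equiv.Perm (Fin 5)) (t : ℂ) (x : V5) : eM s t x = sy (x (s 2) + x (s 3)) (x (s 2) + om * x (s 3)) (x (s 2) + om ^ 2 * x (s 3)) (t * x (s 4)) (om ^ 2 * t * x (s 4)) (om * t * x (s 4)) := rfl

lemma eM_sd (s : Equiv.Perm (Fin 5)) {α t : ℂ} (hα : α ^ 3 = 1) (ht : 2 * t ^ 3 = 1) : SymDet fT (LinearMap.ker (eU s α)) (eM s t) := by
  refine ⟨fun x => ?_, fun x hx => ?_⟩
  · rw [eM_apply]; ext i j; fin_cases i <;> fin_cases j <;> simp [sy]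
  · rw [LinearMap.mem_ker, eU_apply] at hx
    have e : x (s 0) = -(α * x (s 1)) := by linear_combination hx
    rw [fT_perm s, eM_apply]
    simp only [sy, Matrix.det_fin_three, Matrix.of_apply, Matrix.cons_val, e]
    generalize x (s 1) = w; generalize x (s 2) = y1; generalize x (s 3) = y2; generalize x (s 4) = y3
    have h4 : om ^ 4 = om := by linear_combination om * om_cube
    have h5 : om ^ 2 = - om - 1 := by linear_combination om_eq
    have h3 := om_cube
    grind

def eb (i : Fin 5) : V5 := Pi.single i 1
lemma eb_apply (i j : Fin 5) : eb i j = if j = i then 1 else 0 := by simp [eb, Pi.single_apply]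

lemma e_expand (s : Equiv.Perm (Fin 5)) {α : ℂ} {x : V5} (hx : x ∈ LinearMap.ker (eU s α)) :
    x = x (s 2) • eb (s 2) + x (s 3) • eb (s 3) + x (s 4) • eb (s 4) + x (s 1) • (eb (s 1) - α • eb (s 0)) := by
  rw [LinearMap.mem_ker, eU_apply] at hx
  have e : x (s 0) = -(α * x (s 1)) := by linear_combination hx
  funext i
  obtain ⟨k, rfl⟩ := s.surjective i
  fin_cases k <;> (simp [eb_apply, e]; try ring)

/-- quadrics in `y` are combinations of minors: enough for nondegeneracy on an Eckardt hyperplane -/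
lemma eM_nd (s : Equiv.Perm (Fin 5)) {α t : ℂ} (ht : 2 * t ^ 3 = 1) : ND fT (LinearMap.ker (eU s α)) (eM s t) := by
  intro G
  have ht0 : t ≠ 0 := fun h => by rw [h] at ht; norm_num at ht
  set v : V5 := eb (s 1) - α • eb (s 0) with hv
  let f : Fin 3 → V5 := ![eb (s 2), eb (s 3), eb (s 4)]
  let y : Fin 3 → (V5 →ₗ[ℂ] ℂ) := ![LinearMap.proj (s 2), LinearMap.proj (s 3), LinearMap.proj (s 4)]
  let w : V5 →ₗ[ℂ] ℂ := LinearMap.proj (s 1)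
  have hK : ∀ a b : Fin 3, ∃ K : M3, ∀ x, dd (eM s t x) K = y a x * y b x := by
    have h3 := om_cube
    have h5 : om ^ 2 = - om - 1 := by linear_combination om_eq
    have k11 : ∃ K : M3, ∀ x, dd (eM s t x) K = x (s 2) * x (s 2) := ⟨Matrix.diagonal ![1/3, 1/3, 1/3], fun x => by
      rw [dd_eq, eM_apply]; simp [sy]; grind⟩
    have k22 : ∃ K : M3, ∀ x, dd (eM s t x) K = x (s 3) * x (s 3) := ⟨Matrix.diagonal ![1/3, om/3, om^2/3], fun x => by
      rw [dd_eq, eM_apply]; simp [sy]; grind⟩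
    have k33 : ∃ K : M3, ∀ x, dd (eM s t x) K = x (s 4) * x (s 4) := ⟨!![0, om/(3*t^2), om^2/(3*t^2);0,0,1/(3*t^2);0,0,0], fun x => by
      rw [dd_eq, eM_apply]; simp [sy]; field_simp; grind⟩
    have k13 : ∃ K : M3, ∀ x, dd (eM s t x) K = x (s 2) * x (s 4) := ⟨!![0, om^2/(-3*t), om/(-3*t);0,0,1/(-3*t);0,0,0], fun x => by
      rw [dd_eq, eM_apply]; simp [sy]; field_simp; grind⟩
    have k23 : ∃ K : M3, ∀ x, dd (eM s t x) K = x (s 3) * x (s 4) := ⟨!![0, 1/(-3*t), 1/(-3*t);0,0,1/(-3*t);0,0,0], fun x => by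
      rw [dd_eq, eM_apply]; simp [sy]; field_simp; grind⟩
    have k12 : ∃ K : M3, ∀ x, dd (eM s t x) K = x (s 2) * x (s 3) := by
      obtain ⟨K, hK⟩ := k33
      refine ⟨Matrix.diagonal ![-1/3, -om^2/3, -om/3] + (-t^2) • K, fun x => ?_⟩
      rw [dd_add, dd_smul, hK, dd_eq, eM_apply]; simp [sy]; grind
    intro a b
    fin_cases a <;> fin_cases b
    · exact k11
    · exact k12
    · exact k13
    · obtain ⟨K, hK⟩ := k12; exact ⟨K, fun x => by rw [hK]; exact mul_comm _ _⟩
    · exact k22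
    · exact k23
    · obtain ⟨K, hK⟩ := k13; exact ⟨K, fun x => by rw [hK]; exact mul_comm _ _⟩
    · obtain ⟨K, hK⟩ := k23; exact ⟨K, fun x => by rw [hK]; exact mul_comm _ _⟩
    · exact k33
  choose K hK using hK
  let m : V5 →ₗ[ℂ] ℂ := ∑ a, (G (f a) v v + G v (f a) v + G v v (f a)) • y a + G v v v • w
  let c : Fin 3 → Fin 3 → (V5 →ₗ[ℂ] ℂ) := fun a b => G (f a) (f b) + (G (f a) v (f b) + G v (f a) (f b) - G (f a) (f b) v + G (f a) (f b) v) • w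
  refine ⟨m, ∑ a, ∑ b, (c a b).smulRight (K a b), eb (s 1), fun x hx => ?_⟩
  have e1 : fT x x (eb (s 1)) = w x * w x := by
    rw [fT_perm s]; simp [eb_apply, w]
  have e2 : dd (eM s t x) ((∑ a, ∑ b, (c a b).smulRight (K a b)) x) = ∑ a, ∑ b, c a b x * (y a x * y b x) := by
    simp only [LinearMap.sum_apply, LinearMap.smulRight_apply]
    simp only [Fin.sum_univ_three, dd_add, dd_smul, hK]
  rw [e1, e2]
  have e3 : x = ∑ a, y a x • f a + w x • v := by
    rw [Fin.sum_univ_three]; exact e_expand s hx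
  have e4 : ∀ z : V5, G x x z = ∑ a, ∑ b, y a x * y b x * G (f a) (f b) z + w x * ∑ a, y a x * (G (f a) v z + G v (f a) z) + w x * w x * G v v z := fun z => by
    conv_lhs => rw [e3]
    simp only [Fin.sum_univ_three, map_add, map_smul, LinearMap.add_apply, LinearMap.smul_apply, smul_eq_mul]
    ring
  have e5 : ∀ a b, G a b x = ∑ c, y c x * G a b (f c) + w x * G a b v := fun a b => by
    conv_lhs => rw [e3]
    simp only [Fin.sum_univ_three, map_add, map_smul, smul_eq_mul]
  rw [e4]
  simp only [m, c, LinearMap.add_apply, LinearMap.smul_apply, LinearMap.sum_apply, smul_eq_mul, e5, Fin.sum_univ_three]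
  ring

def dom : Fin 3 → ℂ := ![1, om, om ^ 2]
lemma dom_inj : Function.Injective dom := by
  have h1 := om_ne1; have h2 := om_sq_ne1; have h3 := om_sq_ne
  intro a b h
  have e : ∀ a : Fin 3, dom a = om ^ (a : ℕ) := fun a => by fin_cases a <;> simp [dom]
  rw [e, e] at h
  exact om_inj h
lemma sy_one : sy 1 1 1 0 0 0 = 1 := by ext i j; fin_cases i <;> fin_cases j <;> simp [sy]
lemma sy_dom : sy 1 om (om ^ 2) 0 0 0 = Matrix.diagonal dom := by ext i j; fin_cases i <;> fin_cases j <;> simp [sy, dom]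

lemma eM_2 (s : Equiv.Perm (Fin 5)) (t : ℂ) : eM s t (eb (s 2)) = 1 := by
  rw [eM_apply, ← sy_one]; simp [eb_apply]
lemma eM_3 (s : Equiv.Perm (Fin 5)) (t : ℂ) : eM s t (eb (s 3)) = Matrix.diagonal dom := by
  rw [eM_apply, ← sy_dom]; simp [eb_apply]
lemma eM_4 (s : Equiv.Perm (Fin 5)) (t : ℂ) : eM s t (eb (s 4)) = sy 0 0 0 t (om ^ 2 * t) (om * t) := by
  rw [eM_apply]; simp [eb_apply]
lemma eM_v (s : Equiv.Perm (Fin 5)) (α t : ℂ) : eM s t (eb (s 1) - α • eb (s 0)) = 0 := by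
  rw [eM_apply]; simp [eb_apply]
  ext i j; fin_cases i <;> fin_cases j <;> simp [sy]
lemma eb_mem (s : Equiv.Perm (Fin 5)) (α : ℂ) {k : Fin 5} (h0 : k ≠ 0) (h1 : k ≠ 1) : eb (s k) ∈ LinearMap.ker (eU s α) := by
  rw [LinearMap.mem_ker, eU_apply]; simp [eb_apply, h0.symm, h1.symm]
lemma ev_mem (s : Equiv.Perm (Fin 5)) (α : ℂ) : eb (s 1) - α • eb (s 0) ∈ LinearMap.ker (eU s α) := by
  rw [LinearMap.mem_ker, eU_apply]; simp [eb_apply]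

lemma eM_ineq (s : Equiv.Perm (Fin 5)) {α t t' : ℂ} (ht : 2 * t ^ 3 = 1) (ht' : 2 * t' ^ 3 = 1)
    (h : MEq (LinearMap.ker (eU s α)) (eM s t) (eM s t')) : t = t' := by
  obtain ⟨P, hP, h⟩ := h
  have h2 := h _ (eb_mem s α (k := 2) (by decide) (by decide))
  have h3 := h _ (eb_mem s α (k := 3) (by decide) (by decide))
  have h4 := h _ (eb_mem s α (k := 4) (by decide) (by decide))
  rw [eM_2, eM_2] at h2
  rw [eM_3, eM_3] at h3
  rw [eM_4, eM_4] at h4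
  obtain ⟨q, rfl, hq⟩ := diagQ (d := dom) (d' := dom) (fun a b hab e => hab (dom_inj e)) h2.symm h3.symm
  have e := congrFun (congrFun h4 1) 2
  simp [sy, Matrix.diagonal_transpose, Matrix.mul_diagonal, Matrix.diagonal_mul] at e
  have e2 : t' ^ 2 = t ^ 2 := by
    rw [e]; linear_combination t ^ 2 * q 2 ^ 2 * hq 1 + t ^ 2 * hq 2
  have ht0 : t ≠ 0 := fun h => by rw [h] at ht; norm_num at ht
  refine mul_left_cancel₀ (pow_ne_zero 2 ht0) ?_
  linear_combination ht / 2 - ht' / 2 + t' * e2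

lemma sy_conj (q0 q1 q2 a0 a1 a2 a b c : ℂ) : (Matrix.diagonal ![q0, q1, q2]).transpose * sy a0 a1 a2 a b c * Matrix.diagonal ![q0, q1, q2]
    = sy (q0 ^ 2 * a0) (q1 ^ 2 * a1) (q2 ^ 2 * a2) (q1 * q2 * a) (q0 * q2 * b) (q0 * q1 * c) := by
  rw [Matrix.diagonal_transpose]
  ext i j
  rw [Matrix.mul_diagonal, Matrix.diagonal_mul]
  fin_cases i <;> fin_cases j <;> simp [sy] <;> ring

lemma eM_complete (s : Equiv.Perm (Fin 5)) {α : ℂ} (hα : α ^ 3 = 1) {M : V5 →ₗ[ℂ] M3} (hM : SymDet fT (LinearMap.ker (eU s α)) M) :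
    ∃ t, 2 * t ^ 3 = 1 ∧ MEq (LinearMap.ker (eU s α)) M (eM s t) := by
  set v : V5 := eb (s 1) - α • eb (s 0) with hv
  let β : Fin 4 → V5 := ![eb (s 2), eb (s 3), eb (s 4), v]
  have h000 : fT (β 0) (β 0) (β 0) = 1 := by rw [fT_perm s]; simp [β, eb_apply]
  obtain ⟨P, hP, hN⟩ := nf_of_symDet fT_sym hM (β := β) (fun k => by
    fin_cases k
    · exact eb_mem s α (by decide) (by decide)
    · exact eb_mem s α (by decide) (by decide)
    · exact eb_mem s α (by decide) (by decide)
    · exact ev_mem s α) (by rw [h000]; exact one_ne_zero) dom_inj (fun x => by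
      rw [h000, fT_perm s]; simp [β, eb_apply, dom]
      linear_combination (-(x ^ 2 - 1 + x * om + om)) * om_eq)
  set A : Fin 4 → M3 := fun k => P.transpose * M (β k) * P with hA
  have hS := sy_of (hN.sym 2)
  have hV := sy_of (hN.sym 3)
  have h0 : A 0 = sy 1 1 1 0 0 0 := by rw [sy_one]; exact hN.one
  have h1 : A 1 = sy 1 om (om ^ 2) 0 0 0 := by rw [sy_dom]; exact hN.diag
  generalize A 2 0 0 = s0, A 2 1 1 = s1, A 2 2 2 = s2, A 2 1 2 = a, A 2 0 2 = b, A 2 0 1 = c at hS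
  generalize A 3 0 0 = v0, A 3 1 1 = v1, A 3 2 2 = v2, A 3 1 2 = k, A 3 0 2 = l, A 3 0 1 = m at hV
  have q : ∀ i j k, 6 * fT (β i) (β j) (β k) = 6 * pol (A i) (A j) (A k) := fun i j k => by
    rw [hN.eq i j k, h000, one_mul, polL_apply]
  have h3 := om_cube
  have h5 : om ^ 2 = - om - 1 := by linear_combination om_eq
  have q1 := q 0 0 2; have q2 := q 0 1 2; have q3 := q 1 1 2
  have q4 := q 0 2 2; have q5 := q 1 2 2; have q6 := q 2 2 2
  have r1 := q 0 0 3; have r2 := q 0 1 3; have r3 := q 1 1 3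
  have r4 := q 0 2 3; have r5 := q 1 2 3; have r6 := q 2 2 3
  rw [fT_perm s] at q1 q2 q3 q4 q5 q6 r1 r2 r3 r4 r5 r6
  simp only [h0, h1, hS, hV, pol_sy] at q1 q2 q3 q4 q5 q6 r1 r2 r3 r4 r5 r6
  simp [β, v, eb_apply] at q1 q2 q3 q4 q5 q6 r1 r2 r3 r4 r5 r6
  have d0 : s0 = 0 := by grind
  have d1 : s1 = 0 := by grind
  have d2 : s2 = 0 := by grind
  have d3 : v0 = 0 := by grind
  have d4 : v1 = 0 := by grind
  have d5 : v2 = 0 := by grind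
  subst d0 d1 d2 d3 d4 d5
  have A1 : a ^ 2 + b ^ 2 + c ^ 2 = 0 := by grind
  have A2 : a ^ 2 + om * b ^ 2 + om ^ 2 * c ^ 2 = 0 := by grind
  have A3 : 2 * (a * b * c) = 1 := by grind
  have B1 : a * k + b * l + c * m = 0 := by grind
  have B2 : a * k + om * (b * l) + om ^ 2 * (c * m) = 0 := by grind
  have B3 : b * c * k + a * c * l + a * b * m = 0 := by grind
  clear q1 q2 q3 q4 q5 q6 r1 r2 r3 r4 r5 r6 q
  have ha : a ≠ 0 := fun h => by rw [h] at A3; norm_num at A3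
  have hb : b ≠ 0 := fun h => by rw [h] at A3; norm_num at A3
  have hc : c ≠ 0 := fun h => by rw [h] at A3; norm_num at A3
  have solve : ∀ p q r : ℂ, p + q + r = 0 → p + om * q + om ^ 2 * r = 0 → q = om * p ∧ r = om ^ 2 * p := fun p q r h1 h2 => by
    have hd : om ^ 2 - om ≠ 0 := sub_ne_zero.mpr om_sq_ne
    constructor <;> refine mul_left_cancel₀ hd ?_ <;> grind
  obtain ⟨C1, C2⟩ := solve _ _ _ A1 A2
  obtain ⟨C3, C4⟩ := solve _ _ _ B1 B2
  have hk : k = 0 := by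
    have : 3 * a ^ 5 * k = 0 := by
      linear_combination a * b * c * B3 - a ^ 2 * c ^ 2 * C3 - a ^ 2 * b ^ 2 * C4 - (a * k * c ^ 2 + a ^ 3 * k * om ^ 2) * C1 - (a ^ 3 * k * om + a ^ 3 * om * k) * C2 - 3 * a ^ 5 * k * om_cube
    simpa [ha] using this
  have hl : l = 0 := by rw [hk] at C3; simpa [hb] using C3
  have hm : m = 0 := by rw [hk] at C4; simpa [hc] using C4
  have sg : ∀ x y : ℂ, x ^ 2 = y ^ 2 → ∃ e : ℂ, e ^ 2 = 1 ∧ x = e * y := fun x y h => by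
    rcases sq_eq_sq_iff_eq_or_eq_neg.mp h with h | h
    · exact ⟨1, by simp, by simp [h]⟩
    · exact ⟨-1, by simp, by simp [h]⟩
  obtain ⟨e1, he1, hb1⟩ := sg b (om ^ 2 * a) (by rw [C1]; linear_combination (-a ^ 2 * om) * om_cube)
  obtain ⟨e2, he2, hc1⟩ := sg c (om * a) (by rw [C2]; ring)
  subst hk hl hm hb1 hc1
  refine ⟨e1 * e2 * a, ?_, P * Matrix.diagonal ![1, e1, e2], ?_, fun x hx => ?_⟩
  · linear_combination A3 + (2 * a ^ 3 * e1 * e2 * e2 ^ 2) * he1 + 2 * a ^ 3 * e1 * e2 * he2 - 2 * a ^ 3 * e1 * e2 * om_cube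
  · rw [Matrix.det_mul]
    refine hP.mul (IsUnit.mk0 _ ?_)
    have n1 : e1 ≠ 0 := fun h => by rw [h] at he1; norm_num at he1
    have n2 : e2 ≠ 0 := fun h => by rw [h] at he2; norm_num at he2
    simp [Matrix.det_diagonal, Fin.prod_univ_three, n1, n2]
  · have hz : A 3 = 0 := by rw [hV]; ext i j; fin_cases i <;> fin_cases j <;> simp [sy]
    have key : P.transpose * M x * P = x (s 2) • A 0 + x (s 3) • A 1 + x (s 4) • A 2 + x (s 1) • A 3 := by
      conv_lhs => rw [e_expand s hx]
      simp only [map_add, map_smul, hA, Matrix.mul_add, Matrix.add_mul, Matrix.mul_smul, Matrix.smul_mul]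
      rfl
    have : (P * Matrix.diagonal ![1, e1, e2]).transpose * M x * (P * Matrix.diagonal ![1, e1, e2]) =
        (Matrix.diagonal ![1, e1, e2]).transpose * (P.transpose * M x * P) * Matrix.diagonal ![1, e1, e2] := by
      rw [Matrix.transpose_mul]; simp only [Matrix.mul_assoc]
    rw [this, key, hz, smul_zero, add_zero, Matrix.mul_add, Matrix.mul_add, Matrix.add_mul, Matrix.add_mul]
    simp only [Matrix.mul_smul, Matrix.smul_mul, h0, h1, hS, sy_conj]
    rw [eM_apply]
    ext i j
    fin_cases i <;> fin_cases j <;> simp [sy] <;> grind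

/-! ### The 405 hyperplanes cutting Cayley cubics -/

lemma exists_four : ∃ w : ℂ, w ^ 3 = 4 := IsAlgClosed.exists_pow_nat_eq _ (by norm_num)
def b4 : ℂ := exists_four.choose
lemma b4_eq : b4 ^ 3 = 4 := exists_four.choose_spec
lemma b4_ne : b4 ≠ 0 := fun h => by have := b4_eq; rw [h] at this; norm_num at this
lemma exists_kap : ∃ w : ℂ, w ^ 3 = -24 := IsAlgClosed.exists_pow_nat_eq _ (by norm_num)
def kap : ℂ := exists_kap.choose
lemma kap_eq : kap ^ 3 = -24 := exists_kap.choose_spec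
lemma kap_ne : kap ≠ 0 := fun h => by have := kap_eq; rw [h] at this; norm_num at this

/-- twisted coordinates -/
def gx (m : Fin 5) (e : Fin 4 → Fin 3) (j : Fin 4) : V5 →ₗ[ℂ] ℂ := om ^ (e j : ℕ) • LinearMap.proj (m.succAbove j)
def gU (m : Fin 5) (e : Fin 4 → Fin 3) : V5 →ₗ[ℂ] ℂ := b4 • LinearMap.proj m + ∑ j, gx m e j
def gN (m : Fin 5) (e : Fin 4 → Fin 3) (j : Fin 4) : V5 →ₗ[ℂ] ℂ :=
  (kap / 2) • ((1 / 2 : ℂ) • (∑ j, gx m e j) - gx m e j)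

lemma gx_apply (m : Fin 5) (e : Fin 4 → Fin 3) (j : Fin 4) (x : V5) : gx m e j x = om ^ (e j : ℕ) * x (m.succAbove j) := rfl
lemma gU_apply (m : Fin 5) (e : Fin 4 → Fin 3) (x : V5) : gU m e x = b4 * x m + ∑ j, gx m e j x := by simp [gU]
lemma gN_apply (m : Fin 5) (e : Fin 4 → Fin 3) (j : Fin 4) (x : V5) :
    gN m e j x = kap / 2 * (1 / 2 * ∑ j, gx m e j x - gx m e j x) := by simp [gN]

lemma gU_self (m : Fin 5) (e : Fin 4 → Fin 3) : gU m e (eb m) = b4 := by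
  rw [gU_apply]; simp [gx_apply, eb_apply]
lemma gU_succ (m : Fin 5) (e : Fin 4 → Fin 3) (j : Fin 4) : gU m e (eb (m.succAbove j)) = om ^ (e j : ℕ) := by
  rw [gU_apply]; simp [gx_apply, eb_apply]
lemma gU_ne (m : Fin 5) (e : Fin 4 → Fin 3) : gU m e ≠ 0 := fun h => b4_ne (by rw [← gU_self m e, h]; rfl)

lemma gN_cay (m : Fin 5) (e : Fin 4 → Fin 3) : Cay fT (LinearMap.ker (gU m e)) (gN m e) := by
  refine ⟨fun x hx h => ?_, fun x hx => ?_⟩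
  · rw [LinearMap.mem_ker, gU_apply] at hx
    have h' : ∀ j, gx m e j x = 1 / 2 * ∑ j, gx m e j x := fun j => by
      have := h j
      rw [gN_apply] at this
      rcases mul_eq_zero.mp this with h | h
      · exact absurd h (div_ne_zero kap_ne two_ne_zero)
      · linear_combination -h
    have hs : ∑ j, gx m e j x = 0 := by
      have := Finset.sum_congr (rfl : Finset.univ = Finset.univ) (fun j (_ : j ∈ Finset.univ) => h' j)
      rw [Finset.sum_const] at this
      simp only [Finset.card_univ, Fintype.card_fin, nsmul_eq_mul] at this
      push_cast at this
      linear_combination -this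
    funext i
    rcases Fin.eq_self_or_eq_succAbove m i with rfl | ⟨j, rfl⟩
    · rw [hs, add_zero] at hx; simpa [b4_ne] using hx
    · have := h' j; rw [hs, mul_zero, gx_apply] at this
      exact (mul_eq_zero.mp this).resolve_left (om_pow_ne _)
  · rw [LinearMap.mem_ker, gU_apply] at hx
    have e1 : fT x x x = x m ^ 3 + ∑ j, (gx m e j x) ^ 3 := by
      rw [fT_apply, Fin.sum_univ_succAbove _ m]
      congr 1
      · ring
      · refine Finset.sum_congr rfl fun j _ => ?_
        rw [gx_apply, mul_pow, om_pow_cube]; ring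
    have e2 : x m ^ 3 = - (∑ j, gx m e j x) ^ 3 / 4 := by
      have : b4 * x m = - ∑ j, gx m e j x := by linear_combination hx
      have := congrArg (· ^ 3) this
      simp only [mul_pow, b4_eq] at this
      linear_combination this / 4
    rw [e1, e2]
    simp only [e3, gN_apply, Fin.sum_univ_four]
    generalize gx m e 0 x = p; generalize gx m e 1 x = q; generalize gx m e 2 x = r; generalize gx m e 3 x = s
    have hk := kap_eq
    linear_combination (norm := skip) (-(e3 ![1/2 * (p+q+r+s) - p, 1/2 * (p+q+r+s) - q, 1/2 * (p+q+r+s) - r, 1/2 * (p+q+r+s) - s])/8) * hk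
    simp [e3]
    ring

lemma ker_prop {U U' : V5 →ₗ[ℂ] ℂ} (h : LinearMap.ker U = LinearMap.ker U') (i j : Fin 5) :
    U (eb i) * U' (eb j) = U (eb j) * U' (eb i) := by
  have hx : U (eb i) • eb j - U (eb j) • eb i ∈ LinearMap.ker U := by
    rw [LinearMap.mem_ker]; simp; ring
  rw [h, LinearMap.mem_ker] at hx
  simp at hx
  linear_combination hx

lemma ker_of_prop {U U' : V5 →ₗ[ℂ] ℂ} {c : ℂ} (hc : c ≠ 0) (h : ∀ i, U (eb i) = c * U' (eb i)) : LinearMap.ker U = LinearMap.ker U' := by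
  ext x
  rw [LinearMap.mem_ker, LinearMap.mem_ker, form_sum U, form_sum U']
  have : ∑ i, U (Pi.single i 1) * x i = c * ∑ i, U' (Pi.single i 1) * x i := by
    rw [Finset.mul_sum]
    refine Finset.sum_congr rfl fun i _ => ?_
    have := h i
    simp only [eb] at this
    rw [this]; ring
  rw [this]
  simp [hc]

lemma exists_perm {i j : Fin 5} (h : i ≠ j) : ∃ s : Equiv.Perm (Fin 5), s 0 = i ∧ s 1 = j := by
  refine ⟨Equiv.swap (Equiv.swap 0 i 1) j * Equiv.swap 0 i, ?_, ?_⟩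
  · have h1 : (Equiv.swap 0 i) 0 = i := by simp
    have h2 : (Equiv.swap 0 i) 1 ≠ i := fun e => by
      exact absurd ((Equiv.swap 0 i).injective (e.trans h1.symm)) (by decide)
    rw [Equiv.Perm.mul_apply, h1, Equiv.swap_apply_of_ne_of_ne h2.symm h]
  · simp

lemma eU_eb (s : Equiv.Perm (Fin 5)) (α : ℂ) (k : Fin 5) : eU s α (eb k) = if k = s 0 then 1 else if k = s 1 then α else 0 := by
  rw [eU_apply, eb_apply, eb_apply]
  by_cases h0 : k = s 0
  · subst h0; simp
  · by_cases h1 : k = s 1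
    · subst h1; simp
    · simp [h0, h1, Ne.symm h0, Ne.symm h1]

lemma eU_ne (s : Equiv.Perm (Fin 5)) (α : ℂ) : eU s α ≠ 0 := fun h => by
  have := eU_eb s α (s 0)
  rw [h] at this; simp at this

/-- a hyperplane with G-type coefficients -/
lemma g_complete {U : V5 →ₗ[ℂ] ℂ} {m : Fin 5} (hm : U (eb m) ≠ 0) (h : ∀ n, n ≠ m → U (eb m) ^ 3 = 4 * U (eb n) ^ 3) :
    ∃ e, LinearMap.ker U = LinearMap.ker (gU m e) := by
  have hc : U (eb m) / b4 ≠ 0 := div_ne_zero hm b4_ne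
  have : ∀ j, ∃ e : Fin 3, U (eb (m.succAbove j)) / (U (eb m) / b4) = om ^ (e : ℕ) := fun j => cube_one (by
    have := h _ (Fin.succAbove_ne m j)
    rw [div_pow, div_pow, b4_eq, div_eq_one_iff_eq (div_ne_zero (pow_ne_zero 3 hm) (by norm_num))]
    linear_combination -this / 4)
  choose e he using this
  refine ⟨e, ker_of_prop hc fun i => ?_⟩
  rcases Fin.eq_self_or_eq_succAbove m i with rfl | ⟨j, rfl⟩
  · rw [gU_self, div_mul_cancel₀ _ b4_ne]
  · rw [gU_succ, ← he, mul_div_cancel₀ _ hc]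

/-- Eckardt coefficients -/
lemma e_complete {U : V5 →ₗ[ℂ] ℂ} {i j : Fin 5} (hi : U (eb i) ≠ 0) (h3 : U (eb j) ^ 3 = U (eb i) ^ 3)
    (h : ∀ n, n ≠ i → n ≠ j → U (eb n) = 0) (s : Equiv.Perm (Fin 5)) (hs0 : s 0 = i) (hs1 : s 1 = j) :
    ∃ e : Fin 3, LinearMap.ker U = LinearMap.ker (eU s (om ^ (e : ℕ))) := by
  obtain ⟨e, he⟩ := cube_one (x := U (eb j) / U (eb i)) (by rw [div_pow, h3, div_self (pow_ne_zero 3 hi)])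
  refine ⟨e, ker_of_prop hi fun k => ?_⟩
  rw [eU_eb, hs0, hs1, ← he]
  split_ifs with h1 h2
  · rw [h1, mul_one]
  · rw [h2, mul_div_cancel₀ _ hi]
  · rw [h k h1 h2, mul_zero]

lemma g_inj {m m' : Fin 5} {e e' : Fin 4 → Fin 3} (h : LinearMap.ker (gU m e) = LinearMap.ker (gU m' e')) : m = m' ∧ e = e' := by
  have hm : m = m' := by
    by_contra hne
    have := congrArg (· ^ 3) (ker_prop h m m')
    obtain ⟨k, hk⟩ := Fin.exists_succAbove_eq (Ne.symm hne)
    obtain ⟨k', hk'⟩ := Fin.exists_succAbove_eq hne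
    have e1 : (gU m e (eb m')) ^ 3 = 1 := by rw [← hk, gU_succ, om_pow_cube]
    have e2 : (gU m' e' (eb m)) ^ 3 = 1 := by rw [← hk', gU_succ, om_pow_cube]
    simp only [mul_pow, gU_self, e1, e2, b4_eq] at this
    norm_num at this
  subst hm
  refine ⟨rfl, funext fun j => ?_⟩
  have := ker_prop h m (m.succAbove j)
  rw [gU_self, gU_succ, gU_succ, gU_self, mul_comm (om ^ _)] at this
  exact (om_inj (mul_left_cancel₀ b4_ne this)).symm

lemma ge_ne {m : Fin 5} {e : Fin 4 → Fin 3} {s : Equiv.Perm (Fin 5)} {α : ℂ} (h : LinearMap.ker (gU m e) = LinearMap.ker (eU s α)) : False := by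
  have := ker_prop h (s 2) (s 0)
  rw [eU_eb, eU_eb] at this
  simp at this
  rcases Fin.eq_self_or_eq_succAbove m (s 2) with h1 | ⟨j, h1⟩
  · rw [h1, gU_self] at this; exact b4_ne this
  · rw [h1, gU_succ] at this; exact om_pow_ne _ this

lemma ee_inj {s s' : Equiv.Perm (Fin 5)} {α α' : ℂ} (hα : α ≠ 0) (hs : s 0 < s 1) (hs' : s' 0 < s' 1)
    (h : LinearMap.ker (eU s α) = LinearMap.ker (eU s' α')) : s 0 = s' 0 ∧ s 1 = s' 1 ∧ α = α' := by
  have key : ∀ {s s' : Equiv.Perm (Fin 5)} {α α' : ℂ}, LinearMap.ker (eU s α) = LinearMap.ker (eU s' α') → ∀ k, eU s α (eb k) ≠ 0 → k = s' 0 ∨ k = s' 1 := by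
    intro s s' α α' h k hk
    by_contra hn
    push Not at hn
    have := ker_prop h k (s' 0)
    rw [eU_eb s' α', eU_eb s' α'] at this
    simp [hn.1, hn.2] at this
    exact hk this
  have a0 := key h (s 0) (by rw [eU_eb]; simp)
  have a1 := key h (s 1) (by rw [eU_eb]; simp [hα])
  have h01 : s 0 = s' 0 ∧ s 1 = s' 1 := by
    rcases a0 with a0 | a0 <;> rcases a1 with a1 | a1
    · rw [a0, a1] at hs; exact absurd hs (lt_irrefl _)
    · exact ⟨a0, a1⟩
    · rw [a0, a1] at hs; exact absurd (hs.trans hs') (lt_irrefl _)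
    · rw [a0, a1] at hs; exact absurd hs (lt_irrefl _)
  refine ⟨h01.1, h01.2, ?_⟩
  have := ker_prop h (s 0) (s 1)
  rw [eU_eb, eU_eb, eU_eb, eU_eb, ← h01.1, ← h01.2] at this
  simpa using this.symm

/-! ### Classification of the hyperplanes for the Fermat cubic -/

lemma form_span2 {U X K : V5 →ₗ[ℂ] ℂ} (h : ∀ v, U v = 0 → X v = 0 → K v = 0) : ∃ l m : ℂ, K = l • U + m • X := by
  have := mem_span_of_iInf_ker_le_ker (L := ![U, X]) (K := K) (fun v hv => by
    rw [Submodule.mem_iInf] at hv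
    exact h v (hv 0) (hv 1))
  have e : Set.range ![U, X] = {U, X} := by simp [Matrix.range_cons, Set.pair_comm]
  rw [e, Submodule.mem_span_pair] at this
  obtain ⟨l, m, h⟩ := this
  exact ⟨l, m, h.symm⟩

lemma kill3 (l m : Fin 3 → ℂ) : ∃ c : Fin 3 → ℂ, c ≠ 0 ∧ c 0 * l 0 + c 1 * l 1 + c 2 * l 2 = 0 ∧ c 0 * m 0 + c 1 * m 1 + c 2 * m 2 = 0 := by
  obtain ⟨c, hc, h⟩ := Matrix.exists_mulVec_eq_zero_iff.mpr (show (!![l 0, l 1, l 2; m 0, m 1, m 2; 0, 0, 0] : M3).det = 0 by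
    simp [Matrix.det_fin_three])
  refine ⟨c, hc, ?_, ?_⟩
  · have := congrFun h 0
    simp [Matrix.mulVec, dotProduct, Fin.sum_univ_three] at this
    linear_combination this
  · have := congrFun h 1
    simp [Matrix.mulVec, dotProduct, Fin.sum_univ_three] at this
    linear_combination this

lemma not_ind3 {U X Y A B : V5 →ₗ[ℂ] ℂ} {u u' x x' y y' : ℂ} (h1 : U = u • A + u' • B) (h2 : X = x • A + x' • B) (h3 : Y = y • A + y' • B)
    (h : Ind3 U X Y) : False := by
  obtain ⟨c, hc, e1, e2⟩ := kill3 ![u, x, y] ![u', x', y']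
  simp at e1 e2
  obtain ⟨a, b, d⟩ := h (c 0) (c 1) (c 2) (by
    rw [h1, h2, h3]
    ext v
    simp
    generalize A (Pi.single v 1) = p; generalize B (Pi.single v 1) = q
    linear_combination p * e1 + q * e2)
  exact hc (by ext i; fin_cases i <;> assumption)

lemma quad_factor (A B C : ℂ) : ∃ s t l k : ℂ, (s ≠ 0 ∨ t ≠ 0) ∧ A = t * l ∧ B = t * k - s * l ∧ C = -(s * k) := by
  obtain ⟨s, t, hst, h⟩ := quad_zero A B C
  by_cases ht : t = 0
  · have hs : s ≠ 0 := hst.resolve_right (by simpa using ht)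
    subst ht
    have hA : A = 0 := by
      have : s ^ 2 * A = 0 := by linear_combination h
      simpa [hs] using this
    exact ⟨s, 0, -B / s, -C / s, hst, by simp [hA], by field_simp; ring, by field_simp⟩
  · refine ⟨s, t, A / t, (B + s * (A / t)) / t, hst, by field_simp, by field_simp; ring, ?_⟩
    field_simp
    linear_combination h

lemma tangent_line {U X R : V5 →ₗ[ℂ] ℂ}
    (h : ∀ x v, U x = 0 → X x = 0 → R x = 0 → U v = 0 → X v = 0 → fT x x v = 0) :
    ∃ p q : V5, p ≠ 0 ∧ q ≠ 0 ∧ (∀ i, p i * q i = 0) ∧ (U p = 0 ∧ X p = 0 ∧ R p = 0) ∧ (U q = 0 ∧ X q = 0 ∧ R q = 0) := by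
  obtain ⟨p, q, hpq, h0⟩ := ker3 U X R
  have hp := h0 1 0
  have hq := h0 0 1
  have hs := h0 1 1
  simp only [one_smul, zero_smul, add_zero, zero_add] at hp hq hs
  have hpp : ∀ v, U v = 0 → X v = 0 → fT p p v = 0 := fun v => h p v hp.1 hp.2.1 hp.2.2
  have hqq : ∀ v, U v = 0 → X v = 0 → fT q q v = 0 := fun v => h q v hq.1 hq.2.1 hq.2.2
  have hpq2 : ∀ v, U v = 0 → X v = 0 → fT p q v = 0 := fun v h1 h2 => by
    have := h (p + q) v hs.1 hs.2.1 hs.2.2 h1 h2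
    simp only [map_add, LinearMap.add_apply, hpp v h1 h2, hqq v h1 h2, (fT_sym q p v).1] at this
    linear_combination this / 2
  obtain ⟨l1, m1, e1⟩ := form_span2 hpp
  obtain ⟨l2, m2, e2⟩ := form_span2 hpq2
  obtain ⟨l3, m3, e3⟩ := form_span2 hqq
  obtain ⟨c, hc, c1, c2⟩ := kill3 ![l1, l2, l3] ![m1, m2, m3]
  simp at c1 c2
  have key : ∀ i, c 0 * p i ^ 2 + c 1 * (p i * q i) + c 2 * q i ^ 2 = 0 := fun i => by
    have ev : ∀ x y : V5, fT x y (eb i) = x i * y i := fun x y => by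
      rw [fT_apply, Finset.sum_eq_single i (by intro j _ hj; simp [eb_apply, hj]) (by simp)]; simp [eb_apply]
    have f1 := LinearMap.congr_fun e1 (eb i)
    have f2 := LinearMap.congr_fun e2 (eb i)
    have f3 := LinearMap.congr_fun e3 (eb i)
    simp only [ev, LinearMap.add_apply, LinearMap.smul_apply, smul_eq_mul] at f1 f2 f3
    linear_combination c 0 * f1 + c 1 * f2 + c 2 * f3 + U (eb i) * c1 + X (eb i) * c2
  obtain ⟨s, t, l, k, hst, hA, hB, hC⟩ := quad_factor (c 0) (c 1) (c 2)
  refine ⟨t • p + (-s) • q, l • p + k • q, fun hz => ?_, fun hz => ?_, fun i => ?_, h0 _ _, h0 _ _⟩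
  · obtain ⟨a, b⟩ := hpq _ _ hz
    rcases hst with h | h
    · exact h (by simpa using b)
    · exact h a
  · obtain ⟨a, b⟩ := hpq _ _ hz
    refine hc ?_
    ext i
    fin_cases i
    · simp [hA, a]
    · simp [hB, a, b]
    · simp [hC, b]
  · have := key i
    simp only [Pi.add_apply, Pi.smul_apply, smul_eq_mul]
    rw [hA, hB, hC] at this
    linear_combination this

lemma fT_eb (x y : V5) (i : Fin 5) : fT x y (eb i) = x i * y i := by
  rw [fT_apply, Finset.sum_eq_single i (by intro j _ hj; simp [eb_apply, hj]) (by simp)]; simp [eb_apply]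

/-- a nonzero vector with vanishing sum of cubes has support of size at least two -/
lemma supp_two {p : V5} (hp : p ≠ 0) (h : fT p p p = 0) : 2 ≤ (Finset.univ.filter fun i => p i ≠ 0).card := by
  by_contra hlt
  obtain ⟨i, hi⟩ : ∃ i, p i ≠ 0 := by by_contra hn; push Not at hn; exact hp (funext hn)
  have h1 := Finset.card_le_one.mp (show (Finset.univ.filter fun i => p i ≠ 0).card ≤ 1 by omega)
  rw [fT_apply, Finset.sum_eq_single i (fun j _ hj => by
    by_contra hne
    exact hj (h1 j (by simp; intro e; simp [e] at hne) i (by simpa using hi))) (by simp)] at h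
  simp [hi] at h

lemma supp_pair {p q : V5} (hp : p ≠ 0) (hq : q ≠ 0) (hpq : ∀ i, p i * q i = 0) (h1 : fT p p p = 0) (h2 : fT q q q = 0) :
    (∃ i j, i ≠ j ∧ p i ≠ 0 ∧ p j ≠ 0 ∧ ∀ k, k ≠ i → k ≠ j → p k = 0) ∨ (∃ i j, i ≠ j ∧ q i ≠ 0 ∧ q j ≠ 0 ∧ ∀ k, k ≠ i → k ≠ j → q k = 0) := by
  have a1 := supp_two hp h1
  have a2 := supp_two hq h2
  have hd : Disjoint (Finset.univ.filter fun i => p i ≠ 0) (Finset.univ.filter fun i => q i ≠ 0) := by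
    rw [Finset.disjoint_left]
    intro i hi hj
    simp at hi hj
    exact (mul_ne_zero hi hj) (hpq i)
  have hc := Finset.card_union_of_disjoint hd
  have hle := Finset.card_le_univ ((Finset.univ.filter fun i => p i ≠ 0) ∪ (Finset.univ.filter fun i => q i ≠ 0))
  rw [Fintype.card_fin] at hle
  have key : ∀ r : V5, (Finset.univ.filter fun i => r i ≠ 0).card = 2 → ∃ i j, i ≠ j ∧ r i ≠ 0 ∧ r j ≠ 0 ∧ ∀ k, k ≠ i → k ≠ j → r k = 0 := fun r hr => by
    obtain ⟨i, j, hij, he⟩ := Finset.card_eq_two.mp hr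
    have hm : ∀ k, r k ≠ 0 ↔ k = i ∨ k = j := fun k => by
      have : k ∈ (Finset.univ.filter fun i => r i ≠ 0) ↔ k ∈ ({i, j} : Finset (Fin 5)) := by rw [he]
      simpa using this
    refine ⟨i, j, hij, (hm i).mpr (Or.inl rfl), (hm j).mpr (Or.inr rfl), fun k h1 h2 => ?_⟩
    by_contra hk
    rcases (hm k).mp hk with h | h
    · exact h1 h
    · exact h2 h
  by_cases h : (Finset.univ.filter fun i => p i ≠ 0).card = 2
  · exact Or.inl (key p h)
  · exact Or.inr (key q (by omega))

/-- data attached to a tangent plane `U = X = 0` -/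
structure TP (U X Y : V5 →ₗ[ℂ] ℂ) (p q : V5) (i j : Fin 5) : Prop where
  ne : i ≠ j
  pi : p i ≠ 0
  pj : p j ≠ 0
  p0 : ∀ k, k ≠ i → k ≠ j → p k = 0
  cube : p i ^ 3 + p j ^ 3 = 0
  q0 : q ≠ 0
  qi : q i = 0
  qj : q j = 0
  qq : fT q q q = 0
  Up : U p = 0
  Xp : X p = 0
  Yp : Y p = 0
  sq : ∃ l m : ℂ, fT p p = l • U + m • X
  spU : ∃ s t : ℂ, U = s • fT p p + t • fT q q
  spX : ∃ s t : ℂ, X = s • fT p p + t • fT q q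

lemma tp_aux {U X R : V5 →ₗ[ℂ] ℂ}
    (h : ∀ x v, U x = 0 → X x = 0 → R x = 0 → U v = 0 → X v = 0 → fT x x v = 0) :
    ∃ p q i j, R p = 0 ∧ TP U X U p q i j := by
  have main : ∀ p q : V5, p ≠ 0 → q ≠ 0 → (∀ i, p i * q i = 0) → (U p = 0 ∧ X p = 0 ∧ R p = 0) → (U q = 0 ∧ X q = 0 ∧ R q = 0) →
      (∃ i j, i ≠ j ∧ p i ≠ 0 ∧ p j ≠ 0 ∧ ∀ k, k ≠ i → k ≠ j → p k = 0) → ∃ p q i j, R p = 0 ∧ TP U X U p q i j := by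
    rintro p q hp hq hpq kp kq ⟨i, j, hij, pi, pj, p0⟩
    obtain ⟨s, hs0, hs1⟩ := exists_perm hij
    have hne : ∀ k, k ≠ 0 → k ≠ 1 → p (s k) = 0 := fun k h0 h1 => p0 _ (by rw [← hs0]; simpa using h0) (by rw [← hs1]; simpa using h1)
    obtain ⟨l1, m1, e1⟩ := form_span2 (K := fT p p) fun v => h p v kp.1 kp.2.1 kp.2.2
    obtain ⟨l2, m2, e2⟩ := form_span2 (K := fT q q) fun v => h q v kq.1 kq.2.1 kq.2.2
    have qi : q i = 0 := by simpa [pi] using hpq i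
    have qj : q j = 0 := by simpa [pj] using hpq j
    obtain ⟨n, hn⟩ : ∃ n, q n ≠ 0 := by by_contra hn; push Not at hn; exact hq (funext hn)
    have pn : p n = 0 := by simpa [hn] using hpq n
    have ppi : fT p p (eb i) ≠ 0 := by rw [fT_eb]; exact mul_ne_zero pi pi
    have qqi : fT q q (eb i) = 0 := by rw [fT_eb, qi, zero_mul]
    have ppn : fT p p (eb n) = 0 := by rw [fT_eb, pn, zero_mul]
    have qqn : fT q q (eb n) ≠ 0 := by rw [fT_eb]; exact mul_ne_zero hn hn
    have r1 : m2 • fT p p - m1 • fT q q = (l1 * m2 - l2 * m1) • U := by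
      rw [e1, e2]; ext v; simp; ring
    have r2 : l1 • fT q q - l2 • fT p p = (l1 * m2 - l2 * m1) • X := by
      rw [e1, e2]; ext v; simp; ring
    have hD : l1 * m2 - l2 * m1 ≠ 0 := fun hD => by
      rw [hD, zero_smul] at r1 r2
      have a1 := LinearMap.congr_fun r1 (eb n)
      have a2 := LinearMap.congr_fun r2 (eb n)
      simp [ppn, qqn] at a1 a2
      rw [a1, a2, zero_smul, zero_smul, zero_add] at e1
      rw [e1] at ppi
      exact ppi rfl
    refine ⟨p, q, i, j, kp.2.2, hij, pi, pj, p0, ?_, hq, qi, qj, h q q kq.1 kq.2.1 kq.2.2 kq.1 kq.2.1, kp.1, kp.2.1, kp.1, ⟨l1, m1, e1⟩,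
      ⟨m2 / (l1 * m2 - l2 * m1), -m1 / (l1 * m2 - l2 * m1), ?_⟩, ⟨-l2 / (l1 * m2 - l2 * m1), l1 / (l1 * m2 - l2 * m1), ?_⟩⟩
    · have := h p p kp.1 kp.2.1 kp.2.2 kp.1 kp.2.1
      rw [fT_perm s, hne 2 (by decide) (by decide), hne 3 (by decide) (by decide), hne 4 (by decide) (by decide), hs0, hs1] at this
      linear_combination this
    · refine smul_right_injective _ hD ?_
      simp only
      rw [← r1, smul_add, smul_smul, smul_smul, mul_div_cancel₀ _ hD, mul_div_cancel₀ _ hD, neg_smul, sub_eq_add_neg]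
    · refine smul_right_injective _ hD ?_
      simp only
      rw [← r2, smul_add, smul_smul, smul_smul, mul_div_cancel₀ _ hD, mul_div_cancel₀ _ hD, neg_smul, sub_eq_add_neg, add_comm]
  obtain ⟨p, q, hp, hq, hpq, kp, kq⟩ := tangent_line h
  rcases supp_pair hp hq hpq (h p p kp.1 kp.2.1 kp.2.2 kp.1 kp.2.1) (h q q kq.1 kq.2.1 kq.2.2 kq.1 kq.2.1) with h | h
  · exact main p q hp hq hpq kp kq h
  · exact main q p hq hp (fun i => by rw [mul_comm]; exact hpq i) kq kp h

lemma TP.withY {U X Y Y' : V5 →ₗ[ℂ] ℂ} {p q : V5} {i j : Fin 5} (h : TP U X Y p q i j) (hY : Y' p = 0) : TP U X Y' p q i j :=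
  ⟨h.ne, h.pi, h.pj, h.p0, h.cube, h.q0, h.qi, h.qj, h.qq, h.Up, h.Xp, hY, h.sq, h.spU, h.spX⟩

lemma tangent_plane {U X Y Z : V5 →ₗ[ℂ] ℂ} (h : ∀ x, U x = 0 → X x = 0 → fT x x x = -(Y x * Z x ^ 2)) :
    ∃ p q i j, TP U X Y p q i j := by
  by_cases hZ : ∀ x, U x = 0 → X x = 0 → Z x = 0
  · obtain ⟨p, q, i, j, hR, hp⟩ := tp_aux (U := U) (X := X) (R := Y) fun x v h1 h2 _ h3 h4 => by
      have := cub_compare (a0 := fT x x x) (a1 := 3 * fT x x v) (a2 := 3 * fT v v x) (a3 := fT v v v) (b0 := 0) (b1 := 0) (b2 := 0) (b3 := 0) (fun t => by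
        have e1 := tri_line fT_sym x v t
        have e2 := h (x + t • v) (by simp [h1, h3]) (by simp [h2, h4])
        rw [hZ (x + t • v) (by simp [h1, h3]) (by simp [h2, h4])] at e2
        linear_combination e2 - e1)
      linear_combination this / 3
    exact ⟨p, q, i, j, hp.withY hR⟩
  · obtain ⟨p, q, i, j, hR, hp⟩ := tp_aux (U := U) (X := X) (R := Z) fun x v h1 h2 h0 h3 h4 => by
      have := cub_compare (a0 := fT x x x) (a1 := 3 * fT x x v) (a2 := 3 * fT v v x) (a3 := fT v v v) (b0 := 0) (b1 := 0) (b2 := -(Y x * Z v ^ 2))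
        (b3 := -(Y v * Z v ^ 2)) (fun t => by
        have e1 := tri_line fT_sym x v t
        have e2 := h (x + t • v) (by simp [h1, h3]) (by simp [h2, h4])
        simp only [map_add, map_smul, smul_eq_mul, h0] at e1 e2
        linear_combination e2 - e1)
      linear_combination this / 3
    refine ⟨p, q, i, j, hp.withY ?_⟩
    push Not at hZ
    obtain ⟨x, hx1, hx2, hx⟩ := hZ
    obtain ⟨s, hs0, hs1⟩ := exists_perm hp.ne
    have hne : ∀ k, k ≠ 0 → k ≠ 1 → p (s k) = 0 := fun k h0 h1 => hp.p0 _ (by rw [← hs0]; simpa using h0) (by rw [← hs1]; simpa using h1)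
    have a1 : fT p p x = 0 := by
      obtain ⟨l, m, e⟩ := hp.sq
      rw [e]; simp [hx1, hx2]
    have a2 : fT x x p = 0 := by
      rw [fT_perm s, hne 2 (by decide) (by decide), hne 3 (by decide) (by decide), hne 4 (by decide) (by decide), hs0, hs1] at a1 ⊢
      have pi := hp.pi; have pj := hp.pj; have pc := hp.cube
      have pj3 : p j ^ 3 ≠ 0 := pow_ne_zero 3 pj
      refine mul_left_cancel₀ pj3 ?_
      linear_combination (p j ^ 2 * x j - p i ^ 2 * x i) * a1 + x i ^ 2 * p i * pc
    have := cub_compare (a0 := fT x x x) (a1 := 3 * fT x x p) (a2 := 3 * fT p p x) (a3 := fT p p p) (b0 := -(Y x * Z x ^ 2)) (b1 := -(Y p * Z x ^ 2)) (b2 := 0)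
        (b3 := 0) (fun t => by
        have e1 := tri_line fT_sym x p t
        have e2 := h (x + t • p) (by simp [hx1, hp.Up]) (by simp [hx2, hp.Xp])
        simp only [map_add, map_smul, smul_eq_mul, hR] at e1 e2
        linear_combination e2 - e1)
    rw [a2] at this
    have : Y p * Z x ^ 2 = 0 := by linear_combination this
    simpa [hx] using this

lemma half_aux {s t pk pl qk ql qm : ℂ} (h1 : t * qk ^ 2 = s * pk ^ 2) (h2 : t * ql ^ 2 = s * pl ^ 2) (hp : pk ^ 3 + pl ^ 3 = 0) (hpk : pk ≠ 0)
    (hq : qk ^ 3 + ql ^ 3 + qm ^ 3 = 0) (ht : t ≠ 0) :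
    (qm ≠ 0 → qm ^ 6 = 4 * qk ^ 6 ∧ qm ^ 6 = 4 * ql ^ 6) ∧ (qm = 0 → ∃ c, qk = c * pk ∧ ql = c * pl) := by
  have hpk3 : pk ^ 3 ≠ 0 := pow_ne_zero 3 hpk
  have h : (qk * pl) ^ 2 = (ql * pk) ^ 2 := by
    refine mul_left_cancel₀ ht ?_
    linear_combination pl ^ 2 * h1 - pk ^ 2 * h2
  rcases sq_eq_sq_iff_eq_or_eq_neg.mp h with h | h
  · have h3 := congrArg (· ^ 3) h
    simp only [mul_pow] at h3
    have hz : qk ^ 3 + ql ^ 3 = 0 := by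
      refine mul_left_cancel₀ hpk3 ?_
      linear_combination qk ^ 3 * hp - h3
    refine ⟨fun hm => absurd ?_ (pow_ne_zero 3 hm), fun _ => ⟨qk / pk, by field_simp, ?_⟩⟩
    · linear_combination hq - hz
    · field_simp; linear_combination -h
  · have h3 := congrArg (· ^ 3) h
    simp only [mul_pow] at h3
    have hz : qk ^ 3 = ql ^ 3 := by
      refine mul_left_cancel₀ hpk3 ?_
      linear_combination qk ^ 3 * hp - h3
    have hm3 : qm ^ 3 = -2 * qk ^ 3 := by linear_combination hq + hz
    refine ⟨fun _ => ?_, fun hm => ⟨0, ?_, ?_⟩⟩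
    · have : qm ^ 6 = 4 * qk ^ 6 := by linear_combination (qm ^ 3 - 2 * qk ^ 3) * hm3
      exact ⟨this, by linear_combination this + 4 * (qk ^ 3 + ql ^ 3) * hz⟩
    · rw [hm] at hm3
      have : qk ^ 3 = 0 := by linear_combination hm3 / 2
      simpa using this
    · rw [hm] at hm3
      have : ql ^ 3 = 0 := by linear_combination hm3 / 2 - hz
      simpa using this

lemma ext_eb {A B : V5 →ₗ[ℂ] ℂ} (s : Equiv.Perm (Fin 5)) (h : ∀ k, A (eb (s k)) = B (eb (s k))) : A = B := by
  refine LinearMap.ext fun x => ?_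
  rw [form_sum A, form_sum B]
  refine Finset.sum_congr rfl fun i _ => ?_
  have := h (s.symm i)
  rw [Equiv.apply_symm_apply] at this
  simp only [eb] at this
  rw [this]

def EckU (U : V5 →ₗ[ℂ] ℂ) : Prop := ∃ i j, i ≠ j ∧ U (eb i) ≠ 0 ∧ U (eb j) ^ 3 = U (eb i) ^ 3 ∧ ∀ n, n ≠ i → n ≠ j → U (eb n) = 0

lemma TP.eck {U X Y : V5 →ₗ[ℂ] ℂ} {p q : V5} {i j : Fin 5} (h : TP U X Y p q i j) (hU : U ≠ 0) {c : ℂ} (hc : U = c • fT p p) : EckU U := by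
  have hc0 : c ≠ 0 := fun e => hU (by rw [hc, e, zero_smul])
  have ev : ∀ n, U (eb n) = c * (p n * p n) := fun n => by rw [hc]; simp [fT_eb]
  refine ⟨i, j, h.ne, ?_, ?_, fun n h1 h2 => ?_⟩
  · rw [ev]; exact mul_ne_zero hc0 (mul_ne_zero h.pi h.pi)
  · rw [ev, ev]; linear_combination c ^ 3 * (p j ^ 3 - p i ^ 3) * h.cube
  · rw [ev, h.p0 n h1 h2]; simp

lemma fifth : ∀ i j k l : Fin 5, i ≠ j → k ≠ l → i ≠ k → i ≠ l → j ≠ k → j ≠ l → ∃ s : Equiv.Perm (Fin 5), s 0 = i ∧ s 1 = j ∧ s 2 = k ∧ s 3 = l := by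
  intro i j k l h1 h2 h3 h4 h5 h6
  obtain ⟨m, a1, a2, a3, a4⟩ : ∃ m : Fin 5, m ≠ i ∧ m ≠ j ∧ m ≠ k ∧ m ≠ l := by
    clear h1 h2 h3 h4 h5 h6; revert i j k l; decide
  have : Function.Injective ![i, j, k, l, m] := by
    intro a b hab
    fin_cases a <;> fin_cases b <;> simp_all
  exact ⟨Equiv.ofBijective _ (Finite.injective_iff_bijective.mp this), rfl, rfl, rfl, rfl⟩

lemma fermat_hyp {U : V5 →ₗ[ℂ] ℂ} (hU : U ≠ 0) {M : V5 →ₗ[ℂ] M3} (hM : SymDet fT (LinearMap.ker U) M) :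
    EckU U ∨ ∃ m, U (eb m) ≠ 0 ∧ ∀ n, n ≠ m → U (eb m) ^ 3 = 4 * U (eb n) ^ 3 := by
  obtain ⟨P, -, hP, h01⟩ := symDet_norm fT_sym fT_smooth hU hM
  have hF := symDet_forms hP h01
  have hI := classify_forms fT_sym fT_smooth hU _ _ _ _ _ hF
  generalize entM (conjM P M) 0 0 = X, entM (conjM P M) 1 1 = Y, entM (conjM P M) 2 2 = L, entM (conjM P M) 1 2 = W, entM (conjM P M) 0 2 = Z at hF hI
  obtain ⟨p1, q1, i, j, t1⟩ := tangent_plane (U := U) (X := X) (Y := Y) (Z := Z) fun x h1 h2 => by rw [hF x h1, h2]; ring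
  obtain ⟨p2, q2, k, l, t2⟩ := tangent_plane (U := U) (X := Y) (Y := X) (Z := W) fun x h1 h2 => by rw [hF x h1, h2]; ring
  -- `T` vanishes on the span of `p1`, `p2`
  have hl : ∀ x v, U x = 0 → X x = 0 → Y x = 0 → U v = 0 → X v = 0 → Y v = 0 → fT x x v = 0 := fun x v a1 a2 a3 b1 b2 b3 => by
    have := cub_compare (a0 := fT x x x) (a1 := 3 * fT x x v) (a2 := 3 * fT v v x) (a3 := fT v v v) (b0 := 0) (b1 := 0) (b2 := 0) (b3 := 0) (fun t => by
        have e1 := tri_line fT_sym x v t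
        have e2 := hF (x + t • v) (by simp [a1, b1])
        simp only [map_add, map_smul, smul_eq_mul, a2, a3, b2, b3] at e1 e2
        linear_combination e2 - e1)
    linear_combination this / 3
  have c12 := hl p1 p2 t1.Up t1.Xp t1.Yp t2.Up t2.Yp t2.Xp
  obtain ⟨s, hs0, hs1⟩ := exists_perm t1.ne
  have hne : ∀ k, k ≠ 0 → k ≠ 1 → p1 (s k) = 0 := fun k h0 h1 => t1.p0 _ (by rw [← hs0]; simpa using h0) (by rw [← hs1]; simpa using h1)
  have d12 : p1 i ^ 2 * p2 i + p1 j ^ 2 * p2 j = 0 := by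
    rw [fT_perm s, hne 2 (by decide) (by decide), hne 3 (by decide) (by decide), hne 4 (by decide) (by decide), hs0, hs1] at c12
    linear_combination c12
  by_cases hi : p2 i = 0
  · -- disjoint supports
    have hj : p2 j = 0 := by
      rw [hi] at d12; simpa [t1.pj] using d12
    have n1 : i ≠ k := fun e => t2.pi (by rw [← e]; exact hi)
    have n2 : i ≠ l := fun e => t2.pj (by rw [← e]; exact hi)
    have n3 : j ≠ k := fun e => t2.pi (by rw [← e]; exact hj)
    have n4 : j ≠ l := fun e => t2.pj (by rw [← e]; exact hj)
    have p1k := t1.p0 k n1.symm n3.symm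
    have p1l := t1.p0 l n2.symm n4.symm
    obtain ⟨s1, u1, hU1⟩ := t1.spU
    obtain ⟨s2, u2, hU2⟩ := t2.spU
    by_cases hu1 : u1 = 0
    · exact Or.inl (t1.eck hU (c := s1) (by rw [hU1, hu1]; simp))
    by_cases hu2 : u2 = 0
    · exact Or.inl (t2.eck hU (c := s2) (by rw [hU2, hu2]; simp))
    obtain ⟨s, rfl, rfl, rfl, rfl⟩ := fifth i j k l t1.ne t2.ne n1 n2 n3 n4
    have p1m : p1 (s 4) = 0 := t1.p0 _ (by simp) (by simp)
    have p2m : p2 (s 4) = 0 := t2.p0 _ (by simp) (by simp)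
    have f1 : ∀ n, U (eb n) = s1 * (p1 n * p1 n) + u1 * (q1 n * q1 n) := fun n => by conv_lhs => rw [hU1]
                                                                                     simp [fT_eb]
    have f2 : ∀ n, U (eb n) = s2 * (p2 n * p2 n) + u2 * (q2 n * q2 n) := fun n => by conv_lhs => rw [hU2]
                                                                                     simp [fT_eb]
    have Q1 := t1.qq
    have Q2 := t2.qq
    rw [fT_perm s, t1.qi, t1.qj] at Q1
    rw [fT_perm s, t2.qi, t2.qj] at Q2
    obtain ⟨A1, A2⟩ := half_aux (s := s2) (t := u1) (pk := p2 (s 2)) (pl := p2 (s 3)) (qk := q1 (s 2)) (ql := q1 (s 3)) (qm := q1 (s 4))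
      (by have a := f1 (s 2); have b := f2 (s 2); rw [p1k] at a; rw [t2.qi] at b; linear_combination b - a)
      (by have a := f1 (s 3); have b := f2 (s 3); rw [p1l] at a; rw [t2.qj] at b; linear_combination b - a) t2.cube t2.pi (by linear_combination Q1) hu1
    obtain ⟨B1, B2⟩ := half_aux (s := s1) (t := u2) (pk := p1 (s 0)) (pl := p1 (s 1)) (qk := q2 (s 0)) (ql := q2 (s 1)) (qm := q2 (s 4))
      (by have a := f1 (s 0); have b := f2 (s 0); rw [t1.qi] at a; rw [hi] at b; linear_combination a - b)
      (by have a := f1 (s 1); have b := f2 (s 1); rw [t1.qj] at a; rw [hj] at b; linear_combination a - b) t1.cube t1.pi (by linear_combination Q2) hu2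
    have g1 := f1 (s 4)
    have g2 := f2 (s 4)
    rw [p1m] at g1
    rw [p2m] at g2
    by_cases hm : U (eb (s 4)) = 0
    · exfalso
      have z1 : q1 (s 4) = 0 := by rw [hm] at g1; simpa [hu1] using g1.symm
      have z2 : q2 (s 4) = 0 := by rw [hm] at g2; simpa [hu2] using g2.symm
      obtain ⟨c, c1, c2⟩ := A2 z1
      obtain ⟨d, d1, d2⟩ := B2 z2
      have E1 : fT q1 q1 = c ^ 2 • fT p2 p2 := ext_eb s fun n => by
        rw [fT_eb, LinearMap.smul_apply, fT_eb, smul_eq_mul]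
        fin_cases n
        · simp [t1.qi, hi]
        · simp [t1.qj, hj]
        · simp [c1]; ring
        · simp [c2]; ring
        · simp [z1, p2m]
      have E2 : fT q2 q2 = d ^ 2 • fT p1 p1 := ext_eb s fun n => by
        rw [fT_eb, LinearMap.smul_apply, fT_eb, smul_eq_mul]
        fin_cases n
        · simp [d1]; ring
        · simp [d2]; ring
        · simp [t2.qi, p1k]
        · simp [t2.qj, p1l]
        · simp [z2, p1m]
      obtain ⟨s1', u1', hX⟩ := t1.spX
      obtain ⟨s2', u2', hY⟩ := t2.spX
      rw [E1, smul_smul] at hU1 hX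
      rw [E2, smul_smul, add_comm] at hY
      exact not_ind3 hU1 hX hY hI
    · refine Or.inr ⟨s 4, hm, fun n hn => ?_⟩
      have z1 : q1 (s 4) ≠ 0 := fun e => hm (by rw [g1, e]; simp)
      have z2 : q2 (s 4) ≠ 0 := fun e => hm (by rw [g2, e]; simp)
      obtain ⟨a1, a2⟩ := A1 z1
      obtain ⟨b1, b2⟩ := B1 z2
      obtain ⟨n, rfl⟩ := s.surjective n
      have key : n = 0 ∨ n = 1 ∨ n = 2 ∨ n = 3 := by
        have : n ≠ 4 := fun e => hn (by rw [e])
        revert this; clear hn; revert n; decide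
      rcases key with rfl | rfl | rfl | rfl
      · rw [g2, f2, hi]; linear_combination u2 ^ 3 * b1
      · rw [g2, f2, hj]; linear_combination u2 ^ 3 * b2
      · rw [g1, f1, p1k]; linear_combination u1 ^ 3 * a1
      · rw [g1, f1, p1l]; linear_combination u1 ^ 3 * a2
  · -- proportional
    left
    have hj : p2 j ≠ 0 := fun e => hi (by rw [e] at d12; simpa [t1.pi] using d12)
    have hik : i = k ∨ i = l := by by_contra h; push Not at h; exact hi (t2.p0 i h.1 h.2)
    have hjk : j = k ∨ j = l := by by_contra h; push Not at h; exact hj (t2.p0 j h.1 h.2)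
    have hp2 : ∀ n, n ≠ i → n ≠ j → p2 n = 0 := fun n h1 h2 => by
      have := t1.ne
      apply t2.p0 <;> grind
    have hpar : fT p2 p2 = (p2 i / p1 i) ^ 2 • fT p1 p1 := ext_eb s fun n => by
      have pi := t1.pi
      have pj := t1.pj
      rw [fT_eb, LinearMap.smul_apply, fT_eb, smul_eq_mul]
      have key : p2 j * p1 i = p2 i * p1 j := by
        refine mul_left_cancel₀ (pow_ne_zero 2 pj) ?_
        linear_combination p1 i * d12 - p2 i * t1.cube
      by_cases h1 : s n = i
      · rw [h1]; field_simp
      by_cases h2 : s n = j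
      · rw [h2]; field_simp
        linear_combination (p2 j * p1 i + p2 i * p1 j) * key
      · rw [t1.p0 _ h1 h2, hp2 _ h1 h2]; simp
    obtain ⟨l1, m1, e1⟩ := t1.sq
    obtain ⟨l2, m2, e2⟩ := t2.sq
    have hr : (p2 i / p1 i) ^ 2 ≠ 0 := pow_ne_zero 2 (div_ne_zero hi t1.pi)
    set r := (p2 i / p1 i) ^ 2
    obtain ⟨-, z, -⟩ := hI (r * l1 - l2) (r * m1) (-m2) (by
      have : r • (l1 • U + m1 • X) - (l2 • U + m2 • Y) = 0 := by rw [← e1, ← e2, hpar, sub_self]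
      rw [← this]; ext v; simp; ring)
    have hm1 : m1 = 0 := by simpa [hr] using z
    rw [hm1, zero_smul, add_zero] at e1
    have hl1 : l1 ≠ 0 := fun e => by
      rw [e, zero_smul] at e1
      have := LinearMap.congr_fun e1 (eb i)
      rw [fT_eb] at this
      exact t1.pi (by simpa using this)
    exact t1.eck hU (c := l1⁻¹) (by rw [e1, smul_smul, inv_mul_cancel₀ hl1, one_smul])

abbrev PairT : Type := {p : Fin 5 × Fin 5 // p.1 < p.2}
abbrev IdxT : Type := (Fin 5 × (Fin 4 → Fin 3)) ⊕ (PairT × Fin 3 × Fin 3)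

lemma card_pairT : Fintype.card PairT = 10 := by decide

lemma card_IdxT : Nat.card IdxT = 495 := by
  rw [Nat.card_eq_fintype_card, Fintype.card_sum, Fintype.card_prod, Fintype.card_prod, Fintype.card_prod, card_pairT]
  simp

def sg (p : PairT) : Equiv.Perm (Fin 5) := (exists_perm (ne_of_lt p.2)).choose
lemma sg0 (p : PairT) : sg p 0 = p.1.1 := (exists_perm (ne_of_lt p.2)).choose_spec.1
lemma sg1 (p : PairT) : sg p 1 = p.1.2 := (exists_perm (ne_of_lt p.2)).choose_spec.2

def fHs : IdxT → Submodule ℂ V5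
  | Sum.inl (m, e) => LinearMap.ker (gU m e)
  | Sum.inr (p, e, _) => LinearMap.ker (eU (sg p) (om ^ (e : ℕ)))

def fMs : IdxT → V5 →ₗ[ℂ] M3
  | Sum.inl (m, e) => stdM (gN m e)
  | Sum.inr (p, _, f) => eM (sg p) (om ^ (f : ℕ) * tau0)

lemma fermat_complete_e {U : V5 →ₗ[ℂ] ℂ} {M : V5 →ₗ[ℂ] M3} (hM : SymDet fT (LinearMap.ker U) M) (p : PairT)
    (hi : U (eb p.1.1) ≠ 0) (h3 : U (eb p.1.2) ^ 3 = U (eb p.1.1) ^ 3) (h : ∀ n, n ≠ p.1.1 → n ≠ p.1.2 → U (eb n) = 0) :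
    ∃ i, LinearMap.ker U = fHs i ∧ MEq (LinearMap.ker U) M (fMs i) := by
  obtain ⟨e, he⟩ := e_complete hi h3 h (sg p) (sg0 p) (sg1 p)
  rw [he] at hM ⊢
  obtain ⟨t, ht, hMt⟩ := eM_complete (sg p) (om_pow_cube e) hM
  obtain ⟨f, rfl⟩ := exists_tau_e ht
  exact ⟨Sum.inr (p, e, f), rfl, hMt⟩

lemma fermat_reps : Reps fT IdxT fHs fMs where
  fin i := by
    rcases i with ⟨m, e⟩ | ⟨p, e, f⟩
    · exact ker_finrank (gU_ne m e)
    · exact ker_finrank (eU_ne _ _)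
  sd i := by
    rcases i with ⟨m, e⟩ | ⟨p, e, f⟩
    · exact stdM_symDet (gN_cay m e)
    · exact eM_sd _ (om_pow_cube e) (tau_e f)
  nd i := by
    rcases i with ⟨m, e⟩ | ⟨p, e, f⟩
    · exact cay_ND fT_sym fT_smooth (gU_ne m e) (gN_cay m e)
    · exact eM_nd _ (tau_e f)
  complete H M hH hM := by
    obtain ⟨U, hU, rfl⟩ := hyp_ker hH
    rcases fermat_hyp hU hM with ⟨i, j, hij, hi, h3, h⟩ | ⟨m, hm, h⟩
    · rcases lt_or_gt_of_ne hij with hlt | hlt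
      · exact fermat_complete_e hM ⟨(i, j), hlt⟩ hi h3 h
      · refine fermat_complete_e hM ⟨(j, i), hlt⟩ (fun h0 => hi ?_) h3.symm (fun n h1 h2 => h n h2 h1)
        have h0' : U (eb j) = 0 := h0
        rw [h0'] at h3
        exact pow_eq_zero_iff (n := 3) (by norm_num) |>.mp (by rw [← h3]; norm_num)
    · obtain ⟨e, he⟩ := g_complete hm h
      rw [he] at hM ⊢
      exact ⟨Sum.inl (m, e), rfl, cayley_unique fT_sym fT_smooth (gU_ne m e) hM (gN_cay m e)⟩
  ineq i j h hM := by
    rcases i with ⟨m, e⟩ | ⟨p, e, f⟩ <;> rcases j with ⟨m', e'⟩ | ⟨p', e', f'⟩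
    · obtain ⟨rfl, rfl⟩ := g_inj h; rfl
    · exact (ge_ne h).elim
    · exact (ge_ne h.symm).elim
    · obtain ⟨h0, h1, h2⟩ := ee_inj (om_pow_ne e) (by rw [sg0, sg1]; exact p.2) (by rw [sg0, sg1]; exact p'.2) h
      rw [sg0, sg0] at h0
      rw [sg1, sg1] at h1
      obtain rfl : p = p' := Subtype.ext (Prod.ext h0 h1)
      obtain rfl := om_inj h2
      have ht := eM_ineq (sg p) (tau_e f) (tau_e f') hM
      have hn : tau0 ≠ 0 := fun h => by have := tau0_eq; rw [h] at this; norm_num at this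
      obtain rfl := om_inj (mul_right_cancel₀ hn ht)
      rfl

lemma main_result :
    ∃ P : MvPolynomial Deg3Monomials ℂ, P ≠ 0 ∧ ∀ F : MvPolynomial (Fin 5) ℂ, F.IsHomogeneous 3 → evF P F ≠ 0 →
      IsSmoothCubic F ∧ (NodeSet F).Finite ∧ (NodeSet F).ncard = 1485 :=
  main_of_reps card_IdxT fermat_reps

/-- A general smooth cubic threefold `V ⊂ ℙ⁴` contains exactly `1485` lines `l` for
which there exist 2-planes `π₁, π₂` and two distinct lines `r₁ ≠ r₂` on `V` with
`V·π₁ = l + 2r₁` and `V·π₂ = l + 2r₂` (the nodes of the curve `Γ ⊂ F(V)`). -/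
theorem general_cubic_has_1485_nodes :
    ∃ P : MvPolynomial Deg3Monomials ℂ, P ≠ 0 ∧
      ∀ F : MvPolynomial (Fin 5) ℂ, F.IsHomogeneous 3 →
        eval (fun d : Deg3Monomials => F.coeff d.1) P ≠ 0 →
        IsSmoothCubic F ∧
        {l : Submodule ℂ (Fin 5 → ℂ) | IsLine l ∧ LiesOn F l ∧
          ∃ Pl₁ Pl₂ r₁ r₂ : Submodule ℂ (Fin 5 → ℂ), r₁ ≠ r₂ ∧
            LiesOn F r₁ ∧ LiesOn F r₂ ∧
            CycleLplus2R F l r₁ Pl₁ ∧ CycleLplus2R F l r₂ Pl₂}.Finite ∧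
        {l : Submodule ℂ (Fin 5 → ℂ) | IsLine l ∧ LiesOn F l ∧
          ∃ Pl₁ Pl₂ r₁ r₂ : Submodule ℂ (Fin 5 → ℂ), r₁ ≠ r₂ ∧
            LiesOn F r₁ ∧ LiesOn F r₂ ∧
            CycleLplus2R F l r₁ Pl₁ ∧ CycleLplus2R F l r₂ Pl₂}.ncard = 1485 := by
  exact main_result

end
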